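/- There exist constants C₀ > 0 and δ > 0 such that for each pair (d, n₀) ∈ {(8,1), (24,2)} the following holds: let (ε_n)_{n≥n₀} be a sequence of real numbers with |ε_n| < δ·n^{−C₀} for all n ≥ n₀. Let f : ℝ^d → ℂ be a radial Schwartz function, let e be a fixed unit vector in ℝ^d, and define the radial profiles φ(t) = f(t·e) and ψ(t) = f̂(t·e) (the Fourier transform f̂ is again radial and Schwartz, and φ, ψ are smooth). If φ(√(2n+ε_n)) = 0, φ'(√(2n+ε_n)) = 0, ψ(√(2n+ε_n)) = 0 and ψ'(√(2n+ε_n)) = 0 for every integer n ≥ n₀, then f ≡ 0. -/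

import Mathlib

open MeasureTheory FourierTransform Real
open Complex (I)

/-- The exponential `z ↦ e^{2πiz}`. -/
noncomputable def ee (z : ℂ) : ℂ := Complex.exp (2 * π * I * z)

lemma ee_add (z w : ℂ) : ee (z + w) = ee z * ee w := by
  simp only [ee, ← Complex.exp_add]; ring_nf

lemma ee_zero : ee 0 = 1 := by simp [ee]

lemma ee_int (n : ℤ) : ee n = 1 := by
  rw [ee, Complex.exp_eq_one_iff]; exact ⟨n, by ring⟩

lemma norm_ee (z : ℂ) : ‖ee z‖ = Real.exp (-(2 * π * z.im)) := by
  rw [ee, Complex.norm_exp]; congr 1; simp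

lemma continuous_ee : Continuous ee := by unfold ee; fun_prop

lemma hasDerivAt_ee (z : ℂ) : HasDerivAt ee (2 * π * I * ee z) z := by
  have h := ((hasDerivAt_id z).const_mul (2 * π * I)).cexp
  refine HasDerivAt.congr_deriv (f' := Complex.exp (2 * π * I * z) *
    (2 * π * I * 1)) ?_ (by rw [ee]; ring)
  exact h

lemma im_neg_one_div (z : ℂ) : (-1 / z).im = z.im / Complex.normSq z := by
  rw [neg_div, one_div, Complex.neg_im, Complex.inv_im]; ring

lemma im_neg_one_div_pos {z : ℂ} (hz : 0 < z.im) : 0 < (-1 / z).im := by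
  rw [im_neg_one_div]
  have h0 : 0 < Complex.normSq z := Complex.normSq_pos.2 (by rintro rfl; simp at hz)
  positivity

/-- The Gaussian transform of a function on Euclidean space. -/
noncomputable def gaussTransform {d : ℕ} (f : EuclideanSpace ℝ (Fin d) → ℂ) (z : ℂ) : ℂ :=
  ∫ x, f x * ee (z * (‖x‖ ^ 2 / 2 : ℝ))

lemma ee_gaussian {d : ℕ} (z : ℂ) (x : EuclideanSpace ℝ (Fin d)) :
    ee (z * (‖x‖ ^ 2 / 2 : ℝ)) = Complex.exp (-(-(π * I * z)) * ‖x‖ ^ 2) := by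
  unfold ee; congr 1; push_cast; ring

lemma neg_pi_I_mul_re {z : ℂ} (hz : 0 < z.im) : 0 < (-(π * I * z)).re := by
  simp; positivity

lemma integrable_ee_gaussian {d : ℕ} {z : ℂ} (hz : 0 < z.im) :
    Integrable (fun x : EuclideanSpace ℝ (Fin d) => ee (z * (‖x‖ ^ 2 / 2 : ℝ))) := by
  simp_rw [ee_gaussian]
  have := GaussianFourier.integrable_cexp_neg_mul_sq_norm_add
    (V := EuclideanSpace ℝ (Fin d)) (neg_pi_I_mul_re hz) 0 0
  simpa using this

lemma fourier_ee_gaussian {d k : ℕ} (hd : d = 2 * k) (hk : 4 ∣ k) {z : ℂ} (hz : 0 < z.im)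
    (ξ : EuclideanSpace ℝ (Fin d)) :
    𝓕 (fun x : EuclideanSpace ℝ (Fin d) => ee (z * (‖x‖ ^ 2 / 2 : ℝ))) ξ =
      (z ^ k)⁻¹ * ee (-1 / z * (‖ξ‖ ^ 2 / 2 : ℝ)) := by
  have hz0 : z ≠ 0 := by rintro rfl; simp at hz
  simp_rw [ee_gaussian]
  have hpi : (π : ℂ) ≠ 0 := by exact_mod_cast pi_ne_zero
  rw [fourier_gaussian_innerProductSpace (neg_pi_I_mul_re hz)]
  congr 1
  · obtain ⟨j, rfl⟩ := hk
    rw [finrank_euclideanSpace_fin]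
    have : ((d : ℂ) / 2) = ((4 * j : ℕ) : ℂ) := by rw [hd]; push_cast; ring
    rw [this, Complex.cpow_natCast]
    have : (π : ℂ) / (-(π * I * z)) = I * z⁻¹ := by
      field_simp; rw [Complex.I_sq]
    rw [this, mul_pow, inv_pow, pow_mul, Complex.I_pow_four]; simp
  · congr 1
    field_simp; rw [Complex.I_sq]; ring

lemma gaussTransform_inv {d k : ℕ} (hd : d = 2 * k) (hk : 4 ∣ k)
    (f : SchwartzMap (EuclideanSpace ℝ (Fin d)) ℂ) {z : ℂ} (hz : 0 < z.im) :
    gaussTransform f (-1 / z) = z ^ k * gaussTransform (𝓕 (⇑f)) z := by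
  have hz0 : z ≠ 0 := by rintro rfl; simp at hz
  have h := VectorFourier.integral_fourierIntegral_smul_eq_flip (L := innerₗ _) (μ := volume)
    (ν := volume) Real.continuous_fourierChar
    continuous_inner
    f.integrable (integrable_ee_gaussian (d := d) hz)
  have h2 : gaussTransform (𝓕 (⇑f)) z = ∫ x, f x •
      𝓕 (fun x : EuclideanSpace ℝ (Fin d) => ee (z * (‖x‖ ^ 2 / 2 : ℝ))) x := by
    rw [gaussTransform]
    simpa [flip_innerₗ] using! h
  rw [h2, gaussTransform, ← integral_const_mul]
  congr 1; ext x
  rw [fourier_ee_gaussian hd hk hz, smul_eq_mul]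
  field_simp

/-- A function on the half line together with its Laplace transform `B`, which is an eigenfunction
of the weight `k` inversion. -/
structure Profile (k : ℕ) (ε : ℂ) (a a' : ℝ → ℂ) (B : ℂ → ℂ) : Prop where
  zero : ∀ u ≤ 0, a u = 0
  zero' : ∀ u ≤ 0, a' u = 0
  deriv : ∀ u, HasDerivAt a (a' u) u
  cont' : Continuous a'
  decay : ∀ N : ℕ, ∃ C, ∀ u, 0 ≤ u → u ^ N * ‖a u‖ ≤ C
  decay' : ∀ N : ℕ, ∃ C, ∀ u, 0 ≤ u → u ^ N * ‖a' u‖ ≤ C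
  eq : ∀ z : ℂ, 0 < z.im → B z = ∫ u, a u * ee (z * (u : ℝ))
  bound : ∃ C, ∀ z : ℂ, 0 < z.im → ‖B z‖ * (1 + ‖z‖) ^ k ≤ C
  inv : ∀ z : ℂ, 0 < z.im → B (-1 / z) = ε * z ^ k * B z

/-- The normalized radial profile in the variable `u = r² / 2`. -/
noncomputable def prof (k : ℕ) (c : ℝ) (φ : ℝ → ℂ) (u : ℝ) : ℂ :=
  if 0 < u then c * (2 * u) ^ (k - 1) * φ (√(2 * u)) else 0

noncomputable def prof' (k : ℕ) (c : ℝ) (φ φ' : ℝ → ℂ) (u : ℝ) : ℂ :=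
  if 0 < u then c * (2 * (k - 1 : ℕ) * (2 * u) ^ (k - 2) * φ (√(2 * u)) +
    (2 * u) ^ (k - 2) * √(2 * u) * φ' (√(2 * u))) else 0

lemma hasDerivAt_prof_pos {k : ℕ} (hk : 4 ≤ k) (c : ℝ) {φ φ' : ℝ → ℂ}
    (h : ∀ t, HasDerivAt φ (φ' t) t) {u : ℝ} (hu : 0 < u) :
    HasDerivAt (prof k c φ) (prof' k c φ φ' u) u := by
  have h0 : √(2 * u) ≠ 0 := by positivity
  have h1 : HasDerivAt (fun u : ℝ => √(2 * u)) (2 / (2 * √(2 * u))) u := by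
    have := ((hasDerivAt_id u).const_mul 2).sqrt (by simpa using hu.ne')
    simpa using this
  have h2 := (h (√(2 * u))).scomp u h1
  have h3 : HasDerivAt (fun u : ℝ => (2 * (u : ℂ)) ^ (k - 1))
      ((k - 1 : ℕ) * (2 * (u : ℂ)) ^ (k - 1 - 1) * 2) u := by
    have : HasDerivAt (fun u : ℝ => 2 * (u : ℂ)) 2 u := by
      simpa using (Complex.ofRealCLM.hasDerivAt (x := u)).const_mul (2 : ℂ)
    exact this.pow (k - 1)
  have h4 := (h3.const_mul (c : ℂ)).mul h2
  have he : prof k c φ =ᶠ[nhds u] fun u => c * (2 * (u : ℂ)) ^ (k - 1) * φ (√(2 * u)) := by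
    filter_upwards [lt_mem_nhds hu] with v hv
    simp [prof, hv]
  refine (HasDerivAt.congr_of_eventuallyEq h4 he).congr_deriv ?_
  obtain ⟨j, rfl⟩ := Nat.exists_eq_add_of_le hk
  have h5 : (2 * (u : ℂ)) = ((√(2 * u) : ℝ) : ℂ) ^ 2 := by
    rw [← Complex.ofReal_pow, Real.sq_sqrt (by positivity)]; push_cast; ring
  have h6 : ((√(2 * u) : ℝ) : ℂ) ≠ 0 := by exact_mod_cast h0
  simp only [prof', hu, if_true]
  rw [show 4 + j - 1 - 1 = j + 2 by omega, show 4 + j - 1 = j + 3 by omega,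
    show 4 + j - 2 = j + 2 by omega]
  simp only [Function.comp, Complex.real_smul]
  push_cast
  rw [h5]
  field_simp
  ring

lemma norm_prof_le {k : ℕ} (c : ℝ) {φ : ℝ → ℂ} {u : ℝ} (hu : 0 ≤ u) :
    ‖prof k c φ u‖ ≤ |c| * (2 * u) ^ (k - 1) * ‖φ (√(2 * u))‖ := by
  unfold prof
  split_ifs
  · simp [abs_of_nonneg hu]
  · simp only [norm_zero]; positivity

lemma norm_prof'_le {k : ℕ} (c : ℝ) {φ φ' : ℝ → ℂ} {u : ℝ} (hu : 0 ≤ u) :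
    ‖prof' k c φ φ' u‖ ≤ |c| * (2 * k * (2 * u) ^ (k - 2) * ‖φ (√(2 * u))‖ +
      (2 * u) ^ (k - 2) * √(2 * u) * ‖φ' (√(2 * u))‖) := by
  unfold prof'
  split_ifs
  · rw [norm_mul, Complex.norm_real, Real.norm_eq_abs]
    refine mul_le_mul_of_nonneg_left ((norm_add_le _ _).trans (add_le_add ?_ ?_)) (abs_nonneg _)
    · simp only [norm_mul, norm_pow, Complex.norm_real, Complex.norm_natCast, Complex.norm_ofNat,
        Real.norm_eq_abs, abs_of_nonneg hu]
      have : ((k - 1 : ℕ) : ℝ) ≤ k := by exact_mod_cast Nat.sub_le _ _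
      gcongr
    · simp only [norm_mul, norm_pow, Complex.norm_real, Complex.norm_ofNat, Real.norm_eq_abs,
        abs_of_nonneg hu, abs_of_nonneg (Real.sqrt_nonneg (2 * u)), le_refl]
  · simp only [norm_zero]; positivity

lemma sqrt_pow_decay {φ : ℝ → ℂ} (h : ∀ N : ℕ, ∃ C, ∀ t, |t| ^ N * ‖φ t‖ ≤ C) (N : ℕ) :
    ∃ C, ∀ u, 0 ≤ u → u ^ N * ‖φ (√(2 * u))‖ ≤ C := by
  obtain ⟨C, hC⟩ := h (2 * N)
  refine ⟨C, fun u hu => le_trans ?_ (hC (√(2 * u)))⟩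
  rw [abs_of_nonneg (by positivity), pow_mul, Real.sq_sqrt (by positivity)]
  gcongr
  linarith

lemma prof_decay (k : ℕ) (c : ℝ) {φ : ℝ → ℂ} (h : ∀ N : ℕ, ∃ C, ∀ t, |t| ^ N * ‖φ t‖ ≤ C)
    (N : ℕ) : ∃ C, ∀ u, 0 ≤ u → u ^ N * ‖prof k c φ u‖ ≤ C := by
  obtain ⟨C, hC⟩ := sqrt_pow_decay h (N + (k - 1))
  refine ⟨|c| * 2 ^ (k - 1) * C, fun u hu => ?_⟩
  calc _ ≤ u ^ N * (|c| * (2 * u) ^ (k - 1) * ‖φ (√(2 * u))‖) := by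
        gcongr; exact norm_prof_le c hu
    _ = |c| * 2 ^ (k - 1) * (u ^ (N + (k - 1)) * ‖φ (√(2 * u))‖) := by ring
    _ ≤ _ := by gcongr; exact hC u hu

lemma prof'_decay (k : ℕ) (c : ℝ) {φ φ' : ℝ → ℂ} (h : ∀ N : ℕ, ∃ C, ∀ t, |t| ^ N * ‖φ t‖ ≤ C)
    (h' : ∀ N : ℕ, ∃ C, ∀ t, |t| ^ N * ‖φ' t‖ ≤ C)
    (N : ℕ) : ∃ C, ∀ u, 0 ≤ u → u ^ N * ‖prof' k c φ φ' u‖ ≤ C := by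
  obtain ⟨C, hC⟩ := sqrt_pow_decay h (N + (k - 2))
  obtain ⟨C1, hC1⟩ := sqrt_pow_decay h' (N + (k - 2))
  obtain ⟨C2, hC2⟩ := sqrt_pow_decay h' (N + (k - 2) + 1)
  refine ⟨|c| * 2 ^ (k - 2) * (2 * k * C + (C1 + 2 * C2)), fun u hu => ?_⟩
  have hs : √(2 * u) ≤ 1 + 2 * u := by
    rw [Real.sqrt_le_left (by positivity)]; nlinarith
  calc _ ≤ u ^ N * (|c| * (2 * k * (2 * u) ^ (k - 2) * ‖φ (√(2 * u))‖ +
      (2 * u) ^ (k - 2) * (1 + 2 * u) * ‖φ' (√(2 * u))‖)) := by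
        gcongr; refine (norm_prof'_le c hu).trans ?_; gcongr
    _ = |c| * 2 ^ (k - 2) * (2 * k * (u ^ (N + (k - 2)) * ‖φ (√(2 * u))‖) +
        (u ^ (N + (k - 2)) * ‖φ' (√(2 * u))‖ + 2 * (u ^ (N + (k - 2) + 1) * ‖φ' (√(2 * u))‖))) := by
        ring
    _ ≤ _ := by
        have := hC u hu; have := hC1 u hu; have := hC2 u hu
        gcongr

lemma hasDerivAt_prof {k : ℕ} (hk : 4 ≤ k) (c : ℝ) {φ φ' : ℝ → ℂ}
    (h : ∀ t, HasDerivAt φ (φ' t) t) (hb : ∀ N : ℕ, ∃ C, ∀ t, |t| ^ N * ‖φ t‖ ≤ C) (u : ℝ) :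
    HasDerivAt (prof k c φ) (prof' k c φ φ' u) u := by
  rcases lt_trichotomy u 0 with hu | rfl | hu
  · have he : prof k c φ =ᶠ[nhds u] fun u => 0 := by
      filter_upwards [gt_mem_nhds hu] with v hv
      simp [prof, hv.le.not_gt]
    simpa [prof', hu.le.not_gt] using (hasDerivAt_const u (0 : ℂ)).congr_of_eventuallyEq he
  · obtain ⟨C, hC⟩ := hb 0
    simp only [pow_zero, one_mul] at hC
    have hC0 : 0 ≤ C := (norm_nonneg _).trans (hC 0)
    simp only [prof', lt_irrefl, if_false]
    rw [hasDerivAt_iff_isLittleO_nhds_zero]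
    have : (fun h : ℝ => prof k c φ (0 + h) - prof k c φ 0 - h • (0 : ℂ)) =O[nhds 0]
        fun h : ℝ => h ^ 2 := by
      refine Asymptotics.IsBigO.of_bound (|c| * 2 ^ (k - 1) * C) ?_
      filter_upwards [gt_mem_nhds (zero_lt_one' ℝ)] with t ht
      simp only [zero_add, prof, lt_irrefl, if_false, sub_zero, smul_zero]
      split_ifs with h0
      · have h1 : t ^ (k - 1) ≤ t ^ 2 := pow_le_pow_of_le_one h0.le ht.le (by omega)
        simp only [norm_mul, norm_pow, Complex.norm_real, Complex.norm_ofNat, Real.norm_eq_abs,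
          abs_of_pos h0]
        calc _ = |c| * 2 ^ (k - 1) * ‖φ √(2 * t)‖ * t ^ (k - 1) := by ring
          _ ≤ _ := by gcongr; exact hC _
      · simp only [norm_zero]; positivity
    refine this.trans_isLittleO ?_
    have := Asymptotics.isLittleO_pow_id (𝕜 := ℝ) (n := 2) (by norm_num)
    simpa using this
  · exact hasDerivAt_prof_pos hk c h hu

lemma continuous_prof' {k : ℕ} (hk : 4 ≤ k) (c : ℝ) {φ φ' : ℝ → ℂ}
    (h : Continuous φ) (h' : Continuous φ') : Continuous (prof' k c φ φ') := by
  unfold prof'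
  refine Continuous.if ?_ (by fun_prop) continuous_const
  intro u hu
  have : frontier {u : ℝ | 0 < u} = {0} := frontier_Ioi
  rw [this] at hu
  simp only [Set.mem_singleton_iff] at hu
  subst hu
  have : k - 2 ≠ 0 := by omega
  simp [this]

section SchwartzProfile

variable {d k : ℕ} (f : SchwartzMap (EuclideanSpace ℝ (Fin d)) ℂ)
  {e : EuclideanSpace ℝ (Fin d)}

lemma schwartz_profile_decay (he : ‖e‖ = 1) (N : ℕ) : ∃ C, ∀ t : ℝ, |t| ^ N * ‖f (t • e)‖ ≤ C := by
  obtain ⟨C, hC⟩ := f.decay N 0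
  refine ⟨C, fun t => ?_⟩
  simpa [norm_smul, he] using hC.2 (t • e)

lemma schwartz_profile'_decay (he : ‖e‖ = 1) (N : ℕ) :
    ∃ C, ∀ t : ℝ, |t| ^ N * ‖fderiv ℝ f (t • e) e‖ ≤ C := by
  obtain ⟨C, hC⟩ := f.decay N 1
  refine ⟨C, fun t => le_trans ?_ (hC.2 (t • e))⟩
  rw [norm_iteratedFDeriv_one, norm_smul, he, mul_one, Real.norm_eq_abs]
  gcongr
  simpa [he] using (fderiv ℝ f (t • e)).le_opNorm e

lemma schwartz_profile_hasDerivAt (t : ℝ) :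
    HasDerivAt (fun t : ℝ => f (t • e)) (fderiv ℝ f (t • e) e) t := by
  have h1 : HasDerivAt (fun t : ℝ => t • e) e t := by
    simpa using (hasDerivAt_id t).smul_const e
  exact (f.differentiableAt.hasFDerivAt (x := t • e)).comp_hasDerivAt t h1

lemma schwartz_profile'_continuous : Continuous fun t : ℝ => fderiv ℝ f (t • e) e := by
  have : Continuous (fderiv ℝ f) := (f.smooth 1).continuous_fderiv (by norm_num)
  fun_prop

variable (d) in
/-- The constant turning radial integrals over `ℝᵈ` into integrals over the half line. -/
noncomputable def radialConst : ℝ :=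
  d * (volume : Measure (EuclideanSpace ℝ (Fin d))).real (Metric.ball 0 1)

lemma radialConst_pos (hd : 0 < d) : 0 < radialConst d := by
  unfold radialConst
  have : 0 < (volume : Measure (EuclideanSpace ℝ (Fin d))).real (Metric.ball 0 1) :=
    ENNReal.toReal_pos (Metric.measure_ball_pos _ _ one_pos).ne' measure_ball_lt_top.ne
  positivity

lemma gaussTransform_eq_prof (hd : d = 2 * k) (hk : 4 ≤ k)
    (hr : ∀ x y : EuclideanSpace ℝ (Fin d), ‖x‖ = ‖y‖ → f x = f y) (he : ‖e‖ = 1) (z : ℂ) :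
    gaussTransform f z = ∫ u, prof k (radialConst d) (fun t => f (t • e)) u * ee (z * (u : ℝ)) := by
  have hnt : Nontrivial (EuclideanSpace ℝ (Fin d)) := ⟨e, 0, by rintro rfl; simp at he⟩
  have h1 : gaussTransform f z = ∫ x : EuclideanSpace ℝ (Fin d),
      (fun r : ℝ => f (r • e) * ee (z * (r ^ 2 / 2 : ℝ))) ‖x‖ := by
    unfold gaussTransform
    congr 1; ext x
    rw [hr x (‖x‖ • e) (by simp [norm_smul, he])]
  rw [h1, integral_fun_norm_addHaar volume
    (fun r : ℝ => f (r • e) * ee (z * (r ^ 2 / 2 : ℝ))), finrank_euclideanSpace_fin]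
  set g : ℝ → ℂ := fun v => (v : ℂ) ^ (k - 1) * f (√v • e) * ee (z * (v / 2 : ℝ)) with hg
  have h2 : ∫ y in Set.Ioi (0 : ℝ), y ^ (d - 1) • (f (y • e) * ee (z * (y ^ 2 / 2 : ℝ))) =
      (1 / 2 : ℝ) • ∫ y in Set.Ioi (0 : ℝ), g y := by
    rw [← integral_comp_rpow_Ioi g (p := 2) (by norm_num), ← integral_smul]
    refine setIntegral_congr_fun measurableSet_Ioi fun y hy => ?_
    have hy' : 0 < y := hy
    simp only [hg, Real.rpow_two, Real.sqrt_sq hy'.le, smul_smul]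
    obtain ⟨j, rfl⟩ := Nat.exists_eq_add_of_le hk
    rw [show d - 1 = 2 * (4 + j - 1) + 1 by omega]
    norm_num
    ring
  have h3 : ∫ u, prof k (radialConst d) (fun t => f (t • e)) u * ee (z * (u : ℝ)) =
      radialConst d * ∫ u in Set.Ioi (0 : ℝ), g (2 * u) := by
    rw [← integral_const_mul, ← integral_indicator measurableSet_Ioi]
    congr 1; ext u
    by_cases hu : 0 < u
    · rw [Set.indicator_of_mem (by exact hu)]
      simp only [prof, hu, if_true, hg]
      push_cast
      rw [mul_div_cancel_left₀ _ (two_ne_zero)]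
      ring
    · rw [Set.indicator_of_notMem (by exact hu)]
      simp [prof, hu]
  rw [h2, h3, integral_comp_mul_left_Ioi g 0 (by norm_num : (0 : ℝ) < 2), mul_zero, radialConst]
  simp only [nsmul_eq_mul, Complex.real_smul]
  push_cast
  ring

lemma norm_gaussTransform_le {z : ℂ} (hz : 0 < z.im) :
    ‖gaussTransform f z‖ ≤ ∫ x, ‖f x‖ := by
  refine norm_integral_le_of_norm_le f.integrable.norm (Filter.Eventually.of_forall fun x => ?_)
  rw [norm_mul, norm_ee]
  refine mul_le_of_le_one_right (norm_nonneg _) ?_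
  rw [Real.exp_le_one_iff]
  simp only [Complex.im_mul_ofReal, Left.neg_nonpos_iff]
  positivity

lemma profile_of_schwartz (hd : d = 2 * k) (hk : 4 ≤ k) (hk4 : 4 ∣ k)
    (hr : ∀ x y : EuclideanSpace ℝ (Fin d), ‖x‖ = ‖y‖ → f x = f y) (he : ‖e‖ = 1)
    {ε : ℂ} (hε : ε = 1 ∨ ε = -1) (hf : ∀ x, 𝓕 (⇑f) x = ε * f x) :
    Profile k ε (prof k (radialConst d) (fun t => f (t • e)))
      (prof' k (radialConst d) (fun t => f (t • e)) (fun t => fderiv ℝ f (t • e) e))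
      (gaussTransform f) := by
  have hinv : ∀ z : ℂ, 0 < z.im →
      gaussTransform f (-1 / z) = ε * z ^ k * gaussTransform f z := by
    intro z hz
    rw [gaussTransform_inv hd hk4 f hz, mul_comm ε, mul_assoc]
    congr 1
    rw [gaussTransform, gaussTransform, ← integral_const_mul]
    congr 1; ext x
    rw [hf x, mul_assoc]
  have hε1 : ‖ε‖ = 1 := by rcases hε with rfl | rfl <;> simp
  refine ⟨?_, ?_, fun u => hasDerivAt_prof hk _ (schwartz_profile_hasDerivAt f)
      (schwartz_profile_decay f he) u,
    continuous_prof' hk _ (by have := f.continuous; fun_prop) (schwartz_profile'_continuous f),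
    prof_decay _ _ (schwartz_profile_decay f he),
    prof'_decay _ _ (schwartz_profile_decay f he) (schwartz_profile'_decay f he),
    fun z _ => gaussTransform_eq_prof f hd hk hr he z, ?_, hinv⟩
  · intro u hu; simp [prof, hu.not_gt]
  · intro u hu; simp [prof', hu.not_gt]
  · refine ⟨2 ^ (k - 1) * ((∫ x, ‖f x‖) + ∫ x, ‖f x‖), fun z hz => ?_⟩
    have h1 := norm_gaussTransform_le f hz
    have h2 := norm_gaussTransform_le f (im_neg_one_div_pos hz)
    rw [hinv z hz, norm_mul, norm_mul, hε1, norm_pow, one_mul] at h2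
    calc _ ≤ ‖gaussTransform f z‖ * (2 ^ (k - 1) * (1 ^ k + ‖z‖ ^ k)) := by
          gcongr
          exact add_pow_le (by norm_num) (norm_nonneg _) k
      _ = 2 ^ (k - 1) * (‖gaussTransform f z‖ + ‖z‖ ^ k * ‖gaussTransform f z‖) := by ring
      _ ≤ _ := by gcongr

end SchwartzProfile

/-- A continuous rapidly decreasing function on the half line together with its (decaying)
Laplace transform on the upper half plane. -/
structure LaplacePair (b : ℝ → ℂ) (W : ℂ → ℂ) : Prop where
  zero : ∀ u ≤ 0, b u = 0
  cont : Continuous b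
  decay : ∀ N : ℕ, ∃ C, ∀ u, 0 ≤ u → u ^ N * ‖b u‖ ≤ C
  eq : ∀ z : ℂ, 0 < z.im → W z = ∫ u, b u * ee (z * (u : ℝ))
  bound : ∃ C, ∀ z : ℂ, 0 < z.im → ‖W z‖ * (1 + ‖z‖) ^ 3 ≤ C

lemma norm_ee_mul_le_one {z : ℂ} (hz : 0 ≤ z.im) {u : ℝ} (hu : 0 ≤ u) :
    ‖ee (z * u)‖ ≤ 1 := by
  rw [norm_ee, Real.exp_le_one_iff]
  simp only [Complex.im_mul_ofReal, Left.neg_nonpos_iff]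
  positivity

lemma exists_bound_one_add_sq {b : ℝ → ℂ} (hz : ∀ u ≤ 0, b u = 0)
    (h : ∀ N : ℕ, ∃ C, ∀ u, 0 ≤ u → u ^ N * ‖b u‖ ≤ C) (N : ℕ) :
    ∃ C, 0 ≤ C ∧ ∀ u, |u| ^ N * ‖b u‖ ≤ C * (1 + u ^ 2)⁻¹ := by
  obtain ⟨C0, h0⟩ := h N
  obtain ⟨C2, h2⟩ := h (N + 2)
  have hC : 0 ≤ C0 + C2 := (by positivity : (0 : ℝ) ≤ 0 ^ N * ‖b 0‖ + 0 ^ (N + 2) * ‖b 0‖).trans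
    (add_le_add (h0 0 le_rfl) (h2 0 le_rfl))
  refine ⟨C0 + C2, hC, fun u => ?_⟩
  rw [← div_eq_mul_inv, le_div_iff₀ (by positivity)]
  rcases le_or_gt u 0 with hu | hu
  · rw [hz u hu]; simpa using hC
  · rw [abs_of_pos hu]
    calc _ = u ^ N * ‖b u‖ + u ^ (N + 2) * ‖b u‖ := by ring
      _ ≤ _ := add_le_add (h0 u hu.le) (h2 u hu.le)

lemma integrable_of_decay {b : ℝ → ℂ} (hz : ∀ u ≤ 0, b u = 0) (hc : Continuous b)
    (h : ∀ N : ℕ, ∃ C, ∀ u, 0 ≤ u → u ^ N * ‖b u‖ ≤ C) (N : ℕ) {z : ℂ} (hz' : 0 ≤ z.im) :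
    Integrable fun u : ℝ => (u : ℂ) ^ N * (b u * ee (z * u)) := by
  obtain ⟨C, -, hC⟩ := exists_bound_one_add_sq hz h N
  refine (integrable_inv_one_add_sq.const_mul C).mono'
    (by have := continuous_ee; fun_prop) (Filter.Eventually.of_forall fun u => ?_)
  rcases le_or_gt u 0 with hu | hu
  · refine le_trans ?_ (hC u)
    rw [hz u hu]; simp
  · refine le_trans ?_ (hC u)
    rw [norm_mul, norm_mul, norm_pow, Complex.norm_real, Real.norm_eq_abs]
    gcongr
    exact mul_le_of_le_one_right (norm_nonneg _) (norm_ee_mul_le_one hz' hu.le)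

lemma summable_inv_one_add_sq : Summable fun j : ℤ => (1 + (j : ℝ) ^ 2)⁻¹ := by
  refine Summable.of_nonneg_of_le (fun j => by positivity) (fun j => ?_)
    (Summable.add (Real.summable_one_div_int_pow (p := 2).2 (by norm_num))
      (summable_of_ne_finset_zero (s := {0}) (f := fun j : ℤ => if j = 0 then (1 : ℝ) else 0)
        (by intro j hj; simpa using hj)))
  rcases eq_or_ne j 0 with rfl | hj
  · simp
  · have : (j : ℝ) ≠ 0 := by exact_mod_cast hj
    rw [if_neg hj, add_zero, one_div]
    gcongr
    linarith

lemma summable_inv_one_add_shift_sq (x : ℝ) : Summable fun j : ℤ => (1 + (x + j) ^ 2)⁻¹ := by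
  refine Summable.of_nonneg_of_le (fun j => by positivity) (fun j => ?_)
    (summable_inv_one_add_sq.mul_left (2 * (1 + x ^ 2)))
  rw [← div_eq_mul_inv, inv_eq_one_div, div_le_div_iff₀ (by positivity) (by positivity)]
  nlinarith [sq_nonneg (2 * x + j), sq_nonneg (x * (x + j))]

namespace LaplacePair

variable {b : ℝ → ℂ} {W : ℂ → ℂ} (P : LaplacePair b W)
include P

lemma integrable {z : ℂ} (hz : 0 ≤ z.im) : Integrable fun u : ℝ => b u * ee (z * u) := by
  simpa using integrable_of_decay P.zero P.cont P.decay 0 hz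

lemma fourier_apply {z : ℂ} (hz : 0 < z.im) (ξ : ℝ) :
    𝓕 (fun u : ℝ => b u * ee (z * u)) ξ = W (z - ξ) := by
  rw [P.eq _ (by simpa using hz), Real.fourier_real_eq_integral_exp_smul]
  congr 1; ext u
  rw [sub_mul, sub_eq_add_neg, ee_add, smul_eq_mul]
  have : ee (-(ξ * u : ℂ)) = Complex.exp (((-2 * π * u * ξ : ℝ) : ℂ) * I) := by
    unfold ee; congr 1; push_cast; ring
  rw [this]; ring

lemma continuous_horizontal {z : ℂ} (hz : 0 < z.im) : Continuous fun s : ℝ => W (z + s) := by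
  have h : Continuous (𝓕 (fun u : ℝ => b u * ee (z * u))) := by
    exact VectorFourier.fourierIntegral_continuous Real.continuous_fourierChar
      (by fun_prop) (P.integrable hz.le)
  have h2 := h.comp continuous_neg
  refine h2.congr fun s => ?_
  rw [Function.comp, P.fourier_apply hz]; simp

lemma exists_bound_horizontal : ∃ C, 0 ≤ C ∧ ∀ z : ℂ, 0 < z.im → ‖W z‖ ≤ C * (1 + z.re ^ 2)⁻¹ := by
  obtain ⟨C, hC⟩ := P.bound
  refine ⟨C, le_trans (by positivity) (hC I (by simp)), fun z hz => ?_⟩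
  rw [← div_eq_mul_inv, le_div_iff₀ (by positivity)]
  refine le_trans ?_ (hC z hz)
  gcongr
  have h := Complex.abs_re_le_norm z
  have h0 := abs_nonneg z.re
  rw [← sq_abs]
  nlinarith [pow_le_pow_left₀ h0 h 2, pow_nonneg (norm_nonneg z) 3]

lemma integrable_horizontal {z : ℂ} (hz : 0 < z.im) : Integrable fun s : ℝ => W (z + s) := by
  obtain ⟨C, -, hC⟩ := P.exists_bound_horizontal
  have h1 : Integrable fun s : ℝ => C * (1 + (z.re + s) ^ 2)⁻¹ :=
    (integrable_inv_one_add_sq.comp_add_left z.re).const_mul C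
  refine h1.mono' (P.continuous_horizontal hz).aestronglyMeasurable
    (Filter.Eventually.of_forall fun s => ?_)
  simpa using hC (z + s) (by simpa using hz)

lemma inversion {z : ℂ} (hz : 0 < z.im) (u : ℝ) :
    b u = ∫ s : ℝ, W (z + s) * ee (-((z + s) * u)) := by
  set h : ℝ → ℂ := fun u => b u * ee (z * u) with hh
  have hF : 𝓕 h = fun ξ : ℝ => W (z - ξ) := funext fun ξ => P.fourier_apply hz ξ
  have hi : Integrable (𝓕 h) := by
    rw [hF]
    simpa [sub_eq_add_neg] using (P.integrable_horizontal hz).comp_neg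
  have hc : Continuous h := by
    have := P.cont; have := continuous_ee; fun_prop
  have key := congrFun (hc.fourierInv_fourier_eq (P.integrable hz.le) hi) u
  have hne : ee (-(z * u)) * ee (z * u) = 1 := by rw [← ee_add, neg_add_cancel, ee_zero]
  have : b u = ee (-(z * u)) * h u := by
    rw [hh]; linear_combination (-(b u)) * hne
  rw [this, ← key, hF, Real.fourierInv_eq', ← integral_const_mul, ← integral_neg_eq_self]
  congr 1; ext s
  rw [smul_eq_mul, add_mul, neg_add, ee_add]
  have : ee (-(s * u : ℂ)) = Complex.exp (((2 * π * (u * (-s)) : ℝ) : ℂ) * I) := by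
    unfold ee; congr 1; push_cast; ring
  rw [this]; simp; ring

lemma summable_shift {z : ℂ} (hz : 0 < z.im) : Summable fun j : ℤ => W (z + j) := by
  obtain ⟨C, -, hC⟩ := P.exists_bound_horizontal
  refine Summable.of_norm_bounded ((summable_inv_one_add_shift_sq z.re).mul_left C) fun j => ?_
  simpa using hC (z + j) (by simpa using hz)

lemma poisson {z : ℂ} (hz : 0 < z.im) :
    ∑' j : ℤ, W (z + j) = ∑' n : ℕ, b n * ee (n * z) := by
  set h : ℝ → ℂ := fun u => b u * ee (z * u) with hh
  have hc : Continuous h := by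
    have := P.cont; have := continuous_ee; fun_prop
  have h0 : h =O[Filter.cocompact ℝ] fun x => |x| ^ (-2 : ℝ) := by
    obtain ⟨C, hC0, hC⟩ := exists_bound_one_add_sq P.zero P.decay 0
    refine Asymptotics.IsBigO.of_bound C ?_
    filter_upwards [(isCompact_singleton (x := (0 : ℝ))).compl_mem_cocompact] with u hu
    have hu0 : u ≠ 0 := by simpa using hu
    refine le_trans (?_ : _ ≤ ‖b u‖) (le_trans (by simpa using hC u) ?_)
    · rcases le_or_gt u 0 with hu | hu
      · rw [hh]; simp [P.zero u hu]
      · rw [hh, norm_mul]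
        exact mul_le_of_le_one_right (norm_nonneg _) (norm_ee_mul_le_one hz.le hu.le)
    · rw [Real.rpow_neg (abs_nonneg _)]
      norm_num
      gcongr
      linarith
  have hs : Summable fun n : ℤ => 𝓕 h n := by
    simp_rw [hh, P.fourier_apply hz]
    have := (Equiv.neg ℤ).summable_iff.2 (P.summable_shift hz)
    refine this.congr fun n => ?_
    simp [sub_eq_add_neg]
  have key := Real.tsum_eq_tsum_fourier_of_rpow_decay_of_summable hc (b := 2) (by norm_num) h0 hs 0
  have h2 : ∑' n : ℤ, 𝓕 h n * fourier n ((0 : ℝ) : UnitAddCircle) = ∑' j : ℤ, W (z + j) := by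
    rw [← (Equiv.neg ℤ).tsum_eq fun j : ℤ => W (z + j)]
    refine tsum_congr fun n => ?_
    simp only [hh, P.fourier_apply hz]
    simp [sub_eq_add_neg]
  rw [← h2, ← key]
  rw [← Function.Injective.tsum_eq (f := fun n : ℤ => h (0 + n)) (g := ((↑) : ℕ → ℤ))
    Nat.cast_injective]
  · refine tsum_congr fun n => ?_
    simp [hh, mul_comm]
  · intro n hn
    rcases lt_or_ge n 0 with h1 | h1
    · exact absurd (by simp [hh, P.zero n (by exact_mod_cast h1.le)]) hn
    · exact ⟨n.toNat, by simpa using h1⟩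

end LaplacePair

namespace Profile

variable {k : ℕ} {ε : ℂ} {a a' : ℝ → ℂ} {B : ℂ → ℂ} (P : Profile k ε a a' B)
include P

lemma laplacePair (hk : 4 ≤ k) : LaplacePair a B where
  zero := P.zero
  cont := continuous_iff_continuousAt.2 fun u => (P.deriv u).continuousAt
  decay := P.decay
  eq := P.eq
  bound := by
    obtain ⟨C, hC⟩ := P.bound
    refine ⟨C, fun z hz => le_trans ?_ (hC z hz)⟩
    gcongr
    · linarith [norm_nonneg z]
    · omega

lemma laplacePair' (hk : 4 ≤ k) :
    LaplacePair a' fun z => -(2 * π * I) * (z * B z) where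
  zero := P.zero'
  cont := P.cont'
  decay := P.decay'
  eq z hz := by
    have h1 := (P.laplacePair hk).integrable hz.le
    have h2 : Integrable fun u : ℝ => a' u * ee (z * u) := by
      simpa using integrable_of_decay P.zero' P.cont' P.decay' 0 hz.le
    have hd : ∀ u : ℝ, HasDerivAt (fun u : ℝ => ee (z * u)) (2 * π * I * z * ee (z * u)) u := by
      intro u
      have h3 : HasDerivAt (fun u : ℝ => z * (u : ℂ)) z u := by
        simpa using (Complex.ofRealCLM.hasDerivAt (x := u)).const_mul z
      have := (hasDerivAt_ee (z * u)).comp u h3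
      refine this.congr_deriv (by ring)
    have := integral_mul_deriv_eq_deriv_mul_of_integrable (u := a) (v := fun u : ℝ => ee (z * u))
      (fun u _ => P.deriv u) (fun u _ => hd u)
      (by
        refine (h1.const_mul (2 * π * I * z)).congr (Filter.Eventually.of_forall fun u => ?_)
        simp only [Pi.mul_apply]; ring) h2 h1
    rw [P.eq z hz, ← neg_eq_iff_eq_neg.2 this, ← integral_const_mul, ← integral_const_mul,
      ← integral_neg]
    congr 1; ext u; ring
  bound := by
    obtain ⟨C, hC⟩ := P.bound
    refine ⟨2 * π * C, fun z hz => ?_⟩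
    simp only [norm_mul, norm_neg, Complex.norm_ofNat, Complex.norm_real, Complex.norm_I,
      Real.norm_eq_abs, abs_of_pos pi_pos, mul_one]
    calc _ = 2 * π * (‖B z‖ * (‖z‖ * (1 + ‖z‖) ^ 3)) := by ring
      _ ≤ 2 * π * (‖B z‖ * (1 + ‖z‖) ^ k) := by
        gcongr
        calc _ ≤ (1 + ‖z‖) * (1 + ‖z‖) ^ 3 := by gcongr; linarith
          _ = (1 + ‖z‖) ^ 4 := by ring
          _ ≤ _ := by gcongr; linarith [norm_nonneg z]
      _ ≤ _ := by gcongr; exact hC z hz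

end Profile

/-- The weighted size of the values of `a` and `a'` at the integers `n ≥ n₀`. -/
noncomputable def dataSum (n₀ K : ℕ) (a a' : ℝ → ℂ) : ℝ :=
  ∑' n : ℕ, ((n + n₀ : ℕ) : ℝ) ^ K * (‖a (n + n₀ : ℕ)‖ + ‖a' (n + n₀ : ℕ)‖)

/-- The values of profiles and their derivatives at integers `n ≥ n₀` control the profile. -/
def Stable (k n₀ : ℕ) (ε : ℂ) : Prop :=
  ∃ A K : ℕ, ∃ C : ℝ, 0 ≤ C ∧ ∀ a a' B, Profile k ε a a' B → ∀ z : ℂ, 0 < z.im → z.im ≤ 1 →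
    ‖B z‖ * (1 + |z.re|) ^ 3 * z.im ^ A ≤ C * dataSum n₀ K a a'

lemma norm_exp_sub_one_le_sqrt {w : ℂ} (hw : w.re ≤ 2 * π) :
    ‖Complex.exp w - 1‖ ≤ (1 + Real.exp (2 * π)) * √‖w‖ := by
  have h2 : 1 ≤ Real.exp (2 * π) := Real.one_le_exp (by positivity)
  rcases le_or_gt ‖w‖ 1 with h | h
  · refine (Complex.norm_exp_sub_one_le h).trans ?_
    have : ‖w‖ ≤ √‖w‖ := Real.le_sqrt_of_sq_le (by nlinarith [norm_nonneg w])
    nlinarith [norm_nonneg w]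
  · have h1 : 1 ≤ √‖w‖ := Real.one_le_sqrt.2 h.le
    calc _ ≤ ‖Complex.exp w‖ + ‖(1 : ℂ)‖ := norm_sub_le _ _
      _ ≤ Real.exp (2 * π) + 1 := by
        rw [Complex.norm_exp, norm_one]; gcongr
      _ ≤ _ := by nlinarith

lemma norm_ee_sub_le {n : ℕ} (hn : 1 ≤ n) {η : ℝ} (hη : |η| ≤ 1) (s : ℝ) {z : ℂ}
    (hz : z = I * (n : ℂ)⁻¹) :
    ‖ee (-((z + s) * (n : ℝ))) - ee (-((z + s) * (n + η : ℝ)))‖ ≤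
      Real.exp (2 * π) * ((1 + Real.exp (2 * π)) * √(2 * π)) * (√|η| * √(1 + |s|)) := by
  have hn' : (1 : ℝ) ≤ n := by exact_mod_cast hn
  have hn0 : (n : ℂ) ≠ 0 := by exact_mod_cast (by omega : n ≠ 0)
  have hinv : (n : ℝ)⁻¹ ≤ 1 := inv_le_one_of_one_le₀ hn'
  have him : (z + s).im = (n : ℝ)⁻¹ := by
    rw [hz, ← Complex.ofReal_natCast, ← Complex.ofReal_inv]; simp
  have hnz : ‖z + s‖ ≤ 1 + |s| := by
    refine (norm_add_le _ _).trans ?_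
    rw [hz]; simp; linarith
  have h1 : ee (-((z + s) * (n + η : ℝ))) = ee (-((z + s) * (n : ℝ))) * ee (-((z + s) * η)) := by
    rw [← ee_add]; congr 1; push_cast; ring
  have h2 : ‖ee (-((z + s) * (n : ℝ)))‖ = Real.exp (2 * π) := by
    rw [norm_ee]; congr 1
    rw [Complex.neg_im, Complex.im_mul_ofReal, him]; field_simp
  rw [h1, ← mul_one_sub, norm_mul, h2, norm_sub_rev, mul_assoc]
  gcongr
  refine (norm_exp_sub_one_le_sqrt ?_).trans ?_
  · have : (2 * π * I * (-((z + s) * η))).re = 2 * π * ((z + s).im * η) := by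
      simp
    rw [this, him]
    have := abs_le.1 hη
    have h3 : (n : ℝ)⁻¹ * η ≤ 1 :=
      (mul_le_mul_of_nonneg_left this.2 (by positivity)).trans (by simpa using hinv)
    nlinarith [pi_pos]
  · have h4 : √‖2 * π * I * (-((z + s) * η))‖ ≤ √(2 * π) * (√|η| * √(1 + |s|)) := by
      rw [← Real.sqrt_mul (by positivity), ← Real.sqrt_mul (by positivity)]
      apply Real.sqrt_le_sqrt
      simp only [norm_mul, norm_neg, Complex.norm_ofNat, Complex.norm_real, Complex.norm_I,
        Real.norm_eq_abs, abs_of_pos pi_pos, mul_one]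
      rw [mul_comm |η|]; gcongr
    exact (mul_le_mul_of_nonneg_left h4 (by positivity)).trans (le_of_eq (by ring))

/-- The universal constant in the comparison of values at nearby points. -/
noncomputable def nearConst : ℝ :=
  Real.exp (2 * π) * ((1 + Real.exp (2 * π)) * √(2 * π)) *
    ∫ s : ℝ, (1 + |s|) ^ (-(3 / 2) : ℝ)

lemma nearConst_nonneg : 0 ≤ nearConst := by
  unfold nearConst
  have : 0 ≤ ∫ s : ℝ, (1 + |s|) ^ (-(3 / 2) : ℝ) := integral_nonneg fun s => by positivity
  positivity

lemma LaplacePair.norm_sub_le {b : ℝ → ℂ} {W : ℂ → ℂ} (P : LaplacePair b W) {n : ℕ} (hn : 1 ≤ n)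
    {η : ℝ} (hη : |η| ≤ 1) {M : ℝ}
    (hM : ∀ z : ℂ, z.im = (n : ℝ)⁻¹ → ‖W z‖ * (1 + |z.re|) ^ 2 ≤ M) :
    ‖b n - b (n + η)‖ ≤ nearConst * (M * √|η|) := by
  have hn' : (0 : ℝ) < n := by exact_mod_cast hn
  set z : ℂ := I * (n : ℂ)⁻¹ with hz
  have him : z.im = (n : ℝ)⁻¹ := by
    rw [hz, ← Complex.ofReal_natCast, ← Complex.ofReal_inv]; simp
  have hre : z.re = 0 := by
    rw [hz, ← Complex.ofReal_natCast, ← Complex.ofReal_inv]; simp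
  have hpos : 0 < z.im := by rw [him]; positivity
  have hitg : ∀ u : ℝ, Integrable fun s : ℝ => W (z + s) * ee (-((z + s) * u)) := by
    intro u
    refine (P.integrable_horizontal hpos).mul_bdd (c := Real.exp (2 * π * (z.im * u)))
      (by have := continuous_ee; fun_prop) (Filter.Eventually.of_forall fun s => ?_)
    rw [norm_ee]; simp
  rw [P.inversion hpos n, P.inversion hpos (n + η), ← integral_sub (hitg _) (hitg _)]
  have hbi : Integrable fun s : ℝ => (1 + |s|) ^ (-(3 / 2) : ℝ) := by
    have := integrable_one_add_norm (E := ℝ) (μ := volume) (r := 3 / 2) (by norm_num)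
    simpa using this
  set E := Real.exp (2 * π) * ((1 + Real.exp (2 * π)) * √(2 * π)) with hE
  have hE0 : 0 ≤ E := by positivity
  refine (norm_integral_le_of_norm_le (hbi.const_mul (E * (M * √|η|)))
    (Filter.Eventually.of_forall fun s => ?_)).trans ?_
  · rw [← mul_sub, norm_mul]
    have h1 := norm_ee_sub_le hn hη s hz
    have h2 := hM (z + s) (by simpa using him)
    simp only [Complex.add_re, hre, Complex.ofReal_re, zero_add] at h2
    have h3 : √(1 + |s|) = (1 + |s|) ^ 2 * (1 + |s|) ^ (-(3 / 2) : ℝ) := by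
      rw [Real.sqrt_eq_rpow, ← Real.rpow_natCast, ← Real.rpow_add (by positivity)]; norm_num
    have h4 := norm_nonneg (W (z + s))
    calc _ ≤ ‖W (z + s)‖ * (E * (√|η| * √(1 + |s|))) := by gcongr
      _ = ‖W (z + s)‖ * (1 + |s|) ^ 2 * (E * √|η| * (1 + |s|) ^ (-(3 / 2) : ℝ)) := by rw [h3]; ring
      _ ≤ M * (E * √|η| * (1 + |s|) ^ (-(3 / 2) : ℝ)) := by gcongr
      _ = _ := by ring
  · rw [integral_const_mul, nearConst]
    apply le_of_eq; ring

lemma pow_mul_le_two_mul_inv_sq {f : ℝ → ℂ} (h : ∀ N : ℕ, ∃ C, ∀ u, 0 ≤ u → u ^ N * ‖f u‖ ≤ C)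
    (K : ℕ) : ∃ C, 0 ≤ C ∧ ∀ n : ℕ, (n : ℝ) ^ K * ‖f n‖ ≤ C * (1 + (n : ℝ) ^ 2)⁻¹ := by
  obtain ⟨C0, h0⟩ := h K
  obtain ⟨C2, h2⟩ := h (K + 2)
  refine ⟨C0 + C2, ?_, fun n => ?_⟩
  · exact (by positivity : (0 : ℝ) ≤ 0 ^ K * ‖f 0‖ + 0 ^ (K + 2) * ‖f 0‖).trans
      (add_le_add (h0 0 le_rfl) (h2 0 le_rfl))
  · rw [← div_eq_mul_inv, le_div_iff₀ (by positivity)]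
    calc _ = (n : ℝ) ^ K * ‖f n‖ + (n : ℝ) ^ (K + 2) * ‖f n‖ := by ring
      _ ≤ _ := add_le_add (h0 n (by positivity)) (h2 n (by positivity))

lemma summable_nat_inv_one_add_sq : Summable fun n : ℕ => (1 + (n : ℝ) ^ 2)⁻¹ := by
  have := summable_inv_one_add_sq.comp_injective Nat.cast_injective
  refine this.congr fun n => ?_
  simp

namespace Profile

variable {k : ℕ} {ε : ℂ} {a a' : ℝ → ℂ} {B : ℂ → ℂ} (P : Profile k ε a a' B)
include P

lemma summable_pow_mul (K : ℕ) : Summable fun n : ℕ => (n : ℝ) ^ K * (‖a n‖ + ‖a' n‖) := by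
  obtain ⟨C, -, hC⟩ := pow_mul_le_two_mul_inv_sq P.decay K
  obtain ⟨C', -, hC'⟩ := pow_mul_le_two_mul_inv_sq P.decay' K
  refine Summable.of_nonneg_of_le (fun n => by positivity) (fun n => ?_)
    (summable_nat_inv_one_add_sq.mul_left (C + C'))
  rw [mul_add, add_mul]
  exact add_le_add (hC n) (hC' n)

lemma summable_dataSum (n₀ K : ℕ) : Summable fun n : ℕ =>
    ((n + n₀ : ℕ) : ℝ) ^ K * (‖a (n + n₀ : ℕ)‖ + ‖a' (n + n₀ : ℕ)‖) :=
  (P.summable_pow_mul K).comp_injective (add_left_injective n₀)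

end Profile

lemma dataSum_nonneg (n₀ K : ℕ) (a a' : ℝ → ℂ) : 0 ≤ dataSum n₀ K a a' :=
  tsum_nonneg fun n => by positivity

theorem Stable.exists_perturbation {k n₀ : ℕ} (hk : 4 ≤ k) (hn₀ : 1 ≤ n₀) {ε : ℂ}
    (h : Stable k n₀ ε) :
    ∃ C₀ : ℝ, 0 < C₀ ∧ ∃ δ : ℝ, 0 < δ ∧ ∀ η : ℕ → ℝ,
      (∀ n, n₀ ≤ n → |η n| ≤ δ * (n : ℝ) ^ (-C₀)) → ∀ a a' B, Profile k ε a a' B →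
      (∀ n : ℕ, n₀ ≤ n → a (n + η n) = 0 ∧ a' (n + η n) = 0) → ∀ u, a u = 0 := by
  obtain ⟨A, K, C, hC, hS⟩ := h
  set E := nearConst * C * (1 + 2 * π) with hE
  have hE0 : 0 ≤ E := by have := nearConst_nonneg; positivity
  set S := ∑' n : ℕ, (1 + (n : ℝ) ^ 2)⁻¹ with hS'
  have hS0 : 0 ≤ S := tsum_nonneg fun n => by positivity
  set δ := ((4 * E * S + 1) ^ 2)⁻¹ with hδ
  have hδ0 : 0 < δ := by positivity
  have hδ1 : δ ≤ 1 := inv_le_one_of_one_le₀ (one_le_pow₀ (by nlinarith [mul_nonneg hE0 hS0]))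
  refine ⟨2 * (A + K + 2 : ℕ), by positivity, δ, hδ0, fun η hη a a' B P hz => ?_⟩
  set D := dataSum n₀ K a a' with hD
  have hD0 : 0 ≤ D := dataSum_nonneg _ _ _ _
  have key : ∀ n : ℕ, n₀ ≤ n →
      (n : ℝ) ^ K * (‖a n‖ + ‖a' n‖) ≤ E * D * √δ * (2 * (1 + (n : ℝ) ^ 2)⁻¹) := by
    intro n hn
    have hn1 : (1 : ℝ) ≤ n := by exact_mod_cast hn₀.trans hn
    have hη1 : |η n| ≤ δ * ((n : ℝ) ^ (A + K + 2)) ⁻¹ ^ 2 := by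
      refine (hη n hn).trans (le_of_eq ?_)
      rw [Real.rpow_neg (by positivity), inv_pow, ← pow_mul, mul_comm (A + K + 2) 2,
        ← Real.rpow_natCast]
      push_cast; rfl
    have hη2 : |η n| ≤ 1 := by
      refine hη1.trans (mul_le_one₀ hδ1 (by positivity) (pow_le_one₀ (by positivity) ?_))
      exact inv_le_one_of_one_le₀ (one_le_pow₀ hn1)
    have hη3 : √|η n| ≤ √δ * ((n : ℝ) ^ (A + K + 2))⁻¹ := by
      rw [Real.sqrt_le_left (by positivity), mul_pow, Real.sq_sqrt hδ0.le]
      exact hη1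
    have hB : ∀ z : ℂ, z.im = (n : ℝ)⁻¹ → ‖B z‖ * (1 + |z.re|) ^ 3 ≤ C * D * (n : ℝ) ^ A := by
      intro z hz
      have := hS a a' B P z (by rw [hz]; positivity) (by rw [hz]; exact inv_le_one_of_one_le₀ hn1)
      rw [hz, inv_pow, ← div_eq_mul_inv, div_le_iff₀ (by positivity)] at this
      exact this
    have h1 := (P.laplacePair hk).norm_sub_le (hn₀.trans hn) hη2 (M := C * D * (n : ℝ) ^ A)
      (fun z hz => le_trans (by gcongr; · linarith [abs_nonneg z.re]
                                · norm_num) (hB z hz))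
    have h2 := (P.laplacePair' hk).norm_sub_le (hn₀.trans hn) hη2 (M := 2 * π * (C * D * (n : ℝ) ^ A))
      (fun z hz => by
        refine le_trans ?_ (mul_le_mul_of_nonneg_left (hB z hz) (by positivity))
        simp only [norm_mul, norm_neg, Complex.norm_ofNat, Complex.norm_real, Complex.norm_I,
          Real.norm_eq_abs, abs_of_pos pi_pos, mul_one]
        have : ‖z‖ ≤ 1 + |z.re| := by
          refine (Complex.norm_le_abs_re_add_abs_im z).trans ?_
          rw [hz, abs_of_nonneg (show (0 : ℝ) ≤ (n : ℝ)⁻¹ by positivity)]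
          linarith [inv_le_one_of_one_le₀ hn1]
        calc _ = 2 * π * (‖B z‖ * (‖z‖ * (1 + |z.re|) ^ 2)) := by ring
          _ ≤ 2 * π * (‖B z‖ * ((1 + |z.re|) * (1 + |z.re|) ^ 2)) := by gcongr
          _ = _ := by ring)
    rw [(hz n hn).1, sub_zero] at h1
    rw [(hz n hn).2, sub_zero] at h2
    have hN := nearConst_nonneg
    calc _ ≤ (n : ℝ) ^ K * (nearConst * (C * D * (n : ℝ) ^ A * √|η n|) +
          nearConst * (2 * π * (C * D * (n : ℝ) ^ A) * √|η n|)) := by gcongr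
      _ = E * D * (n : ℝ) ^ (A + K) * √|η n| := by rw [hE]; ring
      _ ≤ E * D * (n : ℝ) ^ (A + K) * (√δ * ((n : ℝ) ^ (A + K + 2))⁻¹) := by gcongr
      _ = E * D * √δ * ((n : ℝ) ^ 2)⁻¹ := by
        rw [pow_add _ (A + K) 2]; field_simp
      _ ≤ _ := by
        gcongr
        rw [← div_eq_mul_inv, inv_eq_one_div, div_le_div_iff₀ (by positivity) (by positivity)]
        nlinarith
  have hD2 : D ≤ D / 2 := by
    have h1 : D ≤ ∑' n : ℕ, E * D * √δ * (2 * (1 + ((n + n₀ : ℕ) : ℝ) ^ 2)⁻¹) :=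
      (P.summable_dataSum n₀ K).tsum_le_tsum (fun n => key _ (by omega))
        (((summable_nat_inv_one_add_sq.comp_injective (add_left_injective n₀)).mul_left 2).mul_left _)
    rw [tsum_mul_left, tsum_mul_left] at h1
    have h2 : ∑' n : ℕ, (1 + ((n + n₀ : ℕ) : ℝ) ^ 2)⁻¹ ≤ S :=
      tsum_comp_le_tsum_of_inj summable_nat_inv_one_add_sq (fun n => by positivity)
        (add_left_injective n₀)
    have h3 : √δ = (4 * E * S + 1)⁻¹ := by
      rw [hδ, Real.sqrt_inv, Real.sqrt_sq (by positivity)]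
    have h4 : D ≤ E * D * √δ * (2 * S) := h1.trans (by gcongr)
    have h5 : E * D * √δ * (2 * S) = D / 2 * (4 * E * S * (4 * E * S + 1)⁻¹) := by
      rw [h3]; ring
    rw [h5] at h4
    refine h4.trans (mul_le_of_le_one_right (by positivity) ?_)
    rw [← div_eq_mul_inv, div_le_one (by positivity)]
    linarith
  have hD3 : D = 0 := by linarith
  intro u
  rw [(P.laplacePair hk).inversion (z := I) (by simp) u]
  refine integral_eq_zero_of_ae (Filter.Eventually.of_forall fun s => ?_)
  have := hS a a' B P (I + s) (by simp) (by simp)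
  rw [← hD, hD3] at this
  have h0 : ‖B (I + s)‖ = 0 := by
    refine le_antisymm ?_ (norm_nonneg _)
    have h6 : (0 : ℝ) < (1 + |(I + s : ℂ).re|) ^ 3 * (I + s : ℂ).im ^ A := by
      simp; positivity
    rw [mul_assoc, mul_zero] at this
    exact nonpos_of_mul_nonpos_left this h6
  simp [norm_eq_zero.1 h0]

lemma schwartz_eq_zero_of_radial {d : ℕ} {f : SchwartzMap (EuclideanSpace ℝ (Fin d)) ℂ}
    (hr : ∀ x y : EuclideanSpace ℝ (Fin d), ‖x‖ = ‖y‖ → f x = f y)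
    {e : EuclideanSpace ℝ (Fin d)} (he : ‖e‖ = 1) (h : ∀ t : ℝ, 0 < t → f (t • e) = 0)
    (x : EuclideanSpace ℝ (Fin d)) : f x = 0 := by
  rcases eq_or_ne x 0 with rfl | hx
  · have h1 : Filter.Tendsto (fun t : ℝ => f (t • e)) (nhdsWithin 0 (Set.Ioi 0)) (nhds (f 0)) := by
      have : Continuous fun t : ℝ => f (t • e) := by have := f.continuous; fun_prop
      simpa using (this.tendsto 0).mono_left nhdsWithin_le_nhds
    refine tendsto_nhds_unique h1 (tendsto_const_nhds.congr' ?_)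
    filter_upwards [self_mem_nhdsWithin] with t ht
    exact (h t ht).symm
  · rw [hr x (‖x‖ • e) (by simp [norm_smul, he])]
    exact h _ (norm_pos_iff.2 hx)

lemma fourier_radial {d : ℕ} {f : SchwartzMap (EuclideanSpace ℝ (Fin d)) ℂ}
    (hr : ∀ x y : EuclideanSpace ℝ (Fin d), ‖x‖ = ‖y‖ → f x = f y)
    (x y : EuclideanSpace ℝ (Fin d)) (h : ‖x‖ = ‖y‖) : 𝓕 (⇑f) x = 𝓕 (⇑f) y := by
  have h1 := Real.fourier_comp_linearIsometry (Submodule.reflection (ℝ ∙ (x - y))ᗮ) (⇑f) x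
  have h2 : (⇑f ∘ ⇑(Submodule.reflection (ℝ ∙ (x - y))ᗮ)) = ⇑f :=
    funext fun v => hr _ _ (by simp)
  rw [Submodule.reflection_sub h, h2] at h1
  exact h1

lemma fourier_fourier_radial {d : ℕ} {f : SchwartzMap (EuclideanSpace ℝ (Fin d)) ℂ}
    (hr : ∀ x y : EuclideanSpace ℝ (Fin d), ‖x‖ = ‖y‖ → f x = f y)
    (x : EuclideanSpace ℝ (Fin d)) : 𝓕 (𝓕 (⇑f)) x = f x := by
  have h1 : 𝓕⁻ (𝓕 (⇑f)) (-x) = f (-x) := by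
    rw [f.continuous.fourierInv_fourier_eq f.integrable (𝓕 f).integrable]
  rw [hr x (-x) (by simp), ← h1, Real.fourierInv_eq_fourier_neg, neg_neg]

lemma eigen_eq_zero {d k n₀ : ℕ} (hd : d = 2 * k) (hk : 4 ≤ k) (hk4 : 4 ∣ k) {ε : ℂ}
    (hε : ε = 1 ∨ ε = -1) {η : ℕ → ℝ}
    (H : ∀ a a' B, Profile k ε a a' B →
      (∀ n : ℕ, n₀ ≤ n → a (n + η n) = 0 ∧ a' (n + η n) = 0) → ∀ u, a u = 0)
    {f : SchwartzMap (EuclideanSpace ℝ (Fin d)) ℂ}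
    (hr : ∀ x y : EuclideanSpace ℝ (Fin d), ‖x‖ = ‖y‖ → f x = f y)
    {e : EuclideanSpace ℝ (Fin d)} (he : ‖e‖ = 1) (hf : ∀ x, 𝓕 (⇑f) x = ε * f x)
    (h0 : ∀ n : ℕ, n₀ ≤ n → f (√(2 * (n + η n)) • e) = 0 ∧
      fderiv ℝ f (√(2 * (n + η n)) • e) e = 0) (x : EuclideanSpace ℝ (Fin d)) : f x = 0 := by
  have P := profile_of_schwartz f hd hk hk4 hr he hε hf
  have h := H _ _ _ P fun n hn => ?_
  · refine schwartz_eq_zero_of_radial hr he (fun t ht => ?_) x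
    have h1 := h (t ^ 2 / 2)
    have h2 : 2 * (t ^ 2 / 2) = t ^ 2 := by ring
    have hc := (radialConst_pos (d := d) (by omega)).ne'
    simp only [prof, h2, Real.sqrt_sq ht.le] at h1
    rw [if_pos (by positivity)] at h1
    simpa [hc, ht.ne'] using h1
  · simp only [prof, prof', (h0 n hn).1, (h0 n hn).2]
    simp

lemma exists_uniform {d k n₀ : ℕ} (hd : d = 2 * k) (hk : 4 ≤ k) (hk4 : 4 ∣ k) (hn₀ : 1 ≤ n₀)
    (h1 : Stable k n₀ 1) (h2 : Stable k n₀ (-1)) :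
    ∃ C₀ : ℝ, 0 < C₀ ∧ ∃ δ : ℝ, 0 < δ ∧ ∀ ε : ℕ → ℝ,
      (∀ n : ℕ, n₀ ≤ n → |ε n| ≤ δ * (n : ℝ) ^ (-C₀)) →
          ∀ f : SchwartzMap (EuclideanSpace ℝ (Fin d)) ℂ,
            (∀ x y : EuclideanSpace ℝ (Fin d), ‖x‖ = ‖y‖ → f x = f y) →
            ∀ e : EuclideanSpace ℝ (Fin d), ‖e‖ = 1 →
              (∀ n : ℕ, n₀ ≤ n →
                (fun t : ℝ => f (t • e)) (Real.sqrt (2 * (n : ℝ) + ε n)) = 0 ∧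
                deriv (fun t : ℝ => f (t • e)) (Real.sqrt (2 * (n : ℝ) + ε n)) = 0 ∧
                (fun t : ℝ => 𝓕 (⇑f) (t • e)) (Real.sqrt (2 * (n : ℝ) + ε n)) = 0 ∧
                deriv (fun t : ℝ => 𝓕 (⇑f) (t • e)) (Real.sqrt (2 * (n : ℝ) + ε n)) = 0) →
              ∀ x : EuclideanSpace ℝ (Fin d), f x = 0 := by
  obtain ⟨C1, hC1, δ1, hδ1, H1⟩ := h1.exists_perturbation hk hn₀
  obtain ⟨C2, hC2, δ2, hδ2, H2⟩ := h2.exists_perturbation hk hn₀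
  refine ⟨max C1 C2, by positivity, min δ1 δ2, by positivity, fun ε hε f hr e he h0 x => ?_⟩
  set η : ℕ → ℝ := fun n => ε n / 2 with hη
  have hηε : ∀ n : ℕ, 2 * ((n : ℝ) + η n) = 2 * n + ε n := fun n => by rw [hη]; ring
  have hbound : ∀ C δ : ℝ, C ≤ max C1 C2 → min δ1 δ2 ≤ δ → ∀ n, n₀ ≤ n →
      |η n| ≤ δ * (n : ℝ) ^ (-C) := by
    intro C δ hC hδ n hn
    have hn1 : (1 : ℝ) ≤ n := by exact_mod_cast hn₀.trans hn
    have : |η n| ≤ |ε n| := by rw [hη, abs_div]; norm_num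
    refine this.trans ((hε n hn).trans ?_)
    have : 0 < min δ1 δ2 := by positivity
    refine mul_le_mul hδ (Real.rpow_le_rpow_of_exponent_le hn1 (by linarith)) (by positivity) (by linarith)
  have hf2 : ∀ x, 𝓕 f x = 𝓕 (⇑f) x := fun x => by rw [SchwartzMap.fourier_coe]
  have hz : ∀ (σ : ℂ) (n : ℕ), n₀ ≤ n → (f + σ • 𝓕 f) (√(2 * (n + η n)) • e) = 0 ∧
      fderiv ℝ (f + σ • 𝓕 f) (√(2 * (n + η n)) • e) e = 0 := by
    intro σ n hn
    obtain ⟨ha, hb, hc, hd⟩ := h0 n hn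
    rw [hηε]
    refine ⟨?_, ?_⟩
    · simp only [add_apply, smul_apply, hf2]
      simp only at ha hc
      rw [ha, hc]; simp
    · have e1 := schwartz_profile_hasDerivAt f (e := e) (√(2 * n + ε n))
      have e2 := schwartz_profile_hasDerivAt (𝓕 f) (e := e) (√(2 * n + ε n))
      have e3 := schwartz_profile_hasDerivAt (f + σ • 𝓕 f) (e := e) (√(2 * n + ε n))
      simp only [hf2] at e2
      rw [e1.deriv] at hb
      rw [e2.deriv] at hd
      rw [hb] at e1
      rw [hd] at e2
      have e4 := e1.add (e2.const_mul σ)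
      have := e3.unique (e4.congr_of_eventuallyEq (Filter.Eventually.of_forall fun t => by
        simp [hf2]))
      simpa using this
  have hrad : ∀ σ : ℂ, ∀ x y : EuclideanSpace ℝ (Fin d), ‖x‖ = ‖y‖ →
      (f + σ • 𝓕 f) x = (f + σ • 𝓕 f) y := by
    intro σ x y hxy
    simp [hf2, hr x y hxy, fourier_radial hr x y hxy]
  have hF : ∀ σ : ℂ, σ * σ = 1 → ∀ x, 𝓕 (⇑(f + σ • 𝓕 f)) x = σ * (f + σ • 𝓕 f) x := by
    intro σ hσ x
    rw [← SchwartzMap.fourier_coe, FourierTransform.fourier_add, FourierTransform.fourier_smul]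
    simp only [add_apply, smul_apply, SchwartzMap.fourier_coe,
      fourier_fourier_radial hr, smul_eq_mul]
    linear_combination (-(𝓕 (⇑f) x)) * hσ
  have r1 := eigen_eq_zero hd hk hk4 (Or.inl rfl) (H1 η (hbound _ _ (le_max_left _ _)
    (min_le_left _ _))) (hrad 1) he (hF 1 (by norm_num)) (hz 1) x
  have r2 := eigen_eq_zero hd hk hk4 (Or.inr rfl) (H2 η (hbound _ _ (le_max_right _ _)
    (min_le_right _ _))) (hrad (-1)) he (hF (-1) (by norm_num)) (hz (-1)) x
  simp only [add_apply, smul_apply, smul_eq_mul] at r1 r2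
  linear_combination (r1 + r2) / 2

lemma HasSum.congr_fun' {f g : ℕ → ℂ} {s : ℂ} (hf : HasSum f s) (h : ∀ n, g n = f n) :
    HasSum g s := by
  rwa [show g = f from funext h]

noncomputable def shiftSum (B : ℂ → ℂ) (z : ℂ) : ℂ := ∑' j : ℤ, B (z + j)

noncomputable def shiftSum' (B : ℂ → ℂ) (z : ℂ) : ℂ := ∑' j : ℤ, (z + j) * B (z + j)

noncomputable def halfU (B : ℂ → ℂ) (z : ℂ) : ℂ := ∑' j : ℕ, B (z + j)

noncomputable def halfU' (B : ℂ → ℂ) (z : ℂ) : ℂ := ∑' j : ℕ, j * B (z + j)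

noncomputable def halfL (B : ℂ → ℂ) (z : ℂ) : ℂ := ∑' j : ℕ, B (z - j)

noncomputable def halfL' (B : ℂ → ℂ) (z : ℂ) : ℂ := ∑' j : ℕ, j * B (z - j)

namespace Profile

variable {k : ℕ} {ε : ℂ} {a a' : ℝ → ℂ} {B : ℂ → ℂ} (P : Profile k ε a a' B)
include P

lemma summable_shift (hk : 4 ≤ k) {z : ℂ} (hz : 0 < z.im) : Summable fun j : ℤ => B (z + j) :=
  (P.laplacePair hk).summable_shift hz

lemma summable_shift' (hk : 4 ≤ k) {z : ℂ} (hz : 0 < z.im) :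
    Summable fun j : ℤ => (z + j) * B (z + j) := by
  have h := (P.laplacePair' hk).summable_shift hz
  have h2 : -(2 * π * I) ≠ 0 := neg_ne_zero.2 Complex.two_pi_I_ne_zero
  exact (summable_mul_left_iff h2).1 h

lemma summable_int_mul_shift (hk : 4 ≤ k) {z : ℂ} (hz : 0 < z.im) :
    Summable fun j : ℤ => j * B (z + j) := by
  refine ((P.summable_shift' hk hz).sub ((P.summable_shift hk hz).mul_left z)).congr fun j => ?_
  ring

lemma tsum_int_mul_shift (hk : 4 ≤ k) {z : ℂ} (hz : 0 < z.im) :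
    ∑' j : ℤ, j * B (z + j) = shiftSum' B z - z * shiftSum B z := by
  rw [shiftSum, shiftSum', ← tsum_mul_left,
    ← (P.summable_shift' hk hz).tsum_sub ((P.summable_shift hk hz).mul_left z)]
  exact tsum_congr fun j => by ring

lemma summable_halfU (hk : 4 ≤ k) {z : ℂ} (hz : 0 < z.im) : Summable fun j : ℕ => B (z + j) := by
  simpa [Function.comp_def] using
    (P.summable_shift hk hz).comp_injective (Nat.cast_injective (R := ℤ))

lemma summable_halfU' (hk : 4 ≤ k) {z : ℂ} (hz : 0 < z.im) :
    Summable fun j : ℕ => j * B (z + j) := by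
  simpa [Function.comp_def] using
    (P.summable_int_mul_shift hk hz).comp_injective (Nat.cast_injective (R := ℤ))

lemma summable_halfL (hk : 4 ≤ k) {z : ℂ} (hz : 0 < z.im) : Summable fun j : ℕ => B (z - j) := by
  have := (P.summable_shift hk hz).comp_injective
    (neg_injective.comp (Nat.cast_injective (R := ℤ)))
  simpa [Function.comp_def, sub_eq_add_neg] using this

lemma summable_halfL' (hk : 4 ≤ k) {z : ℂ} (hz : 0 < z.im) :
    Summable fun j : ℕ => j * B (z - j) := by
  have := (P.summable_int_mul_shift hk hz).comp_injective
    (neg_injective.comp (Nat.cast_injective (R := ℤ)))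
  simpa [Function.comp_def, sub_eq_add_neg] using this.neg

lemma halfU_eq (hk : 4 ≤ k) {z : ℂ} (hz : 0 < z.im) : halfU B z = B z + halfU B (z + 1) := by
  rw [halfU, (P.summable_halfU hk hz).tsum_eq_zero_add, halfU]
  congr 1
  · simp
  · exact tsum_congr fun j => by push_cast; ring_nf

lemma halfL_eq (hk : 4 ≤ k) {z : ℂ} (hz : 0 < z.im) : halfL B z = B z + halfL B (z - 1) := by
  rw [halfL, (P.summable_halfL hk hz).tsum_eq_zero_add, halfL]
  congr 1
  · simp
  · exact tsum_congr fun j => by push_cast; ring_nf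

lemma halfU'_eq (hk : 4 ≤ k) {z : ℂ} (hz : 0 < z.im) :
    halfU' B z = halfU' B (z + 1) + halfU B (z + 1) := by
  have hz1 : 0 < (z + 1).im := by simpa using hz
  rw [halfU', (P.summable_halfU' hk hz).tsum_eq_zero_add, halfU, halfU',
    ← (P.summable_halfU' hk hz1).tsum_add (P.summable_halfU hk hz1)]
  simp only [Nat.cast_zero, zero_mul, zero_add]
  exact tsum_congr fun j => by push_cast; ring_nf

lemma halfL'_eq (hk : 4 ≤ k) {z : ℂ} (hz : 0 < z.im) :
    halfL' B z = halfL' B (z - 1) + halfL B (z - 1) := by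
  have hz1 : 0 < (z - 1).im := by simpa using hz
  rw [halfL', (P.summable_halfL' hk hz).tsum_eq_zero_add, halfL, halfL',
    ← (P.summable_halfL' hk hz1).tsum_add (P.summable_halfL hk hz1)]
  simp only [Nat.cast_zero, zero_mul, zero_add]
  exact tsum_congr fun j => by push_cast; ring_nf

lemma halfU_add_halfL (hk : 4 ≤ k) {z : ℂ} (hz : 0 < z.im) :
    halfU B z + halfL B (z - 1) = shiftSum B z := by
  have hz1 : 0 < (z - 1).im := by simpa using hz
  have h := HasSum.of_nat_of_neg_add_one (f := fun j : ℤ => B (z + j))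
    (by simpa using (P.summable_halfU hk hz).hasSum)
    (show HasSum _ (halfL B (z - 1)) from by
      refine (P.summable_halfL hk hz1).hasSum.congr_fun' fun j => ?_
      push_cast; ring_nf)
  exact h.tsum_eq.symm

lemma halfU'_sub_halfL' (hk : 4 ≤ k) {z : ℂ} (hz : 0 < z.im) :
    halfU' B z - (halfL' B (z - 1) + halfL B (z - 1)) = shiftSum' B z - z * shiftSum B z := by
  have hz1 : 0 < (z - 1).im := by simpa using hz
  have h := HasSum.of_nat_of_neg_add_one (f := fun j : ℤ => j * B (z + j))
    (by simpa using (P.summable_halfU' hk hz).hasSum)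
    (show HasSum _ (-(halfL' B (z - 1) + halfL B (z - 1))) from by
      refine ((P.summable_halfL' hk hz1).hasSum.add (P.summable_halfL hk hz1).hasSum).neg.congr_fun'
        fun j => ?_
      push_cast; ring_nf)
  rw [← P.tsum_int_mul_shift hk hz, h.tsum_eq, halfU', sub_eq_add_neg]

lemma shiftSum_eq (hk : 4 ≤ k) {z : ℂ} (hz : 0 < z.im) :
    shiftSum B z = ∑' n : ℕ, a n * ee (n * z) := (P.laplacePair hk).poisson hz

lemma shiftSum'_eq (hk : 4 ≤ k) {z : ℂ} (hz : 0 < z.im) :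
    -(2 * π * I) * shiftSum' B z = ∑' n : ℕ, a' n * ee (n * z) := by
  rw [← (P.laplacePair' hk).poisson hz, shiftSum', ← tsum_mul_left]

end Profile

/-- A node of the weighted Farey tree, as seen from a fixed point of the upper half plane. -/
structure FareyEdge where
  (P Q : ℂ)
  (x y f s t : ℝ)

namespace FareyEdge

def left (e : FareyEdge) : FareyEdge :=
  ⟨e.P, e.P + e.Q, e.x, e.x + e.y, e.f + e.s, e.s, -(e.s + e.t)⟩

def right (e : FareyEdge) : FareyEdge :=
  ⟨e.P + e.Q, e.Q, e.x + e.y, e.y, e.f - e.t, -(e.s + e.t), e.t⟩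

end FareyEdge

section fans

variable (k : ℕ) (B : ℂ → ℂ) (P Q : ℂ)

noncomputable def fanU : ℂ := (P ^ k)⁻¹ * halfU B (Q / P)

noncomputable def fanU' : ℂ := (P ^ k)⁻¹ * halfU' B (Q / P)

noncomputable def fanV : ℂ := -((Q ^ k)⁻¹ * halfL B (-P / Q))

noncomputable def fanV' : ℂ := -((Q ^ k)⁻¹ * halfL' B (-P / Q))

noncomputable def fanEdge : ℂ := (P ^ k)⁻¹ * B (Q / P)

noncomputable def fanSum : ℂ := (P ^ k)⁻¹ * shiftSum B (Q / P)

noncomputable def fanSum' : ℂ :=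
  (P ^ k)⁻¹ * (shiftSum' B (Q / P) - Q / P * shiftSum B (Q / P))

end fans

noncomputable def FareyEdge.phi (k : ℕ) (B : ℂ → ℂ) (e : FareyEdge) : ℂ :=
  e.f * (fanU k B e.P e.Q - fanV k B e.P e.Q) + e.s * fanU' k B e.P e.Q + e.t * fanV' k B e.P e.Q

noncomputable def FareyEdge.datum (k : ℕ) (B : ℂ → ℂ) (e : FareyEdge) : ℂ :=
  (e.f - e.t) * fanSum k B (e.P + e.Q) e.Q - (e.s + e.t) * fanSum' k B (e.P + e.Q) e.Q

lemma ne_zero_of_div_im_pos {P Q : ℂ} (h : 0 < (Q / P).im) : P ≠ 0 ∧ Q ≠ 0 ∧ P + Q ≠ 0 := by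
  refine ⟨?_, ?_, ?_⟩
  · rintro rfl; simp at h
  · rintro rfl; simp at h
  · intro h0
    have hP : P ≠ 0 := by rintro rfl; simp at h
    rw [eq_neg_of_add_eq_zero_right h0, neg_div, div_self hP] at h
    simp at h

lemma div_add_im_pos {P Q : ℂ} (h : 0 < (Q / P).im) : 0 < (Q / (P + Q)).im := by
  obtain ⟨hP, hQ, hR⟩ := ne_zero_of_div_im_pos h
  have h1 : 0 < (-1 / (Q / P)).im := im_neg_one_div_pos h
  have h2 : 0 < (-1 / (Q / P) - 1).im := by simpa using h1
  convert im_neg_one_div_pos h2 using 2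
  have : -1 / (Q / P) - 1 = -((P + Q) / Q) := by field_simp; ring
  rw [this]; field_simp

lemma add_div_im_pos {P Q : ℂ} (h : 0 < (Q / P).im) : 0 < ((P + Q) / P).im := by
  obtain ⟨hP, hQ, hR⟩ := ne_zero_of_div_im_pos h
  rw [add_div, div_self hP]; simpa using h

namespace Profile

variable {k : ℕ} {a a' : ℝ → ℂ} {B : ℂ → ℂ} (Pr : Profile k (-1) a a' B)
include Pr

lemma fanU_eq (hk : 4 ≤ k) {P Q : ℂ} (h : 0 < (Q / P).im) :
    fanU k B P Q = fanEdge k B P Q + fanU k B P (P + Q) := by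
  obtain ⟨hP, hQ, hR⟩ := ne_zero_of_div_im_pos h
  rw [fanU, Pr.halfU_eq hk h, fanU, fanEdge, show (P + Q) / P = Q / P + 1 by field_simp; ring]
  ring

lemma fanU'_eq (hk : 4 ≤ k) {P Q : ℂ} (h : 0 < (Q / P).im) :
    fanU' k B P Q = fanU' k B P (P + Q) + fanU k B P (P + Q) := by
  obtain ⟨hP, hQ, hR⟩ := ne_zero_of_div_im_pos h
  rw [fanU', Pr.halfU'_eq hk h, fanU, fanU', show (P + Q) / P = Q / P + 1 by field_simp; ring]
  ring

omit Pr in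
lemma neg_div_im_pos {P Q : ℂ} (h : 0 < (Q / P).im) : 0 < (-P / Q).im := by
  obtain ⟨hP, hQ, hR⟩ := ne_zero_of_div_im_pos h
  convert im_neg_one_div_pos h using 2
  field_simp

lemma fanEdge_eq {P Q : ℂ} (h : 0 < (Q / P).im) :
    fanEdge k B P Q = -((Q ^ k)⁻¹ * B (-P / Q)) := by
  obtain ⟨hP, hQ, hR⟩ := ne_zero_of_div_im_pos h
  have := Pr.inv _ h
  rw [show -1 / (Q / P) = -P / Q by field_simp] at this
  rw [this, fanEdge, div_pow]
  field_simp

lemma fanV_eq (hk : 4 ≤ k) {P Q : ℂ} (h : 0 < (Q / P).im) :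
    fanV k B P Q = fanEdge k B P Q + fanV k B (P + Q) Q := by
  obtain ⟨hP, hQ, hR⟩ := ne_zero_of_div_im_pos h
  rw [Pr.fanEdge_eq h, fanV, Pr.halfL_eq hk (neg_div_im_pos h), fanV,
    show -(P + Q) / Q = -P / Q - 1 by field_simp; ring]
  ring

lemma fanV'_eq (hk : 4 ≤ k) {P Q : ℂ} (h : 0 < (Q / P).im) :
    fanV' k B P Q = fanV' k B (P + Q) Q + fanV k B (P + Q) Q := by
  obtain ⟨hP, hQ, hR⟩ := ne_zero_of_div_im_pos h
  rw [fanV', Pr.halfL'_eq hk (neg_div_im_pos h), fanV, fanV',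
    show -(P + Q) / Q = -P / Q - 1 by field_simp; ring]
  ring

lemma fanU_sub_fanV (hk : 4 ≤ k) {P Q : ℂ} (h : 0 < (Q / P).im) :
    fanU k B (P + Q) Q - fanV k B P (P + Q) = fanSum k B (P + Q) Q := by
  obtain ⟨hP, hQ, hR⟩ := ne_zero_of_div_im_pos h
  rw [fanSum, ← Pr.halfU_add_halfL hk (div_add_im_pos h), fanU, fanV,
    show -P / (P + Q) = Q / (P + Q) - 1 by field_simp; ring]
  ring

lemma fanU'_add_fanV' (hk : 4 ≤ k) {P Q : ℂ} (h : 0 < (Q / P).im) :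
    fanU' k B (P + Q) Q + (fanV' k B P (P + Q) + fanV k B P (P + Q)) =
      fanSum' k B (P + Q) Q := by
  obtain ⟨hP, hQ, hR⟩ := ne_zero_of_div_im_pos h
  rw [fanSum', ← Pr.halfU'_sub_halfL' hk (div_add_im_pos h), fanU', fanV', fanV,
    show -P / (P + Q) = Q / (P + Q) - 1 by field_simp; ring]
  ring

lemma phi_eq (hk : 4 ≤ k) {e : FareyEdge} (h : 0 < (e.Q / e.P).im) :
    e.phi k B = e.left.phi k B + e.right.phi k B - e.datum k B := by
  simp only [FareyEdge.phi, FareyEdge.left, FareyEdge.right, FareyEdge.datum]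
  rw [Pr.fanU_eq hk h, Pr.fanU'_eq hk h, Pr.fanV_eq hk h, Pr.fanV'_eq hk h,
    ← Pr.fanU_sub_fanV hk h, ← Pr.fanU'_add_fanV' hk h]
  push_cast
  ring

end Profile

/-- Bounding a function on a binary tree by a supersolution. -/
lemma tree_bound {E : Type*} (L R : E → E) (X Y Φ g δ : E → ℝ) (G : E → Prop) {M : ℝ} (hM0 : 0 ≤ M)
    (hXL : ∀ e, X (L e) = X e) (hYL : ∀ e, Y (L e) = X e + Y e)
    (hXR : ∀ e, X (R e) = X e + Y e) (hYR : ∀ e, Y (R e) = Y e)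
    (hL : ∀ e, G e → G (L e)) (hR : ∀ e, G e → G (R e))
    (hX : ∀ e, G e → 1 ≤ X e) (hY : ∀ e, G e → 1 ≤ Y e)
    (hΦ : ∀ e, G e → Φ e ≤ Φ (L e) + Φ (R e) + δ e)
    (hg : ∀ e, G e → δ e + g (L e) + g (R e) ≤ g e) (hg0 : ∀ e, G e → 0 ≤ g e)
    (hM : ∀ e, G e → Φ e ≤ M / (X e * Y e * √(X e * Y e))) {e : E} (he : G e) : Φ e ≤ g e := by
  have key : ∀ n : ℕ, ∀ e, G e → Φ e ≤ g e + M / (X e * Y e * √(X e * Y e + n)) := by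
    intro n
    induction n with
    | zero =>
      intro e he
      have := hM e he
      have := hg0 e he
      simp only [Nat.cast_zero, add_zero]; linarith
    | succ n ih =>
      intro e he
      have h1 := hX e he
      have h2 := hY e he
      have hl := ih _ (hL e he)
      have hr := ih _ (hR e he)
      rw [hXL, hYL] at hl
      rw [hXR, hYR] at hr
      have h0 := hΦ e he
      have h0' := hg e he
      have e1 : M / (X e * (X e + Y e) * √(X e * (X e + Y e) + n)) ≤
          M / (X e * (X e + Y e) * √(X e * Y e + (n + 1 : ℕ))) := by
        refine div_le_div_of_nonneg_left hM0 (by positivity)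
          (mul_le_mul_of_nonneg_left (Real.sqrt_le_sqrt ?_) (by positivity))
        push_cast; nlinarith
      have e2 : M / ((X e + Y e) * Y e * √((X e + Y e) * Y e + n)) ≤
          M / ((X e + Y e) * Y e * √(X e * Y e + (n + 1 : ℕ))) := by
        refine div_le_div_of_nonneg_left hM0 (by positivity)
          (mul_le_mul_of_nonneg_left (Real.sqrt_le_sqrt ?_) (by positivity))
        push_cast; nlinarith
      have e3 : M / (X e * (X e + Y e) * √(X e * Y e + (n + 1 : ℕ))) +
          M / ((X e + Y e) * Y e * √(X e * Y e + (n + 1 : ℕ))) =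
          M / (X e * Y e * √(X e * Y e + (n + 1 : ℕ))) := by
        have : 0 < √(X e * Y e + (n + 1 : ℕ)) := by positivity
        field_simp
        ring
      linarith
  have hx := hX e he
  have hy := hY e he
  refine ge_of_tendsto' (f := fun n : ℕ => g e + M / (X e * Y e * √(X e * Y e + n)))
    (x := Filter.atTop) ?_ fun n => key n e he
  have h1 : Filter.Tendsto (fun n : ℕ => √(X e * Y e + n)) Filter.atTop Filter.atTop :=
    Real.tendsto_sqrt_atTop.comp
      (Filter.tendsto_atTop_add_const_left _ _ tendsto_natCast_atTop_atTop)
  have h2 := h1.const_mul_atTop (mul_pos (zero_lt_one.trans_le hx) (zero_lt_one.trans_le hy))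
  simpa using (h2.const_div_atTop M).const_add (g e)

lemma summable_inv_succ_mul_sqrt :
    Summable fun j : ℕ => 1 / (((j : ℝ) + 1) * √((j : ℝ) + 1)) := by
  have h : Summable fun n : ℕ => 1 / (n : ℝ) ^ (3 / 2 : ℝ) :=
    Real.summable_one_div_nat_rpow.2 (by norm_num)
  refine ((summable_nat_add_iff 1).2 h).congr fun j => ?_
  push_cast
  rw [Real.sqrt_eq_rpow, show (3 / 2 : ℝ) = 1 + 1 / 2 by norm_num,
    Real.rpow_add (by positivity), Real.rpow_one]

noncomputable def fanConst : ℝ := ∑' j : ℕ, 1 / (((j : ℝ) + 1) * √((j : ℝ) + 1))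

lemma mul_sqrt_le_cube {A E T : ℝ} (hA : 0 ≤ A) (_ : 0 ≤ E) (h1 : A ≤ T) (h2 : E ≤ T) :
    A * E * √(A * E) ≤ T ^ 3 := by
  have hT : 0 ≤ T := hA.trans h1
  have h3 : A * E ≤ T ^ 2 := by nlinarith
  have h4 : √(A * E) ≤ T := Real.sqrt_le_iff.2 ⟨hT, h3⟩
  calc _ ≤ T ^ 2 * T := by gcongr
    _ = _ := by ring

lemma fan_tsum_bound {k : ℕ} (hk : 4 ≤ k) {x y C m : ℝ} (hx : 1 ≤ x) (hy : 1 ≤ y) (hm : 0 < m)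
    (hC : 0 ≤ C) {c : ℕ → ℂ} (hc : ∀ j : ℕ, ‖c j‖ ≤ C / (m * (x + y + j * x)) ^ k) :
    (x + y) * ‖∑' j, c j‖ ≤ C / m ^ k * fanConst / (x * y * √(x * y)) ∧
    ‖∑' j : ℕ, j * c j‖ ≤ C / m ^ k * fanConst / (x * y * √(x * y)) := by
  have hq : ∀ j : ℕ, 0 ≤ (j : ℝ) := fun j => Nat.cast_nonneg j
  have key : ∀ j : ℕ, C / (m * (x + y + j * x)) ^ k * (x + y + j * x) ≤
      C / m ^ k / (x * y * √(x * y)) * (1 / (((j : ℝ) + 1) * √((j : ℝ) + 1))) := by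
    intro j
    have := hq j
    have hT1 : 1 ≤ x + y + j * x := by nlinarith
    have h1 : y ≤ x + y + j * x := by nlinarith
    have h2 : (j + 1) * x ≤ x + y + j * x := by nlinarith
    have h3 := mul_sqrt_le_cube (by positivity) (by positivity) h1 h2
    have h4 : (x + y + j * x) ^ 4 ≤ (x + y + j * x) ^ k := pow_le_pow_right₀ hT1 hk
    have e : y * ((j + 1) * x) * √(y * ((j + 1) * x)) =
        (x * y * √(x * y)) * ((j + 1) * √((j : ℝ) + 1)) := by
      rw [show y * ((j + 1) * x) = (x * y) * (j + 1) by ring, Real.sqrt_mul (by positivity)]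
      ring
    rw [e] at h3
    set T := x + y + j * x
    have hs : 0 < (x * y * √(x * y)) * ((j + 1) * √((j : ℝ) + 1)) := by positivity
    calc C / (m * T) ^ k * T = C / m ^ k * (T / T ^ k) := by rw [mul_pow]; field_simp
      _ ≤ C / m ^ k * (1 / T ^ 3) := by
        refine mul_le_mul_of_nonneg_left ?_ (by positivity)
        rw [div_le_div_iff₀ (by positivity) (by positivity)]
        nlinarith
      _ ≤ C / m ^ k * (1 / ((x * y * √(x * y)) * ((j + 1) * √((j : ℝ) + 1)))) := by gcongr
      _ = _ := by field_simp
  have hsum : ∀ d : ℕ → ℂ, (∀ j : ℕ, ‖d j‖ ≤ C / m ^ k / (x * y * √(x * y)) *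
      (1 / (((j : ℝ) + 1) * √((j : ℝ) + 1)))) →
      ‖∑' j, d j‖ ≤ C / m ^ k * fanConst / (x * y * √(x * y)) := by
    intro d hd
    refine (tsum_of_norm_bounded (summable_inv_succ_mul_sqrt.mul_left _).hasSum hd).trans ?_
    rw [tsum_mul_left, fanConst]
    apply le_of_eq; ring
  constructor
  · have h1 : ‖((x + y : ℝ) : ℂ)‖ = x + y := by
      rw [Complex.norm_real, Real.norm_of_nonneg (by positivity)]
    rw [← h1, ← norm_mul, ← tsum_mul_left]
    refine hsum _ fun j => le_trans ?_ (key j)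
    have := hq j
    rw [norm_mul, h1, mul_comm]
    exact mul_le_mul (hc j) (by nlinarith) (by positivity) ((norm_nonneg _).trans (hc j))
  · refine hsum _ fun j => le_trans ?_ (key j)
    have := hq j
    rw [norm_mul, Complex.norm_natCast, mul_comm]
    exact mul_le_mul (hc j) (by nlinarith) (by positivity) ((norm_nonneg _).trans (hc j))

/-- The nodes whose cone is well separated from the kernel of the linear form. -/
structure FareyEdge.Cone (m M : ℝ) (e : FareyEdge) : Prop where
  pos : 0 < (e.Q / e.P).im
  hx : 1 ≤ e.x
  hy : 1 ≤ e.y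
  le : ∀ s t : ℝ, 0 ≤ s → 0 ≤ t → m * (s * e.x + t * e.y) ≤ ‖s * e.P + t * e.Q‖
  hP : ‖e.P‖ ≤ M * e.x
  hQ : ‖e.Q‖ ≤ M * e.y

namespace FareyEdge

lemma Cone.left {m M : ℝ} {e : FareyEdge} (h : e.Cone m M) : e.left.Cone m M where
  pos := add_div_im_pos h.pos
  hx := h.hx
  hy := by have := h.hx; have := h.hy; simp only [FareyEdge.left]; linarith
  le s t hs ht := by
    have := h.le (s + t) t (by positivity) ht
    simp only [FareyEdge.left]
    convert this using 2
    · ring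
    · push_cast; ring
  hP := h.hP
  hQ := (norm_add_le _ _).trans (by have := h.hP; have := h.hQ; simp only [FareyEdge.left]; linarith)

lemma Cone.right {m M : ℝ} {e : FareyEdge} (h : e.Cone m M) : e.right.Cone m M where
  pos := div_add_im_pos h.pos
  hy := h.hy
  hx := by have := h.hx; have := h.hy; simp only [FareyEdge.right]; linarith
  le s t hs ht := by
    have := h.le s (s + t) hs (by positivity)
    simp only [FareyEdge.right]
    convert this using 2
    · ring
    · push_cast; ring
  hQ := h.hQ
  hP := (norm_add_le _ _).trans (by have := h.hP; have := h.hQ; simp only [FareyEdge.right]; linarith)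

structure Slopes (σ : ℝ) (e : FareyEdge) : Prop where
  hs : |e.s| ≤ σ
  ht : |e.t| ≤ σ
  hst : |e.s + e.t| ≤ σ
  hf : |e.f| ≤ σ * (e.x + e.y)

lemma Slopes.left {σ : ℝ} {e : FareyEdge} (h : e.Slopes σ) (hx : 1 ≤ e.x) : e.left.Slopes σ where
  hs := h.hs
  ht := by simpa only [FareyEdge.left, abs_neg] using h.hst
  hst := by
    have : e.s + -(e.s + e.t) = -e.t := by ring
    simpa only [FareyEdge.left, this, abs_neg] using h.ht
  hf := by
    have := h.hf
    have := h.hs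
    have := abs_nonneg e.s
    simp only [FareyEdge.left]
    exact (abs_add_le _ _).trans (by nlinarith)

lemma Slopes.right {σ : ℝ} {e : FareyEdge} (h : e.Slopes σ) (hy : 1 ≤ e.y) :
    e.right.Slopes σ where
  ht := h.ht
  hs := by simpa only [FareyEdge.right, abs_neg] using h.hst
  hst := by
    have : -(e.s + e.t) + e.t = -e.s := by ring
    simpa only [FareyEdge.right, this, abs_neg] using h.hs
  hf := by
    have := h.hf
    have := h.ht
    have := abs_nonneg e.t
    simp only [FareyEdge.right]
    exact (abs_sub _ _).trans (by nlinarith)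

lemma Cone.norm_P {m M : ℝ} {e : FareyEdge} (h : e.Cone m M) : m * e.x ≤ ‖e.P‖ := by
  simpa using h.le 1 0 (by simp) (by simp)

lemma Cone.norm_Q {m M : ℝ} {e : FareyEdge} (h : e.Cone m M) : m * e.y ≤ ‖e.Q‖ := by
  simpa using h.le 0 1 (by simp) (by simp)

lemma Cone.norm_add {m M : ℝ} {e : FareyEdge} (h : e.Cone m M) :
    m * (e.x + e.y) ≤ ‖e.P + e.Q‖ := by
  simpa using h.le 1 1 (by simp) (by simp)

end FareyEdge

namespace Profile

variable {k : ℕ} {a a' : ℝ → ℂ} {B : ℂ → ℂ}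

lemma norm_fan_term_le {C : ℝ} (hC : ∀ z : ℂ, 0 < z.im → ‖B z‖ * (1 + ‖z‖) ^ k ≤ C) {A w : ℂ}
    (hw : 0 < w.im) (hA : A ≠ 0) {T : ℝ} (hT : 0 < T) (h : T ≤ ‖A‖ + ‖A * w‖) :
    ‖(A ^ k)⁻¹ * B w‖ ≤ C / T ^ k := by
  have hA' := norm_pos_iff.2 hA
  rw [le_div_iff₀ (by positivity), norm_mul, norm_inv, norm_pow]
  calc _ ≤ (‖A‖ ^ k)⁻¹ * ‖B w‖ * (‖A‖ + ‖A * w‖) ^ k := by gcongr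
    _ = ‖B w‖ * (1 + ‖w‖) ^ k := by
      rw [norm_mul, show ‖A‖ + ‖A‖ * ‖w‖ = ‖A‖ * (1 + ‖w‖) by ring, mul_pow]
      field_simp
    _ ≤ C := hC w hw

lemma fan_bound (hk : 4 ≤ k) {C : ℝ}
    (hC : ∀ z : ℂ, 0 < z.im → ‖B z‖ * (1 + ‖z‖) ^ k ≤ C) {m M : ℝ} (hm : 0 < m) {e : FareyEdge}
    (he : e.Cone m M) :
    ((e.x + e.y) * ‖fanU k B e.P e.Q‖ ≤
      C / m ^ k * fanConst / (e.x * e.y * √(e.x * e.y)) ∧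
    ‖fanU' k B e.P e.Q‖ ≤ C / m ^ k * fanConst / (e.x * e.y * √(e.x * e.y))) ∧
    (e.x + e.y) * ‖fanV k B e.P e.Q‖ ≤
      C / m ^ k * fanConst / (e.x * e.y * √(e.x * e.y)) ∧
    ‖fanV' k B e.P e.Q‖ ≤ C / m ^ k * fanConst / (e.x * e.y * √(e.x * e.y)) := by
  obtain ⟨hP, hQ, hR⟩ := ne_zero_of_div_im_pos he.pos
  have hx := he.hx
  have hy := he.hy
  have hC0 : 0 ≤ C := le_trans (by positivity) (hC I (by simp))
  constructor
  · have := fan_tsum_bound hk hx hy hm hC0 (c := fun j => (e.P ^ k)⁻¹ * B (e.Q / e.P + j))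
      fun j => norm_fan_term_le hC (by simpa using he.pos) hP (by positivity) ?_
    · convert this using 4
      · rw [fanU, halfU, tsum_mul_left]
      · rw [fanU', halfU', ← tsum_mul_left]
        exact tsum_congr fun j => by ring
    · have h1 := he.norm_P
      have h2 := he.le j 1 (by positivity) (by positivity)
      have h3 : e.P * (e.Q / e.P + j) = (j : ℝ) * e.P + (1 : ℝ) * e.Q := by
        push_cast; field_simp; ring
      rw [h3]; linarith
  · have := fan_tsum_bound hk hy hx hm hC0 (c := fun j => (e.Q ^ k)⁻¹ * B (-e.P / e.Q - j))
      fun j => norm_fan_term_le hC (by simpa using neg_div_im_pos he.pos) hQ (by positivity) ?_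
    · rw [add_comm e.y, mul_comm e.y] at this
      have e1 : fanV k B e.P e.Q = -∑' j : ℕ, (e.Q ^ k)⁻¹ * B (-e.P / e.Q - j) := by
        rw [fanV, halfL, tsum_mul_left]
      have e2 : fanV' k B e.P e.Q = -∑' j : ℕ, j * ((e.Q ^ k)⁻¹ * B (-e.P / e.Q - j)) := by
        rw [fanV', halfL', ← tsum_mul_left]
        exact congrArg Neg.neg (tsum_congr fun j => by ring)
      rw [e1, e2, norm_neg, norm_neg]
      exact this
    · have h1 := he.norm_Q
      have h2 := he.le 1 j (by positivity) (by positivity)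
      have h3 : e.Q * (-e.P / e.Q - j) = -((1 : ℝ) * e.P + (j : ℝ) * e.Q) := by
        push_cast; field_simp; ring
      rw [h3, norm_neg]; linarith

lemma norm_phi_le (hk : 4 ≤ k) {C : ℝ}
    (hC : ∀ z : ℂ, 0 < z.im → ‖B z‖ * (1 + ‖z‖) ^ k ≤ C) {m M σ : ℝ} (hm : 0 < m) {e : FareyEdge}
    (he : e.Cone m M) (hs : e.Slopes σ) :
    ‖e.phi k B‖ ≤ 4 * σ * (C / m ^ k * fanConst) / (e.x * e.y * √(e.x * e.y)) := by
  obtain ⟨⟨h1, h2⟩, h3, h4⟩ := fan_bound hk hC hm he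
  set D := C / m ^ k * fanConst / (e.x * e.y * √(e.x * e.y)) with hD
  have hσ : 0 ≤ σ := (abs_nonneg _).trans hs.hs
  have e1 : 4 * σ * (C / m ^ k * fanConst) / (e.x * e.y * √(e.x * e.y)) = 4 * σ * D := by
    rw [hD]; ring
  rw [e1, FareyEdge.phi]
  have b1 : ‖(e.f : ℂ) * (fanU k B e.P e.Q - fanV k B e.P e.Q)‖ ≤ 2 * σ * D := by
    rw [norm_mul, Complex.norm_real]
    calc _ ≤ (σ * (e.x + e.y)) * (‖fanU k B e.P e.Q‖ + ‖fanV k B e.P e.Q‖) := by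
          have hx := he.hx
          have hy := he.hy
          exact mul_le_mul hs.hf (norm_sub_le _ _) (norm_nonneg _) (by positivity)
      _ ≤ _ := by nlinarith
  have b2 : ‖(e.s : ℂ) * fanU' k B e.P e.Q‖ ≤ σ * D := by
    rw [norm_mul, Complex.norm_real]
    exact mul_le_mul hs.hs h2 (norm_nonneg _) hσ
  have b3 : ‖(e.t : ℂ) * fanV' k B e.P e.Q‖ ≤ σ * D := by
    rw [norm_mul, Complex.norm_real]
    exact mul_le_mul hs.ht h4 (norm_nonneg _) hσ
  refine (norm_add₃_le).trans ?_
  linarith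

/-- Supersolution bound for the Farey tree. -/
lemma norm_phi_le_of_supersolution (Pr : Profile k (-1) a a' B) (hk : 4 ≤ k) {m M σ : ℝ}
    (hm : 0 < m) (g : FareyEdge → ℝ) (G : FareyEdge → Prop)
    (hL : ∀ e, G e → G e.left) (hR : ∀ e, G e → G e.right) (hcone : ∀ e, G e → e.Cone m M)
    (hsl : ∀ e, G e → e.Slopes σ) (hg0 : ∀ e, G e → 0 ≤ g e)
    (hg : ∀ e, G e → ‖e.datum k B‖ + g e.left + g e.right ≤ g e) {e : FareyEdge} (he : G e) :
    ‖e.phi k B‖ ≤ g e := by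
  obtain ⟨C, hC⟩ := Pr.bound
  have hC0 : 0 ≤ C := le_trans (by positivity) (hC I (by simp))
  have hσ : 0 ≤ σ := (abs_nonneg _).trans (hsl e he).hs
  have hf : 0 ≤ fanConst := tsum_nonneg fun j => by positivity
  refine tree_bound (fun e => e.left) (fun e => e.right) (fun e => e.x) (fun e => e.y)
    (fun e => ‖e.phi k B‖) g (fun e => ‖e.datum k B‖) G
    (M := 4 * σ * (C / m ^ k * fanConst)) (by positivity)
    (fun _ => rfl) (fun _ => rfl) (fun _ => rfl) (fun _ => rfl) hL hR
    (fun e he => (hcone e he).hx) (fun e he => (hcone e he).hy) ?_ hg hg0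
    (fun e he => norm_phi_le hk hC hm (hcone e he) (hsl e he)) he
  intro e he
  rw [Pr.phi_eq hk (hcone e he).pos]
  exact (norm_sub_le _ _).trans (by gcongr; exact norm_add_le _ _)

end Profile

lemma conj_ee (w : ℂ) : (starRingEnd ℂ) (ee w) = ee (-(starRingEnd ℂ) w) := by
  rw [ee, ee, ← Complex.exp_conj]
  congr 1
  simp only [map_mul, Complex.conj_ofReal, Complex.conj_I, map_ofNat]
  ring

namespace Profile

variable {k : ℕ} {ε : ℂ} {a a' : ℝ → ℂ} {B : ℂ → ℂ}

lemma conj (P : Profile k ε a a' B) (hk : Even k) (hε : (starRingEnd ℂ) ε = ε) :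
    Profile k ε (fun u => (starRingEnd ℂ) (a u)) (fun u => (starRingEnd ℂ) (a' u))
      (fun z => (starRingEnd ℂ) (B (-(starRingEnd ℂ) z))) where
  zero u hu := by simp [P.zero u hu]
  zero' u hu := by simp [P.zero' u hu]
  deriv u := by
    simpa using (P.deriv u).star
  cont' := Complex.continuous_conj.comp P.cont'
  decay N := by simpa using P.decay N
  decay' N := by simpa using P.decay' N
  eq z hz := by
    rw [P.eq _ (by simpa using hz), ← integral_conj]
    congr 1; ext u
    rw [map_mul, conj_ee]
    simp
  bound := by
    obtain ⟨C, hC⟩ := P.bound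
    refine ⟨C, fun z hz => ?_⟩
    simpa using hC (-(starRingEnd ℂ) z) (by simpa using hz)
  inv z hz := by
    have h := P.inv (-(starRingEnd ℂ) z) (by simpa using hz)
    have e1 : -(starRingEnd ℂ) (-1 / z) = -1 / (-(starRingEnd ℂ) z) := by
      simp [neg_div]
    simp only [e1, h, map_mul, map_pow, Complex.conj_conj, hε, hk.neg_pow]

lemma norm_shiftSum_le (P : Profile k ε a a' B) (hk : 4 ≤ k) {w : ℂ} (hw : 0 < w.im) :
    ‖shiftSum B w‖ ≤ dataSum 1 0 a a' ∧ ‖shiftSum' B w‖ ≤ dataSum 1 0 a a' := by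
  have hs : Summable fun n : ℕ => ‖a (n + 1 : ℕ)‖ + ‖a' (n + 1 : ℕ)‖ := by
    simpa using P.summable_dataSum 1 0
  have hd : dataSum 1 0 a a' = ∑' n : ℕ, (‖a (n + 1 : ℕ)‖ + ‖a' (n + 1 : ℕ)‖) := by
    simp [dataSum]
  have key : ∀ b : ℝ → ℂ, b 0 = 0 → (∀ n : ℕ, ‖b (n + 1 : ℕ)‖ ≤
      ‖a (n + 1 : ℕ)‖ + ‖a' (n + 1 : ℕ)‖) →
      ‖∑' n : ℕ, b n * ee (n * w)‖ ≤ dataSum 1 0 a a' := by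
    intro b h0 hb
    have hb' : ∀ n : ℕ, ‖b (n + 1 : ℕ) * ee ((n + 1 : ℕ) * w)‖ ≤
        ‖a (n + 1 : ℕ)‖ + ‖a' (n + 1 : ℕ)‖ := by
      intro n
      refine le_trans ?_ (hb n)
      rw [norm_mul]
      refine mul_le_of_le_one_right (norm_nonneg _) ?_
      have := norm_ee_mul_le_one hw.le (u := (n + 1 : ℕ)) (by positivity)
      rwa [mul_comm] at this
    have hs1 : Summable fun n : ℕ => b n * ee (n * w) :=
      (summable_nat_add_iff 1).1 (Summable.of_norm_bounded hs hb')
    rw [hs1.tsum_eq_zero_add, hd]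
    simp only [Nat.cast_zero, h0, zero_mul, zero_add]
    exact tsum_of_norm_bounded hs.hasSum hb'
  constructor
  · rw [P.shiftSum_eq hk hw]
    exact key a (P.zero 0 le_rfl) fun n => by simp
  · have h := P.shiftSum'_eq hk hw
    have h1 := key a' (P.zero' 0 le_rfl) fun n => by simp
    rw [← h, norm_mul] at h1
    have h2 : 1 ≤ ‖-(2 * (π : ℂ) * I)‖ := by
      simp only [norm_neg, norm_mul, Complex.norm_ofNat, Complex.norm_real, Complex.norm_I,
        Real.norm_eq_abs, abs_of_pos pi_pos]
      linarith [pi_gt_three]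
    exact (le_mul_of_one_le_left (norm_nonneg _) h2).trans h1

end Profile

lemma norm_fanSum_le {k : ℕ} {B : ℂ → ℂ} {R Q : ℂ} (h : 0 < (Q / R).im) {d r q : ℝ} (hr : 0 < r)
    (hR : r ≤ ‖R‖) (hQ : ‖Q‖ ≤ q * ‖R‖)
    (hd : ∀ w : ℂ, 0 < w.im → ‖shiftSum B w‖ ≤ d ∧ ‖shiftSum' B w‖ ≤ d) :
    ‖fanSum k B R Q‖ ≤ d / r ^ k ∧ ‖fanSum' k B R Q‖ ≤ (1 + q) * d / r ^ k := by
  have hd0 : 0 ≤ d := (norm_nonneg _).trans (hd _ h).1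
  have hR0 : 0 < ‖R‖ := hr.trans_le hR
  have hq : ‖Q / R‖ ≤ q := by rw [norm_div, div_le_iff₀ hR0]; exact hQ
  have h1 : ‖(R ^ k)⁻¹‖ ≤ (r ^ k)⁻¹ := by
    rw [norm_inv, norm_pow]; gcongr
  constructor
  · rw [fanSum, norm_mul, div_eq_inv_mul d]
    exact mul_le_mul h1 (hd _ h).1 (norm_nonneg _) (by positivity)
  · rw [fanSum', norm_mul, div_eq_inv_mul ((1 + q) * d)]
    refine mul_le_mul h1 ?_ (norm_nonneg _) (by positivity)
    refine (norm_sub_le _ _).trans ?_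
    rw [norm_mul]
    have := mul_le_mul hq (hd _ h).1 (norm_nonneg _) ((norm_nonneg _).trans hq)
    linarith [(hd _ h).2]

lemma inv_sqrt_drop {x y : ℝ} (hx : 0 < x) (hy : 0 < y) :
    1 / (x * (x + y) * √(x * (x + y))) ≤
      1 / (x * (x + y) * √(x * y)) - 1 / (2 * √(x * y) * (x + y) ^ 2) := by
  set p := √(x * y) with hp
  set q := √(x * (x + y)) with hq
  have hp0 : 0 < p := by positivity
  have hq0 : 0 < q := by positivity
  have hp2 : p ^ 2 = x * y := Real.sq_sqrt (by positivity)
  have hq2 : q ^ 2 = x * (x + y) := Real.sq_sqrt (by positivity)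
  have hpq : p ≤ q := Real.sqrt_le_sqrt (by nlinarith)
  have h1 : x ^ 2 ≤ (q - p) * (2 * q) := by nlinarith
  have e : 1 / (x * (x + y) * p) - 1 / (2 * p * (x + y) ^ 2) - 1 / (x * (x + y) * q) =
      ((q - p) * (2 * (x * (x + y))) - x ^ 2 * q) / (2 * p * q * (x ^ 2 * (x + y) ^ 2)) := by
    field_simp
    ring
  have h2 : 0 ≤ (q - p) * (2 * (x * (x + y))) - x ^ 2 * q := by
    rw [← hq2]; nlinarith
  have h3 : 0 ≤ 1 / (x * (x + y) * p) - 1 / (2 * p * (x + y) ^ 2) - 1 / (x * (x + y) * q) := by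
    rw [e]; positivity
  linarith

lemma inv_mul_sqrt_drop {x y : ℝ} (hx : 0 < x) (hy : 0 < y) :
    2 / (x + y) ^ 3 + 1 / (x * (x + y) * √(x * (x + y))) + 1 / ((x + y) * y * √((x + y) * y)) ≤
      1 / (x * y * √(x * y)) := by
  have h1 := inv_sqrt_drop hx hy
  have h2 := inv_sqrt_drop hy hx
  rw [add_comm y x, mul_comm y x, mul_comm y (x + y)] at h2
  set p := √(x * y) with hp
  have hp0 : 0 < p := by positivity
  have hp2 : p ^ 2 = x * y := Real.sq_sqrt (by positivity)
  have h3 : 2 * p ≤ x + y := abs_le_of_sq_le_sq' (by nlinarith [sq_nonneg (x - y)]) (by positivity) |>.2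
  have e1 : 1 / (x * (x + y) * p) + 1 / ((x + y) * y * p) = 1 / (x * y * p) := by
    field_simp
    ring
  have e2 : 2 / (x + y) ^ 3 ≤ 1 / (2 * p * (x + y) ^ 2) + 1 / (2 * p * (x + y) ^ 2) := by
    rw [← add_div, div_le_div_iff₀ (by positivity) (by positivity)]
    nlinarith [sq_nonneg (x + y), mul_le_mul_of_nonneg_right h3 (sq_nonneg (x + y))]
  linarith

namespace Profile

variable {k : ℕ} {a a' : ℝ → ℂ} {B : ℂ → ℂ} (Pr : Profile k (-1) a a' B)
include Pr

lemma norm_phi_le_data (hk : 4 ≤ k) {m M σ d : ℝ} (hm : 0 < m)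
    (hd : ∀ w : ℂ, 0 < w.im → ‖shiftSum B w‖ ≤ d ∧ ‖shiftSum' B w‖ ≤ d)
    {e : FareyEdge} (he : e.Cone m M) (hs : e.Slopes σ) :
    ‖e.phi k B‖ ≤ 3 * σ * (1 + M / m) * d / m ^ k / 2 * (1 / (e.x * e.y * √(e.x * e.y))) := by
  have hd0 : 0 ≤ d := (norm_nonneg _).trans (hd _ he.pos).1
  have hσ : 0 ≤ σ := (abs_nonneg _).trans hs.hs
  have hM : 0 ≤ M := by
    have h1 := he.hP
    have h2 := he.hx
    by_contra h
    nlinarith [norm_nonneg e.P]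
  set K := 3 * σ * (1 + M / m) * d / m ^ k / 2 with hK
  have hK0 : 0 ≤ K := by positivity
  refine Pr.norm_phi_le_of_supersolution hk hm
    (fun e => K * (1 / (e.x * e.y * √(e.x * e.y))))
    (fun e => e.Cone m M ∧ e.Slopes σ) (fun e h => ⟨h.1.left, h.2.left h.1.hx⟩)
    (fun e h => ⟨h.1.right, h.2.right h.1.hy⟩) (fun e h => h.1) (fun e h => h.2) ?_ ?_ ⟨he, hs⟩
  · rintro e ⟨h, -⟩
    have := h.hx
    have := h.hy
    positivity
  · rintro e ⟨h, h'⟩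
    have hx := h.hx
    have hy := h.hy
    have h1 := inv_mul_sqrt_drop (zero_lt_one.trans_le hx) (zero_lt_one.trans_le hy)
    have h2 : ‖e.datum k B‖ ≤ K * (2 / (e.x + e.y) ^ 3) := by
      have hRn := h.norm_add
      have hxy : 0 < m * (e.x + e.y) := by positivity
      obtain ⟨f1, f2⟩ := norm_fanSum_le (k := k) (q := M / m) (div_add_im_pos h.pos) hxy hRn
        (by
          refine h.hQ.trans ?_
          rw [div_mul_eq_mul_div, le_div_iff₀ hm]
          nlinarith [mul_le_mul_of_nonneg_left hRn hM, mul_nonneg hM hm.le]) hd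
      have g1 : ‖(e.f : ℂ) - e.t‖ ≤ 2 * σ * (e.x + e.y) := by
        rw [← Complex.ofReal_sub, Complex.norm_real]
        refine (abs_sub _ _).trans ?_
        nlinarith [h'.hf, h'.ht]
      have g2 : ‖(e.s : ℂ) + e.t‖ ≤ σ := by
        rw [← Complex.ofReal_add, Complex.norm_real]; exact h'.hst
      have hT : 1 ≤ e.x + e.y := by linarith
      have h4 : (e.x + e.y) ^ 4 ≤ (e.x + e.y) ^ k := pow_le_pow_right₀ hT hk
      rw [FareyEdge.datum]
      refine (norm_sub_le _ _).trans ?_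
      rw [norm_mul, norm_mul]
      set T := e.x + e.y with hTdef
      have hq : 0 ≤ M / m := by positivity
      calc _ ≤ 2 * σ * T * (d / (m * T) ^ k) + σ * ((1 + M / m) * d / (m * T) ^ k) := by
            gcongr
        _ ≤ 2 * σ * T * ((1 + M / m) * d / (m * T) ^ k) +
            σ * T * ((1 + M / m) * d / (m * T) ^ k) := by
            gcongr
            · nlinarith [mul_nonneg hq hd0]
            · nlinarith
        _ = 3 * σ * (1 + M / m) * d / m ^ k * (T / T ^ k) := by
            rw [mul_pow]; field_simp; ring
        _ ≤ 3 * σ * (1 + M / m) * d / m ^ k * (1 / T ^ 3) := by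
            refine mul_le_mul_of_nonneg_left ?_ (by positivity)
            rw [div_le_div_iff₀ (by positivity) (by positivity)]
            nlinarith
        _ = _ := by rw [hK]; ring
    simp only [FareyEdge.left, FareyEdge.right]
    nlinarith [mul_le_mul_of_nonneg_left h1 hK0]

end Profile

/-- The fan of nodes around infinity. -/
noncomputable def rootEdge (τ : ℂ) (F c : ℕ → ℝ) (n : ℕ) : FareyEdge :=
  ⟨τ + n, τ + n - 1, 1, 1, F n, c (n + 1), c n⟩

lemma rootEdge_pos {τ : ℂ} (hτ : 0 < τ.im) (n : ℕ) : 0 < ((τ + n - 1) / (τ + n)).im := by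
  have h : 0 < (τ + n - 1 : ℂ).im := by simpa using hτ
  have := div_add_im_pos (P := 1) (Q := τ + n - 1) (by simpa using h)
  convert this using 3
  ring

namespace Profile

variable {k : ℕ} {a a' : ℝ → ℂ} {B : ℂ → ℂ} (Pr : Profile k (-1) a a' B)
include Pr

lemma fanU_root (hk : 4 ≤ k) {τ : ℂ} (hτ : 0 < τ.im) (n : ℕ) :
    fanU k B (τ + n) (τ + n - 1) = fanSum k B (τ + n) (τ + n - 1) + B (τ + n) +
      fanV k B (τ + (n + 1 : ℕ)) (τ + (n + 1 : ℕ) - 1) ∧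
    fanU' k B (τ + n) (τ + n - 1) = fanSum' k B (τ + n) (τ + n - 1) - B (τ + n) -
      2 * fanV k B (τ + (n + 1 : ℕ)) (τ + (n + 1 : ℕ) - 1) -
      fanV' k B (τ + (n + 1 : ℕ)) (τ + (n + 1 : ℕ) - 1) := by
  have h1 : 0 < ((τ + n - 1) / 1 : ℂ).im := by simpa using hτ
  have h2 : 0 < ((τ + n) / 1 : ℂ).im := by simpa using hτ
  have e1 := Pr.fanU_sub_fanV hk h1
  have e2 := Pr.fanU'_add_fanV' hk h1
  have e3 := Pr.fanV_eq hk h2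
  have e4 := Pr.fanV'_eq hk h2
  have e5 : fanEdge k B 1 (τ + n) = B (τ + n) := by simp [fanEdge]
  have e6 : (1 : ℂ) + (τ + n - 1) = τ + n := by ring
  have e7 : (1 : ℂ) + (τ + n) = τ + (n + 1 : ℕ) := by push_cast; ring
  have e8 : τ + (n + 1 : ℕ) - 1 = τ + n := by push_cast; ring
  rw [e6] at e1 e2
  rw [e7, e5] at e3
  rw [e7] at e4
  rw [e8, ← e1, ← e2, e3, e4]
  constructor <;> ring

lemma sum_phi_rootEdge (hk : 4 ≤ k) {τ : ℂ} (hτ : 0 < τ.im) {F c : ℕ → ℝ}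
    (hF : ∀ n, F n - F (n + 1) = 2 * c (n + 1)) (N : ℕ) :
    ∑ n ∈ Finset.range (N + 1), (rootEdge τ F c n).phi k B =
      ∑ n ∈ Finset.range N, (F n * fanSum k B (τ + n) (τ + n - 1) +
        c (n + 1) * fanSum' k B (τ + n) (τ + n - 1) + (F n - c (n + 1)) * B (τ + n)) +
      (F N * fanU k B (τ + N) (τ + N - 1) + c (N + 1) * fanU' k B (τ + N) (τ + N - 1)) +
      (c 0 * fanV' k B τ (τ - 1) - F 0 * fanV k B τ (τ - 1)) := by
  induction N with
  | zero =>
    simp [FareyEdge.phi, rootEdge]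
    ring
  | succ N ih =>
    rw [Finset.sum_range_succ, ih, Finset.sum_range_succ]
    obtain ⟨h1, h2⟩ := Pr.fanU_root hk hτ N
    have h3 : (F N : ℂ) - F (N + 1) = 2 * c (N + 1) := by exact_mod_cast hF N
    simp only [FareyEdge.phi, rootEdge]
    rw [h1, h2]
    linear_combination (fanV k B (τ + (N + 1 : ℕ)) (τ + (N + 1 : ℕ) - 1)) * h3

end Profile

noncomputable def rootF (n : ℕ) : ℝ := if n = 0 then 0 else 2 * (-1) ^ (n + 1)

noncomputable def rootC (n : ℕ) : ℝ := if n = 0 then 0 else if n = 1 then -1 else 2 * (-1) ^ n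

lemma rootF_sub (n : ℕ) : rootF n - rootF (n + 1) = 2 * rootC (n + 1) := by
  rcases n with _ | n
  · norm_num [rootF, rootC]
  · simp [rootF, rootC]; ring

lemma abs_rootF (n : ℕ) : |rootF n| ≤ 2 := by
  unfold rootF; split_ifs <;> simp [abs_mul]

lemma abs_rootC (n : ℕ) : |rootC n| ≤ 2 := by
  unfold rootC; split_ifs <;> simp [abs_mul]

lemma abs_rootC_add (n : ℕ) : |rootC (n + 1) + rootC n| ≤ 2 := by
  rcases n with _ | _ | n
  · norm_num [rootC]
  · norm_num [rootC]
  · simp [rootC, pow_succ]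

lemma rootEdge_slopes (τ : ℂ) (n : ℕ) : (rootEdge τ rootF rootC n).Slopes 2 where
  hs := abs_rootC (n + 1)
  ht := abs_rootC n
  hst := abs_rootC_add n
  hf := by simpa [rootEdge] using (abs_rootF n).trans (by norm_num)

lemma rootEdge_cone {τ : ℂ} (hτ : 0 < τ.im) (h1 : τ.im ≤ 1) (hre : 0 ≤ τ.re) (F c : ℕ → ℝ)
    (n : ℕ) : (rootEdge τ F c n).Cone (τ.im * (1 + τ.re + n) / 8) (3 * (1 + τ.re + n)) where
  pos := rootEdge_pos hτ n
  hx := le_rfl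
  hy := le_rfl
  le a b ha hb := by
    simp only [rootEdge, mul_one]
    set w : ℂ := a * (τ + n) + b * (τ + n - 1) with hw
    have hwre : w.re = (a + b) * (τ.re + n) - b := by simp [hw]; ring
    have hwim : w.im = (a + b) * τ.im := by simp [hw]; ring
    have hn : (0 : ℝ) ≤ n := by positivity
    have hab : 0 ≤ a + b := by positivity
    rcases le_or_gt 2 (τ.re + n) with h | h
    · refine le_trans ?_ (Complex.re_le_norm w)
      rw [hwre]
      have e1 : τ.im * (1 + τ.re + n) / 8 ≤ τ.re + n - 1 := by nlinarith
      nlinarith [mul_le_mul_of_nonneg_right e1 hab]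
    · refine le_trans ?_ (Complex.im_le_norm w)
      rw [hwim, mul_comm]
      refine mul_le_mul_of_nonneg_left ?_ hab
      nlinarith
  hP := by
    simp only [rootEdge, mul_one]
    refine (Complex.norm_le_abs_re_add_abs_im _).trans ?_
    have hn : (0 : ℝ) ≤ n := by positivity
    simp only [Complex.add_re, Complex.natCast_re, Complex.add_im, Complex.natCast_im, add_zero]
    rw [abs_of_nonneg (by positivity), abs_of_pos hτ]
    linarith
  hQ := by
    simp only [rootEdge, mul_one]
    refine (Complex.norm_le_abs_re_add_abs_im _).trans ?_
    have hn : (0 : ℝ) ≤ n := by positivity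
    simp only [Complex.add_re, Complex.natCast_re, Complex.add_im, Complex.natCast_im, add_zero,
      Complex.sub_re, Complex.sub_im, Complex.one_re, Complex.one_im, sub_zero]
    rw [abs_of_pos hτ]
    have : |τ.re + n - 1| ≤ τ.re + n + 1 := abs_le.2 ⟨by linarith, by linarith⟩
    linarith

lemma sum_inv_pow_four_le {t : ℝ} (ht : 1 ≤ t) (N : ℕ) :
    ∑ n ∈ Finset.range N, 1 / (t + n) ^ 4 ≤ 2 / t ^ 3 := by
  have key : ∑ n ∈ Finset.range N, 1 / (t + n) ^ 4 ≤ 2 / t ^ 3 - 2 / (t + N) ^ 3 := by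
    induction N with
    | zero => simp
    | succ N ih =>
      rw [Finset.sum_range_succ]
      have hx : 1 ≤ t + N := by have : (0 : ℝ) ≤ N := by positivity
                                linarith
      push_cast
      rw [← add_assoc]
      generalize t + (N : ℝ) = x at *
      have : 1 / x ^ 4 ≤ 2 / x ^ 3 - 2 / (x + 1) ^ 3 := by
        rw [div_sub_div _ _ (by positivity) (by positivity),
          div_le_div_iff₀ (by positivity) (by positivity)]
        have : 0 ≤ x ^ 3 * (x - 1) := mul_nonneg (by positivity) (by linarith)
        nlinarith [mul_nonneg (pow_nonneg (zero_le_one.trans hx) 3)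
          (sq_nonneg x), pow_pos (zero_lt_one.trans_le hx) 3, pow_pos (zero_lt_one.trans_le hx) 4,
          pow_pos (zero_lt_one.trans_le hx) 5, mul_nonneg (by positivity : 0 ≤ x ^ 5)
          (by linarith : 0 ≤ x - 1)]
      linarith
  have : 0 ≤ 2 / (t + N) ^ 3 := by positivity
  linarith

namespace Profile

variable {k : ℕ} {a a' : ℝ → ℂ} {B : ℂ → ℂ} (Pr : Profile k (-1) a a' B)
include Pr

lemma root_identity (hk : 4 ≤ k) {τ : ℂ} (hτ : 0 < τ.im) (N : ℕ) :
    B τ = ∑ n ∈ Finset.range (N + 2), (rootEdge τ rootF rootC n).phi k B -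
      ∑ n ∈ Finset.range (N + 1), (rootF n * fanSum k B (τ + n) (τ + n - 1) +
        rootC (n + 1) * fanSum' k B (τ + n) (τ + n - 1)) -
      (rootF (N + 1) * fanU k B (τ + (N + 1 : ℕ)) (τ + (N + 1 : ℕ) - 1) +
        rootC (N + 2) * fanU' k B (τ + (N + 1 : ℕ)) (τ + (N + 1 : ℕ) - 1)) := by
  have h := Pr.sum_phi_rootEdge hk hτ rootF_sub (N + 1)
  have h0 : rootC 0 = 0 := by simp [rootC]
  have h1 : rootF 0 = 0 := by simp [rootF]
  have hB : ∑ n ∈ Finset.range (N + 1), ((rootF n : ℂ) - rootC (n + 1)) * B (τ + n) = B τ := by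
    rw [Finset.sum_range_succ']
    simp [rootF, rootC]
  rw [h0, h1, Finset.sum_add_distrib, hB] at h
  push_cast at h ⊢
  linear_combination -h

lemma norm_le_dataSum_of_re_nonneg (hk : 4 ≤ k) {τ : ℂ} (hτ : 0 < τ.im) (h1 : τ.im ≤ 1)
    (hre : 0 ≤ τ.re) : ‖B τ‖ * (1 + τ.re) ^ 3 * τ.im ^ (k + 1) ≤ 350 * 8 ^ k * dataSum 1 0 a a' := by
  set y := τ.im with hy
  set t := 1 + τ.re with ht
  set d := dataSum 1 0 a a' with hd
  have ht1 : 1 ≤ t := by linarith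
  have hd0 : 0 ≤ d := dataSum_nonneg _ _ _ _
  have hdw : ∀ w : ℂ, 0 < w.im → ‖shiftSum B w‖ ≤ d ∧ ‖shiftSum' B w‖ ≤ d := fun w hw =>
    Pr.norm_shiftSum_le hk hw
  obtain ⟨C, hC⟩ := Pr.bound
  have hC0 : 0 ≤ C := le_trans (by positivity) (hC I (by simp))
  have hf : 0 ≤ fanConst := tsum_nonneg fun j => by positivity
  set L := 25 * 8 ^ k * d / y ^ (k + 1) with hL
  have hL0 : 0 ≤ L := by positivity
  have hm : ∀ n : ℕ, 0 < y * (t + n) / 8 := fun n => by positivity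
  have hcone := fun n => rootEdge_cone hτ h1 hre rootF rootC n
  have hq : ∀ n : ℕ, 3 * (t + n) / (y * (t + n) / 8) = 24 / y := fun n => by
    field_simp; norm_num
  have hLn : ∀ n : ℕ, (1 + 24 / y) * d / (y * (t + n) / 8) ^ k ≤ L * (1 / (t + n) ^ 4) := by
    intro n
    have e1 : 1 + 24 / y ≤ 25 / y := by
      have : 1 ≤ 1 / y := by rwa [le_div_iff₀ hτ, one_mul]
      have e3 : 25 / y = 1 / y + 24 / y := by ring
      linarith
    have hn : 1 ≤ t + n := by have : (0 : ℝ) ≤ n := by positivity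
                              linarith
    have e2 : (t + n) ^ 4 ≤ (t + n) ^ k := pow_le_pow_right₀ hn hk
    calc _ ≤ (25 / y) * d / (y * (t + n) / 8) ^ k := by gcongr
      _ = L * (1 / (t + n) ^ k) := by
          rw [hL, div_pow, mul_pow, pow_succ]; field_simp
      _ ≤ _ := by gcongr
  have hphi : ∀ n, ‖(rootEdge τ rootF rootC n).phi k B‖ ≤ 3 * (L * (1 / (t + n) ^ 4)) := by
    intro n
    refine (Pr.norm_phi_le_data hk (hm n) hdw (hcone n) (rootEdge_slopes τ n)).trans ?_
    rw [hq]
    simp only [rootEdge, mul_one, Real.sqrt_one, div_one]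
    have := hLn n
    rw [mul_assoc (3 * 2), mul_div_assoc (3 * 2)]
    linarith
  have hdat : ∀ n : ℕ, ‖rootF n * fanSum k B (τ + n) (τ + n - 1) +
        rootC (n + 1) * fanSum' k B (τ + n) (τ + n - 1)‖ ≤ 4 * (L * (1 / (t + n) ^ 4)) := by
    intro n
    have hP := (hcone n).norm_P
    have hQ := (hcone n).hQ
    simp only [rootEdge, mul_one] at hP hQ
    obtain ⟨f1, f2⟩ := norm_fanSum_le (k := k) (q := 24 / y) (rootEdge_pos hτ n) (hm n) hP
      (by
        refine hQ.trans ?_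
        rw [← hq n, div_mul_eq_mul_div, le_div_iff₀ (hm n)]
        exact mul_le_mul_of_nonneg_left hP (by positivity)) hdw
    have f1' : ‖fanSum k B (τ + n) (τ + n - 1)‖ ≤ L * (1 / (t + n) ^ 4) := by
      refine (f1.trans ?_).trans (hLn n)
      have := hm n
      gcongr
      exact le_mul_of_one_le_left hd0 (by have : 0 ≤ 24 / y := by positivity
                                          linarith)
    have f2' := f2.trans (hLn n)
    have g1 : ‖(rootF n : ℂ)‖ ≤ 2 := by rw [Complex.norm_real]; exact abs_rootF n
    have g2 : ‖(rootC (n + 1) : ℂ)‖ ≤ 2 := by rw [Complex.norm_real]; exact abs_rootC _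
    refine (norm_add_le _ _).trans ?_
    rw [norm_mul, norm_mul]
    have := mul_le_mul g1 f1' (norm_nonneg _) (by norm_num)
    have := mul_le_mul g2 f2' (norm_nonneg _) (by norm_num)
    linarith
  have hbd : ∀ N : ℕ, ‖rootF (N + 1) * fanU k B (τ + (N + 1 : ℕ)) (τ + (N + 1 : ℕ) - 1) +
        rootC (N + 2) * fanU' k B (τ + (N + 1 : ℕ)) (τ + (N + 1 : ℕ) - 1)‖ ≤
        3 * (C / (y / 8) ^ k * fanConst) * (1 / ((N : ℝ) + 1)) := by
    intro N
    obtain ⟨⟨f1, f2⟩, -⟩ := fan_bound hk hC (hm (N + 1)) (hcone (N + 1))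
    simp only [rootEdge, mul_one, Real.sqrt_one, div_one] at f1 f2
    have e : C / (y * (t + (N + 1 : ℕ)) / 8) ^ k * fanConst ≤
        C / (y / 8) ^ k * fanConst * (1 / ((N : ℝ) + 1)) := by
      have hN : (0 : ℝ) ≤ N := by positivity
      have : ((y / 8) ^ k) * (N + 1) ≤ (y * (t + (N + 1 : ℕ)) / 8) ^ k := by
        have e1 : y * (t + (N + 1 : ℕ)) / 8 = y / 8 * (t + (N + 1 : ℕ)) := by ring
        rw [e1, mul_pow]
        gcongr
        push_cast
        calc (N : ℝ) + 1 ≤ t + (N + 1) := by linarith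
          _ ≤ _ := le_self_pow₀ (by linarith) (by omega)
      calc _ ≤ C / (((y / 8) ^ k) * (N + 1)) * fanConst := by gcongr
        _ = _ := by field_simp
    have g1 : ‖(rootF (N + 1) : ℂ)‖ ≤ 2 := by rw [Complex.norm_real]; exact abs_rootF _
    have g2 : ‖(rootC (N + 2) : ℂ)‖ ≤ 2 := by rw [Complex.norm_real]; exact abs_rootC _
    refine (norm_add_le _ _).trans ?_
    rw [norm_mul, norm_mul]
    have := mul_le_mul g1 (le_refl ‖fanU k B (τ + (N + 1 : ℕ)) (τ + (N + 1 : ℕ) - 1)‖)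
      (norm_nonneg _) (by norm_num)
    have := mul_le_mul g2 f2 (norm_nonneg _) (by norm_num)
    linarith
  have hfin : ∀ N : ℕ, ‖B τ‖ ≤ 14 * L / t ^ 3 +
      3 * (C / (y / 8) ^ k * fanConst) * (1 / ((N : ℝ) + 1)) := by
    intro N
    rw [Pr.root_identity hk hτ N]
    refine (norm_sub_le _ _).trans (add_le_add ((norm_sub_le _ _).trans ?_) (hbd N))
    have s1 := norm_sum_le_of_le (Finset.range (N + 2)) fun n _ => hphi n
    have s2 := norm_sum_le_of_le (Finset.range (N + 1)) fun n _ => hdat n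
    rw [← Finset.mul_sum, ← Finset.mul_sum] at s1 s2
    have u1 := mul_le_mul_of_nonneg_left (sum_inv_pow_four_le ht1 (N + 2)) hL0
    have u2 := mul_le_mul_of_nonneg_left (sum_inv_pow_four_le ht1 (N + 1)) hL0
    have : 14 * L / t ^ 3 = 3 * (L * (2 / t ^ 3)) + 4 * (L * (2 / t ^ 3)) := by ring
    linarith
  have hlim : ‖B τ‖ ≤ 14 * L / t ^ 3 := by
    have := (tendsto_one_div_add_atTop_nhds_zero_nat (𝕜 := ℝ)).const_mul
      (3 * (C / (y / 8) ^ k * fanConst))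
    have := this.const_add (14 * L / t ^ 3)
    rw [mul_zero, add_zero] at this
    exact ge_of_tendsto' this hfin
  have h2 : ‖B τ‖ * t ^ 3 ≤ 14 * L := by rwa [le_div_iff₀ (by positivity)] at hlim
  have h3 : L * y ^ (k + 1) = 25 * 8 ^ k * d := by rw [hL]; field_simp
  nlinarith [mul_le_mul_of_nonneg_right h2 (by positivity : 0 ≤ y ^ (k + 1))]

lemma norm_le_dataSum (hk : 4 ≤ k) (hke : Even k) {τ : ℂ} (hτ : 0 < τ.im) (h1 : τ.im ≤ 1) :
    ‖B τ‖ * (1 + |τ.re|) ^ 3 * τ.im ^ (k + 1) ≤ 350 * 8 ^ k * dataSum 1 0 a a' := by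
  rcases le_or_gt 0 τ.re with h | h
  · rw [abs_of_nonneg h]; exact Pr.norm_le_dataSum_of_re_nonneg hk hτ h1 h
  · have := (Pr.conj hke (by simp)).norm_le_dataSum_of_re_nonneg hk (τ := -(starRingEnd ℂ) τ)
      (by simpa using hτ) (by simpa using h1) (by simpa using h.le)
    simpa [dataSum, abs_of_neg h] using this

end Profile

lemma stable_neg_one {k : ℕ} (hk : 4 ≤ k) (hke : Even k) : Stable k 1 (-1) :=
  ⟨k + 1, 0, 350 * 8 ^ k, by positivity, fun _ _ _ P _ h h1 => P.norm_le_dataSum hk hke h h1⟩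

lemma inv_pow_five_drop {x y : ℝ} (hx : 0 < x) (hy : 0 < y) :
    960 / (x + y) ^ 10 + 1 / (x * (x + y)) ^ 5 + 1 / ((x + y) * y) ^ 5 ≤ 1 / (x * y) ^ 5 := by
  have h1 : 960 * (x * y) ^ 5 + (x ^ 5 + y ^ 5) * (x + y) ^ 5 ≤ (x + y) ^ 10 := by
    set p := x * y with hp
    set q := x + y with hq
    have hp0 : 0 < p := by positivity
    have h4 : 4 * p ≤ q ^ 2 := by nlinarith [sq_nonneg (x - y)]
    have h5 : x ^ 5 + y ^ 5 = q ^ 5 - 5 * q ^ 3 * p + 5 * q * p ^ 2 := by rw [hp, hq]; ring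
    have h6 : (4 * p) ^ 3 ≤ (q ^ 2) ^ 3 := by gcongr
    have h7 : 3 * p ≤ q ^ 2 - p := by linarith
    have h8 := mul_le_mul h6 h7 (by positivity) (by positivity)
    rw [h5]
    nlinarith [mul_le_mul_of_nonneg_left h8 hp0.le]
  have e : 960 / (x + y) ^ 10 + 1 / (x * (x + y)) ^ 5 + 1 / ((x + y) * y) ^ 5 =
      (960 * (x * y) ^ 5 + (x ^ 5 + y ^ 5) * (x + y) ^ 5) / ((x + y) ^ 10 * (x * y) ^ 5) := by
    field_simp
    ring
  rw [e, div_le_div_iff₀ (by positivity) (by positivity)]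
  nlinarith [mul_le_mul_of_nonneg_right h1 (by positivity : 0 ≤ (x * y) ^ 5)]

lemma fanSum_sub_le {k : ℕ} {B : ℂ → ℂ} {R Q A₀ A₁ : ℂ} (h : 0 < (Q / R).im) {d r q : ℝ}
    (hr : 0 < r) (hR : r ≤ ‖R‖) (hQ : ‖Q‖ ≤ q * ‖R‖)
    (hd : ∀ w : ℂ, 0 < w.im → ‖shiftSum B w - A₀ * ee w‖ ≤ d ∧ ‖shiftSum' B w - A₁ * ee w‖ ≤ d) :
    ‖fanSum k B R Q - A₀ * ((R ^ k)⁻¹ * ee (Q / R))‖ ≤ d / r ^ k ∧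
    ‖fanSum' k B R Q - (A₁ - Q / R * A₀) * ((R ^ k)⁻¹ * ee (Q / R))‖ ≤ (1 + q) * d / r ^ k := by
  have hd0 : 0 ≤ d := (norm_nonneg _).trans (hd _ h).1
  have hR0 : 0 < ‖R‖ := hr.trans_le hR
  have hq : ‖Q / R‖ ≤ q := by rw [norm_div, div_le_iff₀ hR0]; exact hQ
  have h1 : ‖(R ^ k)⁻¹‖ ≤ (r ^ k)⁻¹ := by
    rw [norm_inv, norm_pow]; gcongr
  have e1 : fanSum k B R Q - A₀ * ((R ^ k)⁻¹ * ee (Q / R)) =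
      (R ^ k)⁻¹ * (shiftSum B (Q / R) - A₀ * ee (Q / R)) := by
    rw [fanSum]; ring
  have e2 : fanSum' k B R Q - (A₁ - Q / R * A₀) * ((R ^ k)⁻¹ * ee (Q / R)) =
      (R ^ k)⁻¹ * ((shiftSum' B (Q / R) - A₁ * ee (Q / R)) -
        Q / R * (shiftSum B (Q / R) - A₀ * ee (Q / R))) := by
    rw [fanSum']; ring
  rw [e1, e2]
  constructor
  · rw [norm_mul, div_eq_inv_mul d]
    exact mul_le_mul h1 (hd _ h).1 (norm_nonneg _) (by positivity)
  · rw [norm_mul, div_eq_inv_mul ((1 + q) * d)]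
    refine mul_le_mul h1 ?_ (norm_nonneg _) (by positivity)
    refine (norm_sub_le _ _).trans ?_
    rw [norm_mul]
    have := mul_le_mul hq (hd _ h).1 (norm_nonneg _) ((norm_nonneg _).trans hq)
    linarith [(hd _ h).2]

namespace Profile

variable {k : ℕ} {a a' : ℝ → ℂ} {B : ℂ → ℂ} (Pr : Profile k (-1) a a' B)
include Pr

omit Pr in
lemma norm_datum_le_split (hk : 4 ≤ k) {m M σ d A r : ℝ} {A₀ A₁ : ℂ} (hm : 0 < m) (hM : 0 ≤ M)
    (hd : ∀ w : ℂ, 0 < w.im → ‖shiftSum B w - A₀ * ee w‖ ≤ d ∧ ‖shiftSum' B w - A₁ * ee w‖ ≤ d)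
    {e : FareyEdge} (he : e.Cone m M) (hs : e.Slopes σ) (hr : 0 < r) (hrR : r ≤ ‖e.P + e.Q‖)
    (hA : ‖(e.f - e.t) * A₀ - (e.s + e.t) * (A₁ - e.Q / (e.P + e.Q) * A₀)‖ ≤ A) :
    ‖e.datum k B‖ ≤ A / r ^ k +
      3 * σ * (1 + M / m) * d / m ^ k / 2 * (2 / (e.x + e.y) ^ 3) := by
  have hσ : 0 ≤ σ := (abs_nonneg _).trans hs.hs
  have hd0 : 0 ≤ d := (norm_nonneg _).trans (hd _ he.pos).1
  have hx := he.hx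
  have hy := he.hy
  have hRn := he.norm_add
  have hxy : 0 < m * (e.x + e.y) := by positivity
  have hpos := div_add_im_pos he.pos
  obtain ⟨f1, f2⟩ := fanSum_sub_le (k := k) (q := M / m) hpos hxy hRn
    (by
      refine he.hQ.trans ?_
      rw [div_mul_eq_mul_div, le_div_iff₀ hm]
      nlinarith [mul_le_mul_of_nonneg_left hRn hM, mul_nonneg hM hm.le]) hd
  have g1 : ‖(e.f : ℂ) - e.t‖ ≤ 2 * σ * (e.x + e.y) := by
    rw [← Complex.ofReal_sub, Complex.norm_real]
    refine (abs_sub _ _).trans ?_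
    nlinarith [hs.hf, hs.ht]
  have g2 : ‖(e.s : ℂ) + e.t‖ ≤ σ := by
    rw [← Complex.ofReal_add, Complex.norm_real]; exact hs.hst
  have hT : 1 ≤ e.x + e.y := by linarith
  have h4 : (e.x + e.y) ^ 4 ≤ (e.x + e.y) ^ k := pow_le_pow_right₀ hT hk
  set T := e.x + e.y with hTdef
  set R := e.P + e.Q with hRdef
  have e1 : e.datum k B = ((e.f - e.t) * A₀ - (e.s + e.t) * (A₁ - e.Q / R * A₀)) *
      ((R ^ k)⁻¹ * ee (e.Q / R)) +
      ((e.f - e.t) * (fanSum k B R e.Q - A₀ * ((R ^ k)⁻¹ * ee (e.Q / R))) -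
      (e.s + e.t) * (fanSum' k B R e.Q - (A₁ - e.Q / R * A₀) * ((R ^ k)⁻¹ * ee (e.Q / R)))) := by
    rw [FareyEdge.datum]; ring
  rw [e1]
  refine (norm_add_le _ _).trans (add_le_add ?_ ?_)
  · rw [norm_mul, norm_mul, norm_inv, norm_pow, div_eq_mul_inv]
    have h1 : (‖R‖ ^ k)⁻¹ ≤ (r ^ k)⁻¹ := by gcongr
    have h2 : ‖ee (e.Q / R)‖ ≤ 1 := by
      simpa using norm_ee_mul_le_one hpos.le (u := 1) zero_le_one
    have h3 : (‖R‖ ^ k)⁻¹ * ‖ee (e.Q / R)‖ ≤ (r ^ k)⁻¹ * 1 :=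
      mul_le_mul h1 h2 (norm_nonneg _) (by positivity)
    rw [mul_one] at h3
    exact mul_le_mul hA h3 (by positivity) ((norm_nonneg _).trans hA)
  · refine (norm_sub_le _ _).trans ?_
    rw [norm_mul, norm_mul]
    have hq : 0 ≤ M / m := by positivity
    calc _ ≤ 2 * σ * T * (d / (m * T) ^ k) + σ * ((1 + M / m) * d / (m * T) ^ k) := by
          gcongr
      _ ≤ 2 * σ * T * ((1 + M / m) * d / (m * T) ^ k) +
          σ * T * ((1 + M / m) * d / (m * T) ^ k) := by
          gcongr
          · nlinarith [mul_nonneg hq hd0]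
          · nlinarith
      _ = 3 * σ * (1 + M / m) * d / m ^ k * (T / T ^ k) := by
          rw [mul_pow]; field_simp; ring
      _ ≤ 3 * σ * (1 + M / m) * d / m ^ k * (1 / T ^ 3) := by
          refine mul_le_mul_of_nonneg_left ?_ (by positivity)
          rw [div_le_div_iff₀ (by positivity) (by positivity)]
          nlinarith
      _ = _ := by ring

lemma norm_phi_le_split (hk : 12 ≤ k) {m M σ d A : ℝ} {A₀ A₁ : ℂ} (hm : 0 < m)
    (hd : ∀ w : ℂ, 0 < w.im → ‖shiftSum B w - A₀ * ee w‖ ≤ d ∧ ‖shiftSum' B w - A₁ * ee w‖ ≤ d)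
    (H : FareyEdge → Prop) (hL : ∀ e, H e → H e.left) (hR : ∀ e, H e → H e.right)
    (hA : ∀ e, H e → ‖(e.f - e.t) * A₀ - (e.s + e.t) * (A₁ - e.Q / (e.P + e.Q) * A₀)‖ ≤ A)
    {e : FareyEdge} (he : e.Cone m M) (hs : e.Slopes σ) (hH : H e) :
    ‖e.phi k B‖ ≤ A / m ^ k / 3840 * (1 / (e.x * e.y) ^ 5) +
      3 * σ * (1 + M / m) * d / m ^ k / 2 * (1 / (e.x * e.y * √(e.x * e.y))) := by
  have hd0 : 0 ≤ d := (norm_nonneg _).trans (hd _ he.pos).1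
  have hA0 : 0 ≤ A := (norm_nonneg _).trans (hA e hH)
  have hσ : 0 ≤ σ := (abs_nonneg _).trans hs.hs
  have hM : 0 ≤ M := by
    have h1 := he.hP
    have h2 := he.hx
    by_contra h
    nlinarith [norm_nonneg e.P]
  set K := 3 * σ * (1 + M / m) * d / m ^ k / 2 with hK
  have hK0 : 0 ≤ K := by positivity
  set K' := A / m ^ k / 3840 with hK'
  have hK'0 : 0 ≤ K' := by positivity
  refine Pr.norm_phi_le_of_supersolution (by omega) hm
    (fun e => K' * (1 / (e.x * e.y) ^ 5) + K * (1 / (e.x * e.y * √(e.x * e.y))))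
    (fun e => e.Cone m M ∧ e.Slopes σ ∧ H e)
    (fun e h => ⟨h.1.left, h.2.1.left h.1.hx, hL _ h.2.2⟩)
    (fun e h => ⟨h.1.right, h.2.1.right h.1.hy, hR _ h.2.2⟩) (fun e h => h.1)
    (fun e h => h.2.1) ?_ ?_ ⟨he, hs, hH⟩
  · rintro e ⟨h, -⟩
    have := h.hx
    have := h.hy
    positivity
  · rintro e ⟨h, h', hH⟩
    have hx := h.hx
    have hy := h.hy
    have hxy : 0 < m * (e.x + e.y) := by positivity
    have h1 := inv_mul_sqrt_drop (zero_lt_one.trans_le hx) (zero_lt_one.trans_le hy)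
    have h1' := inv_pow_five_drop (zero_lt_one.trans_le hx) (zero_lt_one.trans_le hy)
    have h2 := norm_datum_le_split (show 4 ≤ k by omega) hm hM hd h h' hxy h.norm_add (hA e hH)
    rw [← hK] at h2
    have h3 : A / (m * (e.x + e.y)) ^ k ≤ K' * (960 / (e.x + e.y) ^ 10) := by
      have hT : 2 ≤ e.x + e.y := by linarith
      set T := e.x + e.y
      have h4 : T ^ 12 ≤ T ^ k := pow_le_pow_right₀ (by linarith) hk
      calc _ = A / m ^ k * (1 / T ^ k) := by rw [mul_pow]; field_simp
        _ ≤ A / m ^ k * (1 / (4 * T ^ 10)) := by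
            gcongr
            nlinarith [mul_le_mul hT hT (by norm_num) (by linarith), pow_pos (by linarith : 0 < T) 10]
        _ = _ := by rw [hK']; field_simp; ring
    simp only [FareyEdge.left, FareyEdge.right]
    nlinarith [mul_le_mul_of_nonneg_left h1 hK0, mul_le_mul_of_nonneg_left h1' hK'0]

end Profile

/-- The two-sided fan of nodes around infinity. -/
noncomputable def fanNode (τ : ℂ) (F σ : ℤ → ℝ) (j : ℤ) : FareyEdge :=
  ⟨τ + j, τ + j - 1, 1, 1, F j, σ j, σ (j - 1)⟩

/-- The boundary term in the telescoping identity for `fanNode`. -/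
noncomputable def fanBoundary (k : ℕ) (B : ℂ → ℂ) (τ : ℂ) (F σ : ℤ → ℝ) (j : ℤ) : ℂ :=
  F j * fanV k B (τ + j) (τ + j - 1) - σ (j - 1) * fanV' k B (τ + j) (τ + j - 1)

/-- The data attached to the nodes of `fanNode`. -/
noncomputable def fanData (k : ℕ) (B : ℂ → ℂ) (τ : ℂ) (F σ : ℤ → ℝ) (j : ℤ) : ℂ :=
  F j * fanSum k B (τ + j) (τ + j - 1) + σ j * fanSum' k B (τ + j) (τ + j - 1)

namespace Profile

variable {k : ℕ} {a a' : ℝ → ℂ} {B : ℂ → ℂ} (Pr : Profile k (-1) a a' B)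
include Pr

lemma phi_fanNode (hk : 4 ≤ k) {τ : ℂ} (hτ : 0 < τ.im) {F σ : ℤ → ℝ}
    (hF : ∀ j, F j - F (j + 1) = 2 * σ j) (j : ℤ) :
    (fanNode τ F σ j).phi k B = fanData k B τ F σ j + (F j - σ j) * B (τ + j) +
      (fanBoundary k B τ F σ (j + 1) - fanBoundary k B τ F σ j) := by
  obtain ⟨h1, h2⟩ := Pr.fanU_root hk (τ := τ + j) (by simpa using hτ) 0
  have e : τ + j + ((0 + 1 : ℕ) : ℂ) = τ + (j + 1 : ℤ) := by push_cast; ring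
  rw [e] at h1 h2
  simp only [Nat.cast_zero, add_zero] at h1 h2
  have h3 : (F j : ℂ) - F (j + 1) = 2 * σ j := by exact_mod_cast hF j
  simp only [FareyEdge.phi, fanNode, fanData, fanBoundary, add_sub_cancel_right]
  rw [h1, h2]
  linear_combination (fanV k B (τ + (j + 1 : ℤ)) (τ + (j + 1 : ℤ) - 1)) * h3

lemma sum_phi_fanNode (hk : 4 ≤ k) {τ : ℂ} (hτ : 0 < τ.im) {F σ : ℤ → ℝ}
    (hF : ∀ j, F j - F (j + 1) = 2 * σ j) (N : ℕ) :
    ∑ n ∈ Finset.range N, (((fanNode τ F σ (n + 1)).phi k B - fanData k B τ F σ (n + 1) -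
        (F (n + 1) - σ (n + 1)) * B (τ + (n + 1 : ℤ))) +
      ((fanNode τ F σ (-n)).phi k B - fanData k B τ F σ (-n) -
        (F (-n) - σ (-n)) * B (τ + (-n : ℤ)))) =
      fanBoundary k B τ F σ (N + 1) - fanBoundary k B τ F σ (-N + 1) := by
  induction N with
  | zero => simp
  | succ N ih =>
    rw [Finset.sum_range_succ, ih, Pr.phi_fanNode hk hτ hF, Pr.phi_fanNode hk hτ hF]
    push_cast
    rw [show -((N : ℤ) + 1) + 1 = -N by ring]
    ring

end Profile

lemma sqrt_one_add_sq_pow (n : ℕ) : √(1 + (n : ℝ) ^ 2) ^ 12 = (1 + (n : ℝ) ^ 2) ^ 6 := by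
  rw [show 12 = 2 * 6 from rfl, pow_mul, Real.sq_sqrt (by positivity)]

lemma add_two_le_sqrt (n : ℕ) : (n : ℝ) + 2 ≤ 3 * √(1 + (n : ℝ) ^ 2) := by
  have h := Real.sq_sqrt (show 0 ≤ 1 + (n : ℝ) ^ 2 by positivity)
  nlinarith [Real.sqrt_nonneg (1 + (n : ℝ) ^ 2), sq_nonneg ((n : ℝ) - 1), sq_nonneg (n : ℝ)]

lemma div_one_add_sq_le (n : ℕ) :
    ((n : ℝ) + 1) / (1 + (n : ℝ) ^ 2) ^ 6 ≤ 64 / (1 + (n : ℝ)) ^ 4 := by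
  have hn : (0 : ℝ) ≤ n := by positivity
  have h1 : (1 + (n : ℝ)) ^ 2 ≤ 2 * (1 + (n : ℝ) ^ 2) := by nlinarith [sq_nonneg ((n : ℝ) - 1)]
  have h2 : ((1 + (n : ℝ)) ^ 2) ^ 6 ≤ (2 * (1 + (n : ℝ) ^ 2)) ^ 6 := by gcongr
  have h3 : (1 + (n : ℝ)) ^ 5 ≤ ((1 + (n : ℝ)) ^ 2) ^ 6 := by
    rw [← pow_mul]
    exact pow_le_pow_right₀ (by linarith) (by norm_num)
  rw [div_le_div_iff₀ (by positivity) (by positivity)]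
  nlinarith

lemma fanNode_cone (F σ : ℤ → ℝ) {j : ℤ} {n : ℕ} (hj : j = n + 1 ∨ j = -n) :
    (fanNode I F σ j).Cone √(1 + (n : ℝ) ^ 2) (n + 2) where
  pos := by
    have := rootEdge_pos (τ := I + j) (by simp) 0
    simpa [fanNode] using this
  hx := le_rfl
  hy := le_rfl
  le a b ha hb := by
    simp only [fanNode, mul_one]
    set w : ℂ := a * (I + j) + b * (I + j - 1) with hw
    have hwre : w.re = (a + b) * j - b := by simp [hw]; ring
    have hwim : w.im = a + b := by simp [hw]
    have h1 : ((a + b) * n) ^ 2 ≤ w.re ^ 2 := by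
      rw [hwre]
      have hn : (0 : ℝ) ≤ (a + b) * n := by positivity
      rcases hj with rfl | rfl
      · push_cast
        refine pow_le_pow_left₀ hn ?_ 2
        linarith
      · push_cast
        rw [show (a + b) * -(n : ℝ) - b = -((a + b) * n + b) by ring, neg_sq]
        refine pow_le_pow_left₀ hn ?_ 2
        linarith
    rw [← abs_of_nonneg (norm_nonneg w)]
    refine le_of_abs_le (sq_le_sq.1 ?_)
    rw [mul_pow, Real.sq_sqrt (by positivity), Complex.sq_norm, Complex.normSq_apply, hwim]
    nlinarith
  hP := by
    simp only [fanNode, mul_one]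
    refine (norm_add_le _ _).trans ?_
    have : |(j : ℝ)| ≤ n + 1 := by
      have hn : (0 : ℝ) ≤ n := by positivity
      rcases hj with rfl | rfl <;> push_cast <;> rw [abs_le] <;> constructor <;> linarith
    rw [Complex.norm_I, Complex.norm_intCast]
    linarith
  hQ := by
    simp only [fanNode, mul_one, add_sub_assoc]
    refine (norm_add_le _ _).trans ?_
    have : |((j - 1 : ℤ) : ℝ)| ≤ n + 1 := by
      have hn : (0 : ℝ) ≤ n := by positivity
      rcases hj with rfl | rfl <;> push_cast <;> rw [abs_le] <;> constructor <;> linarith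
    have e : (j : ℂ) - 1 = ((j - 1 : ℤ) : ℂ) := by push_cast; ring
    rw [Complex.norm_I, e, Complex.norm_intCast]
    linarith

lemma abs_affine_le {α β : ℝ} {σ : ℤ → ℝ} (hα : |α| ≤ 1) (hβ : |β| ≤ 1) (hσ : ∀ j, |σ j| ≤ 2)
    {j : ℤ} {n : ℕ} (hj : j = n + 1 ∨ j = -n) : |α + β * j + σ j| ≤ n + 4 := by
  have h1 : |(j : ℝ)| ≤ n + 1 := by
    have hn : (0 : ℝ) ≤ n := by positivity
    rcases hj with rfl | rfl <;> push_cast <;> rw [abs_le] <;> constructor <;> linarith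
  have h2 : |β * j| ≤ 1 * (n + 1) := by
    rw [abs_mul]; exact mul_le_mul hβ h1 (abs_nonneg _) zero_le_one
  refine (abs_add_le _ _).trans ?_
  have := abs_add_le α (β * j)
  linarith [hσ j]

lemma fanNode_slopes {α β : ℝ} {σ : ℤ → ℝ} (hα : |α| ≤ 1) (hβ : |β| ≤ 1) (hσ : ∀ j, |σ j| ≤ 2)
    (hσβ : ∀ j, σ j + σ (j + 1) = -β) {j : ℤ} {n : ℕ} (hj : j = n + 1 ∨ j = -n) :
    (fanNode I (fun j => α + β * j + σ j) σ j).Slopes (n + 4) := by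
  have hn : (0 : ℝ) ≤ n := by positivity
  refine ⟨(hσ _).trans (by linarith), (hσ _).trans (by linarith), ?_, ?_⟩
  · have := hσβ (j - 1)
    rw [sub_add_cancel] at this
    simp only [fanNode]
    rw [add_comm, this, abs_neg]
    linarith
  · simp only [fanNode]
    refine (abs_affine_le hα hβ hσ hj).trans ?_
    nlinarith

lemma exp_pi_le : Real.exp π ≤ 23.3 := by
  have h1 : Real.exp π ≤ Real.exp (1 + 1 + 1 + 0.1416) := by
    apply Real.exp_le_exp.2
    have := pi_lt_d4
    norm_num at this ⊢; linarith
  rw [Real.exp_add, Real.exp_add, Real.exp_add] at h1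
  have h2 := Real.exp_one_lt_d9
  have h3 : Real.exp 0.1416 ≤ 1.16 := by
    have := Real.exp_bound' (x := 0.1416) (by norm_num) (by norm_num) (n := 3) (by norm_num)
    norm_num [Finset.sum_range_succ, Nat.factorial] at this ⊢
    linarith
  have h4 : Real.exp 1 * Real.exp 1 * Real.exp 1 ≤ 2.7182818286 * 2.7182818286 * 2.7182818286 := by
    gcongr
  refine h1.trans ((mul_le_mul h4 h3 (Real.exp_nonneg _) (by norm_num)).trans ?_)
  norm_num

lemma main_coeff_ge {l : ℝ} (hl : l = 1 ∨ l = -2) :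
    0.00098 ≤ 2 * Real.exp (-π) ^ 2 + l * Real.exp (-π) / 32 := by
  have h : 0.0428 ≤ Real.exp (-π) := by
    rw [Real.exp_neg, le_inv_comm₀ (by norm_num) (Real.exp_pos _)]
    refine exp_pi_le.trans (by norm_num)
  rcases hl with rfl | rfl <;> nlinarith

lemma ee_I : ee I = (Real.exp (-π) ^ 2 : ℝ) := by
  rw [ee, ← Real.exp_nat_mul, Complex.ofReal_exp]
  congr 1
  push_cast
  linear_combination (2 * π : ℂ) * Complex.I_sq

lemma ee_half_add_half_I : ee ((1 + I) / 2) = -(Real.exp (-π) : ℝ) := by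
  rw [ee, show 2 * (π : ℂ) * I * ((1 + I) / 2) = -π + π * I by
    linear_combination (π : ℂ) * Complex.I_sq, Complex.exp_add, Complex.exp_pi_mul_I,
    Complex.ofReal_exp]
  push_cast; ring

/-- The leading term of `fanData`. -/
noncomputable def fanMain (j : ℤ) : ℂ :=
  ((I + j) ^ 12)⁻¹ * ee ((I + j - 1) / (I + j))

lemma fanMain_zero : fanMain 0 = (Real.exp (-π) ^ 2 : ℝ) := by
  have h : (I - 1) / I = I + (1 : ℤ) := by
    field_simp
    push_cast
    linear_combination -Complex.I_sq
  have h2 : I ^ 12 = 1 := by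
    rw [show 12 = 4 * 3 from rfl, pow_mul, Complex.I_pow_four, one_pow]
  rw [fanMain, Int.cast_zero, add_zero, h, h2, ee_add, ee_int, ee_I]
  simp

lemma I_add_one_pow : (I + 1) ^ 12 = -64 := by
  rw [show 12 = 2 * 6 from rfl, pow_mul, show (I + 1) ^ 2 = 2 * I by
    linear_combination Complex.I_sq, mul_pow, show 6 = 4 + 2 from rfl, pow_add I,
    Complex.I_pow_four, Complex.I_sq]
  norm_num

lemma I_sub_one_pow : (I - 1) ^ 12 = -64 := by
  rw [show 12 = 2 * 6 from rfl, pow_mul, show (I - 1) ^ 2 = -2 * I by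
    linear_combination Complex.I_sq, mul_pow, show 6 = 4 + 2 from rfl, pow_add I,
    Complex.I_pow_four, Complex.I_sq]
  norm_num

lemma fanMain_one : fanMain 1 = (Real.exp (-π) / 64 : ℝ) := by
  have h0 : I + 1 ≠ 0 := fun h => by simpa using congrArg Complex.im h
  have h : (I + 1 - 1) / (I + 1) = (1 + I) / 2 := by
    rw [div_eq_div_iff h0 two_ne_zero]
    linear_combination -Complex.I_sq
  rw [fanMain, Int.cast_one, h, ee_half_add_half_I, I_add_one_pow]
  push_cast; ring

lemma fanMain_neg_one : fanMain (-1) = (Real.exp (-π) / 64 : ℝ) := by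
  have h0 : I + -1 ≠ 0 := fun h => by simpa using congrArg Complex.im h
  have h : (I + -1 - 1) / (I + -1) = (1 + I) / 2 + (1 : ℤ) := by
    field_simp
    push_cast
    linear_combination -Complex.I_sq
  rw [fanMain, Int.cast_neg, Int.cast_one, h, ee_add, ee_int, ee_half_add_half_I,
    ← sub_eq_add_neg, I_sub_one_pow]
  push_cast; ring

lemma norm_fanMain_le (j : ℤ) : ‖fanMain j‖ ≤ 1 / (1 + (j : ℝ) ^ 2) ^ 6 := by
  have hn : ‖I + j‖ ^ 2 = 1 + (j : ℝ) ^ 2 := by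
    rw [Complex.sq_norm, Complex.normSq_apply]
    simp; ring
  have hpos : 0 < ((I + j - 1) / (I + j)).im := by
    have := rootEdge_pos (τ := I + j) (by simp) 0
    simpa using this
  have h2 : ‖ee ((I + j - 1) / (I + j))‖ ≤ 1 := by
    simpa using norm_ee_mul_le_one hpos.le (u := 1) zero_le_one
  rw [fanMain, norm_mul, norm_inv, norm_pow, show 12 = 2 * 6 from rfl, pow_mul, hn, one_div]
  exact mul_le_of_le_one_right (by positivity) h2

/-- Slopes `α + β j + σ j` on the fan around infinity for which the leading data are
multiples of a single number `A`. -/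
structure FanRelation (B : ℂ → ℂ) (α β : ℝ) (σ : ℤ → ℝ) (H : FareyEdge → Prop) (A₀ A₁ A : ℂ)
    (d l : ℝ) (lam : ℤ → ℝ) : Prop where
  hα : |α| ≤ 1
  hβ : |β| ≤ 1
  hσ : ∀ j, |σ j| ≤ 2
  add : ∀ j, σ j + σ (j + 1) = -β
  hd : ∀ w : ℂ, 0 < w.im → ‖shiftSum B w - A₀ * ee w‖ ≤ d ∧ ‖shiftSum' B w - A₁ * ee w‖ ≤ d
  left : ∀ e, H e → H e.left
  right : ∀ e, H e → H e.right
  bound : ∀ e, H e →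
    ‖(e.f - e.t) * A₀ - (e.s + e.t) * (A₁ - e.Q / (e.P + e.Q) * A₀)‖ ≤ 2 * ‖A‖
  node : ∀ j, H (fanNode I (fun j => α + β * j + σ j) σ j)
  main : ∀ j : ℤ, ((α + β * j + σ j : ℝ) : ℂ) * A₀ +
    σ j * (A₁ - (I + j - 1) / (I + j) * A₀) = lam j * A
  hl : l = 1 ∨ l = -2
  zero : lam 0 = 1
  one : lam 1 = l
  neg_one : lam (-1) = l
  le_two : ∀ j, |lam j| ≤ 2
  total : α * A₀ + β * (A₁ - I * A₀) = A

namespace FanRelation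

variable {B : ℂ → ℂ} {α β : ℝ} {σ : ℤ → ℝ} {H : FareyEdge → Prop} {A₀ A₁ A : ℂ} {d l : ℝ}
  {lam : ℤ → ℝ} (R : FanRelation B α β σ H A₀ A₁ A d l lam)
include R

lemma d_nonneg : 0 ≤ d := (norm_nonneg _).trans (R.hd I (by simp)).1

lemma norm_fanData_sub_le {j : ℤ} {n : ℕ} (hj : j = n + 1 ∨ j = -n) :
    ‖fanData 12 B I (fun j => α + β * j + σ j) σ j - lam j * A * fanMain j‖ ≤
      (n + 10) * d / (1 + (n : ℝ) ^ 2) ^ 6 := by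
  have hpos : 0 < ((I + j - 1) / (I + j)).im := by
    simpa using rootEdge_pos (τ := I + j) (by simp) 0
  have hn1 : (1 : ℝ) ≤ ‖I + j‖ := by
    have := Complex.abs_im_le_norm (I + j)
    simpa using this
  have hr : √(1 + (n : ℝ) ^ 2) ≤ ‖I + j‖ := by
    have := (fanNode_cone (fun _ => 0) (fun _ => 0) hj).le 1 0 zero_le_one le_rfl
    simpa [fanNode] using this
  have hd0 := R.d_nonneg
  obtain ⟨f1, f2⟩ := fanSum_sub_le (k := 12) (q := 2) hpos (by positivity) hr (by
    refine (norm_sub_le _ _).trans ?_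
    rw [norm_one]; linarith) R.hd
  rw [sqrt_one_add_sq_pow] at f1 f2
  have e : fanData 12 B I (fun j => α + β * j + σ j) σ j - lam j * A * fanMain j =
      ((α + β * j + σ j : ℝ) : ℂ) * (fanSum 12 B (I + j) (I + j - 1) -
        A₀ * (((I + j) ^ 12)⁻¹ * ee ((I + j - 1) / (I + j)))) +
      σ j * (fanSum' 12 B (I + j) (I + j - 1) -
        (A₁ - (I + j - 1) / (I + j) * A₀) *
        (((I + j) ^ 12)⁻¹ * ee ((I + j - 1) / (I + j)))) := by
    rw [← R.main, fanData, fanMain]; ring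
  rw [e]
  refine (norm_add_le _ _).trans ?_
  rw [norm_mul, norm_mul, Complex.norm_real, Complex.norm_real]
  have g1 := mul_le_mul (abs_affine_le R.hα R.hβ R.hσ hj) f1 (norm_nonneg _) (by positivity)
  have g2 := mul_le_mul (R.hσ j) f2 (norm_nonneg _) (by positivity)
  calc _ ≤ ((n : ℝ) + 4) * (d / (1 + (n : ℝ) ^ 2) ^ 6) +
        2 * ((1 + 2) * d / (1 + (n : ℝ) ^ 2) ^ 6) := add_le_add g1 g2
    _ = _ := by ring

lemma norm_phi_le {a a' : ℝ → ℂ} (Pr : Profile 12 (-1) a a' B) {j : ℤ} {n : ℕ}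
    (hj : j = n + 1 ∨ j = -n) :
    ‖(fanNode I (fun j => α + β * j + σ j) σ j).phi 12 B‖ ≤
      2 * ‖A‖ / (1 + (n : ℝ) ^ 2) ^ 6 / 3840 + 6 * (n + 4) * d / (1 + (n : ℝ) ^ 2) ^ 6 := by
  have hd0 := R.d_nonneg
  have h := Pr.norm_phi_le_split le_rfl (by positivity) R.hd H R.left R.right R.bound
    (fanNode_cone _ _ hj) (fanNode_slopes R.hα R.hβ R.hσ R.add hj) (R.node j)
  rw [sqrt_one_add_sq_pow] at h
  refine h.trans ?_
  have h1 : ((n : ℝ) + 2) / √(1 + (n : ℝ) ^ 2) ≤ 3 := by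
    rw [div_le_iff₀ (by positivity)]; exact add_two_le_sqrt n
  simp only [fanNode, mul_one, Real.sqrt_one, one_pow, div_one]
  refine add_le_add le_rfl ?_
  calc _ ≤ 3 * ((n : ℝ) + 4) * (1 + 3) * d / (1 + (n : ℝ) ^ 2) ^ 6 / 2 := by gcongr
    _ = _ := by ring

lemma norm_phi_zero_le {a a' : ℝ → ℂ} (Pr : Profile 12 (-1) a a' B) {j : ℤ}
    (hj : j = 1 ∨ j = 0) :
    ‖(fanNode I (fun j => α + β * j + σ j) σ j).phi 12 B‖ ≤
      0.000161 * ‖A‖ + 42 * d := by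
  have hd0 := R.d_nonneg
  have hj' : j = ((0 : ℕ) : ℤ) + 1 ∨ j = -((0 : ℕ) : ℤ) := by simpa using hj
  have hC := fanNode_cone (fun j => α + β * j + σ j) σ hj'
  have hS := fanNode_slopes R.hα R.hβ R.hσ R.add hj'
  have hN := R.node j
  set e := fanNode I (fun j => α + β * j + σ j) σ j with he
  have hx : e.x = 1 := rfl
  have hy : e.y = 1 := rfl
  simp only [Nat.cast_zero, ne_eq, OfNat.ofNat_ne_zero, not_false_eq_true, zero_pow, add_zero,
    Real.sqrt_one, zero_add] at hC hS
  have hR5 : √5 ≤ ‖e.P + e.Q‖ := by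
    rw [← abs_of_nonneg (norm_nonneg (e.P + e.Q)), ← abs_of_nonneg (Real.sqrt_nonneg 5)]
    refine sq_le_sq.1 ?_
    rw [Real.sq_sqrt (by norm_num), Complex.sq_norm, Complex.normSq_apply]
    rcases hj with rfl | rfl <;> simp [he, fanNode] <;> norm_num
  have e5 : √5 ^ 12 = 15625 := by
    rw [show 12 = 2 * 6 from rfl, pow_mul, Real.sq_sqrt (by norm_num)]; norm_num
  have hdat := Profile.norm_datum_le_split (k := 12) (by norm_num) one_pos (by norm_num) R.hd hC hS
    (by positivity) hR5 (R.bound _ hN)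
  have hl := Pr.norm_phi_le_split le_rfl one_pos R.hd H R.left R.right R.bound
    hC.left (hS.left hC.hx) (R.left _ hN)
  have hr := Pr.norm_phi_le_split le_rfl one_pos R.hd H R.left R.right R.bound
    hC.right (hS.right hC.hy) (R.right _ hN)
  rw [Pr.phi_eq (by norm_num) hC.pos]
  refine (norm_sub_le _ _).trans ((add_le_add (norm_add_le _ _) le_rfl).trans ?_)
  have hlx : e.left.x = 1 := rfl
  have hly : e.left.y = 2 := one_add_one_eq_two
  have hrx : e.right.x = 2 := one_add_one_eq_two
  have hry : e.right.y = 1 := rfl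
  rw [hlx, hly] at hl
  rw [hrx, hry] at hr
  rw [hx, hy, e5] at hdat
  have hs2 : 1 / √2 ≤ 1 := by
    rw [div_le_one (by positivity)]; exact Real.one_le_sqrt.2 (by norm_num)
  norm_num at hl hr hdat hs2
  nlinarith [norm_nonneg A, mul_le_mul_of_nonneg_left hs2 hd0]

end FanRelation

namespace FanRelation

variable {B : ℂ → ℂ} {α β : ℝ} {σ : ℤ → ℝ} {H : FareyEdge → Prop} {A₀ A₁ A : ℂ} {d l : ℝ}
  {lam : ℤ → ℝ} (R : FanRelation B α β σ H A₀ A₁ A d l lam)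
include R

lemma exists_norm_fanBoundary_le {a a' : ℝ → ℂ} (Pr : Profile 12 (-1) a a' B) :
    ∃ C : ℝ, 0 ≤ C ∧ ∀ (j : ℤ) (n : ℕ), (j = n + 1 ∨ j = -n) →
      ‖fanBoundary 12 B I (fun j => α + β * j + σ j) σ j‖ ≤ C * (1 / ((n : ℝ) + 1)) := by
  obtain ⟨C, hC⟩ := Pr.bound
  have hC0 : 0 ≤ C := le_trans (by positivity) (hC I (by simp))
  have hf : 0 ≤ fanConst := by
    have h := (Profile.fan_bound (k := 12) (by norm_num) hC (by positivity)
      (fanNode_cone (fun _ => 0) (fun _ => 0) (n := 0) (j := 0) (by simp))).1.2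
    by_contra hneg
    have hB := (Profile.fan_bound (k := 12) (B := fun _ => 0) (C := 1) (by norm_num)
      (fun z _ => by simp) (by positivity)
      (fanNode_cone (fun _ => 0) (fun _ => 0) (n := 0) (j := 0) (by simp))).1.2
    simp only [fanNode, mul_one, Real.sqrt_one, div_one, sqrt_one_add_sq_pow] at hB
    norm_num at hB
    linarith [(norm_nonneg _).trans hB]
  refine ⟨6 * (C * fanConst) * 64, by positivity, fun j n hj => ?_⟩
  obtain ⟨-, f1, f2⟩ := Profile.fan_bound (k := 12) (by norm_num) hC (by positivity)
    (fanNode_cone (fun _ => 0) (fun _ => 0) hj)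
  simp only [fanNode, mul_one, Real.sqrt_one, div_one, sqrt_one_add_sq_pow] at f1 f2
  set D := C / (1 + (n : ℝ) ^ 2) ^ 6 * fanConst with hD
  have hD0 : 0 ≤ D := by positivity
  rw [fanBoundary]
  refine (norm_sub_le _ _).trans ?_
  rw [norm_mul, norm_mul, Complex.norm_real, Complex.norm_real]
  have g1 := mul_le_mul (abs_affine_le R.hα R.hβ R.hσ hj)
    (show ‖fanV 12 B (I + j) (I + j - 1)‖ ≤ D by
      linarith [norm_nonneg (fanV 12 B (I + j) (I + j - 1))])
    (norm_nonneg _) (by positivity)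
  have g2 := mul_le_mul (R.hσ (j - 1)) f2 (norm_nonneg _) (by positivity)
  have h4 : (64 : ℝ) / (1 + n) ^ 4 ≤ 64 * (1 / (n + 1)) := by
    rw [mul_one_div]
    refine div_le_div_of_nonneg_left (by norm_num) (by positivity) ?_
    rw [add_comm]
    exact le_self_pow₀ (by linarith [(Nat.cast_nonneg n : (0 : ℝ) ≤ n)]) (by norm_num)
  calc _ ≤ ((n : ℝ) + 4) * D + 2 * D := add_le_add g1 g2
    _ ≤ 6 * (C * fanConst) * ((n + 1) / (1 + (n : ℝ) ^ 2) ^ 6) := by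
      have : 6 * (C * fanConst) * ((n + 1) / (1 + (n : ℝ) ^ 2) ^ 6) = 6 * (n + 1) * D := by
        rw [hD]; ring
      rw [this]
      nlinarith [mul_nonneg (Nat.cast_nonneg n : (0 : ℝ) ≤ n) hD0]
    _ ≤ 6 * (C * fanConst) * (64 * (1 / (n + 1))) := by
      gcongr
      exact (div_one_add_sq_le n).trans h4
    _ = _ := by ring

lemma tendsto_sum {a a' : ℝ → ℂ} (Pr : Profile 12 (-1) a a' B) :
    Filter.Tendsto (fun N : ℕ => ∑ n ∈ Finset.range (N + 1),
      (((fanNode I (fun j => α + β * j + σ j) σ (n + 1)).phi 12 B -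
        fanData 12 B I (fun j => α + β * j + σ j) σ (n + 1)) +
      ((fanNode I (fun j => α + β * j + σ j) σ (-n)).phi 12 B -
        fanData 12 B I (fun j => α + β * j + σ j) σ (-n)))) Filter.atTop
      (nhds (α * shiftSum B I +
        β * (shiftSum' B I - I * shiftSum B I))) := by
  have hI : 0 < Complex.I.im := by simp
  have hF : ∀ j : ℤ, (fun j : ℤ => α + β * j + σ j) j - (fun j : ℤ => α + β * j + σ j) (j + 1) =
      2 * σ j := fun j => by
    have := R.add j
    push_cast
    linarith
  obtain ⟨C, hC0, hC⟩ := R.exists_norm_fanBoundary_le Pr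
  have b1 : Filter.Tendsto (fun N : ℕ => fanBoundary 12 B I
      (fun j => α + β * j + σ j) σ ((N + 1 : ℕ) + 1)) Filter.atTop (nhds 0) := by
    refine squeeze_zero_norm (fun N => hC _ (N + 1) (Or.inl rfl)) ?_
    have := ((Filter.tendsto_add_atTop_iff_nat 1).2
      (tendsto_one_div_add_atTop_nhds_zero_nat (𝕜 := ℝ))).const_mul C
    simpa using this
  have b2 : Filter.Tendsto (fun N : ℕ => fanBoundary 12 B I
      (fun j => α + β * j + σ j) σ (-N)) Filter.atTop (nhds 0) := by
    refine squeeze_zero_norm (fun N => hC _ N (Or.inr rfl)) ?_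
    have := (tendsto_one_div_add_atTop_nhds_zero_nat (𝕜 := ℝ)).const_mul C
    simpa using this
  have s1 : HasSum (fun j : ℤ => (α + β * j) * B (I + j))
      (α * shiftSum B I +
        β * (shiftSum' B I - I * shiftSum B I)) := by
    rw [← Pr.tsum_int_mul_shift (by norm_num) hI]
    have u1 := (Pr.summable_shift (by norm_num) hI).hasSum.mul_left (α : ℂ)
    have u2 := (Pr.summable_int_mul_shift (by norm_num) hI).hasSum.mul_left (β : ℂ)
    have e : (fun j : ℤ => (α + β * j) * B (I + j)) = fun j : ℤ =>
        α * B (I + j) + β * (j * B (I + j)) := funext fun j => by ring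
    rw [e]
    exact u1.add u2
  have s2 := (((Equiv.neg ℤ).hasSum_iff.2 s1).nat_add_neg_add_one).tendsto_sum_nat
  have s3 := (Filter.tendsto_add_atTop_iff_nat 1).2 s2
  have key := (b1.sub b2).add s3
  rw [sub_zero, zero_add] at key
  refine key.congr fun N => ?_
  have h := Pr.sum_phi_fanNode (by norm_num) hI hF (N + 1)
  rw [show -((N + 1 : ℕ) : ℤ) + 1 = -N by push_cast; ring] at h
  rw [← h, ← Finset.sum_add_distrib]
  refine Finset.sum_congr rfl fun n _ => ?_
  simp only [Function.comp_apply, Equiv.neg_apply, neg_neg]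
  push_cast
  ring

lemma norm_term_le {a a' : ℝ → ℂ} (Pr : Profile 12 (-1) a a' B) {j : ℤ} {n : ℕ}
    (hj : j = n + 1 ∨ j = -n) :
    ‖(fanNode I (fun j => α + β * j + σ j) σ j).phi 12 B -
        (fanData 12 B I (fun j => α + β * j + σ j) σ j - lam j * A * fanMain j)‖ ≤
      2 * ‖A‖ / (1 + (n : ℝ) ^ 2) ^ 6 / 3840 + 2304 * d / (1 + (n : ℝ)) ^ 4 := by
  have hd0 := R.d_nonneg
  refine (norm_sub_le _ _).trans ((add_le_add (R.norm_phi_le Pr hj)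
    (R.norm_fanData_sub_le hj)).trans ?_)
  have h1 := mul_le_mul_of_nonneg_left (div_one_add_sq_le n) (by positivity : 0 ≤ 34 * d)
  have h2 : 6 * ((n : ℝ) + 4) * d / (1 + (n : ℝ) ^ 2) ^ 6 + (n + 10) * d / (1 + (n : ℝ) ^ 2) ^ 6 ≤
      34 * d * ((n + 1) / (1 + (n : ℝ) ^ 2) ^ 6) := by
    rw [← add_div, ← mul_div_assoc]
    refine div_le_div_of_nonneg_right ?_ (by positivity)
    nlinarith [mul_nonneg (Nat.cast_nonneg n : (0 : ℝ) ≤ n) hd0]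
  have h3 : 34 * d * (64 / (1 + (n : ℝ)) ^ 4) ≤ 2304 * d / (1 + (n : ℝ)) ^ 4 := by
    rw [← mul_div_assoc]
    refine div_le_div_of_nonneg_right ?_ (by positivity)
    linarith
  linarith

lemma norm_term_zero_le {a a' : ℝ → ℂ} (Pr : Profile 12 (-1) a a' B) {j : ℤ}
    (hj : j = 1 ∨ j = 0) :
    ‖(fanNode I (fun j => α + β * j + σ j) σ j).phi 12 B -
        (fanData 12 B I (fun j => α + β * j + σ j) σ j - lam j * A * fanMain j)‖ ≤
      0.000161 * ‖A‖ + 2304 * d := by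
  have hd0 := R.d_nonneg
  have h := R.norm_fanData_sub_le (j := j) (n := 0) (by simpa using hj)
  refine (norm_sub_le _ _).trans ((add_le_add (R.norm_phi_zero_le Pr hj) h).trans ?_)
  norm_num
  linarith

lemma norm_main_le {j : ℤ} {n : ℕ} (hj : j = n + 1 ∨ j = -n) :
    ‖lam j * A * fanMain j‖ ≤ 2 * ‖A‖ / (1 + (n : ℝ) ^ 2) ^ 6 := by
  have h1 := norm_fanMain_le j
  have h2 : 1 / (1 + (j : ℝ) ^ 2) ^ 6 ≤ 1 / (1 + (n : ℝ) ^ 2) ^ 6 := by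
    have hn : (0 : ℝ) ≤ n := by positivity
    have h3 : (n : ℝ) ^ 2 ≤ (j : ℝ) ^ 2 := by
      rcases hj with rfl | rfl <;> push_cast <;> nlinarith
    gcongr 1 / (1 + ?_) ^ 6
  rw [norm_mul, norm_mul, Complex.norm_real]
  calc _ ≤ 2 * ‖A‖ * (1 / (1 + (n : ℝ) ^ 2) ^ 6) := by
        gcongr
        · exact R.le_two j
        · exact h1.trans h2
    _ = _ := by ring

/-- The contribution of the three dominant leading terms. -/
noncomputable def peak (A : ℂ) (lam : ℤ → ℝ) (n : ℕ) : ℂ :=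
  if n = 0 then lam 1 * A * fanMain 1 + lam 0 * A * fanMain 0
  else if n = 1 then lam (-1) * A * fanMain (-1) else 0

omit R in
lemma hasSum_peak : HasSum (peak A lam)
    (lam 1 * A * fanMain 1 + lam 0 * A * fanMain 0 + lam (-1) * A * fanMain (-1)) := by
  have h : HasSum (peak A lam) (∑ n ∈ Finset.range 2, peak A lam n) :=
      hasSum_sum_of_ne_finset_zero fun n hn => by
    have : ¬ n < 2 := fun h => hn (Finset.mem_range.2 h)
    rw [peak, if_neg (by omega), if_neg (by omega)]
  simpa [Finset.sum_range_succ, peak] using h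

/-- Bounds for the coefficients of the remaining leading terms. -/
noncomputable def restBound (n : ℕ) : ℝ :=
  if n = 0 then 0.000322 else if n = 1 then 0.000146 else 4.01 / (1 + (n : ℝ) ^ 2) ^ 6

omit R in
lemma sum_restBound_le (N : ℕ) : ∑ n ∈ Finset.range (3 + N), restBound n ≤ 0.000775 := by
  rw [Finset.sum_range_add]
  have h : ∀ n ∈ Finset.range N, restBound (3 + n) ≤ 0.00062 * (1 / (3 + (n : ℝ)) ^ 4) := by
    intro n _
    rw [restBound, if_neg (by omega), if_neg (by omega)]
    push_cast
    set t : ℝ := 3 + n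
    have ht : 3 ≤ t := by simp [t]
    have h1 : t ^ 12 ≤ (1 + t ^ 2) ^ 6 := by
      rw [show 12 = 2 * 6 from rfl, pow_mul]; gcongr; linarith
    have h2 : (3 : ℝ) ^ 8 ≤ t ^ 8 := by gcongr
    rw [mul_one_div, div_le_div_iff₀ (by positivity) (by positivity)]
    nlinarith [mul_le_mul_of_nonneg_right h2 (by positivity : 0 ≤ t ^ 4)]
  have h1 := Finset.sum_le_sum h
  rw [← Finset.mul_sum] at h1
  have h2 := sum_inv_pow_four_le (t := 3) (by norm_num) N
  have h3 : ∑ n ∈ Finset.range 3, restBound n ≤ 0.000726 := by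
    norm_num [Finset.sum_range_succ, restBound]
  norm_num at h1 h2 h3 ⊢
  linarith

lemma norm_le {a a' : ℝ → ℂ} (Pr : Profile 12 (-1) a a' B) : ‖A‖ ≤ 10 ^ 8 * d := by
  have hd0 := R.d_nonneg
  have hA0 := norm_nonneg A
  set X : ℤ → ℂ := fun j => (fanNode I (fun j => α + β * j + σ j) σ j).phi 12 B -
    fanData 12 B I (fun j => α + β * j + σ j) σ j with hX
  have hterm : ∀ n : ℕ, ‖X (n + 1) + X (-n) + peak A lam n‖ ≤
      ‖A‖ * restBound n + 4608 * d * (1 / (1 + (n : ℝ)) ^ 4) := by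
    intro n
    rcases Nat.lt_or_ge n 1 with hn | hn
    · obtain rfl : n = 0 := by omega
      have t1 := R.norm_term_zero_le Pr (Or.inl rfl)
      have t2 := R.norm_term_zero_le Pr (Or.inr rfl)
      have e : X ((0 : ℕ) + 1) + X (-(0 : ℕ)) + peak A lam 0 =
        ((fanNode I (fun j => α + β * j + σ j) σ 1).phi 12 B -
        (fanData 12 B I (fun j => α + β * j + σ j) σ 1 - lam 1 * A * fanMain 1)) +
        ((fanNode I (fun j => α + β * j + σ j) σ 0).phi 12 B -
        (fanData 12 B I (fun j => α + β * j + σ j) σ 0 - lam 0 * A * fanMain 0)) := by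
        rw [hX, peak, if_pos rfl]
        simp only [Nat.cast_zero, zero_add, neg_zero]
        ring
      rw [e, restBound, if_pos rfl]
      refine (norm_add_le _ _).trans ((add_le_add t1 t2).trans ?_)
      norm_num
      linarith
    have t1 := R.norm_term_le Pr (j := n + 1) (Or.inl rfl)
    have t2 := R.norm_term_le Pr (j := -n) (Or.inr rfl)
    have m1 := R.norm_main_le (j := n + 1) (Or.inl rfl)
    have e1 : 4608 * d * (1 / (1 + (n : ℝ)) ^ 4) =
      2304 * d / (1 + (n : ℝ)) ^ 4 + 2304 * d / (1 + (n : ℝ)) ^ 4 := by ring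
    rcases Nat.lt_or_ge n 2 with hn2 | hn2
    · obtain rfl : n = 1 := by omega
      have m1 : ‖lam 2 * A * fanMain 2‖ ≤ 2 / 15625 * ‖A‖ := by
        have h1 := norm_fanMain_le 2
        norm_num at h1
        rw [norm_mul, norm_mul, Complex.norm_real, Real.norm_eq_abs]
        have := mul_le_mul (mul_le_mul_of_nonneg_right (R.le_two 2) hA0) h1 (norm_nonneg _)
          (by positivity)
        linarith
      have e : X ((1 : ℕ) + 1) + X (-(1 : ℕ)) + peak A lam 1 =
        ((fanNode I (fun j => α + β * j + σ j) σ ((1 : ℕ) + 1)).phi 12 B -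
        (fanData 12 B I (fun j => α + β * j + σ j) σ ((1 : ℕ) + 1) -
          lam ((1 : ℕ) + 1) * A * fanMain ((1 : ℕ) + 1))) - lam 2 * A * fanMain 2 +
        ((fanNode I (fun j => α + β * j + σ j) σ (-(1 : ℕ))).phi 12 B -
        (fanData 12 B I (fun j => α + β * j + σ j) σ (-(1 : ℕ)) -
          lam (-(1 : ℕ)) * A * fanMain (-(1 : ℕ)))) := by
        rw [hX, peak, if_neg one_ne_zero, if_pos rfl, show ((1 : ℕ) : ℤ) + 1 = 2 from rfl]
        simp only [Nat.cast_one]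
        ring
      rw [e, restBound, if_neg one_ne_zero, if_pos rfl, e1]
      refine (norm_add_le _ _).trans ((add_le_add ((norm_sub_le _ _).trans
        (add_le_add t1 m1)) t2).trans ?_)
      norm_num
      linarith
    · have m2 := R.norm_main_le (j := -n) (Or.inr rfl)
      rw [peak, if_neg (by omega), if_neg (by omega), add_zero, restBound, if_neg (by omega),
        if_neg (by omega), e1]
      have e : X (n + 1) + X (-n) =
        ((fanNode I (fun j => α + β * j + σ j) σ (n + 1)).phi 12 B -
        (fanData 12 B I (fun j => α + β * j + σ j) σ (n + 1) -
          lam (n + 1) * A * fanMain (n + 1))) - lam (n + 1) * A * fanMain (n + 1) +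
        (((fanNode I (fun j => α + β * j + σ j) σ (-n)).phi 12 B -
        (fanData 12 B I (fun j => α + β * j + σ j) σ (-n) -
          lam (-n) * A * fanMain (-n))) - lam (-n) * A * fanMain (-n)) := by
        rw [hX]; ring
      rw [e]
      refine (norm_add_le _ _).trans ((add_le_add ((norm_sub_le _ _).trans
        (add_le_add t1 m1)) ((norm_sub_le _ _).trans (add_le_add t2 m2))).trans ?_)
      have : 0 ≤ ‖A‖ / (1 + (n : ℝ) ^ 2) ^ 6 := by positivity
      have e2 : ‖A‖ * (4.01 / (1 + (n : ℝ) ^ 2) ^ 6) = 4.01 * (‖A‖ / (1 + (n : ℝ) ^ 2) ^ 6) := by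
        ring
      have e3 : 2 * ‖A‖ / (1 + (n : ℝ) ^ 2) ^ 6 = 2 * (‖A‖ / (1 + (n : ℝ) ^ 2) ^ 6) := by ring
      rw [e2, e3]
      linarith
  set L := (α : ℂ) * shiftSum B I +
    β * (shiftSum' B I - I * shiftSum B I) with hL
  have hlim := (R.tendsto_sum Pr).add
    ((Filter.tendsto_add_atTop_iff_nat 1).2 (hasSum_peak (A := A) (lam := lam)).tendsto_sum_nat)
  have hlim2 := ((Filter.tendsto_add_atTop_iff_nat 2).2 hlim).norm
  have hle := le_of_tendsto' hlim2 (b := ‖A‖ * 0.000775 + 4608 * d * 2) fun N => by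
    rw [← Finset.sum_add_distrib, show N + 2 + 1 = 3 + N by ring]
    refine (norm_sum_le_of_le _ fun n _ => hterm n).trans ?_
    rw [Finset.sum_add_distrib, ← Finset.mul_sum, ← Finset.mul_sum]
    have h1 := sum_inv_pow_four_le (t := 1) le_rfl (3 + N)
    norm_num at h1
    refine add_le_add (mul_le_mul_of_nonneg_left (sum_restBound_le N) hA0)
      (mul_le_mul_of_nonneg_left ?_ (by positivity))
    simpa using h1
  have hLA : ‖L - A * ee I‖ ≤ 3 * d := by
    obtain ⟨d1, d2⟩ := R.hd I (by simp)
    have e : L - A * ee I = α * (shiftSum B I - A₀ * ee I) +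
        β * ((shiftSum' B I - A₁ * ee I) -
          I * (shiftSum B I - A₀ * ee I)) := by
      rw [hL, ← R.total]; ring
    rw [e]
    refine (norm_add_le _ _).trans ?_
    rw [norm_mul, norm_mul, Complex.norm_real, Complex.norm_real]
    have g1 := mul_le_mul R.hα d1 (norm_nonneg _) zero_le_one
    have g2 := mul_le_mul R.hβ ((norm_sub_le _ _).trans (add_le_add d2
      (show ‖I * (shiftSum B I - A₀ * ee I)‖ ≤ d by
        rw [norm_mul, Complex.norm_I, one_mul]; exact d1))) (norm_nonneg _) zero_le_one
    calc _ ≤ 1 * d + 1 * (d + d) := add_le_add g1 g2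
      _ = _ := by ring
  have hmain : A * ((2 * Real.exp (-π) ^ 2 + l * Real.exp (-π) / 32 : ℝ) : ℂ) =
      (L + (lam 1 * A * fanMain 1 + lam 0 * A * fanMain 0 + lam (-1) * A * fanMain (-1))) -
      (L - A * ee I) := by
    rw [ee_I, fanMain_one, fanMain_zero, fanMain_neg_one, R.zero, R.one, R.neg_one]
    push_cast
    ring
  have hn := congrArg norm hmain
  rw [norm_mul, Complex.norm_real] at hn
  have hc := main_coeff_ge R.hl
  have h1 := (norm_sub_le (L + (lam 1 * A * fanMain 1 + lam 0 * A * fanMain 0 +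
    lam (-1) * A * fanMain (-1))) (L - A * ee I)).trans (add_le_add hle hLA)
  rw [← hn] at h1
  have h2 := mul_le_mul_of_nonneg_left (hc.trans (le_abs_self _)) hA0
  rw [Real.norm_eq_abs] at h1
  norm_num at h1 h2 ⊢
  linarith

end FanRelation

namespace Profile

variable {a a' : ℝ → ℂ} {B : ℂ → ℂ}

lemma norm_tsum_sub_le {c : ℝ → ℂ} (hc : Summable fun n : ℕ => ‖c (n + 2 : ℕ)‖) (h0 : c 0 = 0)
    {w : ℂ} (hw : 0 < w.im) :
    ‖(∑' n : ℕ, c n * ee (n * w)) - c 1 * ee w‖ ≤ ∑' n : ℕ, ‖c (n + 2 : ℕ)‖ := by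
  have hle : ∀ n : ℕ, ‖c (n + 2 : ℕ) * ee ((n + 2 : ℕ) * w)‖ ≤ ‖c (n + 2 : ℕ)‖ := fun n => by
    rw [norm_mul]
    refine mul_le_of_le_one_right (norm_nonneg _) ?_
    have := norm_ee_mul_le_one hw.le (u := (n + 2 : ℕ)) (by positivity)
    rwa [mul_comm, Complex.ofReal_natCast] at this
  have hs : Summable fun n : ℕ => c (n + 2 : ℕ) * ee ((n + 2 : ℕ) * w) :=
    Summable.of_norm_bounded hc hle
  have hs' : Summable fun n : ℕ => c n * ee (n * w) := (summable_nat_add_iff 2).1 hs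
  rw [← hs'.sum_add_tsum_nat_add 2]
  simp only [Finset.sum_range_succ, Finset.range_zero, Finset.sum_empty, Nat.cast_zero, h0,
    zero_mul, zero_add, Nat.cast_one, one_mul, add_sub_cancel_left]
  exact tsum_of_norm_bounded hc.hasSum hle

variable {k : ℕ} {ε : ℂ} (Pr : Profile k ε a a' B)
include Pr

lemma dataSum_one_zero : dataSum 1 0 a a' = ‖a 1‖ + ‖a' 1‖ + dataSum 2 0 a a' := by
  have h := (Pr.summable_dataSum 1 0).tsum_eq_zero_add
  rw [dataSum, h, dataSum]
  simp [add_assoc, one_add_one_eq_two]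

lemma norm_shiftSum_sub_le (hk : 4 ≤ k) {w : ℂ} (hw : 0 < w.im) :
    ‖shiftSum B w - a 1 * ee w‖ ≤ dataSum 2 0 a a' ∧
      ‖shiftSum' B w - -(a' 1 / (2 * π * I)) * ee w‖ ≤ dataSum 2 0 a a' := by
  have hs := Pr.summable_dataSum 2 0
  have hs1 : Summable fun n : ℕ => ‖a (n + 2 : ℕ)‖ :=
    Summable.of_nonneg_of_le (fun _ => norm_nonneg _) (fun n => by simp) hs
  have hs2 : Summable fun n : ℕ => ‖a' (n + 2 : ℕ)‖ :=
    Summable.of_nonneg_of_le (fun _ => norm_nonneg _) (fun n => by simp) hs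
  have l1 : ∑' n : ℕ, ‖a (n + 2 : ℕ)‖ ≤ dataSum 2 0 a a' :=
    hs1.tsum_le_tsum (fun n => by simp) hs
  have l2 : ∑' n : ℕ, ‖a' (n + 2 : ℕ)‖ ≤ dataSum 2 0 a a' :=
    hs2.tsum_le_tsum (fun n => by simp) hs
  constructor
  · rw [Pr.shiftSum_eq hk hw]
    exact (norm_tsum_sub_le hs1 (Pr.zero 0 le_rfl) hw).trans l1
  · have h := (norm_tsum_sub_le hs2 (Pr.zero' 0 le_rfl) hw).trans l2
    rw [← Pr.shiftSum'_eq hk hw] at h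
    have hpi : (2 * π * I : ℂ) ≠ 0 := Complex.two_pi_I_ne_zero
    have e : -(2 * π * I) * shiftSum' B w - a' 1 * ee w =
        -(2 * π * I) * (shiftSum' B w - -(a' 1 / (2 * π * I)) * ee w) := by
      field_simp
      ring
    rw [e, norm_mul] at h
    have h1 : (1 : ℝ) ≤ ‖-(2 * π * I : ℂ)‖ := by
      simp [abs_of_pos pi_pos]; linarith [pi_gt_three]
    nlinarith [norm_nonneg (shiftSum' B w - -(a' 1 / (2 * π * I)) * ee w)]

end Profile

namespace Profile

variable {a a' : ℝ → ℂ} {B : ℂ → ℂ} (Pr : Profile 12 (-1) a a' B)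
include Pr

lemma norm_one_le : ‖a 1‖ ≤ 10 ^ 8 * dataSum 2 0 a a' := by
  have R : FanRelation B 1 0 (fun _ => 0) (fun e => e.s = 0 ∧ e.t = 0 ∧ e.f = 1) (a 1)
      (-(a' 1 / (2 * π * I))) (a 1) (dataSum 2 0 a a') 1 (fun _ => 1) :=
    { hα := by simp
      hβ := by simp
      hσ := by simp
      add := by simp
      hd := fun w hw => Pr.norm_shiftSum_sub_le (by norm_num) hw
      left := by
        rintro e ⟨h1, h2, h3⟩
        simp [FareyEdge.left, h1, h2, h3]
      right := by
        rintro e ⟨h1, h2, h3⟩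
        simp [FareyEdge.right, h1, h2, h3]
      bound := by
        rintro e ⟨h1, h2, h3⟩
        simp [h1, h2, h3]
        linarith [norm_nonneg (a 1)]
      node := by simp [fanNode]
      main := by simp
      hl := Or.inl rfl
      zero := rfl
      one := rfl
      neg_one := rfl
      le_two := by simp
      total := by simp }
  exact R.norm_le Pr

/-- The periodic slopes `1, -2`. -/
noncomputable def altSlope (j : ℤ) : ℝ := if Even j then 1 else -2

lemma norm_deriv_one_le : ‖a' 1‖ ≤ 2 * π * (10 ^ 8 * ((1 + 10 ^ 8) * dataSum 2 0 a a')) := by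
  have hd := dataSum_nonneg 2 0 a a'
  have h1 := Pr.norm_one_le
  have hpi : (2 * π * I : ℂ) ≠ 0 := Complex.two_pi_I_ne_zero
  have habs : ∀ j, |altSlope j| ≤ 2 := fun j => by
    unfold altSlope; split_ifs <;> norm_num
  have hadd : ∀ j, altSlope j + altSlope (j + 1) = -1 := fun j => by
    unfold altSlope
    rcases Int.even_or_odd j with h | h
    · rw [if_pos h, if_neg (by rw [Int.not_even_iff_odd]; exact h.add_one)]; norm_num
    · rw [if_neg (by rwa [Int.not_even_iff_odd]), if_pos h.add_one]; norm_num
  have R : FanRelation B 0 1 altSlope (fun e => |e.s| ≤ 2 ∧ |e.t| ≤ 2 ∧ |e.s + e.t| ≤ 2) 0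
      (-(a' 1 / (2 * π * I))) (-(a' 1 / (2 * π * I)))
      ((1 + 10 ^ 8) * dataSum 2 0 a a') (-2) altSlope :=
    { hα := by simp
      hβ := by simp
      hσ := habs
      add := hadd
      hd := fun w hw => by
        obtain ⟨d1, d2⟩ := Pr.norm_shiftSum_sub_le (by norm_num) hw
        have hw1 : ‖ee w‖ ≤ 1 := by
          simpa using norm_ee_mul_le_one hw.le (u := 1) zero_le_one
        constructor
        · have e : shiftSum B w - 0 * ee w = (shiftSum B w - a 1 * ee w) + a 1 * ee w := by ring
          rw [e]
          refine (norm_add_le _ _).trans ?_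
          rw [norm_mul]
          have := mul_le_mul h1 hw1 (norm_nonneg _) (by positivity)
          linarith
        · nlinarith
      left := by
        rintro e ⟨h1, h2, h3⟩
        refine ⟨h1, by simpa only [FareyEdge.left, abs_neg] using h3, ?_⟩
        have : e.s + -(e.s + e.t) = -e.t := by ring
        simpa only [FareyEdge.left, this, abs_neg] using h2
      right := by
        rintro e ⟨h1, h2, h3⟩
        refine ⟨by simpa only [FareyEdge.right, abs_neg] using h3, h2, ?_⟩
        have : -(e.s + e.t) + e.t = -e.s := by ring
        simpa only [FareyEdge.right, this, abs_neg] using h1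
      bound := by
        rintro e ⟨-, -, h3⟩
        rw [mul_zero, mul_zero, sub_zero, zero_sub, norm_neg, norm_mul, ← Complex.ofReal_add,
          Complex.norm_real]
        exact mul_le_mul_of_nonneg_right h3 (norm_nonneg _)
      node := fun j => ⟨habs _, habs _, by
        have := hadd (j - 1)
        rw [sub_add_cancel] at this
        simp only [fanNode]
        rw [add_comm, this]; norm_num⟩
      main := fun j => by simp
      hl := Or.inr rfl
      zero := by simp [altSlope]
      one := by simp [altSlope]
      neg_one := by simp [altSlope]
      le_two := habs
      total := by simp }
  have h := R.norm_le Pr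
  have hn : ‖(2 * π * I : ℂ)‖ = 2 * π := by simp [abs_of_pos pi_pos]
  rw [norm_neg, norm_div, hn, div_le_iff₀ (by positivity)] at h
  linarith

end Profile

lemma stable_twelve_neg_one : Stable 12 2 (-1) := by
  refine ⟨13, 0, 350 * 8 ^ 12 * (1 + 10 ^ 8 + 2 * π * (10 ^ 8 * (1 + 10 ^ 8))), by positivity,
    fun a a' B Pr z hz h1 => ?_⟩
  have h := Pr.norm_le_dataSum (by norm_num) (by decide) hz h1
  refine h.trans ?_
  rw [Pr.dataSum_one_zero, mul_assoc (350 * 8 ^ 12 : ℝ)]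
  have := Pr.norm_one_le
  have := Pr.norm_deriv_one_le
  gcongr
  linarith

/-- The Fourier coefficient at frequency `u` of `W` along the line of height `v`, damped by a
Gaussian. -/
noncomputable def dampedCoeff (W : ℂ → ℂ) (v l u : ℝ) : ℂ :=
  ∫ x : ℝ, W (v * I + x) * (Real.exp (-l * x ^ 2) * ee (-(x * u)))

lemma fourier_gaussian_shift {μ : ℝ} (hμ : 0 < μ) (u w : ℝ) :
    𝓕 (fun x : ℝ => ((Real.exp (-(π * μ ^ 2) * x ^ 2) : ℝ) : ℂ) * ee (x * u)) w =
      ((1 / μ * Real.exp (-π / μ ^ 2 * (w - u) ^ 2) : ℝ) : ℂ) := by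
  have h := congrFun (fourier_gaussian_pi'
    (b := ((μ ^ 2 : ℝ) : ℂ)) (by rw [Complex.ofReal_re]; positivity) (I * u)) w
  have h2 : (((μ ^ 2 : ℝ) : ℂ)) ^ (1 / 2 : ℂ) = (μ : ℂ) := by
    rw [show (1 / 2 : ℂ) = ((1 / 2 : ℝ) : ℂ) by norm_num, ← Complex.ofReal_cpow (by positivity),
      ← Real.sqrt_eq_rpow, Real.sqrt_sq hμ.le]
  rw [h2] at h
  convert! h using 1
  · refine congrArg (fun f : ℝ → ℂ => 𝓕 f w) (funext fun x => ?_)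
    unfold ee
    rw [Complex.ofReal_exp, ← Complex.exp_add]
    congr 1; push_cast; ring
  · push_cast
    congr 2
    have := Complex.I_sq
    linear_combination (π / (μ : ℂ) ^ 2 * (2 * w * u + (I ^ 2 - 1) * u ^ 2)) * this

lemma integrable_gaussian_ee {l : ℝ} (hl : 0 < l) (u : ℝ) :
    Integrable fun x : ℝ => ((Real.exp (-l * x ^ 2) : ℝ) : ℂ) * ee (x * u) := by
  refine (integrable_exp_neg_mul_sq hl).mono' (by have := continuous_ee; fun_prop)
    (Filter.Eventually.of_forall fun x => ?_)
  rw [norm_mul, norm_ee, Complex.norm_real, Real.norm_of_nonneg (Real.exp_pos _).le]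
  simp

lemma LaplacePair.dampedCoeff_eq {b : ℝ → ℂ} {W : ℂ → ℂ} (P : LaplacePair b W) {v μ : ℝ}
    (hv : 0 < v) (hμ : 0 < μ) (u : ℝ) :
    dampedCoeff W v (π * μ ^ 2) u = ∫ w : ℝ, b w * ee (v * I * w) *
      ((1 / μ * Real.exp (-π / μ ^ 2 * (w - u) ^ 2) : ℝ) : ℂ) := by
  have hz : 0 < ((v : ℂ) * I).im := by simpa using hv
  have h := VectorFourier.integral_fourierIntegral_smul_eq_flip (L := innerₗ ℝ) (μ := volume)
    (ν := volume) Real.continuous_fourierChar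
    continuous_inner (P.integrable hz.le) (integrable_gaussian_ee (l := π * μ ^ 2) (by positivity) u)
  have h2 : ∫ ξ : ℝ, 𝓕 (fun u : ℝ => b u * ee (v * I * u)) ξ •
      (((Real.exp (-(π * μ ^ 2) * ξ ^ 2) : ℝ) : ℂ) * ee (ξ * u)) = ∫ w : ℝ,
      (b w * ee (v * I * w)) •
        𝓕 (fun x : ℝ => ((Real.exp (-(π * μ ^ 2) * x ^ 2) : ℝ) : ℂ) * ee (x * u)) w := by
    simpa [flip_innerₗ] using! h
  simp_rw [fourier_gaussian_shift hμ, smul_eq_mul] at h2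
  rw [← h2, dampedCoeff, ← integral_neg_eq_self]
  congr 1; ext x
  rw [P.fourier_apply hz]
  push_cast
  ring_nf

/-- The polynomial moments of the normalized Gaussian of width `μ`. -/
lemma exists_gaussian_moment_le (N : ℕ) : ∃ c, 0 ≤ c ∧ ∀ μ : ℝ, 0 < μ →
    Integrable (fun s : ℝ => (1 + |s|) ^ N * (1 / μ * Real.exp (-π / μ ^ 2 * s ^ 2))) ∧
    ∫ s : ℝ, (1 + |s|) ^ N * (1 / μ * Real.exp (-π / μ ^ 2 * s ^ 2)) ≤ c * (1 + μ) ^ N := by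
  have hi : Integrable fun r : ℝ => (1 + |r|) ^ N * Real.exp (-π * r ^ 2) := by
    obtain ⟨C, hC⟩ : ∃ C, ∀ r : ℝ, (1 + |r|) ^ N * Real.exp (-1 * r ^ 2) ≤ C := by
      refine ⟨N.factorial * Real.exp 2, fun r => ?_⟩
      have h1 := Real.pow_div_factorial_le_exp (x := 1 + |r|) (by positivity) N
      rw [div_le_iff₀ (by positivity)] at h1
      calc _ ≤ Real.exp (1 + |r|) * N.factorial * Real.exp (-1 * r ^ 2) := by gcongr
        _ = N.factorial * Real.exp (1 + |r| + -1 * r ^ 2) := by rw [Real.exp_add (1 + |r|)]; ring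
        _ ≤ _ := by
          gcongr
          nlinarith [sq_nonneg (2 * |r| - 1), sq_abs r]
    have h3 := (integrable_exp_neg_mul_sq (b := π - 1) (by linarith [pi_gt_three])).const_mul C
    refine h3.mono' (by fun_prop) (Filter.Eventually.of_forall fun r => ?_)
    rw [Real.norm_of_nonneg (by positivity)]
    calc _ = (1 + |r|) ^ N * Real.exp (-1 * r ^ 2) * Real.exp (-(π - 1) * r ^ 2) := by
          rw [mul_assoc, ← Real.exp_add]; ring_nf
      _ ≤ _ := by gcongr; exact hC r
  refine ⟨∫ r : ℝ, (1 + |r|) ^ N * Real.exp (-π * r ^ 2),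
    integral_nonneg fun r => by positivity, fun μ hμ => ?_⟩
  have key : ∀ s : ℝ, (1 + |s|) ^ N * (1 / μ * Real.exp (-π / μ ^ 2 * s ^ 2)) ≤
      (1 + μ) ^ N * μ⁻¹ * (fun r : ℝ => (1 + |r|) ^ N * Real.exp (-π * r ^ 2)) (μ⁻¹ * s) := by
    intro s
    have : 1 + |s| ≤ (1 + μ) * (1 + |μ⁻¹ * s|) := by
      rw [abs_mul, abs_of_pos (inv_pos.2 hμ)]
      have : μ * (μ⁻¹ * |s|) = |s| := by field_simp
      have : 0 ≤ μ⁻¹ * |s| := by positivity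
      nlinarith
    calc _ ≤ ((1 + μ) * (1 + |μ⁻¹ * s|)) ^ N * (1 / μ * Real.exp (-π / μ ^ 2 * s ^ 2)) := by gcongr
      _ = _ := by
        rw [mul_pow, show -π / μ ^ 2 * s ^ 2 = -π * (μ⁻¹ * s) ^ 2 by field_simp]
        simp only [one_div]; ring
  have hi2 := (hi.comp_mul_left' (inv_ne_zero hμ.ne')).const_mul ((1 + μ) ^ N * μ⁻¹)
  have hi3 : Integrable (fun s : ℝ => (1 + |s|) ^ N * (1 / μ * Real.exp (-π / μ ^ 2 * s ^ 2))) := by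
    refine hi2.mono' (by fun_prop) (Filter.Eventually.of_forall fun s => ?_)
    rw [Real.norm_of_nonneg (by positivity)]
    exact key s
  refine ⟨hi3, (integral_mono hi3 hi2 key).trans_eq ?_⟩
  rw [integral_const_mul, Measure.integral_comp_mul_left (fun r : ℝ => (1 + |r|) ^ N * Real.exp (-π * r ^ 2))]
  rw [inv_inv, abs_of_pos hμ, smul_eq_mul]
  field_simp

lemma LaplacePair.norm_dampedCoeff_le {b : ℝ → ℂ} {W : ℂ → ℂ} (P : LaplacePair b W) (N : ℕ) :
    ∃ C, 0 ≤ C ∧ ∀ v l u : ℝ, 0 < v → 0 < l →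
      ‖dampedCoeff W v l u‖ * Real.exp (-l) * (1 + |u|) ^ N ≤ C := by
  obtain ⟨c, hc, hm⟩ := exists_gaussian_moment_le N
  obtain ⟨A, hA0, hA⟩ : ∃ A, 0 ≤ A ∧ ∀ w : ℝ, ‖b w‖ * (1 + |w|) ^ N ≤ A := by
    obtain ⟨A0, hA0⟩ := P.decay 0
    obtain ⟨A1, hA1⟩ := P.decay N
    have h0 : 0 ≤ A0 := le_trans (by positivity) (hA0 0 le_rfl)
    have h1 : 0 ≤ A1 := le_trans (by positivity) (hA1 0 le_rfl)
    refine ⟨2 ^ N * (A0 + A1), by positivity, fun w => ?_⟩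
    rcases le_or_gt w 0 with hw | hw
    · rw [P.zero w hw]; simp; positivity
    · have hb0 := hA0 w hw.le
      have hb1 := hA1 w hw.le
      rw [pow_zero, one_mul] at hb0
      rw [abs_of_pos hw]
      have : (1 + w) ^ N ≤ 2 ^ N * (1 + w ^ N) := by
        calc (1 + w) ^ N ≤ (2 * max 1 w) ^ N := by
              gcongr; linarith [le_max_left 1 w, le_max_right 1 w]
          _ = 2 ^ N * (max 1 w) ^ N := mul_pow _ _ _
          _ ≤ _ := by
            gcongr
            rcases max_cases 1 w with ⟨h, -⟩ | ⟨h, -⟩ <;> rw [h]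
            · simp; positivity
            · simp
      calc _ ≤ ‖b w‖ * (2 ^ N * (1 + w ^ N)) := by gcongr
        _ = 2 ^ N * (‖b w‖ + w ^ N * ‖b w‖) := by ring
        _ ≤ _ := by gcongr
  obtain ⟨E, hE0, hE⟩ : ∃ E, 0 ≤ E ∧ ∀ μ : ℝ, 0 < μ → (1 + μ) ^ N * Real.exp (-(π * μ ^ 2)) ≤ E := by
    refine ⟨N.factorial * Real.exp 2, by positivity, fun r hr => ?_⟩
    have h1 := Real.pow_div_factorial_le_exp (x := 1 + r) (by positivity) N
    rw [div_le_iff₀ (by positivity)] at h1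
    calc _ ≤ Real.exp (1 + r) * N.factorial * Real.exp (-(π * r ^ 2)) := by gcongr
      _ = N.factorial * Real.exp (1 + r + -(π * r ^ 2)) := by rw [Real.exp_add (1 + r)]; ring
      _ ≤ _ := by
        gcongr
        nlinarith [sq_nonneg (2 * r - 1), pi_gt_three, sq_nonneg r]
  refine ⟨A * c * E, by positivity, fun v l u hv hl => ?_⟩
  obtain ⟨μ, hμ, rfl⟩ : ∃ μ, 0 < μ ∧ l = π * μ ^ 2 := by
    refine ⟨√(l / π), by positivity, ?_⟩
    rw [Real.sq_sqrt (by positivity)]; field_simp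
  obtain ⟨hi, hle⟩ := hm μ hμ
  have h1 : ‖dampedCoeff W v (π * μ ^ 2) u‖ * (1 + |u|) ^ N ≤ A * (c * (1 + μ) ^ N) := by
    rw [P.dampedCoeff_eq hv hμ, ← Real.norm_of_nonneg (by positivity : 0 ≤ (1 + |u|) ^ N),
      ← Complex.norm_real, ← norm_mul, ← integral_mul_const]
    refine (norm_integral_le_of_norm_le ((hi.comp_sub_right u).const_mul A)
      (Filter.Eventually.of_forall fun w => ?_)).trans ?_
    · rw [norm_mul, norm_mul, norm_mul, Complex.norm_real, Complex.norm_real,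
        Real.norm_of_nonneg (by positivity), Real.norm_of_nonneg (by positivity)]
      have hw : ‖b w‖ * ‖ee (v * I * w)‖ ≤ ‖b w‖ := by
        rcases le_or_gt w 0 with hw | hw
        · simp [P.zero w hw]
        · exact mul_le_of_le_one_right (norm_nonneg _)
            (norm_ee_mul_le_one (by simpa using hv.le) hw.le)
      have ht : (1 + |u|) ^ N ≤ (1 + |w|) ^ N * (1 + |w - u|) ^ N := by
        rw [← mul_pow]; gcongr
        have := abs_sub_abs_le_abs_sub u w
        rw [abs_sub_comm] at this
        nlinarith [abs_nonneg w, abs_nonneg (w - u), mul_nonneg (abs_nonneg w) (abs_nonneg (w - u))]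
      calc _ ≤ ‖b w‖ * (1 / μ * Real.exp (-π / μ ^ 2 * (w - u) ^ 2)) *
            ((1 + |w|) ^ N * (1 + |w - u|) ^ N) := by gcongr
        _ = (‖b w‖ * (1 + |w|) ^ N) * ((1 + |w - u|) ^ N *
            (1 / μ * Real.exp (-π / μ ^ 2 * (w - u) ^ 2))) := by ring
        _ ≤ _ := by gcongr; exact hA w
    · rw [integral_const_mul, integral_sub_right_eq_self
        (fun s : ℝ => (1 + |s|) ^ N * (1 / μ * Real.exp (-π / μ ^ 2 * s ^ 2)))]
      gcongr
  calc _ = ‖dampedCoeff W v (π * μ ^ 2) u‖ * (1 + |u|) ^ N * Real.exp (-(π * μ ^ 2)) := by ring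
    _ ≤ A * (c * (1 + μ) ^ N) * Real.exp (-(π * μ ^ 2)) := by gcongr
    _ = A * c * ((1 + μ) ^ N * Real.exp (-(π * μ ^ 2))) := by ring
    _ ≤ _ := by gcongr; exact hE μ hμ

lemma LaplacePair.tendsto_dampedCoeff {b : ℝ → ℂ} {W : ℂ → ℂ} (P : LaplacePair b W) {v : ℝ}
    (hv : 0 < v) (u : ℝ) : Filter.Tendsto (fun l => dampedCoeff W v l u) (nhdsWithin 0 (Set.Ioi 0))
      (nhds (b u * Real.exp (-(2 * π * u * v)))) := by
  have hz : 0 < ((v : ℂ) * I).im := by simpa using hv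
  have h1 : b u * (Real.exp (-(2 * π * u * v)) : ℝ) =
      ∫ x : ℝ, W (v * I + x) * ((Real.exp (-0 * x ^ 2) : ℝ) * ee (-(x * u))) := by
    conv_lhs => rw [P.inversion hz u]
    rw [← integral_mul_const]
    congr 1; ext x
    rw [mul_assoc]; congr 1
    unfold ee
    rw [Complex.ofReal_exp, ← Complex.exp_add]
    simp only [neg_zero, zero_mul, Real.exp_zero, Complex.ofReal_one, one_mul]
    congr 1; push_cast
    linear_combination (-(2 * π * v * u : ℂ)) * Complex.I_sq
  rw [h1]
  unfold dampedCoeff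
  have hn : ∀ l x : ℝ, ‖W (v * I + x) * ((Real.exp (-l * x ^ 2) : ℝ) * ee (-(x * u)))‖ =
      ‖W (v * I + x)‖ * Real.exp (-l * x ^ 2) := by
    intro l x
    rw [norm_mul, norm_mul, norm_ee, Complex.norm_real, Real.norm_of_nonneg (Real.exp_pos _).le]
    simp
  refine tendsto_integral_filter_of_dominated_convergence
    (fun x => ‖W (v * I + x)‖) ?_ ?_ (P.integrable_horizontal hz).norm ?_
  · refine Filter.Eventually.of_forall fun l => ?_
    have := continuous_ee
    exact ((P.continuous_horizontal hz).mul (by fun_prop)).aestronglyMeasurable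
  · filter_upwards [self_mem_nhdsWithin] with l hl
    refine Filter.Eventually.of_forall fun x => ?_
    rw [hn]
    refine mul_le_of_le_one_right (norm_nonneg _) (Real.exp_le_one_iff.2 ?_)
    have : 0 < l := hl
    nlinarith [sq_nonneg x, mul_nonneg this.le (sq_nonneg x)]
  · refine Filter.Eventually.of_forall fun x => ?_
    refine Filter.Tendsto.mono_left ?_ nhdsWithin_le_nhds
    refine Continuous.tendsto ?_ 0
    fun_prop

/-- The inversion-invariant weight `(1 + |w|²) / Im w` at `w = x + iv`. -/
noncomputable def rho (v x : ℝ) : ℝ := (1 + v ^ 2 + x ^ 2) / v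

lemma one_le_rho {v : ℝ} (hv : 0 < v) (x : ℝ) : 1 ≤ rho v x := by
  rw [rho, le_div_iff₀ hv]; nlinarith [sq_nonneg (v - 1), sq_nonneg x]

lemma le_rho {v : ℝ} (hv : 0 < v) (x : ℝ) : v ≤ rho v x := by
  rw [rho, le_div_iff₀ hv]; nlinarith [sq_nonneg (v - 1), sq_nonneg x]

lemma inv_le_rho {v : ℝ} (hv : 0 < v) (x : ℝ) : v⁻¹ ≤ rho v x := by
  rw [rho, inv_eq_one_div]; gcongr; nlinarith [sq_nonneg v, sq_nonneg x]

lemma one_add_sq_le_rho_sq {v : ℝ} (hv : 0 < v) (x : ℝ) : 1 + v ^ 2 + x ^ 2 ≤ rho v x ^ 2 := by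
  have h : 1 + v ^ 2 + x ^ 2 = rho v x * v := by rw [rho]; field_simp
  rw [h, sq]
  have := le_rho hv x
  have := one_le_rho hv x
  gcongr

lemma rho_pow_mul_exp_le {t r : ℝ} (ht : 0 < t) (hr : 0 ≤ r) (M : ℕ) :
    r ^ M * Real.exp (-(t * r)) ≤ M.factorial / t ^ M := by
  have h1 := Real.pow_div_factorial_le_exp (x := t * r) (by positivity) M
  rw [div_le_iff₀ (by positivity), mul_pow] at h1
  rw [Real.exp_neg, ← div_eq_mul_inv, div_le_div_iff₀ (by positivity) (by positivity)]
  linarith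

/-- The regularized pairing of `W` with `H` on the upper half plane with weight `v ^ m`. -/
noncomputable def pairing (W : ℂ → ℂ) (m : ℕ) (t : ℝ) (H : ℂ → ℂ) : ℂ :=
  ∫ p : ℝ × ℝ, W (p.1 * I + p.2) * ((p.1 ^ m * Real.exp (-(t * rho p.1 p.2)) : ℝ) : ℂ) *
    H (p.1 * I - p.2) ∂((volume.restrict (Set.Ioi 0)).prod volume)

lemma LaplacePair.continuousOn {b : ℝ → ℂ} {W : ℂ → ℂ} (P : LaplacePair b W) :
    ContinuousOn W {z | 0 < z.im} := by
  have h : ContinuousOn (fun z : ℂ => ∫ u, b u * ee (z * (u : ℝ))) {z | 0 < z.im} := by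
    have hb := (P.integrable (z := 0) le_rfl).norm
    have := continuous_ee
    have := P.cont
    refine continuousOn_of_dominated (bound := fun u => ‖b u * ee (0 * u)‖) ?_ ?_ hb ?_
    · intro z hz
      exact Continuous.aestronglyMeasurable (by fun_prop)
    · intro z hz
      refine Filter.Eventually.of_forall fun u => ?_
      simp only [zero_mul, ee_zero, mul_one]
      rcases le_or_gt u 0 with hu | hu
      · simp [P.zero u hu]
      · rw [norm_mul]
        exact mul_le_of_le_one_right (norm_nonneg _) (norm_ee_mul_le_one (le_of_lt hz) hu.le)
    · refine Filter.Eventually.of_forall fun u => Continuous.continuousOn (by fun_prop)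
  exact h.congr fun z hz => P.eq z hz

lemma measurableSet_Ioi_prod : MeasurableSet (Set.Ioi (0 : ℝ) ×ˢ (Set.univ : Set ℝ)) :=
  measurableSet_Ioi.prod MeasurableSet.univ

lemma restrict_Ioi_prod : (volume.restrict (Set.Ioi (0 : ℝ))).prod (volume : Measure ℝ) =
    (volume : Measure (ℝ × ℝ)).restrict (Set.Ioi 0 ×ˢ Set.univ) := by
  rw [Measure.volume_eq_prod, ← Measure.prod_restrict, Measure.restrict_univ]

lemma ae_prod_of_pos {p : ℝ × ℝ → Prop} (h : ∀ v x : ℝ, 0 < v → p (v, x)) :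
    ∀ᵐ q ∂(volume.restrict (Set.Ioi (0 : ℝ))).prod (volume : Measure ℝ), p q := by
  rw [restrict_Ioi_prod, ae_restrict_iff' measurableSet_Ioi_prod]
  exact Filter.Eventually.of_forall fun q hq => h q.1 q.2 hq.1

lemma aestronglyMeasurable_prod {f : ℝ × ℝ → ℂ}
    (h : ContinuousOn f (Set.Ioi 0 ×ˢ Set.univ)) :
    AEStronglyMeasurable f ((volume.restrict (Set.Ioi (0 : ℝ))).prod (volume : Measure ℝ)) := by
  rw [restrict_Ioi_prod]
  exact h.aestronglyMeasurable measurableSet_Ioi_prod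

lemma integrable_inv_prod : Integrable (fun p : ℝ × ℝ => (1 + p.1 ^ 2)⁻¹ * (1 + p.2 ^ 2)⁻¹)
    ((volume.restrict (Set.Ioi (0 : ℝ))).prod (volume : Measure ℝ)) :=
  (integrable_inv_one_add_sq.restrict (s := Set.Ioi (0 : ℝ))).mul_prod integrable_inv_one_add_sq

lemma continuousOn_pairing_integrand {W : ℂ → ℂ} (hW : ContinuousOn W {z | 0 < z.im}) (m : ℕ)
    (t : ℝ) {H : ℂ → ℂ} (hH : ContinuousOn H {z | 0 < z.im}) :
    ContinuousOn (fun p : ℝ × ℝ => W (p.1 * I + p.2) *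
      ((p.1 ^ m * Real.exp (-(t * rho p.1 p.2)) : ℝ) : ℂ) * H (p.1 * I - p.2))
      (Set.Ioi 0 ×ˢ Set.univ) := by
  have h1 : ContinuousOn (fun p : ℝ × ℝ => W (p.1 * I + p.2)) (Set.Ioi 0 ×ˢ Set.univ) :=
    hW.comp (Continuous.continuousOn (by fun_prop)) fun p hp => by simpa using hp.1
  have h2 : ContinuousOn (fun p : ℝ × ℝ => H (p.1 * I - p.2)) (Set.Ioi 0 ×ˢ Set.univ) :=
    hH.comp (Continuous.continuousOn (by fun_prop)) fun p hp => by simpa using hp.1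
  have h3 : ContinuousOn (fun p : ℝ × ℝ => rho p.1 p.2) (Set.Ioi 0 ×ˢ Set.univ) := by
    unfold rho
    refine ContinuousOn.div (by fun_prop) (by fun_prop) fun p hp => ?_
    have : 0 < p.1 := hp.1
    exact this.ne'
  refine (h1.mul ?_).mul h2
  refine Complex.continuous_ofReal.comp_continuousOn ?_
  exact ContinuousOn.mul (by fun_prop) (Real.continuous_exp.comp_continuousOn
    (continuousOn_const.mul h3).neg)

/-- Pointwise bound behind the absolute convergence of the regularized pairing. -/
lemma weight_le {t : ℝ} (ht : 0 < t) (m M : ℕ) {v : ℝ} (hv : 0 < v) (x : ℝ) :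
    v ^ m * Real.exp (-(t * rho v x)) * rho v x ^ M ≤
      ((m + M + 4).factorial / t ^ (m + M + 4)) * ((1 + v ^ 2)⁻¹ * (1 + x ^ 2)⁻¹) := by
  have h1 := one_le_rho hv x
  have h2 := one_add_sq_le_rho_sq hv x
  have h3 := le_rho hv x
  have h5 := rho_pow_mul_exp_le (r := rho v x) ht (by linarith) (m + M + 4)
  rw [← mul_inv, ← div_eq_mul_inv, le_div_iff₀ (by positivity)]
  refine le_trans ?_ h5
  calc v ^ m * Real.exp (-(t * rho v x)) * rho v x ^ M * ((1 + v ^ 2) * (1 + x ^ 2))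
      ≤ rho v x ^ m * Real.exp (-(t * rho v x)) * rho v x ^ M * (rho v x ^ 2 * rho v x ^ 2) := by
        gcongr <;> nlinarith [sq_nonneg x, sq_nonneg v]
    _ = _ := by ring

lemma integrable_pairing {W : ℂ → ℂ} (hW : ContinuousOn W {z | 0 < z.im}) {A : ℝ}
    (hA : ∀ z : ℂ, 0 < z.im → ‖W z‖ ≤ A) (m : ℕ) {t : ℝ} (ht : 0 < t) {H : ℂ → ℂ}
    (hH : ContinuousOn H {z | 0 < z.im}) {D : ℝ} {M : ℕ}
    (hD : ∀ v x : ℝ, 0 < v → ‖H (v * I - x)‖ ≤ D * rho v x ^ M) :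
    Integrable (fun p : ℝ × ℝ => W (p.1 * I + p.2) *
      ((p.1 ^ m * Real.exp (-(t * rho p.1 p.2)) : ℝ) : ℂ) * H (p.1 * I - p.2))
      ((volume.restrict (Set.Ioi (0 : ℝ))).prod (volume : Measure ℝ)) := by
  refine (integrable_inv_prod.const_mul
    (A * D * ((m + M + 4).factorial / t ^ (m + M + 4)))).mono'
    (aestronglyMeasurable_prod (continuousOn_pairing_integrand hW m t hH)) (ae_prod_of_pos ?_)
  intro v x hv
  have hr := one_le_rho hv x
  have hA' := hA (v * I + x) (by simpa using hv)
  have hA0 : 0 ≤ A := (norm_nonneg _).trans hA'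
  have hD0 : 0 ≤ D := by
    have := (norm_nonneg _).trans (hD v x hv)
    exact nonneg_of_mul_nonneg_left this (by positivity)
  simp only
  rw [norm_mul, norm_mul, Complex.norm_real, Real.norm_of_nonneg (by positivity)]
  calc _ ≤ A * (v ^ m * Real.exp (-(t * rho v x))) * (D * rho v x ^ M) := by
        gcongr; exact hD v x hv
    _ = A * D * (v ^ m * Real.exp (-(t * rho v x)) * rho v x ^ M) := by ring
    _ ≤ A * D * (((m + M + 4).factorial / t ^ (m + M + 4)) * ((1 + v ^ 2)⁻¹ * (1 + x ^ 2)⁻¹)) := by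
        gcongr A * D * ?_; exact weight_le ht m M hv x
    _ = _ := by ring

lemma LaplacePair.exists_norm_le {b : ℝ → ℂ} {W : ℂ → ℂ} (P : LaplacePair b W) :
    ∃ A, 0 ≤ A ∧ ∀ z : ℂ, 0 < z.im → ‖W z‖ ≤ A := by
  obtain ⟨C, hC, h⟩ := P.exists_bound_horizontal
  refine ⟨C, hC, fun z hz => (h z hz).trans (mul_le_of_le_one_right hC ?_)⟩
  exact inv_le_one_of_one_le₀ (by nlinarith [sq_nonneg z.re])

lemma norm_ee_mul_nat_le {v x u : ℝ} (hv : 0 < v) (hu : 0 ≤ u) :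
    ‖ee ((v * I - x) * u)‖ ≤ 1 :=
  norm_ee_mul_le_one (by simpa using hv.le) hu

lemma pairing_ee {b : ℝ → ℂ} {W : ℂ → ℂ} (P : LaplacePair b W) (m : ℕ) {t : ℝ} (ht : 0 < t)
    {u : ℝ} (hu : 0 ≤ u) : pairing W m t (fun s => ee (s * u)) = ∫ v in Set.Ioi (0 : ℝ),
      ((v ^ m * Real.exp (-(t * (v + v⁻¹))) * Real.exp (-(2 * π * u * v)) : ℝ) : ℂ) *
        dampedCoeff W v (t / v) u := by
  obtain ⟨A, -, hA⟩ := P.exists_norm_le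
  have hi := integrable_pairing P.continuousOn hA m ht (H := fun s => ee (s * u))
    (by have := continuous_ee; fun_prop) (D := 1) (M := 0)
    (fun v x hv => by simpa using norm_ee_mul_nat_le hv hu)
  rw [pairing, integral_prod _ hi]
  refine setIntegral_congr_fun measurableSet_Ioi fun v hv => ?_
  have hv : 0 < v := hv
  simp only
  rw [dampedCoeff, ← integral_const_mul]
  congr 1; ext x
  have h1 : Real.exp (-(t * rho v x)) =
      Real.exp (-(t * (v + v⁻¹))) * Real.exp (-(t / v) * x ^ 2) := by
    rw [← Real.exp_add]; congr 1; rw [rho]; field_simp; ring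
  have h2 : ee ((v * I - x) * u) = (Real.exp (-(2 * π * u * v)) : ℝ) * ee (-(x * u)) := by
    unfold ee
    rw [Complex.ofReal_exp, ← Complex.exp_add]
    congr 1; push_cast
    linear_combination (2 * π * v * u : ℂ) * Complex.I_sq
  rw [h1, h2]
  push_cast
  ring

lemma integrableOn_pow_mul_exp (m : ℕ) {r : ℝ} (hr : 0 < r) :
    IntegrableOn (fun v : ℝ => v ^ m * Real.exp (-(r * v))) (Set.Ioi 0) := by
  have := integrableOn_rpow_mul_exp_neg_mul_rpow (p := 1) (s := m) (b := r)
    (by have : (0 : ℝ) ≤ m := by positivity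
        linarith) one_pos hr
  simpa using this

lemma integral_pow_mul_exp (m : ℕ) {r : ℝ} (hr : 0 < r) :
    ∫ v in Set.Ioi (0 : ℝ), v ^ m * Real.exp (-(r * v)) = m.factorial / r ^ (m + 1) := by
  have h := Real.integral_rpow_mul_exp_neg_mul_Ioi (a := (m + 1 : ℕ)) (r := r) (by positivity) hr
  rw [show ((m + 1 : ℕ) : ℝ) - 1 = m by push_cast; ring, Real.rpow_natCast] at h
  simp_rw [Real.rpow_natCast] at h
  rw [h, Nat.cast_add_one, Real.Gamma_nat_eq_factorial, one_div, inv_pow]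
  field_simp

lemma norm_pairing_integrand_le {b : ℝ → ℂ} {W : ℂ → ℂ} (P : LaplacePair b W) (N : ℕ) :
    ∃ C, 0 ≤ C ∧ ∀ (m : ℕ) (t u v : ℝ), 0 < t → 1 ≤ u → 0 < v →
      ‖((v ^ m * Real.exp (-(t * (v + v⁻¹))) * Real.exp (-(2 * π * u * v)) : ℝ) : ℂ) *
        dampedCoeff W v (t / v) u‖ ≤ C * (u ^ N)⁻¹ * (v ^ m * Real.exp (-(2 * π * v))) := by
  obtain ⟨C, hC0, hC⟩ := P.norm_dampedCoeff_le N
  refine ⟨C, hC0, fun m t u v ht hu hv => ?_⟩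
  have h := hC v (t / v) u hv (by positivity)
  rw [norm_mul, Complex.norm_real, Real.norm_of_nonneg (by positivity)]
  have h1 : Real.exp (-(t * (v + v⁻¹))) ≤ Real.exp (-(t / v)) := by
    gcongr; rw [div_eq_mul_inv]; nlinarith
  have h2 : Real.exp (-(2 * π * u * v)) ≤ Real.exp (-(2 * π * v)) := by
    refine Real.exp_le_exp.2 (neg_le_neg ?_)
    nlinarith [mul_nonneg (mul_pos pi_pos hv).le (sub_nonneg.2 hu)]
  have h3 : ‖dampedCoeff W v (t / v) u‖ * Real.exp (-(t / v)) ≤ C * (u ^ N)⁻¹ := by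
    rw [← div_eq_mul_inv, le_div_iff₀ (by positivity)]
    refine le_trans ?_ h
    gcongr
    rw [abs_of_nonneg (by linarith)]; linarith
  calc _ ≤ v ^ m * Real.exp (-(t / v)) * Real.exp (-(2 * π * v)) * ‖dampedCoeff W v (t / v) u‖ := by
        gcongr
    _ = (‖dampedCoeff W v (t / v) u‖ * Real.exp (-(t / v))) * (v ^ m * Real.exp (-(2 * π * v))) := by
        ring
    _ ≤ _ := by gcongr

lemma norm_pairing_ee_le {b : ℝ → ℂ} {W : ℂ → ℂ} (P : LaplacePair b W) (m N : ℕ) :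
    ∃ C, 0 ≤ C ∧ ∀ t u : ℝ, 0 < t → 1 ≤ u →
      ‖pairing W m t (fun s => ee (s * u))‖ ≤ C * (u ^ N)⁻¹ := by
  obtain ⟨C, hC0, hC⟩ := norm_pairing_integrand_le P N
  refine ⟨C * (m.factorial / (2 * π) ^ (m + 1)), by positivity, fun t u ht hu => ?_⟩
  rw [pairing_ee P m ht (by linarith)]
  refine (norm_integral_le_of_norm_le
    ((integrableOn_pow_mul_exp m (r := 2 * π) (by positivity)).const_mul (C * (u ^ N)⁻¹))
    ((ae_restrict_iff' measurableSet_Ioi).2 (Filter.Eventually.of_forall fun v hv =>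
      hC m t u v ht hu hv))).trans_eq ?_
  rw [integral_const_mul, integral_pow_mul_exp m (by positivity)]
  ring

lemma tendsto_pairing_ee {b : ℝ → ℂ} {W : ℂ → ℂ} (P : LaplacePair b W) (m : ℕ) {u : ℝ}
    (hu : 1 ≤ u) : Filter.Tendsto (fun t => pairing W m t (fun s => ee (s * u)))
      (nhdsWithin 0 (Set.Ioi 0)) (nhds (m.factorial / (4 * π * u) ^ (m + 1) * b u)) := by
  obtain ⟨C, hC0, hC⟩ := norm_pairing_integrand_le P 0
  have hu0 : 0 < u := by linarith
  have h1 : Filter.Tendsto (fun t : ℝ => ∫ v in Set.Ioi (0 : ℝ),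
      ((v ^ m * Real.exp (-(t * (v + v⁻¹))) * Real.exp (-(2 * π * u * v)) : ℝ) : ℂ) *
        dampedCoeff W v (t / v) u) (nhdsWithin 0 (Set.Ioi 0)) (nhds (∫ v in Set.Ioi (0 : ℝ),
      ((v ^ m * Real.exp (-(0 * (v + v⁻¹))) * Real.exp (-(2 * π * u * v)) : ℝ) : ℂ) *
        (b u * Real.exp (-(2 * π * u * v))))) := by
    refine tendsto_integral_filter_of_dominated_convergence
      (fun v => C * (u ^ 0)⁻¹ * (v ^ m * Real.exp (-(2 * π * v)))) ?_ ?_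
      ((integrableOn_pow_mul_exp m (r := 2 * π) (by positivity)).const_mul _) ?_
    · filter_upwards [self_mem_nhdsWithin] with t ht
      obtain ⟨A, -, hA⟩ := P.exists_norm_le
      have hi := (integrable_pairing P.continuousOn hA m ht (H := fun s => ee (s * u))
        (by have := continuous_ee; fun_prop) (D := 1) (M := 0)
        (fun v x hv => by simpa using norm_ee_mul_nat_le hv hu0.le)).integral_prod_left
      refine hi.aestronglyMeasurable.congr ?_
      rw [Filter.EventuallyEq, ae_restrict_iff' measurableSet_Ioi]
      refine Filter.Eventually.of_forall fun v hv => ?_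
      have hv : 0 < v := hv
      rw [dampedCoeff, ← integral_const_mul]
      congr 1; ext x
      have h1 : Real.exp (-(t * rho v x)) =
          Real.exp (-(t * (v + v⁻¹))) * Real.exp (-(t / v) * x ^ 2) := by
        rw [← Real.exp_add]; congr 1; rw [rho]; field_simp; ring
      have h2 : ee ((v * I - x) * u) =
          (Real.exp (-(2 * π * u * v)) : ℝ) * ee (-(x * u)) := by
        unfold ee
        rw [Complex.ofReal_exp, ← Complex.exp_add]
        congr 1; push_cast
        linear_combination (2 * π * v * u : ℂ) * Complex.I_sq
      simp only [h1, h2]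
      push_cast
      ring
    · filter_upwards [self_mem_nhdsWithin] with t ht
      rw [ae_restrict_iff' measurableSet_Ioi]
      exact Filter.Eventually.of_forall fun v hv => hC m t u v ht hu hv
    · rw [ae_restrict_iff' measurableSet_Ioi]
      refine Filter.Eventually.of_forall fun v hv => ?_
      have hv : 0 < v := hv
      refine Filter.Tendsto.mul ?_ ((P.tendsto_dampedCoeff hv u).comp ?_)
      · refine Filter.Tendsto.mono_left (Continuous.tendsto (by fun_prop) 0) nhdsWithin_le_nhds
      · refine tendsto_nhdsWithin_iff.2 ⟨?_, ?_⟩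
        · have : Filter.Tendsto (fun t : ℝ => t / v) (nhds 0) (nhds (0 / v)) :=
            Continuous.tendsto (by fun_prop) 0
          rw [zero_div] at this
          exact this.mono_left nhdsWithin_le_nhds
        · filter_upwards [self_mem_nhdsWithin] with t ht
          have : 0 < t := ht
          exact div_pos this hv
  have h2 : ∫ v in Set.Ioi (0 : ℝ),
      ((v ^ m * Real.exp (-(0 * (v + v⁻¹))) * Real.exp (-(2 * π * u * v)) : ℝ) : ℂ) *
        (b u * Real.exp (-(2 * π * u * v))) = m.factorial / (4 * π * u) ^ (m + 1) * b u := by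
    have h3 := integral_pow_mul_exp m (r := 4 * π * u) (by positivity)
    have h4 : ((m.factorial / (4 * π * u) ^ (m + 1) : ℝ) : ℂ) * b u =
        ∫ v in Set.Ioi (0 : ℝ), ((v ^ m * Real.exp (-(4 * π * u * v)) : ℝ) : ℂ) * b u := by
      rw [integral_mul_const, ← h3]; exact congrArg (· * b u) integral_ofReal.symm
    push_cast at h4
    rw [h4]
    congr 1; ext v
    have : Complex.exp (-(4 * π * u * v)) =
        Complex.exp (-(2 * π * u * v)) * Complex.exp (-(2 * π * u * v)) := by
      rw [← Complex.exp_add]; ring_nf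
    rw [this]
    push_cast
    simp
    ring
  rw [← h2]
  refine h1.congr' ?_
  filter_upwards [self_mem_nhdsWithin] with t ht
  rw [pairing_ee P m ht hu0.le]

lemma integral_upperHalfPlane (g : ℂ → ℂ) :
    ∫ z : UpperHalfPlane, g z = ∫ z in {z : ℂ | 0 < z.im}, ((1 / z.im) ^ 2 : ℝ) • g z := by
  have hm : Measurable fun z : UpperHalfPlane =>
      ((1 / NNReal.mk z.im z.im_pos.le : NNReal) ^ 2) := by
    have : Continuous fun z : UpperHalfPlane => NNReal.mk z.im z.im_pos.le :=
      UpperHalfPlane.continuous_im.subtype_mk _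
    have := this.measurable
    fun_prop
  have hr : Set.range UpperHalfPlane.coe = {z : ℂ | 0 < z.im} := by
    ext z; exact ⟨fun ⟨w, hw⟩ => hw ▸ w.im_pos, fun h => ⟨⟨z, h⟩, rfl⟩⟩
  rw [UpperHalfPlane.volume_def, integral_withDensity_eq_integral_smul hm, ← hr,
    ← UpperHalfPlane.measurableEmbedding_coe.map_comap,
    UpperHalfPlane.measurableEmbedding_coe.integral_map]
  refine integral_congr_ae (Filter.Eventually.of_forall fun z => ?_)
  simp only [NNReal.smul_def]
  simp

lemma integral_upperHalfPlane_inv (g : ℂ → ℂ) :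
    ∫ z in {z : ℂ | 0 < z.im}, ((1 / z.im) ^ 2 : ℝ) • g z =
      ∫ z in {z : ℂ | 0 < z.im}, ((1 / z.im) ^ 2 : ℝ) • g (-1 / z) := by
  rw [← integral_upperHalfPlane, ← integral_upperHalfPlane (fun z => g (-1 / z))]
  have := integral_smul_eq_self (μ := (volume : Measure UpperHalfPlane))
    (fun z : UpperHalfPlane => g z) (g := ((ModularGroup.S : Matrix.SpecialLinearGroup (Fin 2) ℤ) : GL (Fin 2) ℝ))
  rw [← this]
  refine integral_congr_ae (Filter.Eventually.of_forall fun z => ?_)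
  have h := UpperHalfPlane.modular_S_smul z
  have h2 : (((ModularGroup.S : Matrix.SpecialLinearGroup (Fin 2) ℤ) : GL (Fin 2) ℝ)) • z =
    ModularGroup.S • z := rfl
  simp only [h2, h]
  congr 1
  rw [neg_div, one_div, inv_neg]

lemma pairing_eq_integral (W : ℂ → ℂ) (m : ℕ) (t : ℝ) (H : ℂ → ℂ) :
    pairing W m t H = ∫ z in {z : ℂ | 0 < z.im},
      W z * ((z.im ^ m * Real.exp (-(t * rho z.im z.re)) : ℝ) : ℂ) *
        H (-(starRingEnd ℂ z)) := by
  rw [pairing, restrict_Ioi_prod, Measure.volume_eq_prod]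
  have hpre : Set.Ioi (0:ℝ) ×ˢ (Set.univ : Set ℝ) = Prod.swap ⁻¹' (Set.univ ×ˢ Set.Ioi 0) := by
    ext p; simp
  have hsw : MeasurePreserving (Prod.swap : ℝ × ℝ → ℝ × ℝ)
    (volume.prod volume) (volume.prod volume) := Measure.measurePreserving_swap
  rw [hpre]
  rw [show (fun p : ℝ × ℝ => W (p.1 * I + p.2) *
      ((p.1 ^ m * Real.exp (-(t * rho p.1 p.2)) : ℝ) : ℂ) * H (p.1 * I - p.2)) =
    fun p : ℝ × ℝ => (fun q : ℝ × ℝ => W (q.2 * I + q.1) *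
      ((q.2 ^ m * Real.exp (-(t * rho q.2 q.1)) : ℝ) : ℂ) * H (q.2 * I - q.1)) p.swap
    from rfl]
  rw [hsw.setIntegral_preimage_emb MeasurableEquiv.prodComm.measurableEmbedding
    (fun q : ℝ × ℝ => W (q.2 * I + q.1) *
      ((q.2 ^ m * Real.exp (-(t * rho q.2 q.1)) : ℝ) : ℂ) * H (q.2 * I - q.1))]
  rw [← Measure.volume_eq_prod,
    ← Complex.volume_preserving_equiv_real_prod.setIntegral_preimage_emb
    Complex.measurableEquivRealProd.measurableEmbedding]
  have hs : Complex.measurableEquivRealProd ⁻¹' (Set.univ ×ˢ Set.Ioi 0) = {z : ℂ | 0 < z.im} := by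
    ext z; simp
  rw [hs]
  refine setIntegral_congr_fun (measurableSet_lt measurable_const Complex.measurable_im) ?_
  intro z _
  simp only [Complex.measurableEquivRealProd_apply]
  have h1 : (z.im : ℂ) * I + z.re = z := by
    conv_rhs => rw [← Complex.re_add_im z]
    ring
  have h2 : (z.im : ℂ) * I - z.re = -(starRingEnd ℂ z) := by
    apply Complex.ext <;> simp
  rw [h1, h2]

lemma rho_neg_one_div {z : ℂ} (hz : 0 < z.im) : rho (-1 / z).im (-1 / z).re = rho z.im z.re := by
  have h0 : 0 < Complex.normSq z := Complex.normSq_pos.mpr (by rintro rfl; simp at hz)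
  have h1 : (-1 / z).im = z.im / Complex.normSq z := by
    rw [neg_div, one_div, Complex.neg_im, Complex.inv_im]; ring
  have h2 : (-1 / z).re = -(z.re / Complex.normSq z) := by
    rw [neg_div, one_div, Complex.neg_re, Complex.inv_re]
  have h3 : z.re ^ 2 + z.im ^ 2 = Complex.normSq z := by rw [Complex.normSq_apply]; ring
  rw [rho, rho, h1, h2]
  field_simp
  have : z.re ^ 2 = Complex.normSq z - z.im ^ 2 := by linarith
  rw [this]
  ring

/-- The pairing against a function of weight `k` with sign `1` is invariant under inversion. -/
lemma Profile.pairing_inv {k : ℕ} (hk : 2 ≤ k) (hke : Even k) {a a' : ℝ → ℂ} {B : ℂ → ℂ}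
    (P : Profile k 1 a a' B) (t : ℝ) (H : ℂ → ℂ) :
    pairing B (k - 2) t H = pairing B (k - 2) t (fun s => (s ^ k)⁻¹ * H (-1 / s)) := by
  rw [pairing_eq_integral, pairing_eq_integral]
  have hms : MeasurableSet {z : ℂ | 0 < z.im} :=
    measurableSet_lt measurable_const Complex.measurable_im
  have key : ∀ G : ℂ → ℂ, ∫ z in {z : ℂ | 0 < z.im},
      B z * ((z.im ^ (k - 2) * Real.exp (-(t * rho z.im z.re)) : ℝ) : ℂ) * G (-(starRingEnd ℂ z)) =
      ∫ z in {z : ℂ | 0 < z.im}, ((1 / z.im) ^ 2 : ℝ) •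
      ((fun z : ℂ => B z * ((z.im ^ k * Real.exp (-(t * rho z.im z.re)) : ℝ) : ℂ) *
        G (-(starRingEnd ℂ z))) z) := by
    intro G
    refine setIntegral_congr_fun hms fun z hz => ?_
    have hz' : (z.im : ℂ) ≠ 0 := by exact_mod_cast (ne_of_gt hz)
    obtain ⟨j, rfl⟩ := Nat.exists_eq_add_of_le hk
    simp only [Complex.real_smul, Nat.add_sub_cancel_left]
    push_cast
    field_simp
    try ring
  rw [key H, key (fun s => (s ^ k)⁻¹ * H (-1 / s)), integral_upperHalfPlane_inv]
  refine setIntegral_congr_fun hms fun z hz => ?_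
  simp only
  have hz0 : z ≠ 0 := by rintro rfl; simp at hz
  have hc0 : (starRingEnd ℂ z) ≠ 0 := by simpa using hz0
  congr 1
  rw [P.inv z hz, rho_neg_one_div hz]
  have h1 : (-1 / z).im = z.im / Complex.normSq z := by
    rw [neg_div, one_div, Complex.neg_im, Complex.inv_im]; ring
  have h2 : -(starRingEnd ℂ (-1 / z)) = -1 / -(starRingEnd ℂ z) := by
    simp [neg_div]
  rw [h2, h1, hke.neg_pow]
  have h3 : (Complex.normSq z : ℂ) = z * starRingEnd ℂ z := (Complex.mul_conj z).symm
  push_cast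
  rw [div_pow, h3]
  field_simp
  rw [mul_pow]
  ring

lemma pairing_mul_ee {k : ℕ} (hk : 4 ≤ k) {a a' : ℝ → ℂ} {B : ℂ → ℂ} {ε : ℂ}
    (P : Profile k ε a a' B) (m : ℕ) {t : ℝ} (ht : 0 < t) {u : ℝ} (hu : 0 ≤ u) :
    pairing B m t (fun s => s * ee (s * u)) =
      2 * I * pairing B (m + 1) t (fun s => ee (s * u)) +
      (2 * π * I)⁻¹ *
        pairing (fun z => -(2 * π * I) * (z * B z)) m t (fun s => ee (s * u)) := by
  have he : ContinuousOn (fun s : ℂ => ee (s * u)) {z | 0 < z.im} := by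
    have := continuous_ee; fun_prop
  have hD : ∀ v x : ℝ, 0 < v → ‖(fun s : ℂ => ee (s * u)) (v * I - x)‖ ≤
      1 * rho v x ^ 0 := fun v x hv => by simpa using norm_ee_mul_nat_le hv hu
  obtain ⟨A, -, hA⟩ := (P.laplacePair hk).exists_norm_le
  obtain ⟨A', -, hA'⟩ := (P.laplacePair' hk).exists_norm_le
  have h1 := integrable_pairing (P.laplacePair hk).continuousOn hA (m + 1) ht he hD
  have h2 := integrable_pairing (P.laplacePair' hk).continuousOn hA' m ht he hD
  unfold pairing
  rw [← integral_const_mul, ← integral_const_mul,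
    ← integral_add (h1.const_mul _) (h2.const_mul _)]
  refine integral_congr_ae (Filter.Eventually.of_forall fun p => ?_)
  have hpi : (π : ℂ) ≠ 0 := by exact_mod_cast Real.pi_ne_zero
  simp only
  push_cast
  field_simp
  ring

lemma ee_nat_decay (N M : ℕ) : ∃ C, 0 ≤ C ∧ ∀ (v x : ℝ) (n : ℕ), 0 < v →
    (n : ℝ) ^ N * (n : ℝ) ^ M * ‖ee ((v * I - x) * (n : ℝ))‖ ≤ C * rho v x ^ (N + M) := by
  refine ⟨(N + M).factorial / (2 * π) ^ (N + M), by positivity, fun v x n hv => ?_⟩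
  rw [norm_ee, ← pow_add]
  have h := rho_pow_mul_exp_le (t := 2 * π * v) (r := n) (by positivity) (by positivity) (N + M)
  have h2 : ((v * I - x) * (n : ℝ)).im = v * n := by simp
  rw [show ((v * I - x) * ((n : ℝ) : ℂ)).im = v * n from h2,
    show -(2 * π * (v * n)) = -(2 * π * v * n) by ring]
  refine h.trans ?_
  rw [mul_pow (2 * π) v, ← div_div, div_eq_mul_inv _ (v ^ (N + M)), ← inv_pow]
  gcongr
  exact inv_le_rho hv x

lemma norm_coeff_mul_ee_le (N : ℕ) : ∃ C, 0 ≤ C ∧ ∀ {n₀ : ℕ} {M : ℝ} {α β : ℕ → ℂ}, 1 ≤ n₀ →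
    0 ≤ M → (∀ n, ‖α n‖ ≤ M * ((n + n₀ : ℕ) : ℝ) ^ N) →
    (∀ n, ‖β n‖ ≤ M * ((n + n₀ : ℕ) : ℝ) ^ N) → ∀ (n : ℕ) (v x : ℝ), 0 < v →
      ‖(α n + β n * (v * I - x)) * ee ((v * I - x) * ((n + n₀ : ℕ) : ℝ))‖ ≤
      (3 * M * C * (((n + n₀ : ℕ) : ℝ) ^ 2)⁻¹) * rho v x ^ (N + 3) := by
  obtain ⟨C, hC0, hC⟩ := ee_nat_decay N 2
  refine ⟨C, hC0, ?_⟩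
  intro n₀ M α β h0 hM hα hβ n v x hv
  have hn : (0 : ℝ) < ((n + n₀ : ℕ) : ℝ) := by exact_mod_cast (by omega)
  have h1 := one_le_rho hv x
  have h2 := one_add_sq_le_rho_sq hv x
  have hs : ‖(v * I - x : ℂ)‖ ≤ rho v x := by
    rw [Complex.norm_eq_sqrt_sq_add_sq]
    refine Real.sqrt_le_iff.mpr ⟨by linarith, ?_⟩
    simp
    linarith
  have h3 : ‖α n + β n * (v * I - x)‖ ≤
      (2 * M * ((n + n₀ : ℕ) : ℝ) ^ N) * rho v x := by
    refine (norm_add_le _ _).trans ?_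
    rw [norm_mul]
    have e1 : ‖α n‖ ≤ M * ((n + n₀ : ℕ) : ℝ) ^ N * rho v x :=
      (hα n).trans (le_mul_of_one_le_right (by positivity) h1)
    have e2 : ‖β n‖ * ‖(v * I - x : ℂ)‖ ≤ M * ((n + n₀ : ℕ) : ℝ) ^ N * rho v x :=
      mul_le_mul (hβ n) hs (norm_nonneg _) (by positivity)
    linarith
  have h4 := hC v x (n + n₀) hv
  rw [norm_mul]
  have hn2 : (0 : ℝ) < ((n + n₀ : ℕ) : ℝ) ^ 2 := by positivity
  set X := ((n + n₀ : ℕ) : ℝ) ^ N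
  set Y := ((n + n₀ : ℕ) : ℝ) ^ 2
  set E := ‖ee ((v * I - x) * ((n + n₀ : ℕ) : ℝ))‖
  have h5 : X * E ≤ C * rho v x ^ (N + 2) * Y⁻¹ := by
    rw [← div_eq_mul_inv, le_div_iff₀ hn2]; linarith
  calc _ ≤ (2 * M * X) * rho v x * E := by gcongr
    _ = 2 * M * rho v x * (X * E) := by ring
    _ ≤ 2 * M * rho v x * (C * rho v x ^ (N + 2) * Y⁻¹) := by gcongr
    _ = 2 * (M * rho v x * (C * rho v x ^ (N + 2) * Y⁻¹)) := by ring
    _ ≤ 3 * (M * rho v x * (C * rho v x ^ (N + 2) * Y⁻¹)) := by gcongr; norm_num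
    _ = _ := by ring

lemma hasSum_pairing {k : ℕ} (hk : 4 ≤ k) {a a' : ℝ → ℂ} {B : ℂ → ℂ} {ε : ℂ}
    (P : Profile k ε a a' B) (n₀ m N : ℕ) {α β : ℕ → ℂ} {M : ℝ}
    (hα : ∀ n, ‖α n‖ ≤ M * ((n + n₀ : ℕ) : ℝ) ^ N) (hβ : ∀ n, ‖β n‖ ≤ M * ((n + n₀ : ℕ) : ℝ) ^ N)
    (h0 : 1 ≤ n₀)
    {F : ℂ → ℂ} (hF : ∀ s : ℂ, 0 < s.im →
      HasSum (fun n : ℕ => (α n + β n * s) * ee (s * ((n + n₀ : ℕ) : ℝ))) (F s))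
    {t : ℝ} (ht : 0 < t) :
    HasSum (fun n : ℕ => α n * pairing B m t (fun s => ee (s * ((n + n₀ : ℕ) : ℝ))) +
      β n * pairing B m t (fun s => s * ee (s * ((n + n₀ : ℕ) : ℝ)))) (pairing B m t F) := by
  obtain ⟨A, hA0, hA⟩ := (P.laplacePair hk).exists_norm_le
  obtain ⟨C, hC0, hC⟩ := norm_coeff_mul_ee_le N
  have hM : 0 ≤ M := by
    by_contra hM
    have := (norm_nonneg _).trans (hα 0)
    have h1 : (0 : ℝ) < ((0 + n₀ : ℕ) : ℝ) ^ N := by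
      have : (0 : ℝ) < ((0 + n₀ : ℕ) : ℝ) := by exact_mod_cast (by omega)
      positivity
    nlinarith
  have hee := continuous_ee
  have hbound := hC h0 hM hα hβ
  have hcont : ∀ n : ℕ, ContinuousOn
      (fun s : ℂ => (α n + β n * s) * ee (s * ((n + n₀ : ℕ) : ℝ))) {z | 0 < z.im} :=
    fun n => by fun_prop
  have hitg : ∀ n : ℕ, Integrable (fun p : ℝ × ℝ => B (p.1 * I + p.2) *
      ((p.1 ^ m * Real.exp (-(t * rho p.1 p.2)) : ℝ) : ℂ) *
        ((α n + β n * (p.1 * I - p.2)) *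
          ee ((p.1 * I - p.2) * ((n + n₀ : ℕ) : ℝ))))
      ((volume.restrict (Set.Ioi (0 : ℝ))).prod (volume : Measure ℝ)) := fun n =>
    integrable_pairing (P.laplacePair hk).continuousOn hA m ht (hcont n) (hbound n)
  have hsum2 : Summable fun n : ℕ => (((n + n₀ : ℕ) : ℝ) ^ 2)⁻¹ :=
    (summable_nat_add_iff (f := fun n : ℕ => ((n : ℝ) ^ 2)⁻¹) n₀).2
      (Real.summable_nat_pow_inv.2 (by norm_num))
  set K := A * ((m + (N + 3) + 4).factorial / t ^ (m + (N + 3) + 4)) with hK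
  have hnorm : ∀ n : ℕ, ∫ p : ℝ × ℝ, ‖B (p.1 * I + p.2) *
      ((p.1 ^ m * Real.exp (-(t * rho p.1 p.2)) : ℝ) : ℂ) *
        ((α n + β n * (p.1 * I - p.2)) *
          ee ((p.1 * I - p.2) * ((n + n₀ : ℕ) : ℝ)))‖
      ∂((volume.restrict (Set.Ioi (0 : ℝ))).prod (volume : Measure ℝ)) ≤
      (∫ p : ℝ × ℝ, K * ((1 + p.1 ^ 2)⁻¹ * (1 + p.2 ^ 2)⁻¹)
        ∂((volume.restrict (Set.Ioi (0 : ℝ))).prod (volume : Measure ℝ))) *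
      (3 * M * C * (((n + n₀ : ℕ) : ℝ) ^ 2)⁻¹) := by
    intro n
    rw [← integral_mul_const]
    refine integral_mono_ae (hitg n).norm ((integrable_inv_prod.const_mul K).mul_const _) ?_
    refine ae_prod_of_pos fun v x hv => ?_
    have h1 := hA (v * I + x) (by simpa using hv)
    have h2 := hbound n v x hv
    have h3 := weight_le ht m (N + 3) hv x
    have hn2 : (0 : ℝ) ≤ (((n + n₀ : ℕ) : ℝ) ^ 2)⁻¹ := by positivity
    have hr := one_le_rho hv x
    simp only
    rw [norm_mul, norm_mul, Complex.norm_real, Real.norm_of_nonneg (by positivity)]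
    calc _ ≤ A * (v ^ m * Real.exp (-(t * rho v x))) *
          ((3 * M * C * (((n + n₀ : ℕ) : ℝ) ^ 2)⁻¹) * rho v x ^ (N + 3)) := by gcongr
      _ = A * (v ^ m * Real.exp (-(t * rho v x)) * rho v x ^ (N + 3)) *
          (3 * M * C * (((n + n₀ : ℕ) : ℝ) ^ 2)⁻¹) := by ring
      _ ≤ A * (((m + (N + 3) + 4).factorial / t ^ (m + (N + 3) + 4)) *
          ((1 + v ^ 2)⁻¹ * (1 + x ^ 2)⁻¹)) * (3 * M * C * (((n + n₀ : ℕ) : ℝ) ^ 2)⁻¹) := by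
            gcongr
      _ = _ := by rw [hK]; ring
  have hs := hasSum_integral_of_summable_integral_norm hitg
    (Summable.of_nonneg_of_le (fun n => integral_nonneg fun p => norm_nonneg _) hnorm
      ((hsum2.mul_left (3 * M * C)).mul_left _))
  have e1 : ∀ n : ℕ, ∫ p : ℝ × ℝ, B (p.1 * I + p.2) *
      ((p.1 ^ m * Real.exp (-(t * rho p.1 p.2)) : ℝ) : ℂ) *
        ((α n + β n * (p.1 * I - p.2)) *
          ee ((p.1 * I - p.2) * ((n + n₀ : ℕ) : ℝ)))
      ∂((volume.restrict (Set.Ioi (0 : ℝ))).prod (volume : Measure ℝ)) =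
      α n * pairing B m t (fun s => ee (s * ((n + n₀ : ℕ) : ℝ))) +
      β n * pairing B m t (fun s => s * ee (s * ((n + n₀ : ℕ) : ℝ))) := by
    intro n
    unfold pairing
    rw [← integral_const_mul, ← integral_const_mul, ← integral_add]
    · refine integral_congr_ae (Filter.Eventually.of_forall fun p => ?_)
      simp only
      ring
    · refine (integrable_pairing (P.laplacePair hk).continuousOn hA m ht
        (H := fun s => ee (s * ((n + n₀ : ℕ) : ℝ))) (D := 1) (M := 0)
        (by fun_prop) fun v x hv => ?_).const_mul _
      simpa using norm_ee_mul_nat_le hv (u := ((n + n₀ : ℕ) : ℝ)) (by positivity)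
    · refine (integrable_pairing (P.laplacePair hk).continuousOn hA m ht
        (H := fun s => s * ee (s * ((n + n₀ : ℕ) : ℝ))) (D := 1) (M := 1)
        (by fun_prop) fun v x hv => ?_).const_mul _
      rw [norm_mul, pow_one, one_mul]
      have h2 := one_add_sq_le_rho_sq hv x
      have h1 := one_le_rho hv x
      have hs : ‖(v * I - x : ℂ)‖ ≤ rho v x := by
        rw [Complex.norm_eq_sqrt_sq_add_sq]
        refine Real.sqrt_le_iff.mpr ⟨by linarith, ?_⟩
        simp
        linarith
      have h3 := norm_ee_mul_nat_le hv (x := x) (u := ((n + n₀ : ℕ) : ℝ)) (by positivity)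
      calc _ ≤ rho v x * 1 := by gcongr
        _ = _ := mul_one _
  have e2 : ∫ p : ℝ × ℝ, ∑' n : ℕ, B (p.1 * I + p.2) *
      ((p.1 ^ m * Real.exp (-(t * rho p.1 p.2)) : ℝ) : ℂ) *
        ((α n + β n * (p.1 * I - p.2)) *
          ee ((p.1 * I - p.2) * ((n + n₀ : ℕ) : ℝ)))
      ∂((volume.restrict (Set.Ioi (0 : ℝ))).prod (volume : Measure ℝ)) = pairing B m t F := by
    unfold pairing
    refine integral_congr_ae (ae_prod_of_pos fun v x hv => ?_)
    exact ((hF (v * I - x) (by simpa using hv)).mul_left _).tsum_eq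
  rw [e2] at hs
  simpa only [e1] using hs

lemma tendsto_pairing_series {k : ℕ} (hk : 4 ≤ k) {a a' : ℝ → ℂ} {B : ℂ → ℂ} {ε : ℂ}
    (P : Profile k ε a a' B) (n₀ m N : ℕ) {α β : ℕ → ℂ} {M : ℝ}
    (hα : ∀ n, ‖α n‖ ≤ M * ((n + n₀ : ℕ) : ℝ) ^ N) (hβ : ∀ n, ‖β n‖ ≤ M * ((n + n₀ : ℕ) : ℝ) ^ N)
    (h0 : 1 ≤ n₀)
    {F : ℂ → ℂ} (hF : ∀ s : ℂ, 0 < s.im →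
      HasSum (fun n : ℕ => (α n + β n * s) * ee (s * ((n + n₀ : ℕ) : ℝ))) (F s)) :
    Filter.Tendsto (fun t => pairing B m t F) (nhdsWithin 0 (Set.Ioi 0))
      (nhds (∑' n : ℕ, (α n * (m.factorial / (4 * π * ((n + n₀ : ℕ) : ℝ)) ^ (m + 1) *
          a (n + n₀ : ℕ)) +
        β n * (2 * I * ((m + 1).factorial / (4 * π * ((n + n₀ : ℕ) : ℝ)) ^ (m + 1 + 1) *
          a (n + n₀ : ℕ)) + (2 * π * I)⁻¹ *
          (m.factorial / (4 * π * ((n + n₀ : ℕ) : ℝ)) ^ (m + 1) * a' (n + n₀ : ℕ)))))) := by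
  obtain ⟨C1, hC1, h1⟩ := norm_pairing_ee_le (P.laplacePair hk) m (N + 2)
  obtain ⟨C2, hC2, h2⟩ := norm_pairing_ee_le (P.laplacePair hk) (m + 1) (N + 2)
  obtain ⟨C3, hC3, h3⟩ := norm_pairing_ee_le (P.laplacePair' hk) m (N + 2)
  have hu : ∀ n : ℕ, (1 : ℝ) ≤ ((n + n₀ : ℕ) : ℝ) := fun n => by exact_mod_cast (by omega)
  have hM : 0 ≤ M := by
    by_contra hM
    have := (norm_nonneg _).trans (hα 0)
    have h1 : (0 : ℝ) < ((0 + n₀ : ℕ) : ℝ) ^ N := by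
      have : (0 : ℝ) < ((0 + n₀ : ℕ) : ℝ) := by exact_mod_cast (by omega)
      positivity
    nlinarith
  have hsum2 : Summable fun n : ℕ => (((n + n₀ : ℕ) : ℝ) ^ 2)⁻¹ :=
    (summable_nat_add_iff (f := fun n : ℕ => ((n : ℝ) ^ 2)⁻¹) n₀).2
      (Real.summable_nat_pow_inv.2 (by norm_num))
  have heq : (fun t => ∑' n : ℕ, (α n * pairing B m t (fun s => ee (s * ((n + n₀ : ℕ) : ℝ))) +
      β n * (2 * I * pairing B (m + 1) t (fun s => ee (s * ((n + n₀ : ℕ) : ℝ))) +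
      (2 * π * I)⁻¹ * pairing (fun z => -(2 * π * I) * (z * B z)) m t
        (fun s => ee (s * ((n + n₀ : ℕ) : ℝ)))))) =ᶠ[nhdsWithin 0 (Set.Ioi 0)]
      fun t => pairing B m t F := by
    filter_upwards [self_mem_nhdsWithin] with t ht
    rw [← (hasSum_pairing hk P n₀ m N hα hβ h0 hF ht).tsum_eq]
    congr 1; ext n
    rw [pairing_mul_ee hk P m ht (by linarith [hu n])]
  refine Filter.Tendsto.congr' heq ?_
  refine tendsto_tsum_of_dominated_convergence
    (bound := fun n => M * (C1 + 2 * C2 + C3) * (((n + n₀ : ℕ) : ℝ) ^ 2)⁻¹)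
    (hsum2.mul_left _) (fun n => ?_) ?_
  · have t1 := tendsto_pairing_ee (P.laplacePair hk) m (hu n)
    have t2 := tendsto_pairing_ee (P.laplacePair hk) (m + 1) (hu n)
    have t3 := tendsto_pairing_ee (P.laplacePair' hk) m (hu n)
    simpa only [Complex.ofReal_natCast] using (t1.const_mul (α n)).add
      (((t2.const_mul (2 * I)).add (t3.const_mul ((2 * π * I)⁻¹))).const_mul (β n))
  · filter_upwards [self_mem_nhdsWithin] with t ht n
    have e1 := h1 t _ ht (hu n)
    have e2 := h2 t _ ht (hu n)
    have e3 := h3 t _ ht (hu n)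
    have hu0 : (0 : ℝ) < ((n + n₀ : ℕ) : ℝ) := by linarith [hu n]
    have hpi : ‖(2 * π * I : ℂ)⁻¹‖ ≤ 1 := by
      rw [norm_inv]
      refine inv_le_one_of_one_le₀ ?_
      simp [abs_of_pos Real.pi_pos]
      linarith [Real.pi_gt_three]
    set X := ((n + n₀ : ℕ) : ℝ)
    have hX : X ^ N * (X ^ (N + 2))⁻¹ = (X ^ 2)⁻¹ := by rw [pow_add]; field_simp
    refine (norm_add_le _ _).trans ?_
    rw [norm_mul, norm_mul]
    have e4 : ‖2 * I * pairing B (m + 1) t (fun s => ee (s * X)) +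
      (2 * π * I)⁻¹ * pairing (fun z => -(2 * π * I) * (z * B z)) m t
        (fun s => ee (s * X))‖ ≤ 2 * (C2 * (X ^ (N + 2))⁻¹) + 1 * (C3 * (X ^ (N + 2))⁻¹) := by
      refine (norm_add_le _ _).trans ?_
      rw [norm_mul, norm_mul, norm_mul]
      simp only [Complex.norm_I, mul_one, Complex.norm_ofNat]
      gcongr
    calc _ ≤ M * X ^ N * (C1 * (X ^ (N + 2))⁻¹) +
          M * X ^ N * (2 * (C2 * (X ^ (N + 2))⁻¹) + 1 * (C3 * (X ^ (N + 2))⁻¹)) := by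
          gcongr
          · exact hα n
          · exact hβ n
      _ = M * (C1 + 2 * C2 + C3) * (X ^ N * (X ^ (N + 2))⁻¹) := by ring
      _ = _ := by rw [hX]

lemma norm_tsum_series_le (m N n₀ : ℕ) (h0 : 1 ≤ n₀) : ∃ C, 0 ≤ C ∧ ∀ {k : ℕ} {ε : ℂ}
    {a a' : ℝ → ℂ} {B : ℂ → ℂ} (_ : Profile k ε a a' B) {α β : ℕ → ℂ} {M : ℝ} (_ : 0 ≤ M)
    (_ : ∀ n, ‖α n‖ ≤ M * ((n + n₀ : ℕ) : ℝ) ^ N) (_ : ∀ n, ‖β n‖ ≤ M * ((n + n₀ : ℕ) : ℝ) ^ N),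
    ‖∑' n : ℕ, (α n * (m.factorial / (4 * π * ((n + n₀ : ℕ) : ℝ)) ^ (m + 1) *
          a (n + n₀ : ℕ)) +
        β n * (2 * I * ((m + 1).factorial / (4 * π * ((n + n₀ : ℕ) : ℝ)) ^ (m + 1 + 1) *
          a (n + n₀ : ℕ)) + (2 * π * I)⁻¹ *
          (m.factorial / (4 * π * ((n + n₀ : ℕ) : ℝ)) ^ (m + 1) * a' (n + n₀ : ℕ))))‖ ≤
      C * M * dataSum n₀ N a a' := by
  have hf1 : (1 : ℝ) ≤ m.factorial := by exact_mod_cast m.factorial_pos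
  have hf2 : (1 : ℝ) ≤ (m + 1).factorial := by exact_mod_cast (m + 1).factorial_pos
  refine ⟨2 * m.factorial + 2 * (m + 1).factorial, by positivity, ?_⟩
  intro k ε a a' B P α β M hM hα hβ
  have hs := P.summable_dataSum n₀ N
  rw [dataSum, ← tsum_mul_left]
  refine tsum_of_norm_bounded (hs.mul_left _).hasSum fun n => ?_
  have hu : (1 : ℝ) ≤ ((n + n₀ : ℕ) : ℝ) := by exact_mod_cast (by omega)
  have hpi : ‖(2 * π * I : ℂ)⁻¹‖ ≤ 1 := by
    rw [norm_inv]
    refine inv_le_one_of_one_le₀ ?_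
    simp [abs_of_pos Real.pi_pos]
    linarith [Real.pi_gt_three]
  have hq : ∀ j f : ℕ, ‖((f : ℂ) / (4 * π * ((n + n₀ : ℕ) : ℝ)) ^ j : ℂ)‖ ≤ f := by
    intro j f
    rw [norm_div, norm_pow, norm_mul, norm_mul]
    simp only [Complex.norm_natCast, Complex.norm_real, Complex.norm_ofNat]
    refine div_le_self (by positivity) (one_le_pow₀ ?_)
    rw [Real.norm_of_nonneg pi_pos.le, Real.norm_of_nonneg (by linarith)]
    nlinarith [Real.pi_gt_three]
  set X := ((n + n₀ : ℕ) : ℝ)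
  have q1 := hq (m + 1) m.factorial
  have q2 := hq (m + 1 + 1) (m + 1).factorial
  set x := ‖a X‖
  set x' := ‖a' X‖
  have hx : 0 ≤ x := norm_nonneg _
  have hx' : 0 ≤ x' := norm_nonneg _
  have e0 : ‖(m.factorial / (4 * π * (X : ℂ)) ^ (m + 1) * a X : ℂ)‖ ≤ m.factorial * x := by
    rw [norm_mul]; gcongr
  have e1 : ‖(m.factorial / (4 * π * (X : ℂ)) ^ (m + 1) * a' X : ℂ)‖ ≤ m.factorial * x' := by
    rw [norm_mul]; gcongr
  have e2 : ‖((m + 1).factorial / (4 * π * (X : ℂ)) ^ (m + 1 + 1) * a X : ℂ)‖ ≤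
      (m + 1).factorial * x := by
    rw [norm_mul]; gcongr
  refine (norm_add_le _ _).trans ?_
  rw [norm_mul (α n), norm_mul (β n)]
  have e4 : ‖2 * I * ((m + 1).factorial / (4 * π * (X : ℂ)) ^ (m + 1 + 1) * a X) +
      (2 * π * I)⁻¹ * (m.factorial / (4 * π * (X : ℂ)) ^ (m + 1) * a' X)‖ ≤
      2 * ((m + 1).factorial * x) + 1 * (m.factorial * x') := by
    refine (norm_add_le _ _).trans ?_
    rw [norm_mul, norm_mul _ (_ * a' X), norm_mul 2]
    simp only [Complex.norm_I, mul_one, Complex.norm_ofNat]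
    gcongr
  calc _ ≤ M * X ^ N * (m.factorial * x) +
        M * X ^ N * (2 * ((m + 1).factorial * x) + 1 * (m.factorial * x')) :=
        add_le_add (mul_le_mul (hα n) e0 (norm_nonneg _) (by positivity))
          (mul_le_mul (hβ n) e4 (norm_nonneg _) (by positivity))
    _ = M * X ^ N * (m.factorial * (x + x') + 2 * (m + 1).factorial * x) := by ring
    _ ≤ M * X ^ N * (2 * m.factorial * (x + x') + 2 * (m + 1).factorial * (x + x')) := by
        gcongr
        · linarith
        · linarith
    _ = _ := by ring

lemma norm_pow_mul_ee (j : ℕ) (z : ℂ) {u : ℝ} (hu : 0 ≤ u) :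
    ‖(u : ℂ) ^ j * ee (z * u)‖ = u ^ j * Real.exp (-(2 * π * z.im * u)) := by
  rw [norm_mul, norm_pow, Complex.norm_real, Real.norm_of_nonneg hu, norm_ee]
  simp [mul_assoc]

lemma integrableOn_pow_mul_ee (j : ℕ) {z : ℂ} (hz : 0 < z.im) :
    IntegrableOn (fun u : ℝ => (u : ℂ) ^ j * ee (z * u)) (Set.Ioi 0) := by
  refine (integrableOn_pow_mul_exp j (r := 2 * π * z.im) (by positivity)).mono'
    (by have := continuous_ee; exact Continuous.aestronglyMeasurable (by fun_prop)) ?_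
  filter_upwards [ae_restrict_mem measurableSet_Ioi] with u hu
  exact (norm_pow_mul_ee j z (le_of_lt hu)).le

lemma tendsto_pow_mul_ee (j : ℕ) {z : ℂ} (hz : 0 < z.im) :
    Filter.Tendsto (fun u : ℝ => (u : ℂ) ^ j * ee (z * u)) Filter.atTop (nhds 0) := by
  rw [tendsto_zero_iff_norm_tendsto_zero]
  have h := tendsto_rpow_mul_exp_neg_mul_atTop_nhds_zero j (2 * π * z.im) (by positivity)
  refine h.congr' ?_
  filter_upwards [Filter.eventually_ge_atTop 0] with u hu
  rw [norm_pow_mul_ee j z hu, Real.rpow_natCast, neg_mul]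

lemma integral_pow_mul_ee (j : ℕ) {z : ℂ} (hz : 0 < z.im) :
    ∫ u in Set.Ioi (0 : ℝ), (u : ℂ) ^ j * ee (z * u) =
      j.factorial * ((-(2 * π * I)) ^ (j + 1))⁻¹ * (z ^ (j + 1))⁻¹ := by
  have hpi : (π : ℂ) ≠ 0 := by exact_mod_cast Real.pi_ne_zero
  have hz0 : z ≠ 0 := by rintro rfl; simp at hz
  have hd : ∀ u : ℝ, HasDerivAt (fun u : ℝ => ee (z * u)) (2 * π * I * z * ee (z * u)) u := by
    intro u
    have h1 : HasDerivAt (fun u : ℝ => z * (u : ℂ)) z u := by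
      simpa using (Complex.ofRealCLM.hasDerivAt (x := u)).const_mul z
    have h2 := (hasDerivAt_ee (z * u)).comp u h1
    refine h2.congr_deriv ?_
    ring
  induction j with
  | zero =>
    have h := integral_Ioi_of_hasDerivAt_of_tendsto' (a := 0) (fun u _ => hd u)
      (by have := (integrableOn_pow_mul_ee 0 hz).const_mul (2 * π * I * z)
          simp only [pow_zero, one_mul] at this
          exact this)
      (by simpa using tendsto_pow_mul_ee 0 hz)
    rw [integral_const_mul] at h
    simp only [pow_zero, one_mul, Complex.ofReal_zero, mul_zero, ee_zero] at h ⊢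
    field_simp
    simp
    linear_combination -h
  | succ j ih =>
    have hp : ∀ u : ℝ, HasDerivAt (fun u : ℝ => (u : ℂ) ^ (j + 1)) (((j + 1 : ℕ) : ℂ) * (u : ℂ) ^ j) u := by
      intro u
      have h := (Complex.ofRealCLM.hasDerivAt (x := u)).fun_pow (j + 1)
      simp only [Complex.ofRealCLM_apply, Complex.ofReal_one, mul_one, Nat.add_sub_cancel] at h
      exact h
    have hitg1 := (integrableOn_pow_mul_ee j hz).const_mul ((j + 1 : ℕ) : ℂ)
    have hitg2 := (integrableOn_pow_mul_ee (j + 1) hz).const_mul (2 * π * I * z)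
    have h := integral_Ioi_of_hasDerivAt_of_tendsto' (a := 0)
      (fun u _ => (hp u).fun_mul (hd u))
      ((hitg1.add hitg2).congr (Filter.Eventually.of_forall fun u => by
        simp only [Pi.add_apply]; ring))
      (by simpa using tendsto_pow_mul_ee (j + 1) hz)
    have h3 : ∫ u in Set.Ioi (0 : ℝ), (((j + 1 : ℕ) : ℂ) * (u : ℂ) ^ j * ee (z * u) +
        (u : ℂ) ^ (j + 1) * (2 * π * I * z * ee (z * u))) =
        ((j + 1 : ℕ) : ℂ) * (∫ u in Set.Ioi (0 : ℝ), (u : ℂ) ^ j * ee (z * u)) +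
        2 * π * I * z * ∫ u in Set.Ioi (0 : ℝ), (u : ℂ) ^ (j + 1) * ee (z * u) := by
      rw [← integral_const_mul, ← integral_const_mul, ← integral_add hitg1 hitg2]
      congr 1; ext u; ring
    rw [h3, ih] at h
    have hI : (2 * π * I * z : ℂ) ≠ 0 := by
      simp [hpi, hz0]
    rw [← mul_right_inj' hI]
    simp only [Complex.ofReal_zero, mul_zero, ee_zero, ne_eq, Nat.add_eq_zero_iff,
      one_ne_zero, and_false, not_false_eq_true, zero_pow, zero_mul, sub_zero] at h
    rw [eq_neg_of_add_eq_zero_right h, Nat.factorial_succ, pow_succ (-(2 * π * I)) (j + 1),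
      pow_succ z (j + 1)]
    push_cast
    field_simp

lemma norm_weight_div_le {k : ℕ} (hk : 4 ≤ k) {a a' : ℝ → ℂ} {B : ℂ → ℂ} {ε : ℂ}
    (P : Profile k ε a a' B) {τ : ℂ} (hτ : 0 < τ.im) : ∃ C, 0 ≤ C ∧ ∀ v x : ℝ, 0 < v →
      ‖B (v * I + x)‖ * v ^ (k - 2) * ((v + τ.im) ^ k)⁻¹ ≤
        C * ((1 + v ^ 2)⁻¹ * (1 + x ^ 2)⁻¹) := by
  obtain ⟨C, hC0, hC⟩ := (P.laplacePair hk).exists_bound_horizontal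
  set y := τ.im
  refine ⟨C * ((1 + y⁻¹) ^ 2), by positivity, fun v x hv => ?_⟩
  have h := hC (v * I + x) (by simpa using hv)
  have h1 : v ^ (k - 2) * ((v + y) ^ k)⁻¹ ≤ (1 + y⁻¹) ^ 2 * (1 + v ^ 2)⁻¹ := by
    have e1 : v ^ (k - 2) ≤ (v + y) ^ (k - 2) := by gcongr; linarith
    have e2 : 1 + v ≤ (1 + y⁻¹) * (v + y) := by
      have : y⁻¹ * y = 1 := inv_mul_cancel₀ hτ.ne'
      have : 0 < y⁻¹ * v := by positivity
      nlinarith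
    have e3 : (1 + v ^ 2) ≤ ((1 + y⁻¹) * (v + y)) ^ 2 := by nlinarith
    have e4 : (v + y) ^ k = (v + y) ^ (k - 2) * (v + y) ^ 2 := by
      rw [← pow_add]; congr 1; omega
    rw [← div_eq_mul_inv, ← div_eq_mul_inv, div_le_div_iff₀ (by positivity) (by positivity), e4]
    calc _ ≤ (v + y) ^ (k - 2) * ((1 + y⁻¹) * (v + y)) ^ 2 := by gcongr
      _ = _ := by ring
  have h2 : (v * I + x : ℂ).re = x := by simp
  rw [h2] at h
  calc _ = ‖B (v * I + x)‖ * (v ^ (k - 2) * ((v + y) ^ k)⁻¹) := by ring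
    _ ≤ (C * (1 + x ^ 2)⁻¹) * ((1 + y⁻¹) ^ 2 * (1 + v ^ 2)⁻¹) := by gcongr
    _ = _ := by ring

lemma tendsto_pairing_kernel {k : ℕ} (hk : 4 ≤ k) {a a' : ℝ → ℂ} {B : ℂ → ℂ} {ε : ℂ}
    (P : Profile k ε a a' B) {τ : ℂ} (hτ : 0 < τ.im) :
    Filter.Tendsto (fun t => pairing B (k - 2) t (fun s => ((s + τ) ^ k)⁻¹))
      (nhdsWithin 0 (Set.Ioi 0)) (nhds (∫ p : ℝ × ℝ, B (p.1 * I + p.2) *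
        ((p.1 ^ (k - 2) : ℝ) : ℂ) * ((p.1 * I - p.2 + τ) ^ k)⁻¹
        ∂((volume.restrict (Set.Ioi 0)).prod volume))) := by
  obtain ⟨C, hC0, hC⟩ := norm_weight_div_le hk P hτ
  have hH : ContinuousOn (fun s : ℂ => ((s + τ) ^ k)⁻¹) {z | 0 < z.im} := by
    refine ContinuousOn.inv₀ (by fun_prop) fun s hs => pow_ne_zero _ fun h => ?_
    have := congrArg Complex.im h
    have hs' : 0 < s.im := hs
    simp at this
    linarith
  refine tendsto_integral_filter_of_dominated_convergence
    (fun p => C * ((1 + p.1 ^ 2)⁻¹ * (1 + p.2 ^ 2)⁻¹)) ?_ ?_ (integrable_inv_prod.const_mul C) ?_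
  · exact Filter.Eventually.of_forall fun t => aestronglyMeasurable_prod
      (continuousOn_pairing_integrand (P.laplacePair hk).continuousOn (k - 2) t hH)
  · filter_upwards [self_mem_nhdsWithin] with t ht
    refine ae_prod_of_pos fun v x hv => ?_
    refine le_trans ?_ (hC v x hv)
    rw [norm_mul, norm_mul, Complex.norm_real, Real.norm_of_nonneg (by positivity), norm_inv,
      norm_pow]
    have h1 : v + τ.im ≤ ‖v * I - x + τ‖ := by
      refine le_trans ?_ (Complex.abs_im_le_norm _)
      simp [le_abs_self]
    have h2 : Real.exp (-(t * rho v x)) ≤ 1 := by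
      rw [Real.exp_le_one_iff]
      have := one_le_rho hv x
      have : 0 < t := ht
      simp only [Left.neg_nonpos_iff]; positivity
    have h3 : 0 < v + τ.im := by linarith
    simp only
    gcongr
    exact mul_le_of_le_one_right (by positivity) h2
  · refine ae_prod_of_pos fun v x hv => ?_
    have h1 : Filter.Tendsto (fun t : ℝ => ((v ^ (k - 2) * Real.exp (-(t * rho v x)) : ℝ) : ℂ))
        (nhdsWithin 0 (Set.Ioi 0)) (nhds ((v ^ (k - 2) : ℝ) : ℂ)) := by
      have : Continuous fun t : ℝ => ((v ^ (k - 2) * Real.exp (-(t * rho v x)) : ℝ) : ℂ) := by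
        fun_prop
      have h := this.tendsto 0
      simp only [zero_mul, neg_zero, Real.exp_zero, mul_one] at h
      exact h.mono_left nhdsWithin_le_nhds
    exact (h1.const_mul _).mul_const _

lemma integral_mul_ee_slice {k : ℕ} (hk : 4 ≤ k) {a a' : ℝ → ℂ} {B : ℂ → ℂ} {ε : ℂ}
    (P : Profile k ε a a' B) {τ : ℂ} {u : ℝ} (hu : 0 < u)
    (hitg : Integrable (fun p : ℝ × ℝ => B (p.1 * I + p.2) * ((p.1 ^ (k - 2) : ℝ) : ℂ) *
      ((u : ℂ) ^ (k - 1) * ee ((p.1 * I - p.2 + τ) * u)))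
      ((volume.restrict (Set.Ioi 0)).prod volume)) :
    ∫ p : ℝ × ℝ, B (p.1 * I + p.2) * ((p.1 ^ (k - 2) : ℝ) : ℂ) *
      ((u : ℂ) ^ (k - 1) * ee ((p.1 * I - p.2 + τ) * u))
      ∂((volume.restrict (Set.Ioi 0)).prod volume) =
    (k - 2).factorial / (4 * π) ^ (k - 1) * (a u * ee (τ * u)) := by
  have hpi : (π : ℂ) ≠ 0 := by exact_mod_cast Real.pi_ne_zero
  have hu0 : (u : ℂ) ≠ 0 := by exact_mod_cast hu.ne'
  rw [integral_prod _ hitg]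
  have h1 : ∀ v ∈ Set.Ioi (0 : ℝ), ∫ x : ℝ, B (v * I + x) * ((v ^ (k - 2) : ℝ) : ℂ) *
      ((u : ℂ) ^ (k - 1) * ee ((v * I - x + τ) * u)) =
      ((v ^ (k - 2) * Real.exp (-(4 * π * u * v)) : ℝ) : ℂ) *
        ((u : ℂ) ^ (k - 1) * a u * ee (τ * u)) := by
    intro v hv
    rw [(P.laplacePair hk).inversion (z := v * I) (by simpa using hv) u]
    rw [show ∀ w : ℂ, ((v ^ (k - 2) * Real.exp (-(4 * π * u * v)) : ℝ) : ℂ) *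
        ((u : ℂ) ^ (k - 1) * w * ee (τ * u)) = (((v ^ (k - 2) * Real.exp (-(4 * π * u * v)) : ℝ) : ℂ) *
        (u : ℂ) ^ (k - 1) * ee (τ * u)) * w from fun w => by ring, ← integral_const_mul]
    congr 1; ext x
    have : ee ((v * I - x + τ) * u) =
        ee (-((v * I + x) * u)) * (Real.exp (-(4 * π * u * v)) : ℝ) * ee (τ * u) := by
      have : ((Real.exp (-(4 * π * u * v)) : ℝ) : ℂ) = ee (2 * v * I * u) := by
        rw [ee, Complex.ofReal_exp]
        congr 1
        push_cast
        linear_combination (-4 * π * u * v : ℂ) * Complex.I_sq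
      rw [this, ← ee_add, ← ee_add]
      congr 1; ring
    rw [this]
    push_cast
    ring
  simp only
  rw [setIntegral_congr_fun measurableSet_Ioi h1, integral_mul_const, integral_complex_ofReal,
    integral_pow_mul_exp (k - 2) (by positivity : 0 < 4 * π * u)]
  have : k - 1 = k - 2 + 1 := by omega
  rw [this]
  push_cast
  rw [mul_pow (4 * π : ℂ) u]
  field_simp

lemma integral_kernel {k : ℕ} (hk : 4 ≤ k) {a a' : ℝ → ℂ} {B : ℂ → ℂ} {ε : ℂ}
    (P : Profile k ε a a' B) {τ : ℂ} (hτ : 0 < τ.im) :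
    ∫ p : ℝ × ℝ, B (p.1 * I + p.2) *
        ((p.1 ^ (k - 2) : ℝ) : ℂ) * ((p.1 * I - p.2 + τ) ^ k)⁻¹
        ∂((volume.restrict (Set.Ioi 0)).prod volume) =
    (-(2 * π * I)) ^ k / (k - 1).factorial * ((k - 2).factorial / (4 * π) ^ (k - 1)) *
      B τ := by
  have hpi : (π : ℂ) ≠ 0 := by exact_mod_cast Real.pi_ne_zero
  have hkk : k - 1 + 1 = k := by omega
  have hfac : ((k - 1).factorial : ℂ) ≠ 0 := by exact_mod_cast Nat.factorial_ne_zero _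
  obtain ⟨C, hC0, hC⟩ := norm_weight_div_le hk P hτ
  have him : ∀ v x : ℝ, (v * I - x + τ : ℂ).im = v + τ.im := fun v x => by simp
  have h1 : ∀ᵐ p : ℝ × ℝ ∂((volume.restrict (Set.Ioi (0 : ℝ))).prod volume),
      B (p.1 * I + p.2) * ((p.1 ^ (k - 2) : ℝ) : ℂ) *
        ((p.1 * I - p.2 + τ) ^ k)⁻¹ =
      (-(2 * π * I)) ^ k / (k - 1).factorial * ∫ u in Set.Ioi (0 : ℝ),
        B (p.1 * I + p.2) * ((p.1 ^ (k - 2) : ℝ) : ℂ) *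
          ((u : ℂ) ^ (k - 1) * ee ((p.1 * I - p.2 + τ) * u)) := by
    refine ae_prod_of_pos fun v x hv => ?_
    simp only
    rw [integral_const_mul, integral_pow_mul_ee (k - 1) (by rw [him]; linarith), hkk]
    field_simp
  set μ := (volume.restrict (Set.Ioi (0 : ℝ))).prod (volume : Measure ℝ) with hμ
  set G : (ℝ × ℝ) × ℝ → ℂ := fun q => B (q.1.1 * I + q.1.2) *
    ((q.1.1 ^ (k - 2) : ℝ) : ℂ) * ((q.2 : ℂ) ^ (k - 1) * ee ((q.1.1 * I - q.1.2 + τ) * q.2))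
    with hG
  have hmeasB : AEStronglyMeasurable (fun p : ℝ × ℝ => B (p.1 * I + p.2)) μ :=
    aestronglyMeasurable_prod ((P.laplacePair hk).continuousOn.comp
      (Continuous.continuousOn (by fun_prop)) fun p hp => by simpa using hp.1)
  have hmeas : AEStronglyMeasurable G (μ.prod (volume.restrict (Set.Ioi (0 : ℝ)))) := by
    have := continuous_ee
    exact (hmeasB.comp_fst.mul (Continuous.aestronglyMeasurable (by fun_prop))).mul
      (Continuous.aestronglyMeasurable (by fun_prop))
  have hitg : Integrable G (μ.prod (volume.restrict (Set.Ioi (0 : ℝ)))) := by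
    refine (integrable_prod_iff hmeas).2 ⟨?_, ?_⟩
    · refine ae_prod_of_pos fun v x hv => ?_
      have hz : 0 < (v * I - x + τ : ℂ).im := by rw [him]; linarith
      exact Integrable.const_mul (integrableOn_pow_mul_ee (k - 1) hz)
        (B (v * I + x) * ((v ^ (k - 2) : ℝ) : ℂ))
    · refine (integrable_inv_prod.const_mul (C * ((k - 1).factorial / (2 * π) ^ k))).mono'
        hmeas.norm.integral_prod_right' (ae_prod_of_pos fun v x hv => ?_)
      have e1 : ∫ u in Set.Ioi (0 : ℝ), ‖G ((v, x), u)‖ =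
          ‖B (v * I + x)‖ * v ^ (k - 2) * ((k - 1).factorial /
            (2 * π * (v + τ.im)) ^ k) := by
        have e0 := integral_pow_mul_exp (k - 1) (by positivity : 0 < 2 * π * (v + τ.im))
        rw [hkk] at e0
        rw [← e0, ← integral_const_mul]
        refine setIntegral_congr_fun measurableSet_Ioi fun u hu => ?_
        simp only [hG, norm_mul (B _ * _)]
        rw [norm_pow_mul_ee _ _ (le_of_lt hu), him, norm_mul, Complex.norm_real,
          Real.norm_of_nonneg (by positivity)]
      rw [e1, Real.norm_of_nonneg (by positivity), mul_pow]
      calc _ = ‖B (v * I + x)‖ * v ^ (k - 2) * ((v + τ.im) ^ k)⁻¹ *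
            ((k - 1).factorial / (2 * π) ^ k) := by field_simp
        _ ≤ C * ((1 + v ^ 2)⁻¹ * (1 + x ^ 2)⁻¹) * ((k - 1).factorial / (2 * π) ^ k) := by
          have := hC v x hv; gcongr
        _ = _ := by ring
  rw [integral_congr_ae h1, integral_const_mul, mul_assoc (_ / _) (_ / _) (B τ)]
  congr 1
  rw [integral_integral_swap (f := fun p u => G (p, u)) hitg, P.eq τ hτ,
    ← setIntegral_eq_integral_of_forall_compl_eq_zero (s := Set.Ioi 0)
      (f := fun u : ℝ => a u * ee (τ * u))
      (fun u hu => by rw [P.zero u (by simpa using hu), zero_mul]), ← integral_const_mul]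
  have hs := hitg.swap.prod_right_ae
  refine integral_congr_ae ?_
  filter_upwards [hs, ae_restrict_mem measurableSet_Ioi] with u hu1 hu
  exact integral_mul_ee_slice hk P hu hu1

lemma pairing_congr (W : ℂ → ℂ) (m : ℕ) (t : ℝ) {H H' : ℂ → ℂ}
    (h : ∀ s : ℂ, 0 < s.im → H s = H' s) : pairing W m t H = pairing W m t H' :=
  integral_congr_ae (ae_prod_of_pos fun v x hv => by
    simp only
    rw [h _ (by simpa using hv)])

lemma norm_series_le {n₀ N : ℕ} (h0 : 1 ≤ n₀) {α β : ℕ → ℂ} {M : ℝ} (hM : 0 ≤ M)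
    (hα : ∀ n, ‖α n‖ ≤ M * ((n + n₀ : ℕ) : ℝ) ^ N) (hβ : ∀ n, ‖β n‖ ≤ M * ((n + n₀ : ℕ) : ℝ) ^ N)
    {F : ℂ → ℂ} (hF : ∀ s : ℂ, 0 < s.im →
      HasSum (fun n : ℕ => (α n + β n * s) * ee (s * ((n + n₀ : ℕ) : ℝ))) (F s)) :
    ∃ D : ℝ, ∀ v x : ℝ, 0 < v → ‖F (v * I - x)‖ ≤ D * rho v x ^ (N + 3) := by
  obtain ⟨C, hC0, hC⟩ := norm_coeff_mul_ee_le N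
  have hsum2 : Summable fun n : ℕ => (((n + n₀ : ℕ) : ℝ) ^ 2)⁻¹ :=
    (summable_nat_add_iff (f := fun n : ℕ => ((n : ℝ) ^ 2)⁻¹) n₀).2
      (Real.summable_nat_pow_inv.2 (by norm_num))
  refine ⟨∑' n : ℕ, 3 * M * C * (((n + n₀ : ℕ) : ℝ) ^ 2)⁻¹, fun v x hv => ?_⟩
  rw [← (hF (v * I - x) (by simpa using hv)).tsum_eq, ← tsum_mul_right]
  exact tsum_of_norm_bounded ((hsum2.mul_left (3 * M * C)).mul_right _).hasSum
    fun n => hC h0 hM hα hβ n v x hv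

theorem norm_le_of_companion {k : ℕ} (hk : 4 ≤ k) (hke : Even k) {n₀ : ℕ} (N : ℕ) (h0 : 1 ≤ n₀) :
    ∃ C, 0 ≤ C ∧ ∀ {a a' : ℝ → ℂ} {B : ℂ → ℂ} (_ : Profile k 1 a a' B) {τ : ℂ} (_ : 0 < τ.im)
      {F : ℂ → ℂ} {α β : ℕ → ℂ} {M : ℝ} (_ : 0 ≤ M)
      (_ : ∀ n, ‖α n‖ ≤ M * ((n + n₀ : ℕ) : ℝ) ^ N) (_ : ∀ n, ‖β n‖ ≤ M * ((n + n₀ : ℕ) : ℝ) ^ N)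
      (_ : ∀ s : ℂ, 0 < s.im →
        HasSum (fun n : ℕ => (α n + β n * s) * ee (s * ((n + n₀ : ℕ) : ℝ))) (F s))
      (_ : ContinuousOn F {z | 0 < z.im})
      (_ : ∀ s : ℂ, 0 < s.im → F s + (s ^ k)⁻¹ * F (-1 / s) =
        ((s + τ) ^ k)⁻¹ + ((s * τ - 1) ^ k)⁻¹), ‖B τ‖ ≤ C * M * dataSum n₀ N a a' := by
  obtain ⟨C, hC0, hC⟩ := norm_tsum_series_le (k - 2) N n₀ h0
  set c : ℂ := (-(2 * π * I)) ^ k / (k - 1).factorial *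
    ((k - 2).factorial / (4 * π) ^ (k - 1)) with hc
  have hpi : (π : ℂ) ≠ 0 := by exact_mod_cast Real.pi_ne_zero
  have hc0 : c ≠ 0 := by
    have h1 : ((k - 1).factorial : ℂ) ≠ 0 := by exact_mod_cast Nat.factorial_ne_zero _
    have h2 : ((k - 2).factorial : ℂ) ≠ 0 := by exact_mod_cast Nat.factorial_ne_zero _
    rw [hc]
    refine mul_ne_zero (div_ne_zero (pow_ne_zero _ ?_) h1) (div_ne_zero h2 (pow_ne_zero _ ?_))
    · simp [hpi]
    · simp [hpi]
  refine ⟨‖c‖⁻¹ * C, by positivity, ?_⟩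
  intro a a' B P τ hτ F α β M hM hα hβ hF hcont hR
  have hne : ∀ s : ℂ, 0 < s.im → s + τ ≠ 0 := fun s hs h => by
    have := congrArg Complex.im h
    simp at this
    linarith
  have hG : ContinuousOn (fun s : ℂ => ((s + τ) ^ k)⁻¹) {z | 0 < z.im} :=
    ContinuousOn.inv₀ (by fun_prop) fun s hs => pow_ne_zero _ (hne s hs)
  obtain ⟨A, hA0, hA⟩ := (P.laplacePair hk).exists_norm_le
  have hW := (P.laplacePair hk).continuousOn
  obtain ⟨D, hD⟩ := norm_series_le h0 hM hα hβ hF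
  have hGb : ∀ v x : ℝ, 0 < v →
      ‖((v * I - x + τ) ^ k)⁻¹‖ ≤ (τ.im ^ k)⁻¹ * rho v x ^ 0 := by
    intro v x hv
    rw [norm_inv, norm_pow, pow_zero, mul_one]
    have h1 : τ.im ≤ ‖v * I - x + τ‖ := by
      refine le_trans ?_ (Complex.abs_im_le_norm _)
      refine le_trans ?_ (le_abs_self _)
      simp [hv.le]
    gcongr
  have heq : ∀ t : ℝ, 0 < t → pairing B (k - 2) t (fun s => ((s + τ) ^ k)⁻¹) =
      pairing B (k - 2) t F := by
    intro t ht
    have i1 := integrable_pairing hW hA (k - 2) ht hcont hD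
    have i2 := integrable_pairing hW hA (k - 2) ht hG hGb
    have h1 : pairing B (k - 2) t (fun s => F s - ((s + τ) ^ k)⁻¹) =
        pairing B (k - 2) t F - pairing B (k - 2) t (fun s => ((s + τ) ^ k)⁻¹) := by
      rw [pairing, pairing, pairing, ← integral_sub i1 i2]
      congr 1; ext p; ring
    have h2 := P.pairing_inv (by omega) hke t (fun s => F s - ((s + τ) ^ k)⁻¹)
    rw [pairing_congr B (k - 2) t
      (H := fun s => (s ^ k)⁻¹ * (F (-1 / s) - ((-1 / s + τ) ^ k)⁻¹)) (H' := fun s => -(F s - ((s + τ) ^ k)⁻¹)) (by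
      intro s hs
      have hs0 : s ≠ 0 := by rintro rfl; simp at hs
      have e : (s ^ k)⁻¹ * ((-1 / s + τ) ^ k)⁻¹ = ((s * τ - 1) ^ k)⁻¹ := by
        rw [← mul_inv, ← mul_pow]
        congr 2
        field_simp
        ring
      rw [mul_sub, e]
      linear_combination hR s hs)] at h2
    have h3 : pairing B (k - 2) t (fun s => -(F s - ((s + τ) ^ k)⁻¹)) =
        -pairing B (k - 2) t (fun s => F s - ((s + τ) ^ k)⁻¹) := by
      rw [pairing, pairing, ← integral_neg]
      congr 1; ext p; ring
    rw [h3, h1] at h2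
    linear_combination -h2 / 2
  have t1 := tendsto_pairing_kernel hk P hτ
  rw [integral_kernel hk P hτ, ← hc] at t1
  have t2 := (tendsto_pairing_series hk P n₀ (k - 2) N hα hβ h0 hF).congr' (by
    filter_upwards [self_mem_nhdsWithin] with t ht
    exact (heq t ht).symm)
  have h := tendsto_nhds_unique t1 t2
  have hb := hC P hM hα hβ
  rw [← h, norm_mul] at hb
  have hc1 : 0 < ‖c‖ := norm_pos_iff.2 hc0
  calc ‖B τ‖ = ‖c‖⁻¹ * (‖c‖ * ‖B τ‖) := by field_simp
    _ ≤ ‖c‖⁻¹ * (C * M * dataSum n₀ N a a') := by gcongr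
    _ = _ := by ring

section Cocycle

open ModularGroup Matrix.SpecialLinearGroup
open scoped MatrixGroups

variable {P : Type*} [MulAction SL(2, ℤ) P]

/-- The partial sums of `e` along the Euclidean algorithm of a bottom row `(c, d)`. -/
def euclidSum (e : P → ℂ) : ℕ → ℤ → P → ℂ
  | 0, _, _ => 0
  | c + 1, d, x => euclidSum e (d % ((c : ℤ) + 1)).toNat (-((c : ℤ) + 1))
      (S • T ^ (d / ((c : ℤ) + 1)) • x) + e (T ^ (d / ((c : ℤ) + 1)) • x)
termination_by c => c
decreasing_by
  have h1 := Int.emod_lt_of_pos d (show (0 : ℤ) < (c : ℤ) + 1 by positivity)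
  have h2 := Int.emod_nonneg d (show ((c : ℤ) + 1) ≠ 0 by positivity)
  omega

/-- The primitive of a cocycle attached to the bottom row `(c, d)`. -/
def rowSum (e : P → ℂ) (c d : ℤ) (x : P) : ℂ := euclidSum e c.natAbs (c.sign * d) x

lemma rowSum_zero (e : P → ℂ) (d : ℤ) (x : P) : rowSum e 0 d x = 0 := by
  simp [rowSum, euclidSum]

lemma rowSum_neg (e : P → ℂ) (c d : ℤ) (x : P) : rowSum e (-c) (-d) x = rowSum e c d x := by
  simp [rowSum]

lemma rowSum_of_pos (e : P → ℂ) {c : ℤ} (hc : 0 < c) (d : ℤ) (x : P) :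
    rowSum e c d x = rowSum e (d % c) (-c) (S • T ^ (d / c) • x) + e (T ^ (d / c) • x) := by
  obtain ⟨n, rfl⟩ : ∃ n : ℕ, c = n + 1 := ⟨(c - 1).toNat, by omega⟩
  have h2 := Int.emod_nonneg d (show ((n : ℤ) + 1) ≠ 0 by positivity)
  have h3 : ((n : ℤ) + 1).natAbs = n + 1 := by omega
  rw [rowSum, h3, Int.sign_eq_one_of_pos hc, one_mul, euclidSum, rowSum]
  congr 1
  rcases h2.eq_or_lt with h | h
  · rw [← h]; simp [euclidSum]
  · rw [Int.sign_eq_one_of_pos h, one_mul]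
    congr 1
    omega

lemma rowSum_induction {e : P → ℂ} (Q : (P → ℂ) → Prop) (h0 : Q fun _ => 0)
    (hadd : ∀ f g, Q f → Q g → Q fun x => f x + g x) (he : ∀ γ : SL(2, ℤ), Q fun x => e (γ • x))
    (c d : ℤ) : Q (rowSum e c d) := by
  have key : ∀ (n : ℕ) (d : ℤ) (γ : SL(2, ℤ)), Q fun x => euclidSum e n d (γ • x) := by
    intro n
    induction n using Nat.strong_induction_on with
    | _ n ih =>
      intro d γ
      rcases n with _ | n
      · simpa [euclidSum] using h0
      · simp only [euclidSum, smul_smul]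
        refine hadd _ _ (ih _ ?_ _ _) (he _)
        have h1 := Int.emod_lt_of_pos d (show (0 : ℤ) < (n : ℤ) + 1 by positivity)
        have h2 := Int.emod_nonneg d (show ((n : ℤ) + 1) ≠ 0 by positivity)
        omega
  have := key c.natAbs (c.sign * d) 1
  simp only [one_smul] at this
  exact this

/-- The relations of `PSL(2, ℤ)` for a function on a set with an action. -/
structure EdgeCocycle (e : P → ℂ) : Prop where
  even : ∀ x, e ((-1 : SL(2, ℤ)) • x) = e x
  rel_S : ∀ x, e x + e (S • x) = 0
  rel_T : ∀ x, e x = e (T⁻¹ • x) + e ((T⁻¹ * S * T⁻¹) • x)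

variable {e : P → ℂ}

lemma EdgeCocycle.rowSum_neg_smul (h : EdgeCocycle e) (c d : ℤ) (x : P) :
    rowSum e c d ((-1 : SL(2, ℤ)) • x) = rowSum e c d x := by
  refine rowSum_induction (Q := fun f => ∀ x, f ((-1 : SL(2, ℤ)) • x) = f x) (fun _ => rfl)
    (fun f g hf hg x => by simp only [hf, hg]) (fun γ x => ?_) c d x
  simp only
  rw [smul_smul, show γ * -1 = -1 * γ by simp, ← smul_smul, h.even]

lemma rowSum_T (e : P → ℂ) (c d : ℤ) (x : P) : rowSum e c (c + d) x = rowSum e c d (T • x) := by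
  have pos : ∀ c d : ℤ, 0 < c → ∀ x, rowSum e c (c + d) x = rowSum e c d (T • x) := by
    intro c d hc x
    rw [rowSum_of_pos e hc, rowSum_of_pos e hc, Int.add_emod_left,
      Int.add_ediv_of_dvd_left (dvd_refl c), Int.ediv_self hc.ne', add_comm 1, zpow_add_one,
      ← smul_smul]
  rcases lt_trichotomy c 0 with hc | rfl | hc
  · rw [← rowSum_neg, ← rowSum_neg e c d, neg_add]; exact pos _ _ (by omega) _
  · simp [rowSum_zero]
  · exact pos _ _ hc x

lemma rowSum_T_inv (e : P → ℂ) (c d : ℤ) (x : P) :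
    rowSum e c (d - c) x = rowSum e c d (T⁻¹ • x) := by
  have := rowSum_T e c (d - c) (T⁻¹ • x)
  rw [smul_inv_smul] at this
  rw [← this]; congr 1; ring

lemma EdgeCocycle.rowSum_S (h : EdgeCocycle e) {c d : ℤ} (hcd : c ≠ 0 ∨ d ≠ 0) (x : P) :
    rowSum e d (-c) x = rowSum e c d (S • x) + e x := by
  have rot : ∀ c d : ℤ, (∀ x, rowSum e d (-c) x = rowSum e c d (S • x) + e x) →
      ∀ x, rowSum e (-c) (-d) x = rowSum e d (-c) (S • x) + e x := by
    intro c d H x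
    rw [H, rowSum_neg, smul_smul, show S * S = (-1 : SL(2, ℤ)) by decide, h.rowSum_neg_smul]
    linear_combination -h.rel_S x
  have rot2 : ∀ c d : ℤ, (∀ x, rowSum e d (-c) x = rowSum e c d (S • x) + e x) →
      ∀ x, rowSum e (-d) (- -c) x = rowSum e (-c) (-d) (S • x) + e x := by
    intro c d H x
    rw [rowSum_neg, rowSum_neg, H]
  have base : ∀ c d : ℤ, 0 < c → 0 ≤ d → d < c →
      ∀ x, rowSum e d (-c) x = rowSum e c d (S • x) + e x := by
    intro c d hc hd hdc x
    rw [rowSum_of_pos e hc, Int.ediv_eq_zero_of_lt hd hdc, Int.emod_eq_of_lt hd hdc, zpow_zero,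
      one_smul, smul_smul, show S * S = (-1 : SL(2, ℤ)) by decide, h.rowSum_neg_smul]
    linear_combination -h.rel_S x
  have quad : ∀ (n : ℕ) (c : ℤ), 0 < c →
      ∀ x, rowSum e n (-c) x = rowSum e c n (S • x) + e x := by
    intro n
    induction n using Nat.strong_induction_on with
    | _ n ih =>
      intro c hc x
      by_cases hn : (n : ℤ) < c
      · exact base c n hc (by positivity) hn x
      push Not at hn
      obtain ⟨m, hm⟩ : ∃ m : ℕ, (n : ℤ) = c + m := ⟨(n - c).toNat, by omega⟩
      have e1 : rowSum e n (-c) x = rowSum e n (n - c) (T⁻¹ • x) := by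
        rw [← rowSum_T_inv, sub_sub_cancel_left]
      have e2 : ∀ y, rowSum e n (n - c) y = rowSum e (c - n) n (S • y) + e y := by
        intro y
        have := rot _ _ (base n (n - c) (by omega) (by omega) (by omega))
        have := rot2 (n - c) (-n) this y
        rw [neg_neg, neg_neg, neg_sub] at this
        exact this
      have e3 : ∀ y, rowSum e (c - n) n y = rowSum e m (-c) (T⁻¹ • y) := by
        intro y
        rw [← rowSum_T_inv, ← rowSum_neg e m, hm]
        congr 1 <;> ring
      have e4 : ∀ y, rowSum e c m y = rowSum e c n (T⁻¹ • y) := by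
        intro y
        rw [← rowSum_T_inv, hm]; congr 1; ring
      rw [e1, e2, e3, ih m (by omega) c hc, e4]
      simp only [smul_smul]
      rw [show T⁻¹ * (S * (T⁻¹ * (S * T⁻¹))) = (-1 : SL(2, ℤ)) * S by decide, ← smul_smul,
        h.rowSum_neg_smul, h.rel_T x, mul_assoc]
      ring
  have quad' : ∀ c d : ℤ, 0 < c → 0 ≤ d →
      ∀ x, rowSum e d (-c) x = rowSum e c d (S • x) + e x := by
    intro c d hc hd
    lift d to ℕ using hd
    exact quad d c hc
  rcases lt_trichotomy c 0 with hc | rfl | hc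
  · rcases lt_or_ge 0 d with hd | hd
    · have := rot2 _ _ (rot _ _ (quad' d (-c) hd (by omega))) x
      simpa using this
    · have := rot _ _ (rot _ _ (quad' (-c) (-d) (by omega) (by omega))) x
      simpa using this
  · rcases lt_trichotomy d 0 with hd | rfl | hd
    · have := rot _ _ (quad' (-d) 0 (by omega) (by omega)) x
      simpa using this
    · simp at hcd
    · have := rot _ _ (rot _ _ (rot _ _ (quad' d 0 hd le_rfl))) x
      simpa using this
  · rcases lt_or_ge d 0 with hd | hd
    · have := rot _ _ (quad' (-d) c (by omega) hc.le) x
      simpa using this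
    · exact quad' c d hc hd x

/-- The cocycle law of `rowSum`. -/
lemma EdgeCocycle.rowSum_mul (h : EdgeCocycle e) (γ : SL(2, ℤ)) {c d : ℤ} (hcd : c ≠ 0 ∨ d ≠ 0)
    (x : P) : rowSum e (c * γ 0 0 + d * γ 1 0) (c * γ 0 1 + d * γ 1 1) x =
      rowSum e c d (γ • x) + rowSum e (γ 1 0) (γ 1 1) x := by
  have hγ : γ ∈ Subgroup.closure {S, T} := by simp [_root_.SpecialLinearGroup.SL2Z_generators]
  have nz : ∀ γ : SL(2, ℤ), c * γ 0 0 + d * γ 1 0 ≠ 0 ∨ c * γ 0 1 + d * γ 1 1 ≠ 0 := by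
    intro γ
    by_contra! H
    have h1 := Matrix.SpecialLinearGroup.det_coe γ
    rw [Matrix.det_fin_two] at h1
    have h2 : c = 0 := by linear_combination γ 1 1 * H.1 - γ 1 0 * H.2 - c * h1
    have h3 : d = 0 := by linear_combination γ 0 0 * H.2 - γ 0 1 * H.1 - d * h1
    omega
  have nz1 : ∀ γ : SL(2, ℤ), γ 1 0 ≠ 0 ∨ γ 1 1 ≠ 0 := by
    intro γ
    by_contra! H
    have h1 := Matrix.SpecialLinearGroup.det_coe γ
    rw [Matrix.det_fin_two, H.1, H.2] at h1
    simp at h1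
  have stepS : ∀ γ : SL(2, ℤ),
      (∀ x, rowSum e (c * γ 0 0 + d * γ 1 0) (c * γ 0 1 + d * γ 1 1) x =
      rowSum e c d (γ • x) + rowSum e (γ 1 0) (γ 1 1) x) → ∀ x,
      rowSum e (c * (γ * S) 0 0 + d * (γ * S) 1 0) (c * (γ * S) 0 1 + d * (γ * S) 1 1) x =
      rowSum e c d ((γ * S) • x) + rowSum e ((γ * S) 1 0) ((γ * S) 1 1) x := by
    intro γ H x
    have a1 := h.rowSum_S (nz γ) x
    have a2 := h.rowSum_S (nz1 γ) x
    simp only [coe_mul, coe_S, Matrix.mul_apply, Fin.sum_univ_two, Matrix.of_apply,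
      Matrix.cons_val', Matrix.cons_val_zero, Matrix.cons_val_one, mul_zero, mul_one, zero_add,
      mul_neg, add_zero, ← smul_smul, Matrix.cons_val_fin_one]
    rw [← neg_add, a1, a2, H]
    ring
  have stepN : ∀ γ : SL(2, ℤ),
      (∀ x, rowSum e (c * γ 0 0 + d * γ 1 0) (c * γ 0 1 + d * γ 1 1) x =
      rowSum e c d (γ • x) + rowSum e (γ 1 0) (γ 1 1) x) → ∀ x,
      rowSum e (c * (γ * S⁻¹) 0 0 + d * (γ * S⁻¹) 1 0)
        (c * (γ * S⁻¹) 0 1 + d * (γ * S⁻¹) 1 1) x =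
      rowSum e c d ((γ * S⁻¹) • x) + rowSum e ((γ * S⁻¹) 1 0) ((γ * S⁻¹) 1 1) x := by
    intro γ H
    have : γ * S⁻¹ = γ * S * S * S := by
      rw [mul_assoc, mul_assoc, show S⁻¹ = S * (S * S) by decide]
    rw [this]
    exact stepS _ (stepS _ (stepS _ H))
  induction hγ using Subgroup.closure_induction_right generalizing x with
  | one => simp [rowSum_zero]
  | mul_right γ _ y hy ih =>
    rcases hy with rfl | rfl
    · exact stepS γ ih x
    · simp only [coe_mul, coe_T, Matrix.mul_apply, Fin.sum_univ_two, Matrix.of_apply,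
        Matrix.cons_val', Matrix.cons_val_zero, Matrix.cons_val_one, mul_zero, mul_one,
        add_zero, ← smul_smul, Matrix.cons_val_fin_one]
      rw [rowSum_T, ← ih, ← rowSum_T]
      congr 1; ring
  | mul_inv_cancel γ _ y hy ih =>
    rcases hy with rfl | rfl
    · exact stepN γ ih x
    · rw [coe_mul, coe_T_inv]
      simp only [Matrix.mul_apply, Fin.sum_univ_two, Matrix.of_apply,
        Matrix.cons_val', Matrix.cons_val_zero, Matrix.cons_val_one, mul_zero, mul_one,
        add_zero, ← smul_smul, Matrix.cons_val_fin_one, mul_neg]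
      rw [neg_add_eq_sub (γ 1 0), rowSum_T_inv, ← ih, ← rowSum_T_inv]
      congr 1; ring

lemma EdgeCocycle.rowSum_top (h : EdgeCocycle e) (γ : SL(2, ℤ)) (x : P) :
    rowSum e (γ 0 0) (γ 0 1) x = e (γ • x) + rowSum e (γ 1 0) (γ 1 1) x := by
  have h1 := h.rowSum_mul γ (c := 1) (d := 0) (by simp) x
  have h2 := h.rowSum_S (c := 0) (d := 1) (by simp) (γ • x)
  rw [rowSum_zero, neg_zero, zero_add] at h2
  simpa [h2] using h1

lemma exists_half_bezout {c d : ℤ} (h : IsCoprime c d) (hdc : d.natAbs ≤ c.natAbs)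
    (hc : 2 ≤ c.natAbs) :
    ∃ a b : ℤ, a * d - b * c = 1 ∧ 2 * a.natAbs ≤ c.natAbs ∧ 2 * b.natAbs ≤ c.natAbs := by
  obtain ⟨u, v, huv⟩ := h
  have h1 : (c.natAbs : ℤ) ∣ v.bmod c.natAbs - v := Int.dvd_bmod_sub_self
  have h2 : v.bmod c.natAbs ≤ ((c.natAbs : ℤ) - 1) / 2 := Int.bmod_le (by omega)
  have h3 : -((c.natAbs : ℤ) / 2) ≤ v.bmod c.natAbs := Int.le_bmod (by omega)
  set a := v.bmod c.natAbs
  rw [Int.natAbs_dvd] at h1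
  obtain ⟨w, hw⟩ := h1
  have ha : 2 * a.natAbs ≤ c.natAbs := by omega
  refine ⟨a, w * d - u, by linear_combination d * hw + huv, ha, ?_⟩
  suffices (w * d - u).natAbs ≤ a.natAbs by omega
  have e1 : (w * d - u) * c = a * d - 1 := by linear_combination -d * hw - huv
  have e2 : (w * d - u).natAbs * c.natAbs ≤ a.natAbs * c.natAbs + 1 := by
    rw [← Int.natAbs_mul, e1]
    have := Int.natAbs_sub_le (a * d) 1
    have h4 : (a * d).natAbs ≤ a.natAbs * c.natAbs := by
      rw [Int.natAbs_mul]; gcongr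
    simp only [Int.natAbs_one] at this
    omega
  by_contra! H
  nlinarith

lemma EdgeCocycle.norm_rowSum_le (h : EdgeCocycle e) {E : ℝ} (hE0 : 0 ≤ E) {x : P}
    (hE : ∀ (γ : SL(2, ℤ)) (n : ℕ), (∀ i j, (γ i j).natAbs ≤ n) → ‖e (γ • x)‖ ≤ E * n ^ 5)
    {c d : ℤ} (hcd : IsCoprime c d) :
    ‖rowSum e c d x‖ ≤ 2 * E * (max c.natAbs d.natAbs : ℕ) ^ 5 := by
  obtain ⟨n, hn⟩ : ∃ n, n = max c.natAbs d.natAbs := ⟨_, rfl⟩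
  rw [← hn]
  induction n using Nat.strong_induction_on generalizing c d with
  | _ n ih =>
  have mk : ∀ a b : ℤ, a * d - b * c = 1 → a.natAbs ≤ n → b.natAbs ≤ n →
      ‖rowSum e c d x‖ ≤ ‖rowSum e a b x‖ + E * n ^ 5 := by
    intro a b hab ha hb
    have h1 := h.rowSum_top ⟨!![a, b; c, d], by simpa [Matrix.det_fin_two] using hab⟩ x
    have h2 := hE ⟨!![a, b; c, d], by simpa [Matrix.det_fin_two] using hab⟩ n (by
      intro i j
      fin_cases i <;> fin_cases j <;> simp <;> omega)
    simp only [Matrix.of_apply, Matrix.cons_val', Matrix.cons_val_zero, Matrix.cons_val_one,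
      Matrix.cons_val_fin_one] at h1
    rw [← sub_eq_iff_eq_add'] at h1
    rw [← h1]
    exact (norm_sub_le _ _).trans (by gcongr)
  by_cases hn2 : 2 ≤ n
  · obtain ⟨a, b, hab, ha, hb⟩ : ∃ a b : ℤ, a * d - b * c = 1 ∧ 2 * a.natAbs ≤ n ∧
        2 * b.natAbs ≤ n := by
      rcases le_total d.natAbs c.natAbs with hle | hle
      · obtain ⟨a, b, h1, h2, h3⟩ := exists_half_bezout hcd hle (by omega)
        exact ⟨a, b, h1, by omega, by omega⟩
      · obtain ⟨a, b, h1, h2, h3⟩ := exists_half_bezout hcd.symm hle (by omega)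
        exact ⟨-b, -a, by linear_combination h1, by omega, by omega⟩
    refine (mk a b hab (by omega) (by omega)).trans ?_
    have := ih (max a.natAbs b.natAbs) (by omega) (c := a) (d := b)
      ⟨d, -c, by linear_combination hab⟩ rfl
    have h4 : ((max a.natAbs b.natAbs : ℕ) : ℝ) ≤ n / 2 := by
      rw [le_div_iff₀ two_pos]
      exact_mod_cast (show max a.natAbs b.natAbs * 2 ≤ n by omega)
    have h5 : 2 * E * ((max a.natAbs b.natAbs : ℕ) : ℝ) ^ 5 ≤ 2 * E * (n / 2) ^ 5 := by gcongr
    have h6 : 0 ≤ E * (n : ℝ) ^ 5 := by positivity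
    linarith [show 2 * E * ((n : ℝ) / 2) ^ 5 = (1 / 16) * (E * n ^ 5) by ring]
  · by_cases hc : c = 0
    · rw [hc, rowSum_zero]; simp; positivity
    · have := mk 0 (-c) (by have : c = 1 ∨ c = -1 := by omega
                            rcases this with rfl | rfl <;> simp) (by simp) (by omega)
      rw [rowSum_zero, norm_zero, zero_add] at this
      exact this.trans (by gcongr; linarith)

end Cocycle

section ConcreteCocycle

open ModularGroup Matrix.SpecialLinearGroup
open scoped MatrixGroups ComplexConjugate

/-- A pair of periods together with a linear form. -/
@[ext] structure PeriodPt where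
  z₁ : ℂ
  z₂ : ℂ
  α : ℂ
  β : ℂ

namespace PeriodPt

instance : MulAction SL(2, ℤ) PeriodPt where
  smul γ x := ⟨γ 0 0 * x.z₁ + γ 0 1 * x.z₂, γ 1 0 * x.z₁ + γ 1 1 * x.z₂,
    γ 1 1 * x.α - γ 1 0 * x.β, -(γ 0 1 * x.α) + γ 0 0 * x.β⟩
  one_smul x := by
    change (PeriodPt.mk _ _ _ _) = x
    simp
  mul_smul γ δ x := by
    change (PeriodPt.mk _ _ _ _) = (PeriodPt.mk _ _ _ _)
    simp only [coe_mul, Matrix.mul_apply, Fin.sum_univ_two, Int.cast_add, Int.cast_mul,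
      PeriodPt.mk.injEq]
    change _ = _ * (_ + _) + _ * (_ + _) ∧ _ = _ * (_ + _) + _ * (_ + _) ∧
      _ = _ * (_ - _) - _ * (_ + _) ∧ _ = -(_ * (_ - _)) + _ * (_ + _)
    refine ⟨?_, ?_, ?_, ?_⟩ <;> ring

lemma smul_def (γ : SL(2, ℤ)) (x : PeriodPt) : γ • x =
    ⟨γ 0 0 * x.z₁ + γ 0 1 * x.z₂, γ 1 0 * x.z₁ + γ 1 1 * x.z₂,
    γ 1 1 * x.α - γ 1 0 * x.β, -(γ 0 1 * x.α) + γ 0 0 * x.β⟩ := rfl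

/-- The signed area of the period parallelogram. -/
def area (x : PeriodPt) : ℝ := (x.z₁ * conj x.z₂).im

lemma area_smul (γ : SL(2, ℤ)) (x : PeriodPt) : (γ • x).area = x.area := by
  have h : (γ 0 0 : ℝ) * γ 1 1 - γ 0 1 * γ 1 0 = 1 := by
    have := Matrix.SpecialLinearGroup.det_coe γ
    rw [Matrix.det_fin_two] at this
    exact_mod_cast this
  simp only [area, smul_def, Complex.mul_im, Complex.add_re, Complex.add_im, Complex.mul_re,
    Complex.conj_re, Complex.conj_im, Complex.intCast_re, Complex.intCast_im]
  linear_combination (x.z₁.im * x.z₂.re - x.z₁.re * x.z₂.im) * h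

end PeriodPt

lemma ne_zero_of_area {z₁ z₂ : ℂ} (h : 0 < (z₁ * conj z₂).im) : z₂ ≠ 0 := by
  rintro rfl; simp at h

lemma im_div_eq_area {z₁ z₂ : ℂ} : (z₁ / z₂).im = (z₁ * conj z₂).im / ‖z₂‖ ^ 2 := by
  rw [div_eq_mul_inv, Complex.inv_def, Complex.normSq_eq_norm_sq, ← mul_assoc,
    Complex.im_mul_ofReal, div_eq_mul_inv]

/-- The Hurwitz zeta sum at an integer. -/
noncomputable def halfSum (k : ℕ) (w : ℂ) : ℂ := ∑' j : ℕ, ((w + j) ^ k)⁻¹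

lemma norm_add_nat_ge {w : ℂ} {c M : ℝ} (hc : 0 < c) (hc1 : c ≤ 1) (hM : 0 ≤ M) (hw : c ≤ w.im)
    (hre : -M ≤ w.re) (j : ℕ) : c / (4 + 2 * M) * (1 + j) ≤ ‖w + j‖ := by
  have h1 : c ≤ ‖w + j‖ := hw.trans (by simpa using Complex.im_le_norm (w + j))
  have h2 : w.re + j ≤ ‖w + j‖ := by simpa using Complex.re_le_norm (w + j)
  rw [div_mul_eq_mul_div, div_le_iff₀ (by positivity)]
  have hj : (0 : ℝ) ≤ j := j.cast_nonneg
  rcases le_total (j : ℝ) (2 * M) with h | h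
  · nlinarith
  · rcases Nat.eq_zero_or_pos j with rfl | h0
    · simp only [Nat.cast_zero] at *
      nlinarith
    · have : (1 : ℝ) ≤ j := by exact_mod_cast h0
      nlinarith

lemma summable_halfSum {k : ℕ} (hk : 4 ≤ k) {w : ℂ} (hw : 0 < w.im) :
    Summable fun j : ℕ => (‖w + j‖ ^ k)⁻¹ := by
  have hs : Summable fun j : ℕ => (1 + (j : ℝ)) ^ (-(k : ℝ)) := by
    have := (Real.summable_nat_rpow (p := -(k : ℝ))).2 (by
      have : (4 : ℝ) ≤ k := by exact_mod_cast hk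
      linarith)
    refine ((summable_nat_add_iff 1).2 this).congr fun j => by push_cast; rw [add_comm]
  obtain ⟨c, hc, H⟩ : ∃ c : ℝ, 0 < c ∧ ∀ j : ℕ, c * (1 + j) ≤ ‖w + j‖ :=
    ⟨min w.im 1 / (4 + 2 * |w.re|), by positivity, fun j => norm_add_nat_ge (by positivity)
      (min_le_right _ _) (abs_nonneg _) (min_le_left _ _) (neg_abs_le _) j⟩
  refine (hs.mul_left (c ^ k)⁻¹).of_nonneg_of_le (fun j => by positivity) fun j => ?_
  rw [Real.rpow_neg (by positivity), Real.rpow_natCast, ← mul_inv, ← mul_pow]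
  gcongr
  exact H j

lemma differentiableOn_halfSum {k : ℕ} (hk : 4 ≤ k) :
    DifferentiableOn ℂ (halfSum k) {w | 0 < w.im} := by
  intro w₀ hw₀
  have hw₀ : 0 < w₀.im := hw₀
  set c := min (w₀.im / 2) 1 with hc
  have hc0 : 0 < c := by positivity
  set M := |w₀.re| + 1
  set U : Set ℂ := {w | c < w.im} ∩ {w | -M < w.re}
  have hU : IsOpen U := (isOpen_lt continuous_const Complex.continuous_im).inter
    (isOpen_lt continuous_const Complex.continuous_re)
  have hmem : w₀ ∈ U :=
    ⟨(min_le_left _ _).trans_lt (half_lt_self hw₀), by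
      have := neg_abs_le w₀.re
      change -(|w₀.re| + 1) < w₀.re; linarith⟩
  have hs : Summable fun j : ℕ => ((c / (4 + 2 * M)) ^ k)⁻¹ * (1 + (j : ℝ)) ^ (-(k : ℝ)) := by
    have := (Real.summable_nat_rpow (p := -(k : ℝ))).2 (by
      have : (4 : ℝ) ≤ k := by exact_mod_cast hk
      linarith)
    exact (((summable_nat_add_iff 1).2 this).congr fun j => by
      push_cast; rw [add_comm]).mul_left _
  refine (DifferentiableOn.differentiableAt (s := U) ?_ (hU.mem_nhds hmem)).differentiableWithinAt
  refine Complex.differentiableOn_tsum_of_summable_norm hs (fun j => ?_) hU fun j w hw => ?_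
  · intro w hw
    have : (w + j) ^ k ≠ 0 := by
      refine pow_ne_zero _ fun h => ?_
      have := congrArg Complex.im h
      simp at this
      linarith [hw.1.out]
    fun_prop (disch := assumption)
  · rw [norm_inv, norm_pow, Real.rpow_neg (by positivity), Real.rpow_natCast, ← mul_inv,
      ← mul_pow]
    gcongr
    exact norm_add_nat_ge hc0 (min_le_right _ _) (by positivity) hw.1.out.le hw.2.out.le j

lemma halfSum_add_one {k : ℕ} (hk : 4 ≤ k) {w : ℂ} (hw : 0 < w.im) :
    halfSum k (w + 1) = halfSum k w - (w ^ k)⁻¹ := by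
  have hs : Summable fun j : ℕ => ((w + j) ^ k)⁻¹ :=
    .of_norm (by simpa [norm_inv, norm_pow] using summable_halfSum hk hw)
  rw [halfSum, halfSum, hs.tsum_eq_zero_add]
  simp [add_assoc, add_comm (1 : ℂ)]

/-- The half-lattice sum of `(λ (z₁ + j z₂) + μ z₂)⁻ᵏ`. -/
noncomputable def rayK (k : ℕ) (l m z₁ z₂ : ℂ) : ℂ :=
  ((l * z₂) ^ k)⁻¹ * halfSum k (z₁ / z₂ + m / l)

lemma rayK_shift {k : ℕ} (hk : 4 ≤ k) {l m z₁ z₂ : ℂ} (hl : l ≠ 0) (hlm : 0 ≤ (m / l).im)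
    (hz : 0 < (z₁ * conj z₂).im) :
    rayK k l m (z₁ + z₂) z₂ = rayK k l m z₁ z₂ - ((l * z₁ + m * z₂) ^ k)⁻¹ := by
  have h2 := ne_zero_of_area hz
  have hw : 0 < (z₁ / z₂ + m / l).im := by
    rw [Complex.add_im, im_div_eq_area]; positivity
  rw [rayK, rayK, show (z₁ + z₂) / z₂ + m / l = z₁ / z₂ + m / l + 1 by field_simp; ring,
    halfSum_add_one hk hw, mul_sub, ← mul_inv, ← mul_pow]
  congr 3
  field_simp

lemma rayK_neg {k : ℕ} (hke : Even k) (l m z₁ z₂ : ℂ) :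
    rayK k l m (-z₁) (-z₂) = rayK k l m z₁ z₂ := by
  rw [rayK, rayK, neg_div_neg_eq, mul_neg, hke.neg_pow]

/-- The inhomogeneity of the functional equation. -/
noncomputable def inhomK (k : ℕ) (t a b : ℂ) : ℂ := ((a + t * b) ^ k)⁻¹ + ((t * a - b) ^ k)⁻¹

lemma inhomK_neg {k : ℕ} (hke : Even k) (t a b : ℂ) : inhomK k t (-a) (-b) = inhomK k t a b := by
  rw [inhomK, inhomK, ← hke.neg_pow (a + t * b), ← hke.neg_pow (t * a - b)]
  ring_nf

lemma inhomK_rot {k : ℕ} (hke : Even k) (t a b : ℂ) : inhomK k t (-b) a = inhomK k t a b := by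
  rw [inhomK, inhomK, ← hke.neg_pow (a + t * b)]
  ring_nf

/-- The diagonal part of the edge cocycle. -/
noncomputable def diagK (k : ℕ) (t z₁ z₂ : ℂ) : ℂ :=
  rayK k 1 t z₁ z₂ + rayK k 1 t (z₁ + z₂) z₂ + rayK k t (-1) z₁ z₂ + rayK k t (-1) (z₁ + z₂) z₂
    - rayK k (t + 1) (-1) (z₁ + z₂) z₂ - rayK k (t - 1) (-1) z₁ z₂

lemma diagK_neg {k : ℕ} (hke : Even k) (t z₁ z₂ : ℂ) :
    diagK k t (-z₁) (-z₂) = diagK k t z₁ z₂ := by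
  simp only [diagK, ← neg_add, rayK_neg hke]

lemma area_add {z₁ z₂ : ℂ} : ((z₁ + z₂) * conj z₂).im = (z₁ * conj z₂).im := by
  simp [Complex.mul_im]; ring

lemma ne_zero_of_im {t : ℂ} (ht : 0 < t.im) : t ≠ 0 := by
  rintro rfl; simp at ht

lemma diagK_shift {k : ℕ} (hk : 4 ≤ k) {t : ℂ} (ht : 0 < t.im) {z₁ z₂ : ℂ}
    (hz : 0 < (z₁ * conj z₂).im) :
    diagK k t (z₁ + z₂) z₂ = diagK k t z₁ z₂ - inhomK k t z₁ z₂ + inhomK k t z₁ (z₁ + z₂)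
      - inhomK k t (z₁ + z₂) z₂ := by
  have hz' : 0 < ((z₁ + z₂) * conj z₂).im := by rwa [area_add]
  have hi : ∀ s : ℂ, 0 < s.im → 0 ≤ (-1 / s).im := fun s hs => (im_neg_one_div_pos hs).le
  have h1 : 0 < (t + 1).im := by simpa using ht
  have h2 : 0 < (t - 1).im := by simpa using ht
  simp only [diagK, inhomK]
  rw [rayK_shift hk one_ne_zero (by simpa using ht.le) hz',
    rayK_shift hk one_ne_zero (by simpa using ht.le) hz,
    rayK_shift hk (ne_zero_of_im ht) (hi t ht) hz', rayK_shift hk (ne_zero_of_im ht) (hi t ht) hz,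
    rayK_shift hk (ne_zero_of_im h1) (hi _ h1) hz', rayK_shift hk (ne_zero_of_im h2) (hi _ h2) hz]
  ring_nf

open Classical in
/-- The edge cocycle with values in quadratic forms. -/
noncomputable def edgeK (k : ℕ) (t : ℂ) (x : PeriodPt) : ℂ :=
  if 0 < x.area then -(x.α ^ 2 * diagK k t x.z₁ x.z₂) + 2 * x.α * x.β * inhomK k t x.z₁ x.z₂
    + x.β ^ 2 * diagK k t (-x.z₂) x.z₁ else 0

lemma edgeCocycle_edgeK {k : ℕ} (hk : 4 ≤ k) (hke : Even k) {t : ℂ} (ht : 0 < t.im) :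
    EdgeCocycle (edgeK k t) where
  even x := by
    rw [edgeK, edgeK, PeriodPt.area_smul]
    split_ifs
    · rw [show (-1 : SL(2, ℤ)) • x = ⟨-x.z₁, -x.z₂, -x.α, -x.β⟩ by
        ext <;> simp [PeriodPt.smul_def]]
      simp only [diagK_neg hke, inhomK_neg hke]
      ring
    · rfl
  rel_S x := by
    rw [edgeK, edgeK, PeriodPt.area_smul]
    split_ifs
    · simp only [PeriodPt.smul_def, coe_S, Matrix.of_apply, Matrix.cons_val', Matrix.cons_val_zero,
        Matrix.cons_val_one, Matrix.cons_val_fin_one, Int.cast_zero, Int.cast_one, Int.cast_neg,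
        zero_mul, neg_mul, one_mul, zero_add, add_zero, zero_sub, neg_neg, diagK_neg hke,
        inhomK_rot hke]
      ring
    · simp
  rel_T x := by
    rw [edgeK, edgeK, edgeK, PeriodPt.area_smul, PeriodPt.area_smul]
    have e1 : T⁻¹ • x = ⟨x.z₁ - x.z₂, x.z₂, x.α, x.α + x.β⟩ := by
      ext <;> simp [PeriodPt.smul_def, coe_T_inv, -coe_inv, sub_eq_add_neg]
    have e2 : (T⁻¹ * S * T⁻¹) • x = ⟨-x.z₁, x.z₁ - x.z₂, -(x.α + x.β), -x.β⟩ := by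
      rw [← smul_smul, e1, ← smul_smul]
      ext <;> simp [PeriodPt.smul_def, coe_T_inv, -coe_inv] <;> ring
    split_ifs with hx
    · rw [e1, e2]
      simp only
      have hx : 0 < (x.z₁ * conj x.z₂).im := hx
      obtain ⟨z, w, a, b⟩ := x
      simp only at *
      have s1 := diagK_shift hk ht (z₁ := z - w) (z₂ := w) (by
        rw [← area_add, sub_add_cancel]; exact hx)
      have s2 := diagK_shift hk ht (z₁ := -z) (z₂ := z - w) (by
        simp [Complex.mul_im] at hx ⊢; linarith)
      have s3 := diagK_shift hk ht (z₁ := -w) (z₂ := z) (by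
        simp [Complex.mul_im] at hx ⊢; linarith)
      rw [sub_add_cancel] at s1
      rw [show -z + (z - w) = -w by ring, inhomK_rot hke t (z - w) z, inhomK_neg hke t z w,
        inhomK_rot hke t (z - w) w] at s2
      rw [show -w + z = z - w by ring, inhomK_rot hke t z w, inhomK_rot hke t (z - w) w] at s3
      rw [diagK_neg hke, inhomK_rot hke t (z - w) z]
      linear_combination -a ^ 2 * s1 - (a + b) ^ 2 * s2 - b ^ 2 * s3
    · simp

end ConcreteCocycle

section CocycleBounds

open ModularGroup Matrix.SpecialLinearGroup
open scoped MatrixGroups ComplexConjugate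

lemma exists_tsum_inv_cube_le : ∃ C : ℝ, 0 < C ∧ ∀ w : ℂ, 0 < w.im →
    Summable (fun j : ℕ => (‖w + j‖ ^ 3)⁻¹) ∧
    ∑' j : ℕ, (‖w + j‖ ^ 3)⁻¹ ≤ C * (1 + 1 / w.im) ^ 3 := by
  have hs : Summable fun m : ℤ => ((1 + |(m : ℝ)|) ^ 3)⁻¹ := by
    have h := (Real.summable_one_div_int_pow (p := 3)).2 (by norm_num)
    refine Summable.of_norm_bounded_eventually (g := fun m : ℤ => ‖1 / (m : ℝ) ^ 3‖) h.norm ?_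
    filter_upwards [Filter.eventually_cofinite_ne (0 : ℤ)] with m hm
    rw [Real.norm_of_nonneg (by positivity), norm_div, norm_one, norm_pow, Real.norm_eq_abs,
      one_div]
    have : 0 < |(m : ℝ)| := by positivity
    gcongr
    linarith
  refine ⟨8 * (∑' m : ℤ, ((1 + |(m : ℝ)|) ^ 3)⁻¹), ?_, fun w hw => ?_⟩
  · exact mul_pos (by norm_num) (hs.tsum_pos (fun m => by positivity) 0 (by simp))
  set N : ℤ := ⌊w.re⌋
  have hinj : Function.Injective fun j : ℕ => N + (j : ℤ) := fun a b h => by simpa using h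
  have hs' : Summable fun j : ℕ => ((1 + |((N + j : ℤ) : ℝ)|) ^ 3)⁻¹ := hs.comp_injective hinj
  have hle : ∀ j : ℕ, (‖w + j‖ ^ 3)⁻¹ ≤
      8 * (1 + 1 / w.im) ^ 3 * ((1 + |((N + j : ℤ) : ℝ)|) ^ 3)⁻¹ := by
    intro j
    have h1 : w.im ≤ ‖w + j‖ := by simpa using Complex.im_le_norm (w + j)
    have h2 : |w.re + j| ≤ ‖w + j‖ := by simpa using Complex.abs_re_le_norm (w + j)
    have h3 : |((N + j : ℤ) : ℝ)| ≤ |w.re + j| + 1 := by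
      have e1 := Int.floor_le w.re
      have e2 := Int.lt_floor_add_one w.re
      push_cast
      rw [show (N : ℝ) + j = (w.re + j) + (N - w.re) by ring]
      refine (abs_add_le _ _).trans ?_
      gcongr
      rw [abs_le]; constructor <;> linarith
    have h0 : 0 < ‖w + j‖ := hw.trans_le h1
    rw [inv_le_iff_one_le_mul₀ (by positivity), mul_right_comm, ← div_eq_mul_inv,
      le_div_iff₀ (by positivity), one_mul, show (8 : ℝ) = 2 ^ 3 by norm_num, ← mul_pow,
      ← mul_pow]
    gcongr
    have : 1 ≤ 1 / w.im * ‖w + j‖ := by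
      rw [div_mul_eq_mul_div, one_mul, le_div_iff₀ hw]; linarith
    nlinarith
  have hs2 := hs'.mul_left (8 * (1 + 1 / w.im) ^ 3)
  have hsum := hs2.of_nonneg_of_le (fun j => by positivity) hle
  refine ⟨hsum, (hsum.tsum_le_tsum hle hs2).trans ?_⟩
  rw [tsum_mul_left, mul_right_comm]
  gcongr
  exact tsum_comp_le_tsum_of_inj hs (fun m => by positivity) hinj

/-- The majorant of `rayK`. -/
noncomputable def rayN (k : ℕ) (l m z₁ z₂ : ℂ) : ℝ :=
  (‖l * z₂‖ ^ k)⁻¹ * ∑' j : ℕ, (‖z₁ / z₂ + m / l + j‖ ^ k)⁻¹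

lemma rayN_nonneg (k : ℕ) (l m z₁ z₂ : ℂ) : 0 ≤ rayN k l m z₁ z₂ :=
  mul_nonneg (by positivity) (tsum_nonneg fun _ => by positivity)

lemma norm_rayK_le {k : ℕ} (hk : 4 ≤ k) {l m z₁ z₂ : ℂ} (hlm : 0 ≤ (m / l).im) (hl : l ≠ 0)
    (hz : 0 < (z₁ * conj z₂).im) :
    ‖rayK k l m z₁ z₂‖ ≤ rayN k l m z₁ z₂ ∧ ‖rayK k l m (z₁ + z₂) z₂‖ ≤ rayN k l m z₁ z₂ ∧
      ‖((l * z₁ + m * z₂) ^ k)⁻¹‖ ≤ rayN k l m z₁ z₂ := by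
  have h2 := ne_zero_of_area hz
  have hw : 0 < (z₁ / z₂ + m / l).im := by
    rw [Complex.add_im, im_div_eq_area]; positivity
  have hs := summable_halfSum hk hw
  have hterm : ((l * z₁ + m * z₂) ^ k)⁻¹ =
      ((l * z₂) ^ k)⁻¹ * ((z₁ / z₂ + m / l) ^ k)⁻¹ := by
    rw [← mul_inv, ← mul_pow]; congr 2; field_simp
  refine ⟨?_, ?_, ?_⟩
  · rw [rayK, rayN, norm_mul, norm_inv, norm_pow]
    gcongr
    refine (norm_tsum_le_tsum_norm (by simpa [norm_inv, norm_pow] using hs)).trans_eq ?_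
    simp [norm_inv, norm_pow]
  · rw [rayK_shift hk hl hlm hz, rayK, rayN, hterm, ← mul_sub, norm_mul, norm_inv, norm_pow]
    gcongr
    rw [← halfSum_add_one hk hw, halfSum, hs.tsum_eq_zero_add]
    have e : ∀ j : ℕ, ‖((z₁ / z₂ + m / l + 1 + j) ^ k)⁻¹‖ =
        (‖z₁ / z₂ + m / l + (j + 1 : ℕ)‖ ^ k)⁻¹ := fun j => by
      rw [norm_inv, norm_pow]; push_cast; ring_nf
    refine (norm_tsum_le_tsum_norm ?_).trans ?_
    · exact ((summable_nat_add_iff 1).2 hs).congr fun j => (e j).symm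
    · simp_rw [e]
      exact le_add_of_nonneg_left (by positivity)
  · rw [hterm, rayN, norm_mul, norm_inv, norm_pow, norm_inv, norm_pow]
    gcongr
    simpa using hs.le_tsum 0 fun j _ => by positivity

/-- A majorant of `diagK` and `inhomK`. -/
noncomputable def majK (k : ℕ) (t z₁ z₂ : ℂ) : ℝ :=
  2 * rayN k 1 t z₁ z₂ + 2 * rayN k t (-1) z₁ z₂ + rayN k (t + 1) (-1) z₁ z₂
    + rayN k (t - 1) (-1) z₁ z₂

lemma norm_le_majK {k : ℕ} (hk : 4 ≤ k) {t : ℂ} (ht : 0 < t.im) {z₁ z₂ : ℂ}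
    (hz : 0 < (z₁ * conj z₂).im) :
    ‖diagK k t z₁ z₂‖ ≤ majK k t z₁ z₂ ∧ ‖inhomK k t z₁ z₂‖ ≤ majK k t z₁ z₂ := by
  have hi : ∀ s : ℂ, 0 < s.im → 0 ≤ (-1 / s).im := fun s hs => (im_neg_one_div_pos hs).le
  have h1 : 0 < (t + 1).im := by simpa using ht
  have h2 : 0 < (t - 1).im := by simpa using ht
  obtain ⟨a1, a2, a3⟩ := norm_rayK_le hk (l := 1) (m := t) (by simpa using ht.le) one_ne_zero hz
  obtain ⟨b1, b2, b3⟩ := norm_rayK_le hk (hi t ht) (ne_zero_of_im ht) hz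
  obtain ⟨-, c2, -⟩ := norm_rayK_le hk (hi _ h1) (ne_zero_of_im h1) hz
  obtain ⟨d1, -, -⟩ := norm_rayK_le hk (hi _ h2) (ne_zero_of_im h2) hz
  constructor
  · rw [diagK, majK]
    refine (norm_sub_le _ _).trans ?_
    refine (add_le_add_left (norm_sub_le _ _) _).trans ?_
    have := norm_add_le (rayK k 1 t z₁ z₂ + rayK k 1 t (z₁ + z₂) z₂ + rayK k t (-1) z₁ z₂)
      (rayK k t (-1) (z₁ + z₂) z₂)
    have := norm_add_le (rayK k 1 t z₁ z₂ + rayK k 1 t (z₁ + z₂) z₂) (rayK k t (-1) z₁ z₂)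
    have := norm_add_le (rayK k 1 t z₁ z₂) (rayK k 1 t (z₁ + z₂) z₂)
    linarith
  · rw [inhomK, majK]
    have := rayN_nonneg k (t + 1) (-1) z₁ z₂
    have := rayN_nonneg k (t - 1) (-1) z₁ z₂
    rw [one_mul] at a3
    rw [neg_one_mul, ← sub_eq_add_neg] at b3
    refine (norm_add_le _ _).trans ?_
    linarith [norm_nonneg ((z₁ + t * z₂) ^ k)⁻¹, norm_nonneg ((t * z₁ - z₂) ^ k)⁻¹]

lemma exists_rayN_le {k : ℕ} (hk : 4 ≤ k) : ∃ C : ℝ, 0 < C ∧ ∀ {l m z₁ z₂ : ℂ} {B q ρ : ℝ},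
    l ≠ 0 → 0 ≤ (m / l).im → 0 < (z₁ * conj z₂).im → 1 ≤ q → 0 < B → 0 < ρ →
    q ≤ B * ‖z₂‖ → ‖z₂‖ ≤ B * q * (z₁ * conj z₂).im →
    (∀ j : ℕ, ρ ≤ ‖l * (z₁ + j * z₂) + m * z₂‖) →
    rayN k l m z₁ z₂ ≤ C * (B * q) ^ 3 * (‖l‖ ^ 3)⁻¹ * (ρ ^ (k - 3))⁻¹ := by
  obtain ⟨C, hC, H⟩ := exists_tsum_inv_cube_le
  refine ⟨8 * C, by positivity, ?_⟩
  intro l m z₁ z₂ B q ρ hl hlm hz hq hB hρ h1 h2 h3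
  have hz2 := ne_zero_of_area hz
  set Δ := (z₁ * conj z₂).im
  set w := z₁ / z₂ + m / l with hwdef
  have hv : Δ / ‖z₂‖ ^ 2 ≤ w.im := by
    rw [hwdef, Complex.add_im, im_div_eq_area]; linarith
  have hw : 0 < w.im := lt_of_lt_of_le (div_pos hz (by positivity)) hv
  obtain ⟨hs, hsle⟩ := H w hw
  have hlz : 0 < ‖l * z₂‖ := norm_pos_iff.2 (mul_ne_zero hl hz2)
  have hterm : ∀ j : ℕ, (‖w + j‖ ^ k)⁻¹ ≤ (‖w + j‖ ^ 3)⁻¹ * ((ρ / ‖l * z₂‖) ^ (k - 3))⁻¹ := by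
    intro j
    have e : l * (z₁ + j * z₂) + m * z₂ = (l * z₂) * (w + j) := by
      rw [hwdef]; field_simp; ring
    have h4 : ρ / ‖l * z₂‖ ≤ ‖w + j‖ := by
      rw [div_le_iff₀ hlz, mul_comm, ← norm_mul, ← e]; exact h3 j
    rw [← mul_inv, show ‖w + j‖ ^ k = ‖w + j‖ ^ 3 * ‖w + j‖ ^ (k - 3) by
      rw [← pow_add]; congr 1; omega]
    have : 0 < ‖w + j‖ := lt_of_lt_of_le (by positivity) h4
    gcongr
  have hsum : ∑' j : ℕ, (‖w + j‖ ^ k)⁻¹ ≤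
      C * (1 + ‖z₂‖ ^ 2 / Δ) ^ 3 * ((ρ / ‖l * z₂‖) ^ (k - 3))⁻¹ := by
    refine ((summable_halfSum hk hw).tsum_le_tsum hterm (hs.mul_right _)).trans ?_
    rw [tsum_mul_right]
    gcongr
    refine hsle.trans ?_
    have : 1 / w.im ≤ ‖z₂‖ ^ 2 / Δ := by
      rw [one_div, ← inv_div]; gcongr
    gcongr
  rw [rayN]
  calc _ ≤ (‖l * z₂‖ ^ k)⁻¹ * (C * (1 + ‖z₂‖ ^ 2 / Δ) ^ 3 * ((ρ / ‖l * z₂‖) ^ (k - 3))⁻¹) := by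
        gcongr
    _ = C * (1 / ‖z₂‖ + ‖z₂‖ / Δ) ^ 3 * (‖l‖ ^ 3)⁻¹ * (ρ ^ (k - 3))⁻¹ := by
        obtain ⟨n, rfl⟩ : ∃ n, k = n + 3 := ⟨k - 3, by omega⟩
        have : ‖l‖ ≠ 0 := by positivity
        have : ‖z₂‖ ≠ 0 := by positivity
        rw [Nat.add_sub_cancel, div_pow, pow_add, norm_mul,
          show 1 / ‖z₂‖ + ‖z₂‖ / Δ = (1 + ‖z₂‖ ^ 2 / Δ) / ‖z₂‖ by field_simp, div_pow]
        field_simp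
    _ ≤ C * (2 * (B * q)) ^ 3 * (‖l‖ ^ 3)⁻¹ * (ρ ^ (k - 3))⁻¹ := by
        have e1 : 1 / ‖z₂‖ ≤ B * q := by
          rw [div_le_iff₀ (by positivity)]
          nlinarith [norm_nonneg z₂]
        have e2 : ‖z₂‖ / Δ ≤ B * q := by
          rwa [div_le_iff₀ hz]
        gcongr
        linarith
    _ = _ := by ring

lemma exists_rayN_one_le {k : ℕ} (hk : 4 ≤ k) {t z₁ z₂ : ℂ} (ht : 0 < t.im) (ht1 : t.im ≤ 1)
    (htre : 0 ≤ t.re) (hz : 0 < (z₁ * conj z₂).im) :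
    rayN k 1 t z₁ z₂ ≤ (‖z₂‖ ^ k)⁻¹ * (512 * (1 + ‖z₁ / z₂‖) ^ 4 * (t.im ^ k)⁻¹ *
      ((1 + ‖t‖) ^ 3)⁻¹) := by
  have hz2 := ne_zero_of_area hz
  set u := z₁ / z₂ with hu
  have hui : 0 < u.im := by rw [hu, im_div_eq_area]; positivity
  have hterm : ∀ j : ℕ, (‖u + t + j‖ ^ k)⁻¹ ≤
      256 * (1 + ‖u‖) ^ 4 * (t.im ^ k)⁻¹ * (1 / ((1 + ‖t‖) + j) ^ 4) := by
    intro j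
    set x := ‖u + t + j‖ with hx
    have h1 : t.im ≤ x := by
      have := Complex.im_le_norm (u + t + j)
      simp at this; linarith
    have hx0 : 0 < x := ht.trans_le h1
    have h2 : ‖t + j‖ ≤ x + ‖u‖ := by
      rw [hx, show t + (j : ℂ) = (u + t + j) - u by ring]; exact norm_sub_le _ _
    have h3 : (j : ℝ) ≤ ‖t + j‖ := by
      have := Complex.re_le_norm (t + j); simp at this; linarith
    have h4 : ‖t‖ ≤ ‖t + j‖ := by
      rw [Complex.norm_def, Complex.norm_def]
      apply Real.sqrt_le_sqrt
      simp only [Complex.normSq_apply, Complex.add_re, Complex.natCast_re, Complex.add_im,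
        Complex.natCast_im, add_zero]
      have : (0 : ℝ) ≤ j := j.cast_nonneg
      nlinarith
    have h5 : (1 + ‖t‖ + j) * t.im ≤ 4 * (1 + ‖u‖) * x := by
      have a1 : 1 + ‖t‖ + j ≤ 2 * (1 + (x + ‖u‖)) := by linarith
      have a2 := norm_nonneg u
      calc (1 + ‖t‖ + j) * t.im ≤ 2 * (1 + (x + ‖u‖)) * t.im := by gcongr
        _ = 2 * ((1 + ‖u‖) * t.im + x * t.im) := by ring
        _ ≤ 2 * ((1 + ‖u‖) * x + x * 1) := by gcongr
        _ ≤ _ := by nlinarith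
    rw [show k = (k - 4) + 4 by omega, pow_add, pow_add]
    have h6 : (x ^ 4)⁻¹ ≤ 256 * (1 + ‖u‖) ^ 4 * (t.im ^ 4)⁻¹ * (1 / ((1 + ‖t‖) + j) ^ 4) := by
      rw [inv_le_iff_one_le_mul₀ (by positivity),
        show 256 * (1 + ‖u‖) ^ 4 * (t.im ^ 4)⁻¹ * (1 / (1 + ‖t‖ + (j : ℝ)) ^ 4) * x ^ 4 =
          (4 * (1 + ‖u‖) * x / ((1 + ‖t‖ + j) * t.im)) ^ 4 by field_simp; ring]
      apply one_le_pow₀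
      rw [le_div_iff₀ (by positivity), one_mul]; exact h5
    rw [mul_inv]
    calc _ ≤ (t.im ^ (k - 4))⁻¹ *
          (256 * (1 + ‖u‖) ^ 4 * (t.im ^ 4)⁻¹ * (1 / ((1 + ‖t‖) + j) ^ 4)) := by gcongr
      _ = _ := by rw [mul_inv]; ring
  rw [rayN, one_mul, div_one]
  gcongr
  refine Real.tsum_le_of_sum_range_le (fun j => by positivity) fun N => ?_
  refine (Finset.sum_le_sum fun j _ => hterm j).trans ?_
  rw [← Finset.mul_sum]
  have := sum_inv_pow_four_le (t := 1 + ‖t‖) (by linarith [norm_nonneg t]) N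
  calc _ ≤ 256 * (1 + ‖u‖) ^ 4 * (t.im ^ k)⁻¹ * (2 / (1 + ‖t‖) ^ 3) := by gcongr
    _ = _ := by ring

lemma exists_majK_le {k : ℕ} (hk : 4 ≤ k) : ∃ C : ℝ, 0 < C ∧ ∀ {t z₁ z₂ : ℂ} {B q n θ : ℝ},
    0 < t.im → t.im ≤ 1 → 0 < (z₁ * conj z₂).im → 1 ≤ q → q ≤ n → 1 ≤ B →
    q ≤ B * ‖z₂‖ → ‖z₂‖ ≤ B * q * (z₁ * conj z₂).im → (∀ j : ℕ, 1 ≤ B * ‖z₁ + j * z₂‖) →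
    (θ = 1 ∨ θ = ((1 + ‖t‖) ^ 3)⁻¹ ∧ 0 ≤ t.re ∧ q * (1 + ‖z₁ / z₂‖) ≤ B * n) →
    q * majK k t z₁ z₂ ≤ C * B ^ (k + 4) * (t.im ^ k)⁻¹ * θ * n ^ 4 := by
  obtain ⟨C, hC, H⟩ := exists_rayN_le hk
  refine ⟨6 * (27 * C + 512), by positivity, ?_⟩
  intro t z₁ z₂ B q n θ ht ht1 hz hq hqn hB h1 h2 h3 hθ
  have hz2 := ne_zero_of_area hz
  have hθ0 : 0 < θ := by
    rcases hθ with h | ⟨h, -⟩ <;> rw [h] <;> positivity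
  have hρ : 0 < t.im / B := by positivity
  have hq4 : q ^ 3 * q ≤ n ^ 4 := by
    rw [← pow_succ]; gcongr
  have fin : ∀ l : ℂ, (‖l‖ ^ 3)⁻¹ ≤ 27 * (t.im ^ 3)⁻¹ * θ →
      q * (C * (B * q) ^ 3 * (‖l‖ ^ 3)⁻¹ * ((t.im / B) ^ (k - 3))⁻¹) ≤
        (27 * C + 512) * (B ^ (k + 4) * (t.im ^ k)⁻¹ * θ * n ^ 4) := by
    intro l hl
    calc _ ≤ q * (C * (B * q) ^ 3 * (27 * (t.im ^ 3)⁻¹ * θ) * ((t.im / B) ^ (k - 3))⁻¹) := by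
          gcongr
      _ = 27 * C * (B ^ k * (t.im ^ k)⁻¹ * θ * (q ^ 3 * q)) := by
          obtain ⟨m, rfl⟩ : ∃ m, k = m + 3 := ⟨k - 3, by omega⟩
          rw [Nat.add_sub_cancel, div_pow, pow_add, pow_add]
          field_simp
      _ ≤ 27 * C * (B ^ (k + 4) * (t.im ^ k)⁻¹ * θ * n ^ 4) := by
          gcongr
          omega
      _ ≤ _ := by
          gcongr; linarith
  have second : ∀ l : ℂ, l.im = t.im → ‖t‖ ≤ ‖l‖ + 1 →
      q * rayN k l (-1) z₁ z₂ ≤ (27 * C + 512) * (B ^ (k + 4) * (t.im ^ k)⁻¹ * θ * n ^ 4) := by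
    intro l hl hlt
    have hl0 : 0 < l.im := hl ▸ ht
    have hle : t.im ≤ ‖l‖ := hl ▸ Complex.im_le_norm l
    refine le_trans ?_ (fin l ?_)
    · have := H (B := B) (q := q) (ne_zero_of_im hl0) (im_neg_one_div_pos hl0).le hz hq
        (by positivity) hρ h1 h2 fun j => by
        have hu := h3 j
        set u := z₁ + j * z₂ with hu_def
        have hu0 : u ≠ 0 := by
          intro h; rw [h] at hu; simp at hu; linarith
        have e1 : l * u + -1 * z₂ = u * (l - z₂ / u) := by field_simp; ring
        have e2 : (z₂ / u).im ≤ 0 := by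
          rw [im_div_eq_area]
          apply div_nonpos_of_nonpos_of_nonneg _ (by positivity)
          rw [hu_def]
          simp [Complex.mul_im] at hz ⊢
          linarith
        have e3 : t.im ≤ ‖l - z₂ / u‖ := by
          refine le_trans ?_ (Complex.im_le_norm _)
          rw [Complex.sub_im, hl]; linarith
        rw [e1, norm_mul, div_le_iff₀ (by positivity)]
        nlinarith
      gcongr
    · rcases hθ with h | ⟨h, -⟩
      · rw [h, mul_one]
        have : (‖l‖ ^ 3)⁻¹ ≤ (t.im ^ 3)⁻¹ := by gcongr
        have h' : 0 < (t.im ^ 3)⁻¹ := by positivity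
        linarith
      · have : (1 + ‖t‖) * t.im ≤ 3 * ‖l‖ := by nlinarith [norm_nonneg t]
        have hl1 : 0 < ‖l‖ := ht.trans_le hle
        rw [h, inv_le_iff_one_le_mul₀ (by positivity),
          show 27 * (t.im ^ 3)⁻¹ * ((1 + ‖t‖) ^ 3)⁻¹ * ‖l‖ ^ 3 =
            (3 * ‖l‖ / ((1 + ‖t‖) * t.im)) ^ 3 by field_simp; ring]
        apply one_le_pow₀
        rw [le_div_iff₀ (by positivity), one_mul]; exact this
  have first : q * rayN k 1 t z₁ z₂ ≤
      (27 * C + 512) * (B ^ (k + 4) * (t.im ^ k)⁻¹ * θ * n ^ 4) := by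
    rcases hθ with h | ⟨h, hre, h4⟩
    · refine le_trans ?_ (fin 1 ?_)
      · have := H (B := B) (q := q) (l := 1) (m := t) one_ne_zero (by simpa using ht.le) hz hq
          (by positivity) hρ h1 h2 fun j => by
          have e1 : 1 * (z₁ + j * z₂) + t * z₂ = z₂ * (z₁ / z₂ + j + t) := by field_simp
          have e2 : 0 ≤ (z₁ / z₂).im := by rw [im_div_eq_area]; positivity
          have e3 : t.im ≤ ‖z₁ / z₂ + j + t‖ := by
            refine le_trans ?_ (Complex.im_le_norm _)
            simp only [Complex.add_im, Complex.natCast_im]; linarith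
          rw [e1, norm_mul, div_le_iff₀ (by positivity)]
          nlinarith
        gcongr
      · rw [h, norm_one, one_pow, inv_one, mul_one]
        have : 1 ≤ (t.im ^ 3)⁻¹ := (one_le_inv₀ (by positivity)).2 (pow_le_one₀ ht.le ht1)
        linarith
    · have h5 : (‖z₂‖ ^ k)⁻¹ ≤ B ^ k := by
        rw [← inv_pow]
        gcongr
        rw [inv_le_iff_one_le_mul₀ (by positivity)]; linarith
      have h6 : q * (1 + ‖z₁ / z₂‖) ^ 4 ≤ (B * n) ^ 4 := by
        refine le_trans ?_ (pow_le_pow_left₀ (by positivity) h4 4)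
        rw [mul_pow]
        gcongr
        exact le_self_pow₀ hq (by norm_num)
      calc q * rayN k 1 t z₁ z₂ ≤ q * ((‖z₂‖ ^ k)⁻¹ * (512 * (1 + ‖z₁ / z₂‖) ^ 4 *
            (t.im ^ k)⁻¹ * ((1 + ‖t‖) ^ 3)⁻¹)) := by
            gcongr; exact exists_rayN_one_le hk ht ht1 hre hz
        _ = (‖z₂‖ ^ k)⁻¹ * (q * (1 + ‖z₁ / z₂‖) ^ 4) * (512 * (t.im ^ k)⁻¹ * θ) := by
            rw [h]; ring
        _ ≤ B ^ k * (B * n) ^ 4 * (512 * (t.im ^ k)⁻¹ * θ) := by gcongr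
        _ = 512 * (B ^ (k + 4) * (t.im ^ k)⁻¹ * θ * n ^ 4) := by ring
        _ ≤ _ := by
          have : 0 ≤ n := by linarith
          gcongr; linarith
  have a1 := second t rfl (by linarith)
  have a2 := second (t + 1) (by simp) (by
    have := norm_sub_le (t + 1) 1; simpa using this)
  have a3 := second (t - 1) (by simp) (by
    have := norm_add_le (t - 1) 1; simpa using this)
  rw [majK]
  linarith

lemma row_bounds {τ : ℂ} {η : ℝ} (hη : 0 < η) (hη1 : η ≤ 1) (hτ : η ≤ τ.im)
    (hre : |τ.re| ≤ 1 / η) (c d : ℤ) :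
    ((max c.natAbs d.natAbs : ℕ) : ℝ) ≤ 3 / η ^ 2 * ‖c * τ + d‖ ∧
    ‖c * τ + d‖ ≤ 3 / η ^ 2 * (max c.natAbs d.natAbs : ℕ) * τ.im ∧
    (τ.im ≤ 1 → ‖c * τ + d‖ ≤ 3 / η * (max c.natAbs d.natAbs : ℕ)) := by
  have hY : 0 < τ.im := hη.trans_le hτ
  set q : ℝ := ((max c.natAbs d.natAbs : ℕ) : ℝ) with hq
  have hmax : q = max |(c : ℝ)| |(d : ℝ)| := by
    rw [hq, Nat.cast_max, Nat.cast_natAbs, Nat.cast_natAbs]; push_cast; rfl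
  have hc : |(c : ℝ)| ≤ q := hmax ▸ le_max_left _ _
  have hd : |(d : ℝ)| ≤ q := hmax ▸ le_max_right _ _
  have hq0 : 0 ≤ q := (abs_nonneg _).trans hc
  set N := ‖(c : ℂ) * τ + d‖
  have h1 : |(c : ℝ)| * τ.im ≤ N := by
    have := Complex.abs_im_le_norm ((c : ℂ) * τ + d)
    simpa [abs_mul, abs_of_pos hY] using this
  have h2 : |(d : ℝ)| ≤ N + |(c : ℝ)| * |τ.re| := by
    have h3 := Complex.abs_re_le_norm ((c : ℂ) * τ + d)
    have h4 : |(d : ℝ)| ≤ |(c : ℝ) * τ.re + d| + |(c : ℝ) * τ.re| := by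
      have := abs_sub ((c : ℝ) * τ.re + d) (c * τ.re)
      simpa using this
    rw [abs_mul] at h4
    have : ((c : ℂ) * τ + d).re = c * τ.re + d := by simp
    rw [this] at h3
    linarith
  have h5 : N ≤ |(c : ℝ)| * (|τ.re| + τ.im) + |(d : ℝ)| := by
    refine (norm_add_le _ _).trans ?_
    rw [norm_mul]
    have := Complex.norm_le_abs_re_add_abs_im τ
    rw [abs_of_pos hY] at this
    simp only [Complex.norm_intCast]
    gcongr
  have hN : 0 ≤ N := norm_nonneg _
  have hi : 1 ≤ 1 / η := by rw [le_div_iff₀ hη]; linarith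
  have hcN : |(c : ℝ)| ≤ N * (1 / η) := by
    rw [mul_one_div, le_div_iff₀ hη]
    exact (mul_le_mul_of_nonneg_left hτ (abs_nonneg _)).trans h1
  have hηη : 3 / η ^ 2 = 3 * ((1 / η) * (1 / η)) := by field_simp
  have hY1 : 1 ≤ 1 / η * τ.im := by rw [div_mul_eq_mul_div, le_div_iff₀ hη]; linarith
  have h6 : N ≤ q * (1 / η + τ.im + 1) := by
    refine h5.trans ?_
    have : |(c : ℝ)| * (|τ.re| + τ.im) ≤ q * (1 / η + τ.im) := by gcongr
    linarith
  set i := 1 / η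
  refine ⟨?_, ?_, fun h => ?_⟩
  · rw [hηη, hmax]
    refine max_le ?_ ?_
    · nlinarith [mul_nonneg hN (by linarith : (0 : ℝ) ≤ i)]
    · have : |(c : ℝ)| * |τ.re| ≤ (N * i) * i := by gcongr
      nlinarith [mul_nonneg hN (by linarith : (0 : ℝ) ≤ i)]
  · rw [hηη]
    refine h6.trans ?_
    have e1 : i ≤ i * i * τ.im := by nlinarith
    have e2 : 1 ≤ i * i * τ.im := hi.trans e1
    have e3 : τ.im ≤ i * i * τ.im := by nlinarith
    calc _ ≤ q * (i * i * τ.im + i * i * τ.im + i * i * τ.im) := by gcongr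
      _ = _ := by ring
  · refine h6.trans ?_
    rw [show 3 / η = 3 * i by simp only [i]; ring]
    nlinarith

/-- Polynomial growth of `rowSum` for the concrete cocycle. -/
lemma exists_rowSum_le {k : ℕ} (hk : 4 ≤ k) (hke : Even k) : ∃ C : ℝ, 0 < C ∧
    ∀ {t τ α β : ℂ} {η V θ : ℝ}, 0 < t.im → t.im ≤ 1 → 0 < η → η ≤ 1 → η ≤ τ.im →
    |τ.re| ≤ 1 / η → ‖α‖ ≤ V → ‖β‖ ≤ V →
    (θ = 1 ∨ θ = ((1 + ‖t‖) ^ 3)⁻¹ ∧ 0 ≤ t.re ∧ τ.im ≤ 1) → ∀ {c d : ℤ}, IsCoprime c d →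
    ‖rowSum (edgeK k t) c d ⟨τ, 1, α, β⟩‖ ≤
      C * (η ^ (3 * (k + 4)))⁻¹ * (t.im ^ k)⁻¹ * θ * V ^ 2 * (max c.natAbs d.natAbs : ℕ) ^ 5 := by
  obtain ⟨C, hC, H⟩ := exists_majK_le hk
  refine ⟨32 * C * 10 ^ (k + 4), by positivity, ?_⟩
  intro t τ α β η V θ ht ht1 hη hη1 hτ hre hα hβ hθ c d hcd
  have hY : 0 < τ.im := hη.trans_le hτ
  have hV : 0 ≤ V := (norm_nonneg _).trans hα
  have hθ0 : 0 < θ := by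
    rcases hθ with h | ⟨h, -⟩ <;> rw [h] <;> positivity
  set B : ℝ := 10 / η ^ 3 with hBdef
  have hB3 : 3 / η ^ 2 ≤ B := by
    rw [hBdef, div_le_div_iff₀ (by positivity) (by positivity)]
    nlinarith [pow_pos hη 2, pow_succ η 2]
  have hB1 : 1 ≤ B := by
    rw [hBdef, le_div_iff₀ (by positivity)]
    have := pow_le_one₀ (n := 3) hη.le hη1
    linarith
  set K := C * B ^ (k + 4) * (t.im ^ k)⁻¹ * θ with hK
  have hK0 : 0 < K := by positivity
  have maj : ∀ (γ : SL(2, ℤ)) (n : ℕ), (∀ i j, (γ i j).natAbs ≤ n) →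
      ((max (γ 1 0).natAbs (γ 1 1).natAbs : ℕ) : ℝ) *
        majK k t (γ 0 0 * τ + γ 0 1) (γ 1 0 * τ + γ 1 1) ≤ K * n ^ 4 := by
    intro γ n hn
    have hdet := Matrix.SpecialLinearGroup.det_coe γ
    rw [Matrix.det_fin_two] at hdet
    set a := γ 0 0
    set b := γ 0 1
    set c := γ 1 0
    set d := γ 1 1
    have hdetR : (a : ℝ) * d - b * c = 1 := by exact_mod_cast hdet
    have harea : ((a * τ + b) * conj (c * τ + d : ℂ)).im = τ.im := by
      simp [Complex.mul_im]
      linear_combination τ.im * hdetR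
    have hq1 : 1 ≤ max c.natAbs d.natAbs := by
      by_contra! h
      have h1 : c = 0 := by omega
      have h2 : d = 0 := by omega
      rw [h1, h2] at hdet; simp at hdet
    have hqn : max c.natAbs d.natAbs ≤ n := max_le (hn 1 0) (hn 1 1)
    obtain ⟨r1, r2, r3⟩ := row_bounds hη hη1 hτ hre c d
    have hmax : max a.natAbs b.natAbs ≤ n := max_le (hn 0 0) (hn 0 1)
    refine H (B := B) ht ht1 (by rw [harea]; exact hY) (by exact_mod_cast hq1)
      (by exact_mod_cast hqn) hB1 (r1.trans (by gcongr)) ?_ (fun j => ?_) ?_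
    · rw [harea]; exact r2.trans (by gcongr)
    · have e : (a * τ + b + j * (c * τ + d) : ℂ) =
          ((a + j * c : ℤ) : ℂ) * τ + ((b + j * d : ℤ) : ℂ) := by push_cast; ring
      rw [e]
      refine le_trans ?_ ((row_bounds hη hη1 hτ hre (a + j * c) (b + j * d)).1.trans
        (by gcongr))
      have : 1 ≤ max (a + j * c).natAbs (b + j * d).natAbs := by
        by_contra! h
        have h1 : a + j * c = 0 := by omega
        have h2 : b + j * d = 0 := by omega
        have : a * d - b * c = 0 := by linear_combination d * h1 - c * h2
        omega
      exact_mod_cast this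
    · refine hθ.imp_right fun ⟨h1, h2, h3⟩ => ⟨h1, h2, ?_⟩
      have r4 := (row_bounds hη hη1 hτ hre a b).2.2 h3
      have hz2 : 0 < ‖(c : ℂ) * τ + d‖ := by
        have : (1 : ℝ) ≤ (max c.natAbs d.natAbs : ℕ) := by exact_mod_cast hq1
        by_contra! h
        have h0 : 0 < 3 / η ^ 2 := by positivity
        nlinarith
      have hnq : ((max c.natAbs d.natAbs : ℕ) : ℝ) ≤ n := by exact_mod_cast hqn
      have hnp : ((max a.natAbs b.natAbs : ℕ) : ℝ) ≤ n := by exact_mod_cast hmax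
      rw [norm_div, mul_add, mul_one, mul_div_assoc', mul_comm _ ‖(a : ℂ) * τ + b‖,
        mul_div_assoc]
      have e1 : ((max c.natAbs d.natAbs : ℕ) : ℝ) / ‖(c : ℂ) * τ + d‖ ≤ 3 / η ^ 2 := by
        rw [div_le_iff₀ hz2]; exact r1
      calc _ ≤ (n : ℝ) + (3 / η * n) * (3 / η ^ 2) := by gcongr; exact r4.trans (by gcongr)
        _ = (η ^ 3 + 9) / η ^ 3 * n := by field_simp; ring
        _ ≤ B * n := by
          rw [hBdef]; gcongr
          have := pow_le_one₀ (n := 3) hη.le hη1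
          linarith
  have edge : ∀ (γ : SL(2, ℤ)) (n : ℕ), (∀ i j, (γ i j).natAbs ≤ n) →
      ‖edgeK k t (γ • ⟨τ, 1, α, β⟩)‖ ≤ 16 * V ^ 2 * K * n ^ 5 := by
    intro γ n hn
    have m1 := maj γ n hn
    have m2 := maj (S * γ) n (by
      intro i j
      fin_cases i <;> simpa [Matrix.mul_apply, Fin.sum_univ_two] using hn _ _)
    have area0 : (γ • (⟨τ, 1, α, β⟩ : PeriodPt)).area = τ.im := by
      rw [PeriodPt.area_smul]; simp [PeriodPt.area]
    rw [edgeK, if_pos (by rw [area0]; exact hY)]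
    have hA := area0
    simp only [PeriodPt.smul_def, PeriodPt.area, mul_one] at hA ⊢
    simp only [coe_mul, coe_S, Matrix.mul_apply, Fin.sum_univ_two, Matrix.of_apply,
      Matrix.cons_val', Matrix.cons_val_zero, Matrix.cons_val_one, Matrix.cons_val_fin_one,
      zero_mul, one_mul, zero_add, add_zero, neg_mul, Int.cast_neg] at m2
    rw [← neg_add] at m2
    set a := γ 0 0
    set b := γ 0 1
    set c := γ 1 0
    set d := γ 1 1
    obtain ⟨b1, b2⟩ := norm_le_majK hk ht (by rw [hA]; exact hY)
    obtain ⟨b3, -⟩ := norm_le_majK hk ht (z₁ := -(c * τ + d)) (z₂ := a * τ + b) (by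
      have hA' := hA ▸ hY
      simp [Complex.mul_im] at hA' ⊢
      linarith)
    set M1 := majK k t (a * τ + b) (c * τ + d)
    set M2 := majK k t (-(c * τ + d)) (a * τ + b)
    have hM1 : 0 ≤ M1 := (norm_nonneg _).trans b1
    have hM2 : 0 ≤ M2 := (norm_nonneg _).trans b3
    set q : ℝ := ((max c.natAbs d.natAbs : ℕ) : ℝ) with hq
    set p : ℝ := ((max a.natAbs b.natAbs : ℕ) : ℝ) with hp
    have hqn : q ≤ n := by rw [hq]; exact_mod_cast max_le (hn 1 0) (hn 1 1)
    have hpn : p ≤ n := by rw [hp]; exact_mod_cast max_le (hn 0 0) (hn 0 1)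
    have hq0 : 0 ≤ q := Nat.cast_nonneg _
    have hp0 : 0 ≤ p := Nat.cast_nonneg _
    have lin : ∀ (u v : ℤ) (s : ℝ), ((max u.natAbs v.natAbs : ℕ) : ℝ) ≤ s →
        ‖(u : ℂ)‖ ≤ s ∧ ‖(v : ℂ)‖ ≤ s := by
      intro u v s hs
      rw [Nat.cast_max, Nat.cast_natAbs, Nat.cast_natAbs] at hs
      simp only [Complex.norm_intCast]
      push_cast at hs
      exact max_le_iff.1 hs
    obtain ⟨c1, c2⟩ := lin c d q le_rfl
    obtain ⟨c3, c4⟩ := lin a b p le_rfl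
    have hα' : ‖(d : ℂ) * α - c * β‖ ≤ 2 * q * V := by
      refine (norm_sub_le _ _).trans ?_
      rw [norm_mul, norm_mul]
      calc _ ≤ q * V + q * V := by gcongr
        _ = _ := by ring
    have hβ' : ‖-((b : ℂ) * α) + a * β‖ ≤ 2 * p * V := by
      refine (norm_add_le _ _).trans ?_
      rw [norm_neg, norm_mul, norm_mul]
      calc _ ≤ p * V + p * V := by gcongr
        _ = _ := by ring
    refine (norm_add_le _ _).trans ((add_le_add_left (norm_add_le _ _) _).trans ?_)
    simp only [norm_neg, norm_mul, norm_pow, Complex.norm_ofNat]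
    calc _ ≤ (2 * q * V) ^ 2 * M1 + 2 * (2 * q * V) * (2 * p * V) * M1
          + (2 * p * V) ^ 2 * M2 := by gcongr
      _ = 4 * V ^ 2 * (q * (q * M1)) + 8 * V ^ 2 * (p * (q * M1)) + 4 * V ^ 2 * (p * (p * M2)) := by
          ring
      _ ≤ 4 * V ^ 2 * (n * (K * n ^ 4)) + 8 * V ^ 2 * (n * (K * n ^ 4))
          + 4 * V ^ 2 * (n * (K * n ^ 4)) := by gcongr
      _ = _ := by ring
  refine ((edgeCocycle_edgeK hk hke ht).norm_rowSum_le (by positivity) edge hcd).trans_eq ?_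
  rw [hK, hBdef, div_pow, ← pow_mul]
  ring

end CocycleBounds

section Weights

open ModularGroup Matrix.SpecialLinearGroup EisensteinSeries ModularForm ModularFormClass UpperHalfPlane
open scoped MatrixGroups ComplexConjugate

lemma bernoulli_eight_twelve : bernoulli 8 = -1 / 30 ∧ bernoulli 12 = -691 / 2730 := by
  have h5 : bernoulli' 5 = 0 := bernoulli'_eq_zero_of_odd (by decide) (by norm_num)
  have h7 : bernoulli' 7 = 0 := bernoulli'_eq_zero_of_odd (by decide) (by norm_num)
  have h9 : bernoulli' 9 = 0 := bernoulli'_eq_zero_of_odd (by decide) (by norm_num)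
  have h11 : bernoulli' 11 = 0 := bernoulli'_eq_zero_of_odd (by decide) (by norm_num)
  have h6 : bernoulli' 6 = 1 / 42 := by
    rw [bernoulli'_def]; norm_num [Finset.sum_range_succ, h5, Nat.choose]
  have h8 : bernoulli' 8 = -1 / 30 := by
    rw [bernoulli'_def]; norm_num [Finset.sum_range_succ, h5, h6, h7, Nat.choose]
  have h10 : bernoulli' 10 = 5 / 66 := by
    rw [bernoulli'_def]; norm_num [Finset.sum_range_succ, h5, h6, h7, h8, h9, Nat.choose]
  rw [bernoulli_eq_bernoulli'_of_ne_one (by norm_num), bernoulli_eq_bernoulli'_of_ne_one (by norm_num)]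
  refine ⟨h8, ?_⟩
  rw [bernoulli'_def]
  norm_num [Finset.sum_range_succ, h5, h6, h7, h8, h9, h10, h11, Nat.choose]

/-- The combination `E₄ E₈ - E₁₂` is a nonzero multiple of the discriminant. -/
lemma exists_eisenstein_eq_discriminant : ∃ c : ℂ, c ≠ 0 ∧ ∀ z : ℍ,
    E (k := 4) (by norm_num) z * E (k := 8) (by norm_num) z - E (k := 12) (by norm_num) z =
      c * discriminant z := by
  set E8 : ModularForm 𝒮ℒ 8 := E (by norm_num : 3 ≤ 8)
  set E12 : ModularForm 𝒮ℒ 12 := E (by norm_num : 3 ≤ 12)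
  let f : ModularForm 𝒮ℒ 12 := ModularForm.mcast (by norm_num) (E₄.mul E8) - E12
  have hf : ∀ z, f z = E₄ z * E8 z - E12 z := fun z => by
    simp only [f, ModularForm.coe_mcast, ModularForm.coe_mul, sub_apply, Pi.mul_apply]
  have hq : qExpansion 1 f = qExpansion 1 E₄ * qExpansion 1 E8 - qExpansion 1 E12 := by
    simp only [f, FunLike.coe_sub, ModularForm.coe_mcast,
      ModularForm.qExpansion_sub one_pos one_mem_strictPeriods_SL,
      ModularForm.qExpansion_mul one_pos one_mem_strictPeriods_SL]
  have h0 : ModularForm.IsCuspForm f := by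
    simp [ModularForm.isCuspForm_iff_coeffZero_eq_zero, hq, PowerSeries.coeff_mul,
      -PowerSeries.coeff_zero_eq_constantCoeff, E8, E12,
      E_qExpansion_coeff_zero _ (show Even 4 by decide),
      E_qExpansion_coeff_zero _ (show Even 8 by decide),
      E_qExpansion_coeff_zero _ (show Even 12 by decide)]
  have h1 : (qExpansion 1 f).coeff 1 ≠ 0 := by
    rw [hq]
    norm_num [PowerSeries.coeff_mul, Finset.Nat.antidiagonal_succ, E₄_qExpansion_coeff_one, E8, E12,
      E_qExpansion_coeff_zero _ (show Even 4 by decide),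
      E_qExpansion_coeff_zero _ (show Even 8 by decide),
      E_qExpansion_coeff _ (show Even 8 by decide), E_qExpansion_coeff _ (show Even 12 by decide),
      bernoulli_eight_twelve.1, bernoulli_eight_twelve.2, -PowerSeries.coeff_zero_eq_constantCoeff]
  obtain ⟨g, hg⟩ := h0
  obtain ⟨c, hc⟩ := CuspForm.exists_smul_discriminant_of_weight_eq_twelve g
  have hgE : (g : ℍ → ℂ) = f := congrArg DFunLike.coe hg
  have hcg : ∀ z, f z = c * discriminant z := fun z => by
    rw [← congr_fun hgE z, ← hc]; rfl
  refine ⟨c, ?_, fun z => by rw [← hcg, hf]⟩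
  rintro rfl
  have hs := ModularForm.qExpansion_smul one_pos one_mem_strictPeriods_SL (0 : ℂ) f
  rw [show (0 : ℂ) • (f : ℍ → ℂ) = f by ext z; simp [hcg]] at hs
  rw [zero_smul] at hs
  rw [hs] at h1
  simp at h1

end Weights

section EdgeForms

open ModularGroup Matrix.SpecialLinearGroup
open scoped MatrixGroups ComplexConjugate

/-- Functions that are quadratic in the linear form and homogeneous and holomorphic in the
periods. -/
structure IsForm (k : ℕ) (f : PeriodPt → ℂ) : Prop where
  zero : ∀ x, x.area ≤ 0 → f x = 0
  quad : ∀ z₁ z₂, ∃ A B C, ∀ α β, f ⟨z₁, z₂, α, β⟩ = α ^ 2 * A + α * β * B + β ^ 2 * C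
  homog : ∀ u : ℂ, u ≠ 0 → ∀ z₁ z₂ α β, f ⟨u * z₁, u * z₂, α, β⟩ = (u ^ k)⁻¹ * f ⟨z₁, z₂, α, β⟩
  hol : ∀ (γ : SL(2, ℤ)) α β, DifferentiableOn ℂ (fun τ => f (γ • ⟨τ, 1, α, β⟩)) {τ | 0 < τ.im}

lemma IsForm.const_zero (k : ℕ) : IsForm k fun _ => 0 where
  zero _ _ := rfl
  quad _ _ := ⟨0, 0, 0, by simp⟩
  homog := by simp
  hol _ _ _ := differentiableOn_const _

lemma IsForm.add {k : ℕ} {f g : PeriodPt → ℂ} (hf : IsForm k f) (hg : IsForm k g) :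
    IsForm k fun x => f x + g x where
  zero x hx := by simp [hf.zero x hx, hg.zero x hx]
  quad z₁ z₂ := by
    obtain ⟨A, B, C, h⟩ := hf.quad z₁ z₂
    obtain ⟨A', B', C', h'⟩ := hg.quad z₁ z₂
    exact ⟨A + A', B + B', C + C', fun α β => by rw [h, h']; ring⟩
  homog u hu z₁ z₂ α β := by rw [hf.homog u hu, hg.homog u hu]; ring
  hol γ α β := (hf.hol γ α β).add (hg.hol γ α β)

lemma IsForm.smul {k : ℕ} {f : PeriodPt → ℂ} (hf : IsForm k f) (γ : SL(2, ℤ)) :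
    IsForm k fun x => f (γ • x) where
  zero x hx := hf.zero _ (by rwa [PeriodPt.area_smul])
  quad z₁ z₂ := by
    simp only [PeriodPt.smul_def]
    obtain ⟨A, B, C, h⟩ := hf.quad (γ 0 0 * z₁ + γ 0 1 * z₂) (γ 1 0 * z₁ + γ 1 1 * z₂)
    generalize ((γ 0 0 : ℤ) : ℂ) = a at h ⊢
    generalize ((γ 0 1 : ℤ) : ℂ) = b at h ⊢
    generalize ((γ 1 0 : ℤ) : ℂ) = c at h ⊢
    generalize ((γ 1 1 : ℤ) : ℂ) = d at h ⊢
    refine ⟨d ^ 2 * A - d * b * B + b ^ 2 * C,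
      -2 * c * d * A + (a * d + b * c) * B - 2 * a * b * C, c ^ 2 * A - c * a * B + a ^ 2 * C,
      fun α β => by rw [h]; ring⟩
  homog u hu z₁ z₂ α β := by
    simp only [PeriodPt.smul_def]
    rw [← hf.homog u hu]
    congr 2 <;> ring
  hol γ' α β := by simpa only [mul_smul] using hf.hol (γ * γ') α β

lemma differentiableOn_rayK {k : ℕ} (hk : 4 ≤ k) {l m : ℂ} (hl : l ≠ 0) (hlm : 0 ≤ (m / l).im)
    {f g : ℂ → ℂ} {s : Set ℂ} (hf : DifferentiableOn ℂ f s) (hg : DifferentiableOn ℂ g s)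
    (h : ∀ z ∈ s, 0 < (f z * conj (g z)).im) :
    DifferentiableOn ℂ (fun z => rayK k l m (f z) (g z)) s := by
  have h0 : ∀ z ∈ s, g z ≠ 0 := fun z hz => ne_zero_of_area (h z hz)
  refine (((hg.const_mul l).pow k).inv fun z hz => pow_ne_zero _ (mul_ne_zero hl (h0 z hz))).mul
    ((differentiableOn_halfSum hk).comp ((hf.div hg h0).add_const _) fun z hz => ?_)
  have := h z hz
  have h1 : 0 < ‖g z‖ := norm_pos_iff.2 (h0 z hz)
  have h2 : 0 < (f z / g z).im := by rw [im_div_eq_area]; positivity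
  exact (by rw [Complex.add_im]; positivity : 0 < (f z / g z + m / l).im)

lemma differentiableOn_diagK {k : ℕ} (hk : 4 ≤ k) {t : ℂ} (ht : 0 < t.im)
    {f g : ℂ → ℂ} {s : Set ℂ} (hf : DifferentiableOn ℂ f s) (hg : DifferentiableOn ℂ g s)
    (h : ∀ z ∈ s, 0 < (f z * conj (g z)).im) :
    DifferentiableOn ℂ (fun z => diagK k t (f z) (g z)) s := by
  have h' : ∀ z ∈ s, 0 < ((f z + g z) * conj (g z)).im := fun z hz => by
    rw [area_add]; exact h z hz
  have hi : ∀ s : ℂ, 0 < s.im → 0 ≤ (-1 / s).im := fun s hs => (im_neg_one_div_pos hs).le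
  have h1 : 0 < (t + 1).im := by simpa using ht
  have h2 : 0 < (t - 1).im := by simpa using ht
  have h3 : 0 ≤ (t / 1).im := by simpa using ht.le
  have hfg := hf.add hg
  exact (((((differentiableOn_rayK hk one_ne_zero h3 hf hg h).add
    (differentiableOn_rayK hk one_ne_zero h3 hfg hg h')).add
    (differentiableOn_rayK hk (ne_zero_of_im ht) (hi _ ht) hf hg h)).add
    (differentiableOn_rayK hk (ne_zero_of_im ht) (hi _ ht) hfg hg h')).sub
    (differentiableOn_rayK hk (ne_zero_of_im h1) (hi _ h1) hfg hg h')).sub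
    (differentiableOn_rayK hk (ne_zero_of_im h2) (hi _ h2) hf hg h)

lemma add_mul_ne_zero_of_area {t z₁ z₂ : ℂ} (ht : 0 < t.im) (h : 0 < (z₁ * conj z₂).im) :
    z₁ + t * z₂ ≠ 0 ∧ t * z₁ - z₂ ≠ 0 := by
  have h2 := ne_zero_of_area h
  have h3 : 0 < (z₁ / z₂).im := by
    rw [im_div_eq_area]
    have : 0 < ‖z₂‖ := norm_pos_iff.2 h2
    positivity
  have h1 : z₁ ≠ 0 := fun h => by simp [h] at h3
  constructor
  · rw [show z₁ + t * z₂ = z₂ * (z₁ / z₂ + t) by field_simp]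
    exact mul_ne_zero h2 (ne_zero_of_im (by rw [Complex.add_im]; positivity))
  · have h4 : 0 < (-1 / (z₁ / z₂)).im := im_neg_one_div_pos h3
    rw [show t * z₁ - z₂ = z₁ * (t + -1 / (z₁ / z₂)) by field_simp; ring]
    exact mul_ne_zero h1 (ne_zero_of_im (by rw [Complex.add_im]; positivity))

lemma rayK_homog (k : ℕ) (l m z₁ z₂ : ℂ) {u : ℂ} (hu : u ≠ 0) :
    rayK k l m (u * z₁) (u * z₂) = (u ^ k)⁻¹ * rayK k l m z₁ z₂ := by
  rw [rayK, rayK, mul_div_mul_left _ _ hu, mul_left_comm, mul_pow, mul_inv, mul_assoc]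

lemma isForm_edgeK {k : ℕ} (hk : 4 ≤ k) {t : ℂ} (ht : 0 < t.im) : IsForm k (edgeK k t) where
  zero x hx := if_neg hx.not_gt
  quad z₁ z₂ := by
    by_cases h : 0 < (z₁ * conj z₂).im
    · refine ⟨-diagK k t z₁ z₂, 2 * inhomK k t z₁ z₂, diagK k t (-z₂) z₁, fun α β => ?_⟩
      rw [edgeK, PeriodPt.area]; dsimp only; rw [if_pos h]; ring
    · exact ⟨0, 0, 0, fun α β => by rw [edgeK, PeriodPt.area]; dsimp only; rw [if_neg h]; ring⟩
  homog u hu z₁ z₂ α β := by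
    have harea : (0 < (PeriodPt.mk (u * z₁) (u * z₂) α β).area) =
        (0 < (PeriodPt.mk z₁ z₂ α β).area) := by
      have : (PeriodPt.mk (u * z₁) (u * z₂) α β).area =
          ‖u‖ ^ 2 * (PeriodPt.mk z₁ z₂ α β).area := by
        rw [PeriodPt.area, PeriodPt.area, map_mul, mul_mul_mul_comm, Complex.mul_conj,
          Complex.normSq_eq_norm_sq, Complex.im_ofReal_mul]
      have h0 : 0 < ‖u‖ := norm_pos_iff.2 hu
      rw [this, mul_pos_iff_of_pos_left (by positivity)]
    have hd : ∀ z₁ z₂, diagK k t (u * z₁) (u * z₂) = (u ^ k)⁻¹ * diagK k t z₁ z₂ := by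
      intro z₁ z₂
      simp only [diagK, ← mul_add, rayK_homog _ _ _ _ _ hu]
      ring
    have hi : inhomK k t (u * z₁) (u * z₂) = (u ^ k)⁻¹ * inhomK k t z₁ z₂ := by
      rw [inhomK, inhomK, mul_left_comm t, mul_left_comm t, ← mul_add, ← mul_sub, mul_pow, mul_pow,
        mul_inv, mul_inv, mul_add]
    simp only [edgeK, harea, ← mul_neg, hd, hi]
    split_ifs <;> ring
  hol γ α β := by
    have hA : ∀ τ ∈ {τ : ℂ | 0 < τ.im}, 0 < (γ • PeriodPt.mk τ 1 α β).area := fun τ hτ => by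
      rw [PeriodPt.area_smul]; simpa [PeriodPt.area] using hτ
    refine DifferentiableOn.congr (f := fun τ => _) ?_ fun τ hτ => by
      rw [edgeK, if_pos (hA τ hτ)]
    simp only [PeriodPt.smul_def, PeriodPt.area] at hA ⊢
    have hB : ∀ τ ∈ {τ : ℂ | 0 < τ.im},
        0 < (-(γ 1 0 * τ + γ 1 1 * 1) * conj (γ 0 0 * τ + γ 0 1 * 1)).im := fun τ hτ => by
      have := hA τ hτ
      simp [Complex.mul_im] at this ⊢
      linarith
    have d1 : DifferentiableOn ℂ (fun τ : ℂ => γ 0 0 * τ + γ 0 1 * 1) {τ | 0 < τ.im} := by fun_prop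
    have d2 : DifferentiableOn ℂ (fun τ : ℂ => γ 1 0 * τ + γ 1 1 * 1) {τ | 0 < τ.im} := by fun_prop
    refine (((differentiableOn_diagK hk ht d1 d2 hA).const_mul _).neg.add
      (DifferentiableOn.const_mul ?_ _)).add ((differentiableOn_diagK hk ht d2.neg d1 hB).const_mul _)
    exact (((d1.add (d2.const_mul t)).pow k).inv fun τ hτ =>
      pow_ne_zero _ (add_mul_ne_zero_of_area ht (hA τ hτ)).1).add
      ((((d1.const_mul t).sub d2).pow k).inv fun τ hτ =>
      pow_ne_zero _ (add_mul_ne_zero_of_area ht (hA τ hτ)).2)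

lemma isForm_rowSum {k : ℕ} (hk : 4 ≤ k) {t : ℂ} (ht : 0 < t.im) (c d : ℤ) :
    IsForm k (rowSum (edgeK k t) c d) :=
  rowSum_induction (IsForm k) (.const_zero k) (fun _ _ => .add) (isForm_edgeK hk ht).smul c d

end EdgeForms

section RowAverage

open ModularGroup Matrix.SpecialLinearGroup EisensteinSeries Matrix
open scoped MatrixGroups ComplexConjugate

def rowForm (v : Fin 2 → ℤ) (x : PeriodPt) : ℂ := v 0 * x.z₁ + v 1 * x.z₂

/-- The height of a row. -/
def rowHt (v : Fin 2 → ℤ) : ℝ := (max (v 0).natAbs (v 1).natAbs : ℕ)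

noncomputable def latSum (k : ℕ) (x : PeriodPt) : ℂ := ∑' p : gammaSet 1 1 0, (rowForm p x ^ k)⁻¹

noncomputable def rowWt (v : Fin 2 → ℤ) (x : PeriodPt) : ℂ :=
  latSum 4 x * (rowForm v x ^ 8)⁻¹ - 2 * (rowForm v x ^ 12)⁻¹

noncomputable def latDisc (x : PeriodPt) : ℂ := latSum 4 x * latSum 8 x - 2 * latSum 12 x

/-- The weighted sum of `rowSum e` over all rows. -/
noncomputable def rowAvg (e : PeriodPt → ℂ) (x : PeriodPt) : ℂ :=
  ∑' p : gammaSet 1 1 0, rowSum e (p.1 0) (p.1 1) x * rowWt p x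

/-- Right multiplication by `γ` on coprime rows. -/
noncomputable def rowEquiv (γ : SL(2, ℤ)) : gammaSet 1 1 0 ≃ gammaSet 1 1 0 :=
  (gammaSetEquiv 0 γ).trans (gammaSet_one_equiv 1 _ 0)

lemma rowEquiv_apply (γ : SL(2, ℤ)) (p : gammaSet 1 1 0) (j : Fin 2) :
    (rowEquiv γ p).1 j = p.1 0 * γ 0 j + p.1 1 * γ 1 j := by
  change (p.1 ᵥ* (γ : Matrix (Fin 2) (Fin 2) ℤ)) j = _
  simp [Matrix.vecMul, dotProduct, Fin.sum_univ_two]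

lemma rowForm_smul (γ : SL(2, ℤ)) (p : gammaSet 1 1 0) (x : PeriodPt) :
    rowForm p (γ • x) = rowForm (rowEquiv γ p) x := by
  simp only [rowForm, PeriodPt.smul_def, rowEquiv_apply]
  push_cast
  ring

lemma latSum_smul (k : ℕ) (γ : SL(2, ℤ)) (x : PeriodPt) : latSum k (γ • x) = latSum k x := by
  simp only [latSum, rowForm_smul]
  exact (rowEquiv γ).tsum_eq fun p => (rowForm p x ^ k)⁻¹

lemma rowWt_smul (γ : SL(2, ℤ)) (p : gammaSet 1 1 0) (x : PeriodPt) :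
    rowWt p (γ • x) = rowWt (rowEquiv γ p) x := by
  simp only [rowWt, latSum_smul, rowForm_smul]

lemma latDisc_smul (γ : SL(2, ℤ)) (x : PeriodPt) : latDisc (γ • x) = latDisc x := by
  simp only [latDisc, latSum_smul]

lemma latSum_homog (k : ℕ) (u z₁ z₂ α β : ℂ) :
    latSum k ⟨u * z₁, u * z₂, α, β⟩ = (u ^ k)⁻¹ * latSum k ⟨z₁, z₂, α, β⟩ := by
  rw [latSum, latSum, ← tsum_mul_left]
  congr 1 with p
  rw [← mul_inv, ← mul_pow]
  simp only [rowForm]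
  ring_nf

lemma rowWt_homog (v : Fin 2 → ℤ) (u z₁ z₂ α β : ℂ) :
    rowWt v ⟨u * z₁, u * z₂, α, β⟩ = (u ^ 12)⁻¹ * rowWt v ⟨z₁, z₂, α, β⟩ := by
  have : rowForm v ⟨u * z₁, u * z₂, α, β⟩ = u * rowForm v ⟨z₁, z₂, α, β⟩ := by
    simp only [rowForm]; ring
  simp only [rowWt, latSum_homog, this, mul_pow, mul_inv]
  ring

lemma latDisc_homog (u z₁ z₂ α β : ℂ) :
    latDisc ⟨u * z₁, u * z₂, α, β⟩ = (u ^ 12)⁻¹ * latDisc ⟨z₁, z₂, α, β⟩ := by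
  simp only [latDisc, latSum_homog]
  ring

lemma rowAvg_homog {k : ℕ} {e : PeriodPt → ℂ} (h : ∀ c d, IsForm k (rowSum e c d)) {u : ℂ}
    (hu : u ≠ 0) (z₁ z₂ α β : ℂ) : rowAvg e ⟨u * z₁, u * z₂, α, β⟩ =
      (u ^ k)⁻¹ * (u ^ 12)⁻¹ * rowAvg e ⟨z₁, z₂, α, β⟩ := by
  rw [rowAvg, rowAvg, ← tsum_mul_left]
  congr 1 with p
  rw [rowWt_homog, (h _ _).homog u hu]
  ring

lemma rowHt_pos {p : Fin 2 → ℤ} (hp : p ∈ gammaSet 1 1 0) : 1 ≤ rowHt p := by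
  rw [mem_gammaSet_one] at hp
  have : 1 ≤ max (p 0).natAbs (p 1).natAbs := by
    rcases hp.ne_zero_or_ne_zero with h | h <;> omega
  unfold rowHt
  exact_mod_cast this

lemma summable_rowHt : Summable fun p : gammaSet 1 1 0 => (rowHt p ^ 3)⁻¹ := by
  have := (summable_one_div_norm_rpow (k := 3) (by norm_num)).comp_injective
    (i := ((↑) : gammaSet 1 1 0 → Fin 2 → ℤ)) Subtype.val_injective
  refine this.congr fun p => ?_
  simp only [Function.comp_apply, norm_eq_max_natAbs, rowHt]
  rw [Real.rpow_neg (by positivity)]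
  norm_cast

lemma inv_pow_rowHt_le {p : Fin 2 → ℤ} (hp : p ∈ gammaSet 1 1 0) {m n : ℕ} (h : n ≤ m) :
    (rowHt p ^ m)⁻¹ ≤ (rowHt p ^ n)⁻¹ := by
  have h1 := rowHt_pos hp
  have : 0 < rowHt p := by linarith
  gcongr

section Bounds

variable {η : ℝ} {τ : ℂ} (hη : 0 < η) (hη1 : η ≤ 1) (hτ : η ≤ τ.im) (hre : |τ.re| ≤ 1 / η)

include hη hη1 hτ hre

lemma norm_inv_rowForm_le {p : Fin 2 → ℤ} (hp : p ∈ gammaSet 1 1 0) (m : ℕ) (α β : ℂ) :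
    ‖(rowForm p ⟨τ, 1, α, β⟩ ^ m)⁻¹‖ ≤ (3 / η ^ 2) ^ m * (rowHt p ^ m)⁻¹ := by
  have h := (row_bounds hη hη1 hτ hre (p 0) (p 1)).1
  have h1 := rowHt_pos hp
  change rowHt p ≤ _ at h
  have h0 : 0 < rowHt p := by linarith
  rw [rowForm, mul_one, norm_inv, norm_pow, ← inv_pow, ← inv_pow, ← mul_pow]
  gcongr
  rw [inv_eq_one_div, div_le_iff₀ (by by_contra! h'; nlinarith [show 0 < 3 / η ^ 2 by positivity]),
    mul_right_comm, ← div_eq_mul_inv, le_div_iff₀ h0, one_mul]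
  exact h

lemma norm_latSum_le {m : ℕ} (hm : 3 ≤ m) (α β : ℂ) :
    Summable (fun p : gammaSet 1 1 0 => (rowForm p ⟨τ, 1, α, β⟩ ^ m)⁻¹) ∧
    ‖latSum m ⟨τ, 1, α, β⟩‖ ≤ (3 / η ^ 2) ^ m * ∑' p : gammaSet 1 1 0, (rowHt p ^ 3)⁻¹ := by
  have hb : ∀ p : gammaSet 1 1 0, ‖(rowForm p ⟨τ, 1, α, β⟩ ^ m)⁻¹‖ ≤
      (3 / η ^ 2) ^ m * (rowHt p ^ 3)⁻¹ := fun p =>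
    (norm_inv_rowForm_le hη hη1 hτ hre p.2 m α β).trans
      (mul_le_mul_of_nonneg_left (inv_pow_rowHt_le p.2 hm) (by positivity))
  have hs := summable_rowHt.mul_left ((3 / η ^ 2) ^ m)
  exact ⟨.of_norm_bounded hs hb, (tsum_of_norm_bounded hs.hasSum hb).trans_eq tsum_mul_left⟩

lemma norm_rowWt_le {p : Fin 2 → ℤ} (hp : p ∈ gammaSet 1 1 0) (α β : ℂ) :
    ‖rowWt p ⟨τ, 1, α, β⟩‖ ≤ (3 / η ^ 2) ^ 12 * (∑' p : gammaSet 1 1 0, (rowHt p ^ 3)⁻¹ + 2) *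
      (rowHt p ^ 8)⁻¹ := by
  have h1 := (norm_latSum_le hη hη1 hτ hre (m := 4) (by norm_num) α β).2
  have h2 := norm_inv_rowForm_le hη hη1 hτ hre hp 8 α β
  have h3 := norm_inv_rowForm_le hη hη1 hτ hre hp 12 α β
  set Z := ∑' p : gammaSet 1 1 0, (rowHt p ^ 3)⁻¹
  have h4 := inv_pow_rowHt_le hp (show 8 ≤ 12 by norm_num)
  calc _ ≤ ‖latSum 4 ⟨τ, 1, α, β⟩‖ * ‖(rowForm p ⟨τ, 1, α, β⟩ ^ 8)⁻¹‖ +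
        2 * ‖(rowForm p ⟨τ, 1, α, β⟩ ^ 12)⁻¹‖ := by
        rw [rowWt]; refine (norm_sub_le _ _).trans_eq ?_; rw [norm_mul, norm_mul]; norm_num
    _ ≤ (3 / η ^ 2) ^ 4 * Z * ((3 / η ^ 2) ^ 8 * (rowHt p ^ 8)⁻¹) +
        2 * ((3 / η ^ 2) ^ 12 * (rowHt p ^ 8)⁻¹) := by
        gcongr
        · exact (norm_nonneg _).trans h1
        · exact h3.trans (by gcongr)
    _ = _ := by ring

end Bounds

lemma exists_avgTerm_le {k : ℕ} (hk : 4 ≤ k) (hke : Even k) {η : ℝ} (hη : 0 < η) (hη1 : η ≤ 1) :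
    ∃ C, 0 < C ∧ ∀ {t τ α β : ℂ} {V θ : ℝ}, 0 < t.im → t.im ≤ 1 → η ≤ τ.im → |τ.re| ≤ 1 / η →
      ‖α‖ ≤ V → ‖β‖ ≤ V → (θ = 1 ∨ θ = ((1 + ‖t‖) ^ 3)⁻¹ ∧ 0 ≤ t.re ∧ τ.im ≤ 1) →
      ∀ p : gammaSet 1 1 0,
      ‖rowSum (edgeK k t) (p.1 0) (p.1 1) ⟨τ, 1, α, β⟩ * rowWt p ⟨τ, 1, α, β⟩‖ ≤
        C * ((t.im ^ k)⁻¹ * θ * V ^ 2) * (rowHt p ^ 3)⁻¹ := by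
  obtain ⟨C, hC, H⟩ := exists_rowSum_le hk hke
  obtain ⟨Z, hZd⟩ : ∃ Z, Z = ∑' p : gammaSet 1 1 0, (rowHt p ^ 3)⁻¹ := ⟨_, rfl⟩
  have hZ : 0 ≤ Z := hZd ▸ tsum_nonneg fun p => by
    have := rowHt_pos p.2
    positivity
  refine ⟨C * (η ^ (3 * (k + 4)))⁻¹ * ((3 / η ^ 2) ^ 12 * (Z + 2)), by positivity, ?_⟩
  intro t τ α β V θ ht ht1 hτ hre hα hβ hθ p
  have h1 := H ht ht1 hη hη1 hτ hre hα hβ hθ ((mem_gammaSet_one _).1 p.2)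
  have h2 := norm_rowWt_le hη hη1 hτ hre p.2 α β
  rw [← hZd] at h2
  have h3 := rowHt_pos p.2
  have h4 : 0 < rowHt p := by linarith
  rw [norm_mul]
  refine (mul_le_mul h1 h2 (norm_nonneg _) ((norm_nonneg _).trans h1)).trans_eq ?_
  change _ * rowHt p ^ 5 * _ = _
  rw [show rowHt p ^ 8 = rowHt p ^ 5 * rowHt p ^ 3 by ring]
  field_simp

end RowAverage

section AverageAnalysis

open ModularGroup Matrix.SpecialLinearGroup EisensteinSeries Matrix Filter Topology
open scoped MatrixGroups ComplexConjugate

lemma exists_region {τ : ℂ} (hτ : 0 < τ.im) :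
    ∃ η : ℝ, 0 < η ∧ η ≤ 1 ∧ η ≤ τ.im ∧ |τ.re| ≤ 1 / η := by
  have h := abs_nonneg τ.re
  refine ⟨min τ.im (1 + |τ.re|)⁻¹, lt_min hτ (by positivity),
    (min_le_right _ _).trans (inv_le_one_of_one_le₀ (by linarith)), min_le_left _ _, ?_⟩
  rw [le_div_iff₀ (lt_min hτ (by positivity))]
  calc _ ≤ |τ.re| * (1 + |τ.re|)⁻¹ := by gcongr; exact min_le_right _ _
    _ ≤ 1 := by rw [mul_inv_le_iff₀ (by positivity)]; linarith

lemma differentiableOn_tsum_rows {F : gammaSet 1 1 0 → ℂ → ℂ}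
    (hF : ∀ p, DifferentiableOn ℂ (F p) {τ | 0 < τ.im})
    (hb : ∀ η : ℝ, 0 < η → η ≤ 1 → ∃ C, ∀ p (τ : ℂ), η ≤ τ.im → |τ.re| ≤ 1 / η →
      ‖F p τ‖ ≤ C * (rowHt p ^ 3)⁻¹) :
    DifferentiableOn ℂ (fun τ => ∑' p, F p τ) {τ | 0 < τ.im} := by
  intro τ hτ
  obtain ⟨η, h0, h1, h2, h3⟩ := exists_region hτ
  obtain ⟨C, hC⟩ := hb (η / 2) (by positivity) (by linarith)
  have ho : IsOpen {z : ℂ | η / 2 < z.im ∧ |z.re| < 1 / (η / 2)} :=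
    (isOpen_lt continuous_const Complex.continuous_im).inter
      (isOpen_lt Complex.continuous_re.abs continuous_const)
  have hd := Complex.differentiableOn_tsum_of_summable_norm (summable_rowHt.mul_left C)
    (fun p => (hF p).mono fun z hz => (by positivity : 0 < η / 2).trans hz.1) ho
    fun p z hz => hC p z hz.1.le hz.2.le
  refine (hd.differentiableAt (ho.mem_nhds ⟨by linarith, h3.trans_lt ?_⟩)).differentiableWithinAt
  exact one_div_lt_one_div_of_lt (by positivity) (by linarith)

lemma differentiableOn_inv_rowForm (p : gammaSet 1 1 0) (m : ℕ) (α β : ℂ) :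
    DifferentiableOn ℂ (fun τ => (rowForm p ⟨τ, 1, α, β⟩ ^ m)⁻¹) {τ | 0 < τ.im} := by
  refine DifferentiableOn.inv (by simp only [rowForm]; fun_prop) fun τ hτ => pow_ne_zero _ fun h => ?_
  obtain ⟨η, h0, h1, h2, h3⟩ := exists_region hτ
  have h4 := (row_bounds h0 h1 h2 h3 (p.1 0) (p.1 1)).1
  have h5 := rowHt_pos p.2
  simp only [rowForm, mul_one, rowHt] at h h5
  rw [h, norm_zero, mul_zero] at h4
  linarith

lemma differentiableOn_latSum {m : ℕ} (hm : 3 ≤ m) (α β : ℂ) :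
    DifferentiableOn ℂ (fun τ => latSum m ⟨τ, 1, α, β⟩) {τ | 0 < τ.im} :=
  differentiableOn_tsum_rows (fun p => differentiableOn_inv_rowForm p m α β) fun η h0 h1 =>
    ⟨(3 / η ^ 2) ^ m, fun p τ h2 h3 => (norm_inv_rowForm_le h0 h1 h2 h3 p.2 m α β).trans
      (mul_le_mul_of_nonneg_left (inv_pow_rowHt_le p.2 hm) (by positivity))⟩

lemma exists_latDisc_eq : ∃ c : ℂ, c ≠ 0 ∧ ∀ (z : UpperHalfPlane) α β,
    latDisc ⟨z, 1, α, β⟩ = c * ModularForm.discriminant z := by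
  obtain ⟨c, hc, h⟩ := exists_eisenstein_eq_discriminant
  have hE : ∀ {m : ℕ} (hm : 3 ≤ m) (z : UpperHalfPlane) α β,
      latSum m ⟨z, 1, α, β⟩ = 2 * ModularForm.E hm z := fun {m} hm z α β => by
    have : ModularForm.E hm z = (1 / 2 : ℂ) * ∑' v : gammaSet 1 1 0, eisSummand m v z := rfl
    rw [this, latSum, ← mul_assoc]
    norm_num [eisSummand, rowForm]
  refine ⟨4 * c, by simpa, fun z α β => ?_⟩
  rw [latDisc, hE (by norm_num), hE (by norm_num), hE (by norm_num), mul_assoc 4, ← h]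
  ring

variable {k : ℕ} (hk : 4 ≤ k) (hke : Even k) {t : ℂ} (ht : 0 < t.im) (ht1 : t.im ≤ 1)

include hk hke ht ht1

lemma summable_avgTerm {τ : ℂ} (hτ : 0 < τ.im) (α β : ℂ) : Summable fun p : gammaSet 1 1 0 =>
    rowSum (edgeK k t) (p.1 0) (p.1 1) ⟨τ, 1, α, β⟩ * rowWt p ⟨τ, 1, α, β⟩ := by
  obtain ⟨η, h0, h1, h2, h3⟩ := exists_region hτ
  obtain ⟨C, hC, H⟩ := exists_avgTerm_le hk hke h0 h1
  exact .of_norm_bounded (summable_rowHt.mul_left _) (H ht ht1 h2 h3 (le_max_left ‖α‖ ‖β‖)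
    (le_max_right _ _) (.inl rfl))

lemma differentiableOn_rowAvg (α β : ℂ) :
    DifferentiableOn ℂ (fun τ => rowAvg (edgeK k t) ⟨τ, 1, α, β⟩) {τ | 0 < τ.im} := by
  refine differentiableOn_tsum_rows (fun p => ?_) fun η h0 h1 => ?_
  · have := (isForm_rowSum hk ht (p.1 0) (p.1 1)).hol 1 α β
    simp only [one_smul] at this
    exact this.mul (((differentiableOn_latSum (by norm_num) α β).mul
      (differentiableOn_inv_rowForm p 8 α β)).sub
      ((differentiableOn_inv_rowForm p 12 α β).const_mul 2))
  · obtain ⟨C, hC, H⟩ := exists_avgTerm_le hk hke h0 h1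
    exact ⟨_, fun p τ h2 h3 => H ht ht1 h2 h3 (le_max_left ‖α‖ ‖β‖) (le_max_right _ _) (.inl rfl) p⟩

/-- The average of the row sums splits the cocycle. -/
lemma rowAvg_smul {τ : ℂ} (hτ : 0 < τ.im) (α β : ℂ) (γ : SL(2, ℤ)) :
    rowAvg (edgeK k t) (γ • ⟨τ, 1, α, β⟩) = rowAvg (edgeK k t) ⟨τ, 1, α, β⟩ -
      rowSum (edgeK k t) (γ 1 0) (γ 1 1) ⟨τ, 1, α, β⟩ * latDisc ⟨τ, 1, α, β⟩ := by
  set x : PeriodPt := ⟨τ, 1, α, β⟩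
  obtain ⟨η, h0, h1, h2, h3⟩ := exists_region hτ
  have s1 := (norm_latSum_le h0 h1 h2 h3 (m := 8) (by norm_num) α β).1
  have s2 := (norm_latSum_le h0 h1 h2 h3 (m := 12) (by norm_num) α β).1
  have hw : HasSum (fun p : gammaSet 1 1 0 => rowWt p x) (latDisc x) :=
    (s1.hasSum.mul_left _).sub (s2.hasSum.mul_left _)
  have hs := ((summable_avgTerm hk hke ht ht1 hτ α β).hasSum.sub
    (hw.mul_left (rowSum (edgeK k t) (γ 1 0) (γ 1 1) x)))
  rw [← (rowEquiv γ).hasSum_iff] at hs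
  refine (hs.congr_fun ?_).tsum_eq
  intro p
  simp only [Function.comp_apply, rowWt_smul, rowEquiv_apply]
  rw [(edgeCocycle_edgeK hk hke ht).rowSum_mul γ
    (((mem_gammaSet_one _).1 p.2).ne_zero_or_ne_zero) x]
  ring

lemma rowAvg_quad {τ : ℂ} (hτ : 0 < τ.im) (α β : ℂ) : rowAvg (edgeK k t) ⟨τ, 1, α, β⟩ =
    α ^ 2 * rowAvg (edgeK k t) ⟨τ, 1, 1, 0⟩ + α * β * (rowAvg (edgeK k t) ⟨τ, 1, 1, 1⟩ -
      rowAvg (edgeK k t) ⟨τ, 1, 1, 0⟩ - rowAvg (edgeK k t) ⟨τ, 1, 0, 1⟩) +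
    β ^ 2 * rowAvg (edgeK k t) ⟨τ, 1, 0, 1⟩ := by
  have hs := fun α β => (summable_avgTerm hk hke ht ht1 hτ α β).hasSum
  refine (HasSum.tsum_eq (((((hs 1 0).mul_left (α ^ 2)).add ((((hs 1 1).sub (hs 1 0)).sub
    (hs 0 1)).mul_left (α * β))).add ((hs 0 1).mul_left (β ^ 2))).congr_fun fun p => ?_))
  obtain ⟨A, B, C, h⟩ := (isForm_rowSum hk ht (p.1 0) (p.1 1)).quad τ 1
  have hw : ∀ α β, rowWt p ⟨τ, 1, α, β⟩ = rowWt p ⟨τ, 1, 0, 0⟩ := fun _ _ => rfl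
  simp only [h, hw]
  ring

end AverageAnalysis

section PeriodicExpansion

open Filter Topology Function.Periodic

local notation "I∞" => comap Complex.im atTop

lemma eventually_im_pos : ∀ᶠ z : ℂ in I∞, 0 < z.im := tendsto_comap.eventually_gt_atTop 0

lemma eventually_differentiableAt_comap {g : ℂ → ℂ}
    (hd : DifferentiableOn ℂ g {τ | 0 < τ.im}) : ∀ᶠ z : ℂ in I∞, DifferentiableAt ℂ g z :=
  eventually_im_pos.mono fun _ hz =>
    hd.differentiableAt ((isOpen_lt continuous_const Complex.continuous_im).mem_nhds hz)

lemma exists_strip_eq {g : ℂ → ℂ} (hp : Function.Periodic g 1) (τ : ℂ) :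
    ∃ x : ℝ, |x| ≤ 1 / 2 ∧ g τ = g (x + τ.im * I) := by
  refine ⟨τ.re - round τ.re, abs_sub_round _, ?_⟩
  rw [show ((τ.re - round τ.re : ℝ) : ℂ) + τ.im * I = τ - (round τ.re : ℤ) * 1 by
    apply Complex.ext <;> simp, hp.sub_int_mul_eq]

/-- Fourier expansion of a periodic function that is bounded at `i∞`, with Cauchy's estimate and
the maximum principle. -/
lemma exists_periodic_expansion {g : ℂ → ℂ} (hp : Function.Periodic g 1)
    (hd : DifferentiableOn ℂ g {τ | 0 < τ.im}) (hb : BoundedAtFilter I∞ g) : ∃ a : ℕ → ℂ,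
    (∀ τ, 0 < τ.im → HasSum (fun n : ℕ => a n * ee (τ * n)) (g τ)) ∧
    ∀ y M : ℝ, 0 < y → (∀ x : ℝ, |x| ≤ 1 / 2 → ‖g (x + y * I)‖ ≤ M) →
      (∀ n : ℕ, ‖a n‖ ≤ M * Real.exp (2 * π * n * y)) ∧ ∀ τ : ℂ, y ≤ τ.im → ‖g τ‖ ≤ M := by
  have hp' : Function.Periodic g (1 : ℝ) := by simpa using hp
  have h1 : (1 : ℝ) ≠ 0 := one_ne_zero
  have hG : DifferentiableOn ℂ (cuspFunction 1 g) (Metric.ball 0 1) := by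
    intro q hq
    rcases eq_or_ne q 0 with rfl | h0
    · exact (differentiableAt_cuspFunction_zero one_pos hp' (eventually_differentiableAt_comap hd)
        hb).differentiableWithinAt
    · have := im_invQParam_pos_of_norm_lt_one one_pos (by simpa using hq) h0
      rw [← qParam_right_inv h1 h0]
      exact (differentiableAt_cuspFunction h1 hp' (hd.differentiableAt
        ((isOpen_lt continuous_const Complex.continuous_im).mem_nhds this))).differentiableWithinAt
  have hq : ∀ τ : ℂ, cuspFunction 1 g (qParam 1 τ) = g τ := eq_cuspFunction h1 hp'
  refine ⟨fun n => (n.factorial : ℂ)⁻¹ * iteratedDeriv n (cuspFunction 1 g) 0, fun τ hτ => ?_,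
    fun y M hy hM => ?_⟩
  · have := Complex.hasSum_taylorSeries_on_ball hG
      (mem_ball_zero_iff.2 (norm_qParam_lt_one one_pos hτ))
    rw [hq] at this
    refine this.congr_fun fun n => ?_
    simp only [sub_zero, smul_eq_mul, qParam, ee, ← Complex.exp_nat_mul, Complex.ofReal_one, div_one]
    ring_nf
  · set r := Real.exp (-2 * π * y)
    have hr : 0 < r := Real.exp_pos _
    have hr1 : r < 1 := Real.exp_lt_one_iff.2 (by nlinarith [Real.pi_pos])
    have hs : ∀ q ∈ Metric.sphere (0 : ℂ) r, ‖cuspFunction 1 g q‖ ≤ M := by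
      intro q hqr
      rw [mem_sphere_zero_iff_norm] at hqr
      have h0 : q ≠ 0 := norm_pos_iff.1 (hqr ▸ hr)
      have him : (invQParam 1 q).im = y := by
        rw [im_invQParam, hqr, Real.log_exp]
        field_simp
      obtain ⟨x, hx, h⟩ := exists_strip_eq hp (invQParam 1 q)
      rw [← qParam_right_inv h1 h0, hq, h, him]
      exact hM x hx
    have hc : DiffContOnCl ℂ (cuspFunction 1 g) (Metric.ball 0 r) :=
      (hG.mono ((closure_mono (Metric.ball_subset_closedBall)).trans (by
        rw [Metric.isClosed_closedBall.closure_eq]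
        exact Metric.closedBall_subset_ball hr1))).diffContOnCl
    constructor
    · intro n
      have := Complex.norm_iteratedDeriv_le_of_forall_mem_sphere_norm_le n hr hc hs
      rw [norm_mul, norm_inv, Complex.norm_natCast, inv_mul_le_iff₀ (by positivity)]
      refine this.trans_eq ?_
      rw [mul_div_assoc, div_eq_mul_inv M, ← Real.exp_nat_mul, ← Real.exp_neg]
      ring_nf
    · intro τ hτ
      rw [← hq τ]
      refine Complex.norm_le_of_forall_mem_frontier_norm_le Metric.isBounded_ball hc
        (fun q h => hs q (by rwa [frontier_ball 0 hr.ne'] at h)) ?_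
      rw [closure_ball 0 hr.ne', mem_closedBall_zero_iff, norm_qParam, div_one]
      exact Real.exp_le_exp.2 (by nlinarith [Real.pi_pos])

lemma isBigO_exp_of_periodic {g : ℂ → ℂ} (hp : Function.Periodic g 1)
    (hd : DifferentiableOn ℂ g {τ | 0 < τ.im})
    (h0 : Tendsto g (I∞ ⊓ 𝓟 {τ | |τ.re| ≤ 1}) (𝓝 0)) :
    g =O[I∞] fun τ => Real.exp (-2 * π * τ.im) := by
  have hp' : Function.Periodic g (1 : ℝ) := by simpa using hp
  have := exp_decay_of_zero_at_inf one_pos hp' (eventually_differentiableAt_comap hd) (f := g) ?_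
  · simpa using this
  rw [ZeroAtFilter, Metric.tendsto_nhds]
  intro ε hε
  have h1 := Metric.tendsto_nhds.1 h0 ε hε
  rw [eventually_inf_principal, eventually_comap, eventually_atTop] at h1
  obtain ⟨A, hA⟩ := h1
  rw [eventually_comap, eventually_atTop]
  refine ⟨A, fun y hy τ hτ => ?_⟩
  obtain ⟨x, hx, h⟩ := exists_strip_eq hp τ
  rw [h]
  exact hA y hy _ (by simp [hτ]) (by simp; linarith)

lemma tendsto_pow_mul_of_isBigO_exp {g : ℂ → ℂ} (h : g =O[I∞] fun τ => Real.exp (-2 * π * τ.im))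
    (j : ℕ) : Tendsto (fun τ => τ ^ j * g τ) (I∞ ⊓ 𝓟 {τ | |τ.re| ≤ 1}) (𝓝 0) := by
  have h1 : (fun τ : ℂ => τ ^ j) =O[I∞ ⊓ 𝓟 {τ | |τ.re| ≤ 1}] fun τ => τ.im ^ j := by
    refine Asymptotics.IsBigO.pow (.of_bound 2 ?_) j
    filter_upwards [mem_inf_of_left (tendsto_comap.eventually_ge_atTop 1),
      mem_inf_of_right (mem_principal_self _)] with τ h2 h3
    rw [Real.norm_of_nonneg (by linarith)]
    have := Complex.norm_le_abs_re_add_abs_im τ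
    rw [abs_of_nonneg (by linarith : 0 ≤ τ.im)] at this
    linarith [show |τ.re| ≤ 1 from h3]
  refine (h1.mul (h.mono inf_le_left)).trans_tendsto ?_
  have h2 := ((Real.tendsto_pow_mul_exp_neg_atTop_nhds_zero j).comp
    ((tendsto_comap (f := Complex.im)).const_mul_atTop (by positivity : 0 < 2 * π))).const_mul
    ((2 * π) ^ j)⁻¹
  rw [mul_zero] at h2
  refine (h2.mono_left inf_le_left).congr fun τ => ?_
  simp only [Function.comp_apply, mul_pow]
  rw [mul_assoc, inv_mul_cancel_left₀ (by positivity)]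
  ring_nf

end PeriodicExpansion

section Splitting

open ModularGroup Matrix.SpecialLinearGroup EisensteinSeries Matrix Filter Topology Asymptotics
open scoped MatrixGroups ComplexConjugate

local notation "I∞" => comap Complex.im atTop

noncomputable def avgNum (k : ℕ) (t α w τ : ℂ) : ℂ := rowAvg (edgeK k t) ⟨τ, 1, α, w - α * τ⟩

/-- The splitting of the cocycle, as a function of the period and of an invariant linear form. -/
noncomputable def avgU (k : ℕ) (t α w τ : ℂ) : ℂ := avgNum k t α w τ / latDisc ⟨τ, 1, 0, 0⟩

lemma latDisc_ne_zero {τ : ℂ} (hτ : 0 < τ.im) (α β : ℂ) : latDisc ⟨τ, 1, α, β⟩ ≠ 0 := by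
  obtain ⟨c, hc, h⟩ := exists_latDisc_eq
  rw [h ⟨τ, hτ⟩]
  exact mul_ne_zero hc (ModularForm.discriminant_ne_zero _)

lemma exp_isBigO_latDisc :
    (fun τ : ℂ => Real.exp (-2 * π * τ.im)) =O[I∞] fun τ => latDisc ⟨τ, 1, 0, 0⟩ := by
  obtain ⟨c, hc, h⟩ := exists_latDisc_eq
  obtain ⟨K, hK⟩ := ModularForm.exp_isBigO_discriminant.bound
  obtain ⟨A, hA⟩ := UpperHalfPlane.atImInfty_mem _ |>.1 hK
  refine .of_bound (K * ‖c‖⁻¹) ?_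
  filter_upwards [tendsto_comap.eventually_ge_atTop A, eventually_im_pos] with τ h1 h2
  rw [h ⟨τ, h2⟩, norm_mul, mul_assoc K, inv_mul_cancel_left₀ (by simpa)]
  exact hA ⟨τ, h2⟩ h1

variable {k : ℕ} (hk : 4 ≤ k) (hke : Even k) {t : ℂ} (ht : 0 < t.im) (ht1 : t.im ≤ 1)

include hk hke ht ht1

lemma avgNum_periodic (α w : ℂ) : Function.Periodic (avgNum k t α w) 1 := by
  intro τ
  rcases le_or_gt τ.im 0 with hτ | hτ
  · have : ∀ τ : ℂ, τ.im ≤ 0 → avgNum k t α w τ = 0 := fun τ hτ => by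
      simp only [avgNum, rowAvg]
      rw [tsum_congr (g := fun _ => 0), tsum_zero]
      intro p
      rw [(isForm_rowSum hk ht _ _).zero _ (by simpa [PeriodPt.area] using hτ), zero_mul]
    rw [this _ hτ, this _ (by simpa using hτ)]
  · have h := rowAvg_smul hk hke ht ht1 hτ α (w - α * τ) T
    rw [show (T 1 0 : ℤ) = 0 by simp [T], rowSum_zero, zero_mul, sub_zero, PeriodPt.smul_def] at h
    rw [avgNum, avgNum, ← h]
    congr 2 <;> simp [T]
    ring

lemma avgU_periodic (α w : ℂ) : Function.Periodic (avgU k t α w) 1 := by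
  intro τ
  rw [avgU, avgU, avgNum_periodic hk hke ht ht1]
  congr 1
  rw [← latDisc_smul T ⟨τ, 1, 0, 0⟩, PeriodPt.smul_def]
  congr 2 <;> simp [T]

lemma avgNum_eq {τ : ℂ} (hτ : 0 < τ.im) (α w : ℂ) : avgNum k t α w τ =
    α ^ 2 * avgNum k t 1 0 τ + α * w * (avgNum k t 1 1 τ - avgNum k t 1 0 τ - avgNum k t 0 1 τ) +
    w ^ 2 * avgNum k t 0 1 τ := by
  simp only [avgNum, rowAvg_quad hk hke ht ht1 hτ _ (_ - _)]
  ring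

lemma differentiableOn_avgNum (α w : ℂ) : DifferentiableOn ℂ (avgNum k t α w) {τ | 0 < τ.im} := by
  have h := differentiableOn_rowAvg hk hke ht ht1
  refine DifferentiableOn.congr (f := fun τ => _) ?_ fun τ hτ => by
    rw [avgNum, rowAvg_quad hk hke ht ht1 hτ]
  have h1 : DifferentiableOn ℂ (fun τ => w - α * τ) {τ | 0 < τ.im} := by fun_prop
  exact (((h 1 0).const_mul _).add ((h1.const_mul α).mul (((h 1 1).sub (h 1 0)).sub (h 0 1)))).add
    ((h1.pow 2).mul (h 0 1))

lemma differentiableOn_avgU (α w : ℂ) : DifferentiableOn ℂ (avgU k t α w) {τ | 0 < τ.im} :=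
  (differentiableOn_avgNum hk hke ht ht1 α w).div (((differentiableOn_latSum (by norm_num) 0 0).mul
    (differentiableOn_latSum (by norm_num) 0 0)).sub
    ((differentiableOn_latSum (by norm_num) 0 0).const_mul 2)) fun _ hτ => latDisc_ne_zero hτ 0 0

lemma tendsto_rowAvg (α β : ℂ) : Tendsto (fun τ => rowAvg (edgeK k t) ⟨τ, 1, α, β⟩)
    (I∞ ⊓ 𝓟 {τ | |τ.re| ≤ 1}) (𝓝 0) := by
  have hl : ∀ᶠ τ : ℂ in I∞ ⊓ 𝓟 {τ | |τ.re| ≤ 1}, 1 ≤ τ.im ∧ |τ.re| ≤ 1 / 1 := by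
    filter_upwards [mem_inf_of_left (tendsto_comap.eventually_ge_atTop 1),
      mem_inf_of_right (mem_principal_self _)] with τ h2 h3 using ⟨h2, by simpa using h3⟩
  obtain ⟨C, hC, H⟩ := exists_avgTerm_le hk hke one_pos le_rfl
  rw [← tsum_zero (β := gammaSet 1 1 0)]
  refine tendsto_tsum_of_dominated_convergence (summable_rowHt.mul_left _) (fun p => ?_)
    (hl.mono fun τ hτ => H ht ht1 hτ.1 hτ.2 (le_max_left ‖α‖ ‖β‖) (le_max_right _ _) (.inl rfl))
  rcases eq_or_ne (p.1 0) 0 with h0 | h0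
  · simpa only [h0, rowSum_zero, zero_mul] using tendsto_const_nhds
  have hi : ∀ m ≠ 0, Tendsto (fun τ => (rowForm p ⟨τ, 1, α, β⟩ ^ m)⁻¹)
      (I∞ ⊓ 𝓟 {τ | |τ.re| ≤ 1}) (𝓝 0) := fun m hm => by
    refine (tendsto_inv₀_cobounded.comp ((tendsto_pow_cobounded_cobounded hm).comp
      (tendsto_norm_atTop_iff_cobounded.1 ?_)))
    refine tendsto_atTop_mono' _ (hl.mono fun τ hτ => ?_) (tendsto_comap.mono_left inf_le_left)
    refine le_trans ?_ (Complex.abs_im_le_norm _)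
    have : (1 : ℝ) ≤ |(p.1 0 : ℝ)| := by exact_mod_cast Int.one_le_abs h0
    simp only [rowForm, Complex.add_im, Complex.mul_im]
    simp [abs_mul]
    nlinarith [le_abs_self τ.im, abs_nonneg τ.im]
  obtain ⟨C', hC', H'⟩ := exists_rowSum_le hk hke
  have hb : IsBoundedUnder (· ≤ ·) (I∞ ⊓ 𝓟 {τ | |τ.re| ≤ 1})
      (norm ∘ fun τ => rowSum (edgeK k t) (p.1 0) (p.1 1) ⟨τ, 1, α, β⟩) :=
    isBoundedUnder_of_eventually_le (hl.mono fun τ hτ => H' ht ht1 one_pos le_rfl hτ.1 hτ.2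
      (le_max_left ‖α‖ ‖β‖) (le_max_right _ _) (.inl rfl) ((mem_gammaSet_one _).1 p.2))
  have hb' : IsBoundedUnder (· ≤ ·) (I∞ ⊓ 𝓟 {τ | |τ.re| ≤ 1})
      (norm ∘ fun τ => latSum 4 ⟨τ, 1, α, β⟩) :=
    isBoundedUnder_of_eventually_le (hl.mono fun τ hτ =>
      (norm_latSum_le one_pos le_rfl hτ.1 hτ.2 (by norm_num) α β).2)
  refine isBoundedUnder_le_mul_tendsto_zero hb ?_
  have := (isBoundedUnder_le_mul_tendsto_zero hb' (hi 8 (by norm_num))).sub ((hi 12 (by norm_num)).const_mul 2)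
  simpa [rowWt] using this

lemma avgNum_isBigO (α w : ℂ) : avgNum k t α w =O[I∞] fun τ => Real.exp (-2 * π * τ.im) := by
  have hR := tendsto_rowAvg hk hke ht ht1
  have hp := avgNum_periodic hk hke ht ht1
  have hd := differentiableOn_avgNum hk hke ht ht1
  have hpos : ∀ᶠ τ : ℂ in I∞ ⊓ 𝓟 {τ | |τ.re| ≤ 1}, 0 < τ.im := mem_inf_of_left eventually_im_pos
  have hC := isBigO_exp_of_periodic (hp 0 1) (hd 0 1) ((hR 0 1).congr fun τ => by simp [avgNum])
  have hC1 := tendsto_pow_mul_of_isBigO_exp hC 1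
  have hC2 := tendsto_pow_mul_of_isBigO_exp hC 2
  have hB := isBigO_exp_of_periodic (((hp 1 1).sub (hp 1 0)).sub (hp 0 1))
    (((hd 1 1).sub (hd 1 0)).sub (hd 0 1)) (by
      have := ((((hR 1 1).sub (hR 1 0)).sub (hR 0 1))).sub (hC1.const_mul 2)
      simp only [mul_zero, sub_zero] at this
      refine this.congr' (hpos.mono fun τ hτ => ?_)
      simp only [avgNum, Pi.sub_apply, rowAvg_quad hk hke ht ht1 hτ _ (_ - _)]
      ring)
  have hB1 := tendsto_pow_mul_of_isBigO_exp hB 1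
  have hA := isBigO_exp_of_periodic (hp 1 0) (hd 1 0) (by
    have := ((hR 1 0).sub hB1).sub hC2
    simp only [sub_zero] at this
    refine this.congr' (hpos.mono fun τ hτ => ?_)
    simp only [avgNum, Pi.sub_apply, rowAvg_quad hk hke ht ht1 hτ _ (_ - _)]
    ring)
  exact (((hA.const_mul_left (α ^ 2)).add (hB.const_mul_left (α * w))).add
    (hC.const_mul_left (w ^ 2))).congr' (eventually_im_pos.mono fun τ hτ =>
      (avgNum_eq hk hke ht ht1 hτ α w).symm) .rfl

lemma avgU_bounded (α w : ℂ) : BoundedAtFilter I∞ (avgU k t α w) := by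
  have h := ((avgNum_isBigO hk hke ht ht1 α w).trans exp_isBigO_latDisc).mul
    (isBigO_refl (fun τ : ℂ => (latDisc ⟨τ, 1, 0, 0⟩)⁻¹) I∞)
  exact (h.congr' .rfl (g₂ := fun _ => (1 : ℂ)) (eventually_im_pos.mono fun τ hτ =>
    mul_inv_cancel₀ (latDisc_ne_zero hτ 0 0))).trans
    (isBigO_const_const (1 : ℂ) (one_ne_zero : (1 : ℝ) ≠ 0) _)

lemma avgU_eq_smul {τ : ℂ} (hτ : 0 < τ.im) (α w : ℂ) (γ : SL(2, ℤ)) (hu : (γ 1 0 : ℂ) * τ + γ 1 1 ≠ 0) :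
    avgU k t α w τ = (((γ 1 0 : ℂ) * τ + γ 1 1) ^ k)⁻¹ *
      avgU k t (α * (γ 1 0 * τ + γ 1 1) - γ 1 0 * w) (w / (γ 1 0 * τ + γ 1 1))
        ((γ 0 0 * τ + γ 0 1) / (γ 1 0 * τ + γ 1 1)) +
      rowSum (edgeK k t) (γ 1 0) (γ 1 1) ⟨τ, 1, α, w - α * τ⟩ := by
  have h1 := rowAvg_smul hk hke ht ht1 hτ α (w - α * τ) γ
  have h2 := latDisc_smul γ ⟨τ, 1, 0, 0⟩
  have hD : latDisc ⟨τ, 1, α, w - α * τ⟩ = latDisc ⟨τ, 1, 0, 0⟩ := rfl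
  have hdet : (γ 0 0 : ℂ) * γ 1 1 - γ 0 1 * γ 1 0 = 1 := by
    exact_mod_cast (det_fin_two _).symm.trans γ.det_coe
  have h0 := latDisc_ne_zero hτ 0 0
  rw [hD] at h1
  simp only [PeriodPt.smul_def, mul_one, mul_zero, sub_zero, neg_zero, add_zero] at h1 h2
  generalize ((γ 0 0 : ℤ) : ℂ) = a at *
  generalize ((γ 0 1 : ℤ) : ℂ) = b at *
  generalize hc : ((γ 1 0 : ℤ) : ℂ) = c at *
  generalize hd : ((γ 1 1 : ℤ) : ℂ) = d at *
  set u := c * τ + d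
  set τ' := (a * τ + b) / u
  have e1 : a * τ + b = u * τ' := by simp only [τ']; field_simp
  have e3 : d * α - c * (w - α * τ) = α * u - c * w := by simp only [u]; ring
  have e4 : -(b * α) + a * (w - α * τ) = w / u - (α * u - c * w) * τ' := by
    simp only [τ']
    field_simp
    simp only [u]
    linear_combination w * hdet
  have hU := rowAvg_homog (isForm_rowSum hk ht) hu τ' 1 (α * u - c * w)
    (w / u - (α * u - c * w) * τ')
  have hL := latDisc_homog u τ' 1 0 0
  rw [mul_one] at hU hL
  rw [e3, e4, e1, hU] at h1
  rw [e1, hL] at h2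
  rw [avgU, avgU, avgNum, avgNum, ← sub_eq_zero, ← h2]
  rw [← h2] at h0 h1
  have h3 := right_ne_zero_of_mul h0
  field_simp at h1 ⊢
  linear_combination (-1) * h1

end Splitting

section SplittingBounds

open ModularGroup Matrix.SpecialLinearGroup EisensteinSeries Matrix Filter Topology
open scoped MatrixGroups

variable {k : ℕ} (hk : 4 ≤ k) (hke : Even k)

include hk hke

lemma exists_avgU_le_of_half_le : ∃ C, 0 < C ∧ ∀ {t α w τ : ℂ} {V : ℝ}, 0 < t.im → t.im ≤ 1 →
    0 ≤ t.re → ‖α‖ ≤ V → ‖w‖ ≤ V → 1 / 2 ≤ τ.im →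
    ‖avgU k t α w τ‖ ≤ C * ((t.im ^ k)⁻¹ * ((1 + ‖t‖) ^ 3)⁻¹) * V ^ 2 := by
  obtain ⟨C, hC, H⟩ := exists_avgTerm_le hk hke (by norm_num : (0 : ℝ) < 1 / 2) (by norm_num)
  have hc : ContinuousOn (fun x : ℝ => ‖latDisc ⟨x + (1 / 2 : ℝ) * I, 1, 0, 0⟩‖)
      (Set.Icc (-(1 / 2)) (1 / 2)) := by
    refine (((((differentiableOn_latSum (by norm_num) 0 0).mul
      (differentiableOn_latSum (by norm_num) 0 0)).sub
      ((differentiableOn_latSum (by norm_num) 0 0).const_mul 2)).continuousOn.comp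
      (f := fun x : ℝ => (x : ℂ) + (1 / 2 : ℝ) * I) (by fun_prop) fun x _ => ?_).norm)
    simp
  obtain ⟨x0, -, hm⟩ := isCompact_Icc.exists_isMinOn ⟨0, by norm_num⟩ hc
  have hm0 : 0 < ‖latDisc ⟨x0 + (1 / 2 : ℝ) * I, 1, 0, 0⟩‖ :=
    norm_pos_iff.2 (latDisc_ne_zero (by simp) 0 0)
  set m := ‖latDisc ⟨x0 + (1 / 2 : ℝ) * I, 1, 0, 0⟩‖
  obtain ⟨Z, hZ⟩ : ∃ Z, Z = ∑' p : gammaSet 1 1 0, (rowHt p ^ 3)⁻¹ := ⟨_, rfl⟩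
  have hZ0 : 0 ≤ Z := hZ ▸ tsum_nonneg fun p => by
    have := rowHt_pos p.2
    positivity
  refine ⟨C * 4 * (Z + 1) / m, by positivity, ?_⟩
  intro t α w τ V ht ht1 htr hα hw hτ
  obtain ⟨_, -, h⟩ := exists_periodic_expansion (avgU_periodic hk hke ht ht1 α w)
    (differentiableOn_avgU hk hke ht ht1 α w) (avgU_bounded hk hke ht ht1 α w)
  refine (h (1 / 2) _ (by norm_num) fun x hx => ?_).2 τ hτ
  have hV : 0 ≤ V := (norm_nonneg _).trans hα
  have hx' : ‖(x : ℂ) + (1 / 2 : ℝ) * I‖ ≤ 1 := by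
    refine (norm_add_le _ _).trans ?_
    norm_num [-one_div] at hx ⊢
    linarith
  have hβ : ‖w - α * (x + (1 / 2 : ℝ) * I)‖ ≤ 2 * V := by
    refine (norm_sub_le _ _).trans ?_
    rw [norm_mul]
    nlinarith [mul_le_mul hα hx' (norm_nonneg _) hV]
  have hb := tsum_of_norm_bounded (summable_rowHt.hasSum.mul_left _) (H ht ht1
    (τ := x + (1 / 2 : ℝ) * I) (by simp) (by simp at hx ⊢; linarith)
    (hα.trans (by linarith)) hβ (.inr ⟨rfl, htr, by norm_num⟩))
  rw [← hZ] at hb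
  rw [avgU, norm_div, div_le_iff₀ (norm_pos_iff.2 (latDisc_ne_zero (by simp) 0 0))]
  refine hb.trans (le_trans ?_ (mul_le_mul_of_nonneg_left (hm (abs_le.1 hx)) (by positivity)))
  change _ ≤ _ * m
  have : 0 ≤ C * ((t.im ^ k)⁻¹ * ((1 + ‖t‖) ^ 3)⁻¹ * V ^ 2) := by positivity
  rw [show C * 4 * (Z + 1) / m * ((t.im ^ k)⁻¹ * ((1 + ‖t‖) ^ 3)⁻¹) * V ^ 2 * m =
    C * ((t.im ^ k)⁻¹ * ((1 + ‖t‖) ^ 3)⁻¹ * V ^ 2) * (4 * (Z + 1)) by field_simp]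
  nlinarith

lemma exists_avgU_le : ∃ C N, 0 < C ∧ ∀ {t α w τ : ℂ} {V : ℝ}, 0 < t.im → t.im ≤ 1 →
    0 ≤ t.re → ‖α‖ ≤ V → ‖w‖ ≤ V → 0 < τ.im → τ.im ≤ 1 → |τ.re| ≤ 1 / 2 →
    ‖avgU k t α w τ‖ ≤ C * ((t.im ^ k)⁻¹ * ((1 + ‖t‖) ^ 3)⁻¹) * V ^ 2 * (τ.im ^ N)⁻¹ := by
  obtain ⟨C1, hC1, H1⟩ := exists_avgU_le_of_half_le hk hke
  obtain ⟨C2, hC2, H2⟩ := exists_rowSum_le hk hke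
  refine ⟨3 ^ k * (C1 * 8 ^ 2) + C2 * 3 ^ 2 * 6 ^ 5, 3 * (k + 4) + 10, by positivity, ?_⟩
  intro t α w τ V ht ht1 htr hα hw hτ hτ1 hre
  obtain ⟨γ, hγ⟩ := exists_smul_mem_fd ⟨τ, hτ⟩
  have him := three_le_four_mul_im_sq_of_mem_fd hγ
  set y := τ.im
  set M := (t.im ^ k)⁻¹ * ((1 + ‖t‖) ^ 3)⁻¹ with hM
  have hM0 : 0 ≤ M := by positivity
  have hV : 0 ≤ V := (norm_nonneg _).trans hα
  have hg : 1 / 2 ≤ (γ • (⟨τ, hτ⟩ : UpperHalfPlane)).im := by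
    nlinarith [(γ • (⟨τ, hτ⟩ : UpperHalfPlane)).im_pos]
  have hg1 := im_smul_eq_div_normSq γ ⟨τ, hτ⟩
  rw [denom_apply] at hg1
  have hgc : ((γ • (⟨τ, hτ⟩ : UpperHalfPlane) : UpperHalfPlane) : ℂ) =
      (γ 0 0 * τ + γ 0 1) / (γ 1 0 * τ + γ 1 1) := by
    simpa using congrArg UpperHalfPlane.coe (UpperHalfPlane.specialLinearGroup_apply γ ⟨τ, hτ⟩)
  set u : ℂ := γ 1 0 * τ + γ 1 1
  change (γ • (⟨τ, hτ⟩ : UpperHalfPlane)).im = y / Complex.normSq u at hg1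
  have hy2 : 0 < y ^ 2 := by positivity
  have hy21 : y ^ 2 ≤ 1 := pow_le_one₀ hτ.le hτ1
  have hco : IsCoprime (γ 1 0) (γ 1 1) := isCoprime_row γ 1
  have hq := (row_bounds hτ hτ1 le_rfl (hre.trans (by
    rw [div_le_div_iff₀ (by norm_num) hτ]; linarith)) (γ 1 0) (γ 1 1)).1
  set q : ℝ := ((max (γ 1 0).natAbs (γ 1 1).natAbs : ℕ) : ℝ)
  have hq1 : 1 ≤ q := by
    have : 1 ≤ max (γ 1 0).natAbs (γ 1 1).natAbs := by
      rcases hco.ne_zero_or_ne_zero with h | h <;> omega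
    exact Nat.one_le_cast.2 this
  have hu0 : 0 < ‖u‖ := by by_contra! h; nlinarith [show 0 < 3 / y ^ 2 by positivity]
  have hu2 : ‖u‖ ≤ 2 := by
    rw [hg1, le_div_iff₀ (by simpa using hu0), Complex.normSq_eq_norm_sq] at hg
    nlinarith
  have hui : ‖u‖⁻¹ ≤ 3 / y ^ 2 := by
    rw [inv_le_iff_one_le_mul₀ hu0]
    linarith
  have hq6 : q ≤ 6 / y ^ 2 := hq.trans (by
    rw [div_mul_eq_mul_div]; gcongr; linarith)
  have hcq : ‖((γ 1 0 : ℤ) : ℂ)‖ ≤ q := by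
    rw [Complex.norm_intCast, ← Int.cast_abs, Int.abs_eq_natAbs, Int.cast_natCast]
    exact Nat.cast_le.2 (le_max_left _ _)
  rw [avgU_eq_smul hk hke ht ht1 hτ α w γ (norm_pos_iff.1 hu0)]
  have b1 : ‖α * u - γ 1 0 * w‖ ≤ 8 * V / y ^ 2 := by
    refine (norm_sub_le _ _).trans ?_
    rw [norm_mul, norm_mul]
    calc _ ≤ V * 2 + 6 / y ^ 2 * V := by gcongr; exact hcq.trans hq6
      _ ≤ V * 2 / y ^ 2 + 6 / y ^ 2 * V := by
        gcongr
        exact le_div_self (by positivity) hy2 hy21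
      _ = _ := by ring
  have b2 : ‖w / u‖ ≤ 8 * V / y ^ 2 := by
    rw [norm_div, div_eq_mul_inv]
    calc _ ≤ V * (3 / y ^ 2) := by gcongr
      _ ≤ _ := by rw [mul_div_assoc', mul_comm V]; gcongr; norm_num
  have b3 : ‖w - α * τ‖ ≤ 3 * V := by
    have : ‖τ‖ ≤ 2 := (Complex.norm_le_abs_re_add_abs_im τ).trans (by
      rw [abs_of_pos hτ]; linarith)
    refine (norm_sub_le _ _).trans ?_
    rw [norm_mul]
    nlinarith [mul_le_mul hα this (norm_nonneg _) hV]
  have e1 := H1 ht ht1 htr b1 b2 (hg.trans_eq (congrArg Complex.im hgc))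
  have e2 := H2 ht ht1 hτ hτ1 le_rfl (hre.trans (by
    rw [div_le_div_iff₀ (by norm_num) hτ]; linarith)) (hα.trans (by linarith : V ≤ 3 * V)) b3
    (.inr ⟨rfl, htr, hτ1⟩) hco
  refine (norm_add_le _ _).trans ?_
  rw [norm_mul, norm_inv, norm_pow, ← inv_pow]
  have hpow : ∀ j ≤ 3 * (k + 4) + 10, (y ^ j)⁻¹ ≤ (y ^ (3 * (k + 4) + 10))⁻¹ := fun j hj =>
    inv_anti₀ (by positivity) (pow_le_pow_of_le_one hτ.le hτ1 hj)
  calc _ ≤ (3 / y ^ 2) ^ k * (C1 * M * (8 * V / y ^ 2) ^ 2) +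
        C2 * (y ^ (3 * (k + 4)))⁻¹ * (t.im ^ k)⁻¹ * ((1 + ‖t‖) ^ 3)⁻¹ * (3 * V) ^ 2 *
          (6 / y ^ 2) ^ 5 := by
        refine add_le_add (mul_le_mul (pow_le_pow_left₀ (by positivity) hui k) e1 (norm_nonneg _)
          (by positivity)) (e2.trans ?_)
        change _ * q ^ 5 ≤ _
        gcongr
    _ = 3 ^ k * (C1 * 8 ^ 2) * M * V ^ 2 * (y ^ (2 * k + 4))⁻¹ +
        C2 * 3 ^ 2 * 6 ^ 5 * M * V ^ 2 * (y ^ (3 * (k + 4) + 10))⁻¹ := by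
        rw [hM]
        simp only [div_pow, mul_pow, pow_add, ← pow_mul]
        field_simp
        ring
    _ ≤ _ := by
        have := mul_le_mul_of_nonneg_left (hpow (2 * k + 4) (by omega))
          (by positivity : 0 ≤ 3 ^ k * (C1 * 8 ^ 2) * M * V ^ 2)
        linarith

end SplittingBounds

section Companion

open ModularGroup Filter Topology
open scoped MatrixGroups

variable {k : ℕ} (hk : 4 ≤ k) (hke : Even k)

include hk hke

/-- The polynomial in the period obtained by polarizing the averaged splitting. -/
lemma avgU_companion_eq {t : ℂ} (ht : 0 < t.im) (ht1 : t.im ≤ 1) {τ : ℂ} (hτ : 0 < τ.im)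
    {F : ℂ → ℂ} (hF : ∀ s, F s =
      (avgU k t 1 1 s - avgU k t 1 0 s - avgU k t 0 1 s) / 2 + avgU k t 0 1 s * s) :
    F τ + (τ ^ k)⁻¹ * F (-1 / τ) = inhomK k t τ 1 := by
  have h0 : τ ≠ 0 := by rintro rfl; simp at hτ
  have hS := im_neg_one_div_pos hτ
  have hq : ∀ {s : ℂ}, 0 < s.im → ∀ α w, avgU k t α w s = α ^ 2 * avgU k t 1 0 s +
      α * w * (avgU k t 1 1 s - avgU k t 1 0 s - avgU k t 0 1 s) + w ^ 2 * avgU k t 0 1 s := by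
    intro s hs α w
    simp only [avgU]
    rw [avgNum_eq hk hke ht ht1 hs α w]
    ring
  have hU : ∀ α w, avgU k t α w τ = (τ ^ k)⁻¹ * avgU k t (α * τ - w) (w / τ) (-1 / τ) +
      (-(α ^ 2 * diagK k t τ 1) + 2 * α * (w - α * τ) * inhomK k t τ 1 +
        (w - α * τ) ^ 2 * diagK k t (-1) τ) := by
    intro α w
    have h := avgU_eq_smul hk hke ht ht1 hτ α w S (by simpa [S] using h0)
    have hr := (edgeCocycle_edgeK hk hke ht).rowSum_S (c := 0) (d := 1) (by simp)
      ⟨τ, 1, α, w - α * τ⟩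
    rw [neg_zero, rowSum_zero, zero_add, edgeK, if_pos (by simpa [PeriodPt.area] using hτ)] at hr
    simpa [S, hr] using h
  rw [hF, hF]
  have e1 := hU 1 (τ + 1)
  have e2 := hU 1 τ
  have e3 := hU 0 1
  rw [hq hτ, hq hS] at e1 e2
  rw [hq hS] at e3
  have e : τ * τ⁻¹ = 1 := mul_inv_cancel₀ h0
  simp only [div_eq_mul_inv] at e1 e2 e3 ⊢
  have e' : (τ + 1) * τ⁻¹ = 1 + τ⁻¹ := by rw [add_mul, e, one_mul]
  rw [e'] at e1
  rw [e] at e2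
  linear_combination (e1 - e2 - e3) / 2

lemma exists_companion : ∃ (C : ℝ) (N : ℕ), 0 < C ∧ ∀ {t : ℂ}, 0 < t.im → t.im ≤ 1 → 0 ≤ t.re →
    ∃ (F : ℂ → ℂ) (α β : ℕ → ℂ),
      (∀ n, ‖α n‖ ≤ C * ((t.im ^ k)⁻¹ * ((1 + ‖t‖) ^ 3)⁻¹) * (n + 1) ^ N) ∧
      (∀ n, ‖β n‖ ≤ C * ((t.im ^ k)⁻¹ * ((1 + ‖t‖) ^ 3)⁻¹) * (n + 1) ^ N) ∧
      (∀ s : ℂ, 0 < s.im → HasSum (fun n : ℕ => (α n + β n * s) * ee (s * n)) (F s)) ∧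
      ContinuousOn F {s | 0 < s.im} ∧
      ∀ s : ℂ, 0 < s.im → F s + (s ^ k)⁻¹ * F (-1 / s) = inhomK k t s 1 := by
  obtain ⟨C, N, hC, H⟩ := exists_avgU_le hk hke
  refine ⟨C * (2 * Real.exp (2 * π)), N, by positivity, fun {t} ht ht1 htr => ?_⟩
  set M := (t.im ^ k)⁻¹ * ((1 + ‖t‖) ^ 3)⁻¹ with hM
  have hM0 : 0 ≤ M := by positivity
  have key : ∀ α w : ℂ, ‖α‖ ≤ 1 → ‖w‖ ≤ 1 → ∃ a : ℕ → ℂ,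
      (∀ τ : ℂ, 0 < τ.im → HasSum (fun n : ℕ => a n * ee (τ * n)) (avgU k t α w τ)) ∧
      ∀ n, ‖a n‖ ≤ C * M * Real.exp (2 * π) * (n + 1) ^ N := by
    intro α w hα hw
    obtain ⟨a, ha, h⟩ := exists_periodic_expansion (avgU_periodic hk hke ht ht1 α w)
      (differentiableOn_avgU hk hke ht ht1 α w) (avgU_bounded hk hke ht ht1 α w)
    refine ⟨a, ha, fun n => ?_⟩
    have hn : (0 : ℝ) < n + 1 := by positivity
    obtain ⟨y, hy⟩ : ∃ y, y = (n + 1 : ℝ)⁻¹ := ⟨_, rfl⟩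
    have hy0 : 0 < y := by rw [hy]; positivity
    have hy1 : y ≤ 1 := hy ▸ inv_le_one_of_one_le₀ (by linarith)
    have hny : n * y ≤ 1 := by rw [hy, ← div_eq_mul_inv, div_le_one hn]; linarith
    refine ((h y (C * M * (n + 1) ^ N) hy0 fun x hx => ?_).1 n).trans ?_
    · have := H (τ := x + y * I) ht ht1 htr hα hw (by simpa using hy0) (by simpa using hy1)
        (by simpa using hx)
      rwa [← hM, show (x + y * I : ℂ).im = y by simp, ← inv_pow, hy, inv_inv, ← hy, one_pow,
        mul_one] at this
    · rw [mul_right_comm]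
      have := Real.exp_le_exp.2 (show 2 * π * n * y ≤ 2 * π by nlinarith [Real.pi_pos])
      gcongr
  obtain ⟨p, hp, hpb⟩ := key 0 1 (by simp) (by simp)
  obtain ⟨q, hq, hqb⟩ := key 1 0 (by simp) (by simp)
  obtain ⟨r, hr, hrb⟩ := key 1 1 (by simp) (by simp)
  refine ⟨_, fun n => (r n - q n - p n) / 2, p, fun n => ?_, fun n => ?_, fun s hs => ?_, ?_,
    fun s hs => avgU_companion_eq hk hke ht ht1 hs fun s => rfl⟩
  · have h1 := norm_sub_le (r n - q n) (p n)
    have h2 := norm_sub_le (r n) (q n)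
    rw [norm_div, Complex.norm_ofNat]
    have := hpb n; have := hqb n; have := hrb n
    have : 0 ≤ C * M * Real.exp (2 * π) * (n + 1) ^ N := by positivity
    linarith
  · have : 0 ≤ C * M * Real.exp (2 * π) * (n + 1) ^ N := by positivity
    linarith [hpb n]
  · convert! ((((hr s hs).sub (hq s hs)).sub (hp s hs)).div_const 2).add ((hp s hs).mul_right s)
      using 2 with n
    ring
  · have hc := fun α w => (differentiableOn_avgU hk hke ht ht1 α w).continuousOn
    exact ((((hc 1 1).sub (hc 1 0)).sub (hc 0 1)).div_const 2).add
      ((hc 0 1).mul continuousOn_id)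

end Companion

section Corrections

open ModularGroup EisensteinSeries ModularForm UpperHalfPlane
open scoped MatrixGroups ArithmeticFunction.sigma Topology Manifold

/-- A continuous function on the upper half-plane with a `q`-expansion of moderate growth. -/
structure HasModerateExpansion (g : ℂ → ℂ) (p : PowerSeries ℂ) : Prop where
  cont : ContinuousOn g {τ | 0 < τ.im}
  bound : ∃ C : ℝ, 0 ≤ C ∧ ∃ N : ℕ, ∀ n, ‖p.coeff n‖ ≤ C * (n + 1) ^ N
  hasSum : ∀ τ : ℂ, 0 < τ.im → HasSum (fun n : ℕ => p.coeff n * ee (τ * n)) (g τ)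

namespace HasModerateExpansion

variable {f g : ℂ → ℂ} {p q : PowerSeries ℂ}

lemma add (hf : HasModerateExpansion f p) (hg : HasModerateExpansion g q) :
    HasModerateExpansion (fun τ => f τ + g τ) (p + q) := by
  refine ⟨hf.cont.add hg.cont, ?_, fun τ hτ => ?_⟩
  · obtain ⟨C, hC, N, h⟩ := hf.bound
    obtain ⟨D, hD, M, h'⟩ := hg.bound
    refine ⟨C + D, by positivity, N + M, fun n => ?_⟩
    rw [map_add, add_mul]
    have hn : (1 : ℝ) ≤ n + 1 := by simp
    refine (norm_add_le _ _).trans (add_le_add ((h n).trans ?_) ((h' n).trans ?_)) <;>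
    gcongr <;> first | exact hn | omega
  · simpa only [map_add, add_mul] using (hf.hasSum τ hτ).add (hg.hasSum τ hτ)

lemma smul (c : ℂ) (hf : HasModerateExpansion f p) :
    HasModerateExpansion (fun τ => c * f τ) (c • p) := by
  refine ⟨continuousOn_const.mul hf.cont, ?_, fun τ hτ => ?_⟩
  · obtain ⟨C, hC, N, h⟩ := hf.bound
    refine ⟨‖c‖ * C, by positivity, N, fun n => ?_⟩
    rw [PowerSeries.coeff_smul, norm_smul, mul_assoc]
    gcongr
    exact h n
  · simpa only [PowerSeries.coeff_smul, smul_eq_mul, mul_assoc] using (hf.hasSum τ hτ).mul_left c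

lemma mul (hf : HasModerateExpansion f p) (hg : HasModerateExpansion g q) :
    HasModerateExpansion (fun τ => f τ * g τ) (p * q) := by
  refine ⟨hf.cont.mul hg.cont, ?_, fun τ hτ => ?_⟩
  · obtain ⟨C, hC, N, h⟩ := hf.bound
    obtain ⟨D, hD, M, h'⟩ := hg.bound
    refine ⟨C * D, by positivity, N + M + 1, fun n => ?_⟩
    rw [PowerSeries.coeff_mul]
    have e : C * D * ((n : ℝ) + 1) ^ (N + M + 1) =
        ∑ _i ∈ Finset.HasAntidiagonal.antidiagonal n, C * D * ((n : ℝ) + 1) ^ (N + M) := by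
      rw [Finset.sum_const, Finset.Nat.card_antidiagonal, nsmul_eq_mul, pow_succ]
      push_cast
      ring
    rw [e]
    refine norm_sum_le_of_le _ fun i hi => ?_
    have hi := Finset.HasAntidiagonal.mem_antidiagonal.1 hi
    have h1 : ((i.1 : ℕ) : ℝ) ≤ n := by exact_mod_cast (by omega : i.1 ≤ n)
    have h2 : ((i.2 : ℕ) : ℝ) ≤ n := by exact_mod_cast (by omega : i.2 ≤ n)
    rw [norm_mul, pow_add]
    calc _ ≤ C * (n + 1) ^ N * (D * (n + 1) ^ M) :=
          mul_le_mul ((h i.1).trans (by gcongr)) ((h' i.2).trans (by gcongr)) (norm_nonneg _)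
            (by positivity)
      _ = _ := by ring
  · have s1 := (hf.hasSum τ hτ).summable.norm
    have s2 := (hg.hasSum τ hτ).summable.norm
    have h := (summable_norm_sum_mul_antidiagonal_of_summable_norm s1 s2).of_norm.hasSum
    rw [← tsum_mul_tsum_eq_tsum_sum_antidiagonal_of_summable_norm s1 s2, (hf.hasSum τ hτ).tsum_eq,
      (hg.hasSum τ hτ).tsum_eq] at h
    convert! h using 2 with n
    rw [PowerSeries.coeff_mul, Finset.sum_mul]
    refine Finset.sum_congr rfl fun i hi => ?_
    rw [← Finset.HasAntidiagonal.mem_antidiagonal.1 hi, Nat.cast_add, mul_add, ee_add]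
    ring

lemma of_sigma {f : ℍ → ℂ} (hf : MDiff f) (c : ℂ) (j : ℕ)
    (h : ∀ z : ℍ, HasSum (fun m : ℕ => (if m = 0 then 1 else c * σ j m : ℂ) * ee z ^ m) (f z)) :
    HasModerateExpansion (f ∘ ofComplex)
      (PowerSeries.mk fun m => if m = 0 then 1 else c * σ j m) := by
  refine ⟨(UpperHalfPlane.mdifferentiable_iff.1 hf).continuousOn,
    ⟨1 + ‖c‖, by positivity, j + 1, fun n => ?_⟩, fun τ hτ => ?_⟩
  · rw [PowerSeries.coeff_mk]
    split_ifs with hn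
    · simp [hn]
    · have : ((σ j n : ℕ) : ℝ) ≤ (n + 1) ^ (j + 1) := by
        refine (Nat.cast_le.2 (ArithmeticFunction.sigma_le_pow_succ j n)).trans ?_
        push_cast
        gcongr
        linarith
      rw [norm_mul, Complex.norm_natCast]
      gcongr
      linarith [norm_nonneg c]
  · rw [Function.comp_apply, ofComplex_apply_of_im_pos hτ]
    convert! h ⟨τ, hτ⟩ using 2 with n
    rw [PowerSeries.coeff_mk, ee, ee, ← Complex.exp_nat_mul]
    congr 2
    ring

end HasModerateExpansion

/-- The Eisenstein series of weights two, four and six, as functions of a complex variable. -/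
lemma exists_eisenstein_expansions : ∃ (e₂ e₄ e₆ : ℂ → ℂ) (p₂ p₄ p₆ : PowerSeries ℂ),
    HasModerateExpansion e₂ p₂ ∧ HasModerateExpansion e₄ p₄ ∧ HasModerateExpansion e₆ p₆ ∧
    (p₂.coeff 0 = 1 ∧ p₂.coeff 1 = -24) ∧ (p₄.coeff 0 = 1 ∧ p₄.coeff 1 = 240) ∧
    (p₆.coeff 0 = 1 ∧ p₆.coeff 1 = -504) ∧
    ∀ τ : ℂ, 0 < τ.im → e₂ (-1 / τ) = τ ^ 2 * e₂ τ + 2 * (3 / (π * Complex.I)) * τ ∧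
      e₄ (-1 / τ) = τ ^ 4 * e₄ τ ∧ e₆ (-1 / τ) = τ ^ 6 * e₆ τ := by
  have hE : ∀ {k : ℕ} (hk : 3 ≤ k) (hk2 : Even k) (z : ℍ),
      HasSum (fun m : ℕ => (if m = 0 then 1 else -(2 * k / bernoulli k : ℂ) * σ (k - 1) m : ℂ) *
        ee z ^ m) (E hk z) := by
    intro k hk hk2 z
    have h := ModularForm.hasSum_qExpansion (E hk) one_pos one_mem_strictPeriods_SL z
    simpa only [E_qExpansion_coeff hk hk2, Function.Periodic.qParam, Complex.ofReal_one, div_one, ee]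
      using h
  have hS : ∀ (τ : ℂ) (hτ : 0 < τ.im), S • (⟨τ, hτ⟩ : ℍ) = ⟨-1 / τ, im_neg_one_div_pos hτ⟩ := by
    intro τ hτ
    rw [modular_S_smul]
    ext
    simp [neg_div, ← inv_neg]
  have hT : ∀ {k : ℕ} (f : ModularForm 𝒮ℒ k) (τ : ℂ), 0 < τ.im →
      (f ∘ ofComplex) (-1 / τ) = τ ^ k * (f ∘ ofComplex) τ := by
    intro k f τ hτ
    rw [Function.comp_apply, Function.comp_apply, ofComplex_apply_of_im_pos hτ,
      ofComplex_apply_of_im_pos (im_neg_one_div_pos hτ), ← hS τ hτ]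
    have h := SlashInvariantForm.slash_action_eqn'' f (γ := Matrix.SpecialLinearGroup.mapGL ℝ S)
      (Γ := 𝒮ℒ) ⟨S, rfl⟩ ⟨τ, hτ⟩
    rw [zpow_natCast] at h
    exact h.trans (by congr 2; exact denom_S _)
  refine ⟨E2 ∘ ofComplex, E₄ ∘ ofComplex, E₆ ∘ ofComplex, _, _, _,
    .of_sigma E2_mdifferentiable (-24) 1 fun z => ?_,
    .of_sigma (ModularFormClass.holo E₄) _ _ (hE (k := 4) (by norm_num) (by decide)),
    .of_sigma (ModularFormClass.holo E₆) _ _ (hE (k := 6) (by norm_num) (by decide)), ?_, ?_, ?_,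
    fun τ hτ => ⟨?_, hT E₄ τ hτ, hT E₆ τ hτ⟩⟩
  · simpa [ee] using hasSum_qExpansion_E2 (z := z)
  · simp [-PowerSeries.coeff_zero_eq_constantCoeff]
  · norm_num [-PowerSeries.coeff_zero_eq_constantCoeff, show bernoulli 4 = -1 / 30 by decide +kernel]
  · norm_num [-PowerSeries.coeff_zero_eq_constantCoeff, show bernoulli 6 = 1 / 42 by decide +kernel]
  · rw [Function.comp_apply, Function.comp_apply, ofComplex_apply_of_im_pos hτ,
      ofComplex_apply_of_im_pos (im_neg_one_div_pos hτ), ← hS τ hτ]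
    have h0 : τ ≠ 0 := by rintro rfl; simp at hτ
    have hπ : (π : ℂ) ≠ 0 := by simp
    have h := G2_S_transform ⟨τ, hτ⟩
    change _ = (τ ^ 2)⁻¹ * _ - -2 * π * Complex.I / τ at h
    simp only [E2, Pi.smul_apply, smul_eq_mul, riemannZeta_two, h]
    field_simp
    ring_nf
    rw [Complex.I_sq]
    ring

end Corrections

section StableOne

/-- Coefficients of the functions `h + g τ` that are anti-invariant in weight `k`. -/
def antiForms (k : ℕ) : Submodule ℂ (Bool → PowerSeries ℂ) where
  carrier := {q | ∃ g h : ℂ → ℂ, HasModerateExpansion g (q true) ∧ HasModerateExpansion h (q false) ∧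
    ∀ τ : ℂ, 0 < τ.im → h τ + g τ * τ + (τ ^ k)⁻¹ * (h (-1 / τ) + g (-1 / τ) * (-1 / τ)) = 0}
  zero_mem' := by
    have h0 : HasModerateExpansion (fun _ => 0) 0 :=
      ⟨continuousOn_const, ⟨0, le_rfl, 0, by simp⟩, by simp [hasSum_zero]⟩
    exact ⟨_, _, h0, h0, by simp⟩
  add_mem' := by
    rintro p q ⟨g, h, hg, hh, e⟩ ⟨g', h', hg', hh', e'⟩
    exact ⟨_, _, hg.add hg', hh.add hh', fun τ hτ => by linear_combination e τ hτ + e' τ hτ⟩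
  smul_mem' := by
    rintro c q ⟨g, h, hg, hh, e⟩
    exact ⟨_, _, hg.smul c, hh.smul c, fun τ hτ => by linear_combination c * e τ hτ⟩

lemma exists_mem_antiForms_four (x : Bool → ℕ → ℂ) :
    ∃ q ∈ antiForms 4, ∀ b, ∀ i < 1, (q b).coeff i = x b i := by
  obtain ⟨e₂, e₄, e₆, p₂, p₄, p₆, h₂, h₄, h₆, ⟨c20, -⟩, ⟨c40, -⟩, ⟨c60, -⟩, hS⟩ :=
    exists_eisenstein_expansions
  set s : ℂ := 3 / (π * I)
  have hs : s ≠ 0 := by simp [s]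
  have m1 : (fun b => bif b then p₆ else 0 : Bool → PowerSeries ℂ) ∈ antiForms 4 := by
    refine ⟨_, _, h₆, by simpa using h₆.smul 0, fun τ hτ => ?_⟩
    have h0 : τ ≠ 0 := by rintro rfl; simp at hτ
    rw [(hS τ hτ).2.2]
    field_simp
    ring
  have m2 : (fun b => bif b then p₂ * p₄ else s • p₄ : Bool → PowerSeries ℂ) ∈ antiForms 4 := by
    refine ⟨_, _, h₂.mul h₄, h₄.smul s, fun τ hτ => ?_⟩
    have h0 : τ ≠ 0 := by rintro rfl; simp at hτ
    rw [(hS τ hτ).1, (hS τ hτ).2.1]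
    field_simp
    ring
  refine ⟨_, (antiForms 4).add_mem ((antiForms 4).smul_mem (x true 0 - x false 0 / s) m1)
    ((antiForms 4).smul_mem (x false 0 / s) m2), fun b i hi => ?_⟩
  obtain rfl : i = 0 := by omega
  cases b <;> simp [PowerSeries.coeff_mul, c20, c40, c60, -PowerSeries.coeff_zero_eq_constantCoeff]
  field_simp

lemma exists_mem_antiForms_twelve (x : Bool → ℕ → ℂ) :
    ∃ q ∈ antiForms 12, ∀ b, ∀ i < 2, (q b).coeff i = x b i := by
  obtain ⟨e₂, e₄, e₆, p₂, p₄, p₆, h₂, h₄, h₆, ⟨c20, c21⟩, ⟨c40, c41⟩, ⟨c60, c61⟩, hS⟩ :=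
    exists_eisenstein_expansions
  set s : ℂ := 3 / (π * I)
  have hs : s ≠ 0 := by simp [s]
  have m1 : (fun b => bif b then p₄ * (p₄ * p₆) else 0 : Bool → PowerSeries ℂ) ∈ antiForms 12 := by
    refine ⟨_, _, h₄.mul (h₄.mul h₆), by simpa using h₆.smul 0, fun τ hτ => ?_⟩
    have h0 : τ ≠ 0 := by rintro rfl; simp at hτ
    rw [(hS τ hτ).2.1, (hS τ hτ).2.2]
    field_simp
    ring
  have m2 : (fun b => bif b then p₂ * (p₄ * (p₄ * p₄)) else s • (p₄ * (p₄ * p₄)) :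
      Bool → PowerSeries ℂ) ∈ antiForms 12 := by
    refine ⟨_, _, h₂.mul (h₄.mul (h₄.mul h₄)), (h₄.mul (h₄.mul h₄)).smul s, fun τ hτ => ?_⟩
    have h0 : τ ≠ 0 := by rintro rfl; simp at hτ
    rw [(hS τ hτ).1, (hS τ hτ).2.1]
    field_simp
    ring
  have m3 : (fun b => bif b then p₂ * (p₆ * p₆) else s • (p₆ * p₆) :
      Bool → PowerSeries ℂ) ∈ antiForms 12 := by
    refine ⟨_, _, h₂.mul (h₆.mul h₆), (h₆.mul h₆).smul s, fun τ hτ => ?_⟩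
    have h0 : τ ≠ 0 := by rintro rfl; simp at hτ
    rw [(hS τ hτ).1, (hS τ hτ).2.2]
    field_simp
    ring
  have m4 : (fun b => bif b then p₂ * (p₂ * (p₄ * p₆)) else (2 * s) • (p₂ * (p₄ * p₆)) :
      Bool → PowerSeries ℂ) ∈ antiForms 12 := by
    refine ⟨_, _, h₂.mul (h₂.mul (h₄.mul h₆)), (h₂.mul (h₄.mul h₆)).smul (2 * s), fun τ hτ => ?_⟩
    have h0 : τ ≠ 0 := by rintro rfl; simp at hτ
    rw [(hS τ hτ).1, (hS τ hτ).2.1, (hS τ hτ).2.2]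
    field_simp
    ring
  set c4 := (x true 1 + 24 * x true 0 - x false 1 / s) / 288 with hc4
  set A := x false 0 / s - 2 * c4 with hA
  set c2 := (x false 1 / s + 576 * c4 + 1008 * A) / 1728 with hc2
  refine ⟨_, (antiForms 12).add_mem ((antiForms 12).add_mem ((antiForms 12).add_mem
    ((antiForms 12).smul_mem (x true 0 - A - c4) m1) ((antiForms 12).smul_mem c2 m2))
    ((antiForms 12).smul_mem (A - c2) m3)) ((antiForms 12).smul_mem c4 m4), fun b i hi => ?_⟩
  obtain rfl | rfl : i = 0 ∨ i = 1 := by omega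
  all_goals
    cases b <;> simp [PowerSeries.coeff_mul, c20, c40, c60, c21, c41, c61,
      Finset.Nat.antidiagonal_succ, -PowerSeries.coeff_zero_eq_constantCoeff]
    all_goals
      simp only [hc2, hA, hc4]
      field_simp
      ring

theorem stable_one {k : ℕ} (hk : 4 ≤ k) (hke : Even k) {n₀ : ℕ} (h0 : 1 ≤ n₀)
    (h : ∀ x : Bool → ℕ → ℂ, ∃ q ∈ antiForms k, ∀ b, ∀ i < n₀, (q b).coeff i = x b i) :
    Stable k n₀ 1 := by
  obtain ⟨C₁, N₁, hC₁, H₁⟩ := exists_companion hk hke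
  choose q hq hqc using fun ι : Bool × Fin n₀ =>
    h fun b i => if b = ι.1 ∧ i = ι.2 then 1 else 0
  have hqb : ∀ ι : (Bool × Fin n₀) × Bool, ∃ C : ℝ, 0 ≤ C ∧ ∃ N : ℕ, ∀ n,
      ‖(q ι.1 ι.2).coeff n‖ ≤ C * (n + 1) ^ N := by
    rintro ⟨ι, b⟩
    obtain ⟨g, h, hg, hh, -⟩ := hq ι
    cases b
    exacts [hh.bound, hg.bound]
  choose D hD M hM using hqb
  set D' := ∑ ι, D ι
  set M' := ∑ ι, M ι
  have hD' : 0 ≤ D' := Finset.sum_nonneg fun ι _ => hD ι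
  have hqb : ∀ ι b n, ‖(q ι b).coeff n‖ ≤ D' * ((n : ℝ) + 1) ^ M' := fun ι b n => by
    refine (hM (ι, b) n).trans ?_
    gcongr
    · exact Finset.single_le_sum (fun ι _ => hD ι) (Finset.mem_univ (ι, b))
    · simp
    · exact Finset.single_le_sum (fun ι _ => Nat.zero_le (M ι)) (Finset.mem_univ (ι, b))
  obtain ⟨C₂, hC₂, H₂⟩ := norm_le_of_companion hk hke (N₁ + M') h0
  set E := (1 + 2 * n₀ * (n₀ ^ N₁ * D')) * 2 ^ (N₁ + M')
  have hE : 0 ≤ E := by positivity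
  have key : ∀ {a a' : ℝ → ℂ} {B : ℂ → ℂ}, Profile k 1 a a' B → ∀ z : ℂ, 0 < z.im → z.im ≤ 1 →
      0 ≤ z.re → ‖B z‖ * (1 + |z.re|) ^ 3 * z.im ^ k ≤ C₂ * (C₁ * E) * dataSum n₀ (N₁ + M') a a' := by
    intro a a' B P z hz hz1 hzr
    obtain ⟨F, α, β, hα, hβ, hF, hFc, hFe⟩ := H₁ hz hz1 hzr
    set K := C₁ * ((z.im ^ k)⁻¹ * ((1 + ‖z‖) ^ 3)⁻¹) with hK
    have hK0 : 0 ≤ K := by positivity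
    let p : Bool → ℕ → ℂ := fun b => bif b then β else α
    have hp : ∀ b n, ‖p b n‖ ≤ K * ((n : ℝ) + 1) ^ N₁ := by
      rintro (_ | _)
      exacts [hα, hβ]
    set Q : Bool → PowerSeries ℂ := ∑ ι : Bool × Fin n₀, p ι.1 ι.2 • q ι with hQ
    have hQc : ∀ b n, (Q b).coeff n = ∑ ι : Bool × Fin n₀, p ι.1 ι.2 * (q ι b).coeff n :=
      fun b n => by rw [hQ, Finset.sum_apply, map_sum]; rfl
    have hQ0 : ∀ b, ∀ n < n₀, (Q b).coeff n = p b n := by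
      intro b n hn
      rw [hQc, Finset.sum_eq_single (b, ⟨n, hn⟩)]
      · rw [hqc _ _ _ hn]; simp
      · rintro ⟨b', j⟩ - hne
        rw [hqc _ _ _ hn, if_neg, mul_zero]
        rintro ⟨rfl, rfl⟩
        exact hne rfl
      · simp
    have hb : ∀ b n, ‖p b (n + n₀) - (Q b).coeff (n + n₀)‖ ≤
        K * E * ((n + n₀ : ℕ) : ℝ) ^ (N₁ + M') := by
      intro b n
      have hn : (1 : ℝ) ≤ (n + n₀ : ℕ) := by exact_mod_cast (by omega : 1 ≤ n + n₀)
      have h1 : ‖(Q b).coeff (n + n₀)‖ ≤ 2 * n₀ * (K * n₀ ^ N₁ * (D' * ((n + n₀ : ℕ) + 1) ^ M')) := by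
        rw [hQc]
        have hcard : 2 * n₀ * (K * n₀ ^ N₁ * (D' * ((n + n₀ : ℕ) + 1) ^ M')) =
            ∑ _ι : Bool × Fin n₀, K * n₀ ^ N₁ * (D' * ((n + n₀ : ℕ) + 1) ^ M') := by simp
        rw [hcard]
        refine norm_sum_le_of_le _ fun ι _ => ?_
        rw [norm_mul]
        refine mul_le_mul ((hp _ _).trans ?_) (hqb _ _ _) (norm_nonneg _) (by positivity)
        gcongr
        exact_mod_cast ι.2.2
      have h2 := (norm_sub_le _ _).trans (add_le_add (hp b (n + n₀)) h1)
      set m : ℝ := ((n + n₀ : ℕ) : ℝ)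
      have h3 : (m + 1) ^ (N₁ + M') ≤ 2 ^ (N₁ + M') * m ^ (N₁ + M') := by
        rw [← mul_pow]; gcongr; linarith
      have h4 : (m + 1) ^ N₁ ≤ (m + 1) ^ (N₁ + M') := pow_le_pow_right₀ (by linarith) (by omega)
      have h5 : (m + 1) ^ M' ≤ (m + 1) ^ (N₁ + M') := pow_le_pow_right₀ (by linarith) (by omega)
      calc _ ≤ _ := h2
        _ ≤ K * (m + 1) ^ (N₁ + M') + 2 * n₀ * (K * n₀ ^ N₁ * (D' * (m + 1) ^ (N₁ + M'))) := by
          gcongr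
        _ = K * (1 + 2 * n₀ * (n₀ ^ N₁ * D')) * (m + 1) ^ (N₁ + M') := by ring
        _ ≤ K * (1 + 2 * n₀ * (n₀ ^ N₁ * D')) * (2 ^ (N₁ + M') * m ^ (N₁ + M')) := by gcongr
        _ = _ := by ring
    obtain ⟨g, h, hg, hh, he⟩ : Q ∈ antiForms k :=
      Submodule.sum_mem _ fun ι _ => Submodule.smul_mem _ _ (hq ι)
    have hB := H₂ P hz (M := K * E) (by positivity) (hb false) (hb true)
      (F := fun s => F s - (h s + g s * s)) (fun s hs => ?_)
      (hFc.sub (hh.cont.add (hg.cont.mul continuousOn_id))) fun s hs => ?_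
    · have hre : (1 + |z.re|) ^ 3 ≤ (1 + ‖z‖) ^ 3 := by gcongr; exact Complex.abs_re_le_norm z
      have hd := dataSum_nonneg n₀ (N₁ + M') a a'
      calc _ ≤ C₂ * (K * E) * dataSum n₀ (N₁ + M') a a' * (1 + ‖z‖) ^ 3 * z.im ^ k := by gcongr
        _ = _ := by rw [hK]; field_simp
    · have h1 := (hF s hs).sub ((hh.hasSum s hs).add ((hg.hasSum s hs).mul_right s))
      rw [← hasSum_nat_add_iff' n₀, Finset.sum_eq_zero, sub_zero] at h1
      · convert! h1 using 2 with n
        simp [p]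
        ring
      · intro n hn
        have hn := Finset.mem_range.1 hn
        have e1 := hQ0 false n hn
        have e2 := hQ0 true n hn
        simp only [p, cond_true, cond_false] at e1 e2
        rw [e1, e2]
        ring
    · have := hFe s hs
      simp only [inhomK, mul_one, mul_comm z s] at this
      linear_combination this - he s hs
  refine ⟨k, N₁ + M', C₂ * (C₁ * E), by positivity, fun a a' B P z hz hz1 => ?_⟩
  rcases le_or_gt 0 z.re with hr | hr
  · exact key P z hz hz1 hr
  · have := key (P.conj hke (by simp)) (-(starRingEnd ℂ) z) (by simpa using hz)
      (by simpa using hz1) (by simpa using hr.le)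
    simpa [dataSum, abs_of_neg hr] using this

end StableOne

theorem stmt9 :
    ∃ C₀ : ℝ, 0 < C₀ ∧ ∃ δ : ℝ, 0 < δ ∧
      ∀ d n₀ : ℕ, ((d, n₀) = (8, 1) ∨ (d, n₀) = (24, 2)) →
        ∀ ε : ℕ → ℝ, (∀ n : ℕ, n₀ ≤ n → |ε n| < δ * (n : ℝ) ^ (-C₀)) →
          ∀ f : SchwartzMap (EuclideanSpace ℝ (Fin d)) ℂ,
            (∀ x y : EuclideanSpace ℝ (Fin d), ‖x‖ = ‖y‖ → f x = f y) →  -- f is radial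
            ∀ e : EuclideanSpace ℝ (Fin d), ‖e‖ = 1 →
              (∀ n : ℕ, n₀ ≤ n →
                (fun t : ℝ => f (t • e)) (Real.sqrt (2 * (n : ℝ) + ε n)) = 0 ∧
                deriv (fun t : ℝ => f (t • e)) (Real.sqrt (2 * (n : ℝ) + ε n)) = 0 ∧
                (fun t : ℝ => 𝓕 (⇑f) (t • e)) (Real.sqrt (2 * (n : ℝ) + ε n)) = 0 ∧
                deriv (fun t : ℝ => 𝓕 (⇑f) (t • e)) (Real.sqrt (2 * (n : ℝ) + ε n)) = 0) →
              ∀ x : EuclideanSpace ℝ (Fin d), f x = 0 := by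
  obtain ⟨C1, hC1, δ1, hδ1, H1⟩ := exists_uniform (d := 8) rfl le_rfl (by norm_num) le_rfl
    (stable_one (by norm_num) (by decide) le_rfl exists_mem_antiForms_four)
    (stable_neg_one (by norm_num) (by decide))
  obtain ⟨C2, hC2, δ2, hδ2, H2⟩ :=
    exists_uniform (d := 24) (k := 12) rfl (by norm_num) (by norm_num) (by norm_num)
      (stable_one (by norm_num) (by decide) (by norm_num) exists_mem_antiForms_twelve)
      stable_twelve_neg_one
  refine ⟨max C1 C2, by positivity, min δ1 δ2, by positivity, fun d n₀ hdn ε hε => ?_⟩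
  have hbound : ∀ C δ : ℝ, C ≤ max C1 C2 → min δ1 δ2 ≤ δ → 1 ≤ n₀ → ∀ n, n₀ ≤ n →
      |ε n| ≤ δ * (n : ℝ) ^ (-C) := by
    intro C δ hC hδ hn₀ n hn
    have hn1 : (1 : ℝ) ≤ n := by exact_mod_cast hn₀.trans hn
    refine (hε n hn).le.trans ?_
    have : 0 < min δ1 δ2 := by positivity
    refine mul_le_mul hδ (Real.rpow_le_rpow_of_exponent_le hn1 (by linarith)) (by positivity) (by linarith)
  rcases hdn with hdn | hdn
  · obtain ⟨rfl, rfl⟩ := Prod.mk.inj hdn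
    exact H1 ε (hbound _ _ (le_max_left _ _) (min_le_left _ _) le_rfl)
  · obtain ⟨rfl, rfl⟩ := Prod.mk.inj hdn
    exact H2 ε (hbound _ _ (le_max_right _ _) (min_le_right _ _) (by norm_num))
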